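/- Let n ≥ 2, let F_n be the free group on e₁,…,e_n, and let 0 ≤ d < 1/16. Fix a finite system of equations V(x̄) = 1, i.e. a finite set of words in the free group on variables x̄ = (x₁,…,x_k). For each ℓ let Γ_ℓ be a random group of density d at length ℓ and π_ℓ : F_n → Γ_ℓ the quotient map. Then, with probability tending to 1 as ℓ → ∞, every tuple b̄_ℓ in Γ_ℓ with V(b̄_ℓ) = 1 is the image under π_ℓ of a tuple c̄_ℓ in F_n with V(c̄_ℓ) = 1 in F_n. -/

import Mathlib

open Filter

/-- A boolean combination of equations `w = 1`, where the words `w` range over `α`. -/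
inductive BoolComb (α : Type*) : Type _
  | eq : α → BoolComb α
  | not : BoolComb α → BoolComb α
  | and : BoolComb α → BoolComb α → BoolComb α
  | or : BoolComb α → BoolComb α → BoolComb α

/-- Truth of a boolean combination of equations under an evaluation `ev` of the words
in a group `G`. -/
def BoolComb.Holds {α : Type*} {G : Type*} [Group G] (ev : α → G) : BoolComb α → Prop
  | .eq w => ev w = 1
  | .not φ => ¬ BoolComb.Holds ev φ
  | .and φ ψ => BoolComb.Holds ev φ ∧ BoolComb.Holds ev ψ
  | .or φ ψ => BoolComb.Holds ev φ ∨ BoolComb.Holds ev ψ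

/-- The number of relators `⌊(2n-1)^(dℓ)⌋` at density `d` and length `ℓ`. -/
noncomputable def numRel (n : ℕ) (d : ℝ) (ℓ : ℕ) : ℕ :=
  ⌊(2 * (n : ℝ) - 1) ^ (d * (ℓ : ℝ))⌋₊

/-- The tuples of `N` relators, each a reduced word of length `ℓ` in the free group
on `n` generators. -/
def relTuples (n ℓ N : ℕ) : Set (Fin N → FreeGroup (Fin n)) :=
  {r | ∀ i, ((r i).toWord).length = ℓ}

/-- The random group presented by a tuple `r` of relators: the quotient of the free group
on `n` generators by the normal closure of the relators. -/
abbrev RandGroup {n N : ℕ} (r : Fin N → FreeGroup (Fin n)) : Type :=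
  FreeGroup (Fin n) ⧸ Subgroup.normalClosure (Set.range r)

/-- The canonical quotient map `π : F_n → Γ` onto the random group. -/
def randProj {n N : ℕ} (r : Fin N → FreeGroup (Fin n)) :
    FreeGroup (Fin n) →* RandGroup r :=
  QuotientGroup.mk' _

/-- The probability, for a uniformly random `N`-tuple of reduced relators of length `ℓ`
(chosen uniformly and independently), that property `P` holds. -/
noncomputable def relProb (n ℓ N : ℕ) (P : (Fin N → FreeGroup (Fin n)) → Prop) : ℝ :=
  (Set.ncard {r ∈ relTuples n ℓ N | P r} : ℝ) / (Set.ncard (relTuples n ℓ N) : ℝ)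

/-- `P` holds with overwhelming probability in the random group of density `d`:
the probability tends to `1` as `ℓ → ∞`. -/
def wop (n : ℕ) (d : ℝ) (P : ∀ ℓ : ℕ, (Fin (numRel n d ℓ) → FreeGroup (Fin n)) → Prop) : Prop :=
  Tendsto (fun ℓ => relProb n ℓ (numRel n d ℓ) (P ℓ)) atTop (nhds 1)

namespace RandomGroup

open FreeGroup List Finset

variable {α : Type}

/-- Words in the letters of a free group. -/
abbrev Word (α : Type) := List (α × Bool)

/-- The formal inverse of a letter. -/
def linv (l : α × Bool) : α × Bool := (l.1, !l.2)

@[simp] lemma linv_linv (l : α × Bool) : linv (linv l) = l := by simp [linv]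

lemma linv_ne (l : α × Bool) : linv l ≠ l := by
  rcases l with ⟨a, b⟩; simp [linv]

lemma invRev_cons' (l : α × Bool) (p : Word α) :
    invRev (l :: p) = invRev p ++ [linv l] := by
  simp [invRev, linv]

lemma invRev_concat (p : Word α) (l : α × Bool) :
    invRev (p ++ [l]) = linv l :: invRev p := by
  simp [invRev, linv]

lemma isReduced_cons_cons' {a b : α × Bool} {p : Word α} :
    IsReduced (a :: b :: p) ↔ b ≠ linv a ∧ IsReduced (b :: p) := by
  rw [isReduced_cons_cons]
  rcases a with ⟨a1, a2⟩; rcases b with ⟨b1, b2⟩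
  simp only [linv, ne_eq, Prod.mk.injEq]
  cases a2 <;> cases b2 <;> grind

lemma not_isReduced_mid {p q : Word α} {l : α × Bool} :
    ¬ IsReduced (p ++ l :: linv l :: q) := by
  intro h
  have := h.infix (L₁ := [l, linv l]) ⟨p, q, by simp⟩
  rw [isReduced_cons_cons'] at this
  grind

lemma isReduced_invRev {p : Word α} (h : IsReduced p) : IsReduced (invRev p) := by
  rw [isReduced_iff_not_step] at h ⊢
  intro L hL
  exact h (invRev L) (by simpa using hL.invRev)

lemma isReduced_append_iff {p q : Word α} :
    IsReduced (p ++ q) ↔ IsReduced p ∧ IsReduced q ∧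
      ∀ p' l q' m, p = p' ++ [l] → q = m :: q' → m ≠ linv l := by
  constructor
  · intro h
    refine ⟨h.infix ⟨[], q, by simp⟩, h.infix ⟨p, [], by simp⟩, ?_⟩
    rintro p' l q' m rfl rfl rfl
    exact not_isReduced_mid (p := p') (q := q') (l := l) (by grind)
  · rintro ⟨hp, hq, h⟩
    rcases eq_nil_or_concat p with rfl | ⟨p', l, rfl⟩
    · simpa
    rcases q with _ | ⟨m, q'⟩
    · grind
    have h1 : IsReduced (l :: m :: q') :=
      isReduced_cons_cons'.2 ⟨h p' l q' m (by simp) rfl, hq⟩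
    have h2 : IsReduced (p' ++ [l]) := by grind
    have := IsReduced.append_overlap h2 (L₃ := m :: q') (by grind) (by simp)
    grind

/-- A folded labelled graph with inverse edges. -/
structure Gr (α V : Type) where
  E : V → α × Bool → V → Prop
  symm : ∀ {a l c}, E a l c → E c (linv l) a
  det : ∀ {a l c c'}, E a l c → E a l c' → c = c'

/-- Reading a word along edges. -/
def Rd {V : Type} (E : V → α × Bool → V → Prop) : V → Word α → V → Prop
  | a, [], c => a = c
  | a, l :: p, c => ∃ m, E a l m ∧ Rd E m p c

section Rd
variable {V : Type} {E : V → α × Bool → V → Prop}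

@[simp] lemma Rd_nil {a c : V} : Rd E a [] c ↔ a = c := Iff.rfl

lemma Rd_cons {a c : V} {l : α × Bool} {p : Word α} :
    Rd E a (l :: p) c ↔ ∃ m, E a l m ∧ Rd E m p c := Iff.rfl

lemma Rd_append {a c : V} {p q : Word α} :
    Rd E a (p ++ q) c ↔ ∃ m, Rd E a p m ∧ Rd E m q c := by
  induction p generalizing a with
  | nil => simp
  | cons l p ih =>
    simp only [cons_append, Rd_cons, ih]
    grind

lemma Rd_singleton {a c : V} {l : α × Bool} : Rd E a [l] c ↔ E a l c := by
  simp [Rd]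

lemma Rd.map {V' : Type} {E' : V' → α × Bool → V' → Prop} (f : V → V')
    (h : ∀ a l c, E a l c → E' (f a) l (f c)) {a c : V}
    {p : Word α} (hp : Rd E a p c) : Rd E' (f a) p (f c) := by
  induction p generalizing a with
  | nil => exact congrArg f hp
  | cons l p ih => obtain ⟨m, h1, h2⟩ := hp; exact ⟨f m, h _ _ _ h1, ih h2⟩

end Rd

section Gr
variable {V : Type} (G : Gr α V)

lemma Gr.rd_symm {a c : V} {p : Word α} (h : Rd G.E a p c) : Rd G.E c (invRev p) a := by
  induction p generalizing a with
  | nil => simp_all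
  | cons l p ih =>
    obtain ⟨m, h1, h2⟩ := h
    rw [invRev_cons', Rd_append]
    exact ⟨m, ih h2, Rd_singleton.2 (G.symm h1)⟩

lemma Gr.rd_det {a c c' : V} {p : Word α} (h : Rd G.E a p c) (h' : Rd G.E a p c') :
    c = c' := by
  induction p generalizing a with
  | nil => simp_all
  | cons l p ih =>
    obtain ⟨m, h1, h2⟩ := h
    obtain ⟨m', h1', h2'⟩ := h'
    obtain rfl := G.det h1 h1'
    grind

lemma Gr.rd_det' {a a' c : V} {p : Word α} (h : Rd G.E a p c) (h' : Rd G.E a' p c) :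
    a = a' :=
  G.rd_det (G.rd_symm h) (G.rd_symm h')

lemma Gr.rd_step {a c : V} {p q : Word α} (h : Rd G.E a p c) (hs : Red.Step p q) :
    Rd G.E a q c := by
  cases hs with
  | @not L1 L2 x b =>
    rw [Rd_append] at h ⊢
    obtain ⟨m, h1, m1, h2, m2, h3, h4⟩ := h
    refine ⟨m, h1, ?_⟩
    have : m2 = m := G.det (l := (x, !b)) h3 (G.symm h2)
    grind

lemma Gr.rd_red {a c : V} {p q : Word α} (h : Rd G.E a p c) (hs : Red p q) :
    Rd G.E a q c := by
  induction hs with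
  | refl => exact h
  | tail _ h2 ih => exact G.rd_step ih h2

lemma Gr.rd_mk_eq {a c c' : V} {p q : Word α} (h : Rd G.E a p c) (h' : Rd G.E a q c')
    (hpq : FreeGroup.mk p = FreeGroup.mk q) : c = c' := by
  obtain ⟨r, h1, h2⟩ := Red.exact.1 hpq
  exact G.rd_det (G.rd_red h h1) (G.rd_red h' h2)

end Gr

/-- A system of long arcs to be attached to a folded graph; two arcs sharing an initial segment
of length `κ` coincide. -/
structure Arcs {V : Type} (G : Gr α V) (κ : ℕ) where
  A : V → Word α → V → Prop
  two_le : 2 ≤ κ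
  inv : ∀ {e t v}, A e t v → A v (invRev t) e
  red : ∀ {e t v}, A e t v → IsReduced t
  len : ∀ {e t v}, A e t v → 3 * κ ≤ t.length
  first : ∀ {e l t v b}, A e (l :: t) v → ¬ G.E e l b
  uniq : ∀ {e t v t' v'}, A e t v → A e t' v' → t.take κ = t'.take κ → t = t' ∧ v = v'

namespace Arcs

variable {V : Type} {G : Gr α V} {κ : ℕ} (S : Arcs G κ)

/-- Two descriptions of a point on an arc from its two ends. -/
def Dual (x y : V × Word α) : Prop := S.A x.1 (x.2 ++ invRev y.2) y.1

variable {S}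

lemma Dual.symm {x y : V × Word α} (h : S.Dual x y) : S.Dual y x := by
  have := S.inv h
  simpa [Dual] using this

lemma Dual.len {x y : V × Word α} (h : S.Dual x y) :
    3 * κ ≤ x.2.length + y.2.length := by
  have := S.len h
  simp_all

lemma Dual.uniq {x y z : V × Word α} (hx : κ ≤ x.2.length)
    (h : S.Dual x y) (h' : S.Dual x z) : y = z := by
  obtain ⟨h1, h2⟩ := S.uniq h h' (by
    grind)
  have := FreeGroup.invRev_injective (append_cancel_left h1)
  grind

variable (S)

/-- Equivalence of descriptions of points. -/
def Rel (x y : V × Word α) : Prop :=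
  x = y ∨ S.Dual x y ∨ ∃ z, z.2.length < κ ∧ S.Dual z x ∧ S.Dual z y

lemma rel_equivalence : Equivalence S.Rel := by
  have long : ∀ {z x}, z.2.length < κ → S.Dual z x → κ ≤ x.2.length := by
    intro z x h1 h2; have := h2.len; omega
  refine ⟨fun x => Or.inl rfl, ?_, ?_⟩
  · rintro x y (rfl | h | ⟨z, h1, h2, h3⟩)
    · exact Or.inl rfl
    · exact Or.inr (Or.inl h.symm)
    · exact Or.inr (Or.inr ⟨z, h1, h3, h2⟩)
  · rintro x y z (rfl | h | ⟨w, h1, h2, h3⟩) (rfl | h' | ⟨w', h1', h2', h3'⟩)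
    · exact Or.inl rfl
    · exact Or.inr (Or.inl h')
    · exact Or.inr (Or.inr ⟨w', h1', h2', h3'⟩)
    · exact Or.inr (Or.inl h)
    · rcases lt_or_ge y.2.length κ with hy | hy
      · exact Or.inr (Or.inr ⟨y, hy, h.symm, h'⟩)
      · exact Or.inl (Dual.uniq hy h.symm h')
    · obtain rfl := Dual.uniq (long h1' h2') h.symm h2'.symm
      exact Or.inr (Or.inl h3')
    · exact Or.inr (Or.inr ⟨w, h1, h2, h3⟩)
    · obtain rfl := Dual.uniq (long h1 h3) h' h3.symm
      exact Or.inr (Or.inl h2.symm)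
    · obtain rfl := Dual.uniq (long h1 h3) h2'.symm h3.symm
      exact Or.inr (Or.inr ⟨w', h1, h2, h3'⟩)

/-- The vertex set after attaching the arcs. -/
def Nd : Type := Quotient (⟨S.Rel, S.rel_equivalence⟩ : Setoid (V × Word α))

/-- The vertex reached from `e` by reading `p` on an arc. -/
def nd (e : V) (p : Word α) : S.Nd :=
  Quotient.mk (⟨S.Rel, S.rel_equivalence⟩ : Setoid (V × Word α)) (e, p)

variable {S}

lemma nd_eq {e e' : V} {p p' : Word α} :
    S.nd e p = S.nd e' p' ↔ S.Rel (e, p) (e', p') :=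
  Quotient.eq (r := (⟨S.Rel, S.rel_equivalence⟩ : Setoid (V × Word α)))

lemma nd_dual {e e' : V} {p p' : Word α} (h : S.A e (p ++ invRev p') e') :
    S.nd e p = S.nd e' p' := nd_eq.2 (Or.inr (Or.inl h))

lemma nd_arc {e v : V} {t : Word α} (h : S.A e t v) : S.nd e t = S.nd v [] :=
  nd_dual (by simp_all)

variable (S)

/-- An arc continues from `e` after `p` with `l`. -/
def St (e : V) (p : Word α) (l : α × Bool) : Prop :=
  ∃ t v, S.A e t v ∧ p ++ [l] <+: t

/-- The edges after attaching the arcs. -/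
def Ed (X : S.Nd) (l : α × Bool) (Y : S.Nd) : Prop :=
  (∃ e p, S.St e p l ∧ X = S.nd e p ∧ Y = S.nd e (p ++ [l])) ∨
  (∃ e p, S.St e p (linv l) ∧ X = S.nd e (p ++ [linv l]) ∧ Y = S.nd e p) ∨
  ∃ a b, G.E a l b ∧ X = S.nd a [] ∧ Y = S.nd b []

/-- A description of minimal depth. -/
def Std (e : V) (p : Word α) : Prop :=
  p.length < κ ∨ ∀ y, S.Dual (e, p) y → κ ≤ y.2.length

variable {S}

lemma Std.eq_cases {e e' : V} {p p' : Word α} (h : S.Std e p)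
    (he : S.nd e p = S.nd e' p') :
    (e = e' ∧ p = p') ∨ (S.Dual (e, p) (e', p') ∧ κ ≤ p'.length) := by
  rcases nd_eq.1 he with h1 | h1 | ⟨z, h1, h2, h3⟩
  · grind
  · right
    refine ⟨h1, ?_⟩
    rcases h with h | h
    · have := h1.len; grind
    grind
  · have := h2.len
    simp only at this
    rcases h with h | h
    · omega
    · have := h _ h2.symm; omega

lemma std_nil (e : V) : S.Std e [] := Or.inl (by have := S.two_le; grind)

lemma exists_std (X : S.Nd) : ∃ e p, X = S.nd e p ∧ S.Std e p := by
  obtain ⟨⟨e, p⟩, rfl⟩ := Quotient.exists_rep X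
  by_cases h : S.Std e p
  · exact ⟨e, p, rfl, h⟩
  · simp only [Std, not_or, not_lt, not_forall, not_le] at h
    obtain ⟨h1, ⟨v, q⟩, h2, h3⟩ := h
    exact ⟨v, q, nd_dual h2, Or.inl h3⟩

lemma Std.out {e : V} {p : Word α} {l : α × Bool} {Y : S.Nd} (h : S.Std e p)
    (hY : S.Ed (S.nd e p) l Y) :
    (S.St e p l ∧ Y = S.nd e (p ++ [l])) ∨
    (∃ p', p = p' ++ [linv l] ∧ S.St e p' (linv l) ∧ Y = S.nd e p') ∨
    ∃ b, p = [] ∧ G.E e l b ∧ Y = S.nd b [] := by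
  have k2 := S.two_le
  rcases hY with ⟨e', p', hs, hX, rfl⟩ | ⟨e', p', hs, hX, rfl⟩ | ⟨a, b, hE, hX, rfl⟩
  · rcases h.eq_cases hX with ⟨rfl, rfl⟩ | ⟨hd, hl⟩
    · grind
    · obtain ⟨t, v, hA, s, rfl⟩ := hs
      have hd' : S.A e' (p' ++ invRev p) e := hd.symm
      obtain ⟨h1, h2⟩ := S.uniq hA hd' (by
        grind)
      rw [append_assoc] at h1
      have h3 := append_cancel_left h1
      have h4 : p = invRev s ++ [linv l] := by
        rw [← invRev_invRev (L₁ := p), ← h3, singleton_append, invRev_cons']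
      refine Or.inr (Or.inl ⟨invRev s, h4, ?_, ?_⟩)
      · exact ⟨p ++ invRev p', e', hd, by grind⟩
      · refine nd_dual ?_
        simp_all
  · rcases h.eq_cases hX with ⟨rfl, rfl⟩ | ⟨hd, hl⟩
    · grind
    · have hd' : S.A e (p ++ [l] ++ invRev p') e' := by
        have : S.A e (p ++ invRev (p' ++ [linv l])) e' := hd
        rw [invRev_concat, linv_linv] at this
        grind
      exact Or.inl ⟨⟨_, _, hd', prefix_append _ _⟩, (nd_dual hd').symm⟩
  · rcases h.eq_cases hX with ⟨rfl, rfl⟩ | ⟨hd, hl⟩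
    · grind
    grind

lemma St.not_back {e : V} {p : Word α} {l : α × Bool} (h : S.St e (p ++ [linv l]) l) :
    False := by
  obtain ⟨t, v, hA, s, rfl⟩ := h
  have := S.red hA
  refine not_isReduced_mid (p := p) (q := s) (l := linv l) ?_
  simp_all

variable (S)

/-- The graph obtained by attaching the arcs and folding. -/
def gr : Gr α S.Nd where
  E := S.Ed
  symm := by
    rintro X l Y (⟨e, p, h1, h2, h3⟩ | ⟨e, p, h1, h2, h3⟩ | ⟨a, b, h1, h2, h3⟩)
    · exact Or.inr (Or.inl ⟨e, p, by simpa, by simpa, h2⟩)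
    · exact Or.inl ⟨e, p, h1, h3, h2⟩
    · exact Or.inr (Or.inr ⟨b, a, G.symm h1, h3, h2⟩)
  det := by
    intro X l Y Y' h h'
    obtain ⟨e, p, rfl, hs⟩ := exists_std X
    rcases hs.out h with ⟨h1, rfl⟩ | ⟨p1, rfl, h1, rfl⟩ | ⟨b, rfl, h1, rfl⟩ <;>
    rcases hs.out h' with ⟨h2, rfl⟩ | ⟨p2, hp, h2, rfl⟩ | ⟨b', hp, h2, rfl⟩
    · rfl
    · subst hp; exact h1.not_back.elim
    · subst hp
      obtain ⟨t, v, hA, s, rfl⟩ := h1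
      exact (S.first (by simpa using hA) h2).elim
    · exact h2.not_back.elim
    · simp_all
    · simp at hp
    · obtain ⟨t, v, hA, s, rfl⟩ := h2
      exact (S.first (by simpa using hA) h1).elim
    · simp at hp
    · rw [G.det h1 h2]

/-- The inclusion of the old vertices. -/
def inc (a : V) : S.Nd := S.nd a []

variable {S}

lemma inc_inj {a b : V} (h : S.inc a = S.inc b) : a = b := by
  have k2 := S.two_le
  rcases (std_nil a).eq_cases h with h | h
  · exact h.1
  grind

lemma inc_edge {a b : V} {l : α × Bool} (h : G.E a l b) : S.gr.E (S.inc a) l (S.inc b) :=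
  Or.inr (Or.inr ⟨a, b, h, rfl, rfl⟩)

lemma rd_inc {a b : V} {p : Word α} (h : Rd G.E a p b) :
    Rd S.gr.E (S.inc a) p (S.inc b) := h.map S.inc fun _ _ _ => inc_edge

lemma rd_arc_from {e v : V} {p q t : Word α} (h : S.A e t v) (ht : p ++ q <+: t) :
    Rd S.gr.E (S.nd e p) q (S.nd e (p ++ q)) := by
  induction q generalizing p with
  | nil => simp
  | cons l q ih =>
    refine ⟨S.nd e (p ++ [l]), Or.inl ⟨e, p, ⟨t, v, h, ?_⟩, rfl, rfl⟩, ?_⟩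
    · refine IsPrefix.trans ?_ ht
      simp_all
    grind

lemma rd_arc_prefix {e v : V} {p t : Word α} (h : S.A e t v) (ht : p <+: t) :
    Rd S.gr.E (S.inc e) p (S.nd e p) := by
  simpa [inc] using rd_arc_from (p := []) h (by grind)

lemma rd_arc {e v : V} {t : Word α} (h : S.A e t v) :
    Rd S.gr.E (S.inc e) t (S.inc v) := by
  have := rd_arc_prefix h prefix_rfl
  rwa [nd_arc h] at this

lemma std_of_arc {e v : V} {p q : Word α} (h : S.A e (p ++ q) v) (hq : κ ≤ q.length) :
    S.Std e p := by
  rcases lt_or_ge p.length κ with hp | hp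
  · exact Or.inl hp
  · right
    intro y hy
    have : S.Dual (e, p) (v, invRev q) := by simpa [Dual] using h
    rw [Dual.uniq hp hy this]
    simp_all

/-- A reduced path leaving the old part follows an arc until it is close to its end. -/
lemma follow {a : V} {X : S.Nd} {p : Word α} (hp : IsReduced p) (hne : p ≠ [])
    (hX : Rd S.gr.E (S.inc a) p X) (hf : ∀ l p' b, p = l :: p' → ¬ G.E a l b) :
    ∃ t v, S.A a t v ∧ (p <+: t ∨ t.take (t.length - κ + 1) <+: p) := by
  induction p using reverseRecOn generalizing X with
  | nil => grind
  | append_singleton p l ih =>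
    obtain ⟨Y, hY, hYX⟩ := Rd_append.1 hX
    rw [Rd_singleton] at hYX
    rcases eq_or_ne p [] with rfl | hp0
    · obtain rfl : S.inc a = Y := hY
      rcases (std_nil a).out hYX with ⟨h1, rfl⟩ | ⟨p', h, -⟩ | ⟨b, -, hE, -⟩
      · obtain ⟨t, v, hA, hs⟩ := h1
        grind
      · simp at h
      grind
    · obtain ⟨t, v, hA, h | h⟩ := ih (hp.infix ⟨[], [l], by simp⟩) hp0 hY (by
        grind)
      · obtain rfl := S.gr.rd_det (rd_arc_prefix hA h) hY
        rcases lt_or_ge (t.length - κ) p.length with hl | hl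
        · refine ⟨t, v, hA, Or.inr ?_⟩
          refine IsPrefix.trans ?_ (prefix_append p [l])
          exact prefix_of_prefix_length_le (take_prefix _ _) h (by simp; omega)
        · obtain ⟨q, rfl⟩ := h
          have hl3 := S.len hA
          have hs : S.Std a p := std_of_arc hA (by grind)
          rcases hs.out hYX with ⟨h1, rfl⟩ | ⟨p', rfl, -⟩ | ⟨b, rfl, -⟩
          · obtain ⟨t, v, hA, hs⟩ := h1
            grind
          · exfalso
            refine not_isReduced_mid (p := p') (q := []) (l := linv l) ?_
            simpa using hp
          grind
      grind

section Potential

variable {Γ : Type} [Group Γ] (f : FreeGroup α →* Γ)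

/-- A labelling of the vertices by group elements compatible with the edges. -/
def _root_.RandomGroup.Gr.Pot {V : Type} (G : Gr α V) (φ : V → Γ) : Prop :=
  ∀ a l b, G.E a l b → φ b = φ a * f (FreeGroup.mk [l])

variable {f}

lemma _root_.RandomGroup.Gr.Pot.rd {V : Type} {G : Gr α V} {φ : V → Γ} (h : G.Pot f φ) {a b : V}
    {p : Word α} (hp : Rd G.E a p b) : φ b = φ a * f (FreeGroup.mk p) := by
  induction p generalizing a with
  | nil => obtain rfl := Rd_nil.1 hp; rw [← one_eq_mk]; simp
  | cons l p ih =>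
    obtain ⟨m, h1, h2⟩ := hp
    rw [ih h2, h _ _ _ h1, mul_assoc, ← _root_.map_mul, mul_mk]
    simp

lemma exists_pot {φ : V → Γ} (h : G.Pot f φ)
    (hA : ∀ e t v, S.A e t v → φ v = φ e * f (FreeGroup.mk t)) :
    ∃ ψ : S.Nd → Γ, S.gr.Pot f ψ ∧ ∀ e p, ψ (S.nd e p) = φ e * f (FreeGroup.mk p) := by
  have hD : ∀ x y, S.Dual x y → φ x.1 * f (FreeGroup.mk x.2) = φ y.1 * f (FreeGroup.mk y.2) := by
    intro x y hxy
    rw [hA _ _ _ hxy, mul_assoc, ← mul_mk, ← inv_mk, _root_.map_mul,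
      _root_.map_inv]
    simp
  refine ⟨Quotient.lift (fun x => φ x.1 * f (FreeGroup.mk x.2)) ?_, ?_, fun e p => rfl⟩
  · rintro x y (rfl | h | ⟨z, -, h1, h2⟩)
    · rfl
    · exact hD _ _ h
    grind
  · rintro X l Y (⟨e, p, -, rfl, rfl⟩ | ⟨e, p, -, rfl, rfl⟩ | ⟨a, b, hE, rfl, rfl⟩)
    · change φ e * f (FreeGroup.mk (p ++ [l])) = φ e * f (FreeGroup.mk p) * _
      rw [← mul_mk, _root_.map_mul, mul_assoc]
    · change φ e * f (FreeGroup.mk p) = φ e * f (FreeGroup.mk (p ++ [linv l])) * _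
      rw [mul_assoc, ← _root_.map_mul, mul_mk]
      congr 2
      refine Quot.sound ?_ |>.symm
      have := Red.Step.not (α := α) (L₁ := p) (L₂ := []) (x := l.1) (b := !l.2)
      simpa [linv] using this
    · change φ b * f (FreeGroup.mk []) = φ a * f (FreeGroup.mk []) * _
      rw [← one_eq_mk]
      simpa using h _ _ _ hE

end Potential

end Arcs

/-- A symmetrised set of relators satisfying a metric small cancellation condition. -/
structure SC (α : Type) where
  R : Set (Word α)
  pi : Word α → ℕ
  κ : ℕ
  η : ℕ
  two_le : 2 ≤ κ
  rot : ∀ {p q}, p ++ q ∈ R → q ++ p ∈ R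
  inv : ∀ {p}, p ∈ R → invRev p ∈ R
  red : ∀ {p}, p ∈ R → IsReduced (p ++ p)
  pi_rot : ∀ p q, pi (p ++ q) = pi (q ++ p)
  pi_inv : ∀ p, pi (invRev p) = pi p
  pi_le : ∀ {r}, r ∈ R → pi r ≤ κ
  lt_pi : ∀ {r}, r ∈ R → η < pi r
  len : ∀ {r}, r ∈ R → 6 * κ + 2 * pi r ≤ r.length
  piece : ∀ {r s p}, r ∈ R → s ∈ R → r ≠ s → p <+: r → p <+: s → p.length + η < pi r
  prim : ∀ {p q}, p ++ q ∈ R → p ≠ [] → q ≠ [] → q ++ p ≠ p ++ q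

variable (C : SC α)

lemma SC.pos {r : Word α} (hr : r ∈ C.R) : 0 < C.pi r := (Nat.zero_le _).trans_lt (C.lt_pi hr)

lemma SC.red1 {r : Word α} (hr : r ∈ C.R) : IsReduced r :=
  (C.red hr).infix ⟨[], r, by simp⟩

lemma SC.eq_of_prefix {r s p : Word α} (hr : r ∈ C.R) (hs : s ∈ C.R) (h1 : p <+: r)
    (h2 : p <+: s) (hp : C.pi r ≤ p.length) : r = s := by
  by_contra h
  have := C.piece hr hs h h1 h2
  omega

/-- Every long enough reading of a relator closes up. -/
def SC.Good {V : Type} (G : Gr α V) : Prop :=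
  ∀ a b p q, p ++ q ∈ C.R → Rd G.E a p b → ¬ Rd G.E a (p ++ q) a →
    p.length + 3 * C.κ ≤ (p ++ q).length

lemma Gr.closed_rot {V : Type} (G : Gr α V) {a b : V} {p q : Word α}
    (h : Rd G.E a p b) : Rd G.E a (p ++ q) a ↔ Rd G.E b (q ++ p) b := by
  constructor
  · intro h1
    obtain ⟨m, h2, h3⟩ := Rd_append.1 h1
    obtain rfl := G.rd_det h h2
    exact Rd_append.2 ⟨a, h3, h⟩
  · intro h1
    obtain ⟨m, h2, h3⟩ := Rd_append.1 h1
    obtain rfl := G.rd_det' h h3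
    exact Rd_append.2 ⟨b, h, h2⟩

lemma Gr.closed_inv {V : Type} (G : Gr α V) {a : V} {p : Word α} :
    Rd G.E a (invRev p) a ↔ Rd G.E a p a :=
  ⟨fun h => by simpa using G.rd_symm h, fun h => G.rd_symm h⟩

section Cells

variable {C} {V : Type} {G : Gr α V} (hG : C.Good G)

/-- The arcs completing the cells which overlap the graph in a long segment. -/
def SC.Good.arcs : Arcs G C.κ where
  A e t v := ∃ o, t ++ o ∈ C.R ∧ Rd G.E v o e ∧ C.pi (t ++ o) ≤ o.length ∧ t ≠ [] ∧
    (∀ l t' b, t = l :: t' → ¬ G.E e l b) ∧ ∀ l t' b, t = t' ++ [l] → ¬ G.E v (linv l) b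
  two_le := C.two_le
  inv := by
    rintro e t v ⟨o, h1, h2, h3, h4, h5, h6⟩
    have h7 : invRev t ++ invRev o ∈ C.R := by
      have := C.inv (C.rot h1)
      rwa [invRev_append] at this
    refine ⟨invRev o, h7, G.rd_symm h2, ?_, ?_, ?_, ?_⟩
    · rw [← invRev_append, C.pi_inv, C.pi_rot]; simpa
    · intro h; apply h4; simpa using congrArg invRev h
    · intro l t' b h
      have : t = invRev t' ++ [linv l] := by
        rw [← invRev_invRev (L₁ := t), h, invRev_cons']
      simpa using h6 _ _ b this
    · intro l t' b h
      have : t = linv l :: invRev t' := by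
        rw [← invRev_invRev (L₁ := t), h, invRev_concat]
      grind
  red := by
    rintro e t v ⟨o, h1, -⟩
    exact (C.red1 h1).infix ⟨[], o, by simp⟩
  len := by
    rintro e t v ⟨o, h1, h2, h3, h4, h5, h6⟩
    have := hG v e o t (C.rot h1) h2 (by
      intro h
      obtain ⟨m, h7, h8⟩ := Rd_append.1 h
      obtain rfl := G.rd_det h2 h7
      obtain ⟨l, t', rfl⟩ := exists_cons_of_ne_nil h4
      obtain ⟨m', h9, -⟩ := h8
      grind)
    grind
  first := by
    grind
  uniq := by
    have len : ∀ {e t v o}, t ++ o ∈ C.R → Rd G.E v o e → t ≠ [] → 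
        (∀ l t' b, t = l :: t' → ¬ G.E e l b) → C.κ ≤ t.length := by
      intro e t v o h1 h2 h4 h5
      have := hG v e o t (C.rot h1) h2 (by
        intro h
        obtain ⟨m, h7, h8⟩ := Rd_append.1 h
        obtain rfl := G.rd_det h2 h7
        obtain ⟨l, t', rfl⟩ := exists_cons_of_ne_nil h4
        obtain ⟨m', h9, -⟩ := h8
        grind)
      grind
    have main : ∀ {e v v' t s o}, Rd G.E v (s ++ o) e → Rd G.E v' o e →
        (∀ l t' b, t ++ s = t' ++ [l] → ¬ G.E v' (linv l) b) → s = [] := by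
      intro e v v' t s o h1 h2 h3
      rcases eq_nil_or_concat s with rfl | ⟨s', l, rfl⟩
      · rfl
      · exfalso
        obtain ⟨m, h4, h5⟩ := Rd_append.1 h1
        obtain rfl := G.rd_det' h2 h5
        rw [concat_eq_append, Rd_append] at h4
        obtain ⟨m', -, h6⟩ := h4
        rw [Rd_singleton] at h6
        exact h3 l (t ++ s') m' (by simp) (G.symm h6)
    rintro e t v t' v' ⟨o, h1, h2, h3, h4, h5, h6⟩ ⟨o', h1', h2', h3', h4', h5', h6'⟩ ht
    have hl := len h1 h2 h4 h5
    have hr : t ++ o = t' ++ o' := by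
      refine C.eq_of_prefix (p := t.take C.κ) h1 h1' ?_ ?_ ?_
      · grind
      · grind
      · simp only [length_take]
        have := C.pi_le h1
        omega
    have key : t = t' := by
      rcases append_eq_append_iff.1 hr with ⟨s, rfl, rfl⟩ | ⟨s, rfl, rfl⟩
      · have := main h2 h2' h6'
        simp [this]
      · have := main h2' h2 h6
        simp [this]
    subst key
    obtain rfl := append_cancel_left hr
    exact ⟨rfl, G.rd_det' h2 h2'⟩

variable {hG}

lemma SC.Good.rd_cell {e v : V} {t : Word α} (h : hG.arcs.A e t v) :
    ∃ o, t ++ o ∈ C.R ∧ Rd G.E v o e ∧ C.pi (t ++ o) ≤ o.length :=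
  let ⟨o, h1, h2, h3, _⟩ := h
  ⟨o, h1, h2, h3⟩

/-- Relators read along an arc coincide with the cell of the arc. -/
lemma SC.Good.along {a v : V} {w q t r : Word α} (hA : hG.arcs.A a t v)
    (hwq : w ++ q <+: t) (hr : r ∈ C.R) (hqr : q <+: r) (hq : C.pi r ≤ q.length) :
    ∃ t' o, t = w ++ t' ∧ r = t' ++ o ++ w ∧ Rd G.E v o a ∧ C.pi r ≤ o.length := by
  obtain ⟨o, h1, h2, h3⟩ := SC.Good.rd_cell hA
  obtain ⟨s, rfl⟩ := hwq
  have h4 : q ++ s ++ o ++ w ∈ C.R := by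
    have := C.rot (p := w) (q := q ++ s ++ o) (by grind)
    grind
  have h5 : r = q ++ s ++ o ++ w :=
    C.eq_of_prefix hr h4 hqr ⟨s ++ o ++ w, by simp⟩ hq
  refine ⟨q ++ s, o, by simp, h5, h2, ?_⟩
  have h6 : C.pi r = C.pi (w ++ q ++ s ++ o) := by
    rw [h5, C.pi_rot]; simp
  grind

lemma SC.Good.along_short {a : V} {X : hG.arcs.Nd} {w q r : Word α}
    (hX : Rd hG.arcs.gr.E (hG.arcs.inc a) (w ++ q) X) (hred : IsReduced (w ++ q))
    (hf : ∀ l p' b, w ++ q = l :: p' → ¬ G.E a l b) (hw : w.length < C.κ)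
    (hr : r ∈ C.R) (hqr : q <+: r) (hq : C.pi r ≤ q.length) :
    ∃ t v t' o, hG.arcs.A a t v ∧ t = w ++ t' ∧ r = t' ++ o ++ w ∧ Rd G.E v o a ∧
      C.pi r ≤ o.length := by
  have hpos := C.pos hr
  have hle := C.pi_le hr
  obtain ⟨s, hs⟩ := take_prefix (C.pi r) q
  obtain ⟨Y, hY, -⟩ := Rd_append.1 (show Rd hG.arcs.gr.E (hG.arcs.inc a)
    ((w ++ q.take (C.pi r)) ++ s) X by grind)
  have hql : (q.take (C.pi r)).length = C.pi r := by simp; omega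
  obtain ⟨t, v, hA, h | h⟩ := Arcs.follow (S := hG.arcs) (p := w ++ q.take (C.pi r))
    (hred.infix ⟨[], s, by simp [hs]⟩)
    (by grind) hY (by
      grind)
  · obtain ⟨t', o, h1, h2, h3, h4⟩ := SC.Good.along hA h hr ((take_prefix _ _).trans hqr)
      (by rw [hql])
    grind
  · have h1 := h.length_le
    have h2 := hG.arcs.len hA
    grind

lemma SC.Good.closed_of_marked {a b : V} {p q : Word α} (hr : p ++ q ∈ C.R)
    (hp : Rd G.E a p b) (hl : C.pi (p ++ q) ≤ p.length) :
    Rd hG.arcs.gr.E (hG.arcs.inc a) (p ++ q) (hG.arcs.inc a) := by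
  classical
  by_cases hcl : Rd G.E a (p ++ q) a
  · exact Arcs.rd_inc hcl
  let P : ℕ → Prop := fun m => ∃ o1 o2 t u w, p ++ q = o2 ++ t ++ o1 ∧ Rd G.E u o1 a ∧
    Rd G.E a o2 w ∧ C.pi (p ++ q) ≤ o2.length ∧ m = o1.length + o2.length
  have hP : ∃ m, P m ∧ m ≤ (p ++ q).length :=
    ⟨p.length, ⟨[], p, q, a, b, by simp, by simp, hp, hl, by simp⟩, by simp⟩
  have hmax : ∃ m, P m ∧ ∀ m', P m' → m' ≤ m := by
    obtain ⟨m, hm1, hm2⟩ := hP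
    refine ⟨Nat.findGreatest P (p ++ q).length, Nat.findGreatest_spec hm2 hm1, fun m' hm' => ?_⟩
    refine Nat.le_findGreatest ?_ hm'
    grind
  obtain ⟨m, ⟨o1, o2, t, u, w, h1, h2, h3, h4, rfl⟩, hm⟩ := hmax
  have hrot : t ++ (o1 ++ o2) ∈ C.R := by
    have := C.rot (p := o2) (q := t ++ o1) (by grind)
    grind
  have huw : Rd G.E u (o1 ++ o2) w := Rd_append.2 ⟨a, h2, h3⟩
  have hpi : C.pi (t ++ (o1 ++ o2)) = C.pi (p ++ q) := by
    rw [h1, ← append_assoc, C.pi_rot]; simp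
  have ht : t ≠ [] := by
    rintro rfl
    have := hG u w (o1 ++ o2) [] (by grind) huw (by
      intro h
      apply hcl
      rw [h1, append_nil]
      rw [append_nil] at h
      exact (G.closed_rot h2).1 h)
    have := C.two_le
    grind
  have hA : hG.arcs.A w t u := by
    refine ⟨o1 ++ o2, hrot, huw, ?_, ht, ?_, ?_⟩
    · grind
    · rintro l t' b rfl hE
      have := hm (o1.length + (o2 ++ [l]).length) ⟨o1, o2 ++ [l], t', u, b, by simpa using h1, h2,
        Rd_append.2 ⟨w, h3, Rd_singleton.2 hE⟩, by simp; omega, rfl⟩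
      simp at this
    · rintro l t' b rfl hE
      have := hm ((l :: o1).length + o2.length) ⟨l :: o1, o2, t', b, w, by simpa using h1,
        ⟨u, by simpa using G.symm hE, h2⟩, h3, h4, rfl⟩
      simp at this
  rw [h1]
  exact Rd_append.2 ⟨_, Rd_append.2 ⟨_, Arcs.rd_inc h3, Arcs.rd_arc hA⟩, Arcs.rd_inc h2⟩

end Cells

/-- Moving the base point of a cell, or reversing it. -/
inductive Turn {V : Type} (G : Gr α V) : V → Word α → V → Word α → Prop
  | refl (a r) : Turn G a r a r
  | rot {a r b u v} : Turn G a r b (u ++ v) → ∀ {c}, Rd G.E b u c → Turn G a r c (v ++ u)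
  | inv {a r b s} : Turn G a r b s → Turn G a r b (invRev s)

namespace Turn

variable {V : Type} {G : Gr α V} {a b c : V} {r s t : Word α}

lemma trans (h : Turn G a r b s) (h' : Turn G b s c t) : Turn G a r c t := by
  induction h' with
  | refl => exact h
  | rot _ h2 ih => exact ih.rot h2
  | inv _ ih => exact ih.inv

lemma closed (h : Turn G a r b s) : Rd G.E a r a ↔ Rd G.E b s b := by
  induction h with
  | refl => grind
  | rot _ h2 ih => rw [ih]; exact G.closed_rot h2
  | inv _ ih => rw [ih, G.closed_inv]

lemma mem {C : SC α} (h : Turn G a r b s) (hr : r ∈ C.R) : s ∈ C.R := by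
  induction h with
  | refl => exact hr
  | rot _ h2 ih => exact C.rot ih
  | inv _ ih => exact C.inv ih

lemma pi_eq {C : SC α} (h : Turn G a r b s) : C.pi s = C.pi r := by
  induction h with
  | refl => rfl
  | rot _ h2 ih => rw [C.pi_rot, ih]
  | inv _ ih => rw [C.pi_inv, ih]

end Turn

section Cells

variable {C : SC α} {V : Type} {G : Gr α V} {hG : C.Good G}

variable (hG) in
/-- The cell overlaps the old graph in a long segment. -/
def SC.Good.Hits (X : hG.arcs.Nd) (r : Word α) : Prop :=
  ∃ c d o s, Turn hG.arcs.gr X r (hG.arcs.inc c) (o ++ s) ∧ Rd G.E c o d ∧ C.pi r ≤ o.length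

lemma SC.Good.Hits.of_turn {X Y : hG.arcs.Nd} {r s : Word α} (h : hG.Hits Y s)
    (ht : Turn hG.arcs.gr X r Y s) : hG.Hits X r := by
  obtain ⟨c, d, o, q, h1, h2, h3⟩ := h
  exact ⟨c, d, o, q, ht.trans h1, h2, by rw [ht.pi_eq (C := C)] at h3; exact h3⟩

lemma SC.Good.Hits.closed {X : hG.arcs.Nd} {r : Word α} (h : hG.Hits X r)
    (hr : r ∈ C.R) : Rd hG.arcs.gr.E X r X := by
  obtain ⟨c, d, o, s, h1, h2, h3⟩ := h
  rw [h1.closed]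
  exact SC.Good.closed_of_marked (h1.mem hr) h2 (by rw [h1.pi_eq (C := C)]; exact h3)

lemma SC.Good.hits_along {a v : V} {X : hG.arcs.Nd} {t w t' o r : Word α}
    (hA : hG.arcs.A a t v) (ht : t = w ++ t') (hr : r = t' ++ o ++ w) (ho : Rd G.E v o a)
    (hX : Rd hG.arcs.gr.E (hG.arcs.inc a) w X) (hpi : C.pi r ≤ o.length) : hG.Hits X r := by
  have h1 := Arcs.rd_arc hA
  rw [ht, Rd_append] at h1
  obtain ⟨Y, h2, h3⟩ := h1
  obtain rfl := hG.arcs.gr.rd_det hX h2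
  refine ⟨v, a, o, w ++ t', ?_, ho, hpi⟩
  have := (Turn.refl (G := hG.arcs.gr) X (t' ++ (o ++ w))).rot h3
  grind

lemma SC.Good.hits_short {a : V} {X Y : hG.arcs.Nd} {w p q : Word α}
    (hX : Rd hG.arcs.gr.E (hG.arcs.inc a) w X) (hY : Rd hG.arcs.gr.E X p Y)
    (hred : IsReduced (w ++ p))
    (hf : ∀ l p' b, w ++ p = l :: p' → ¬ G.E a l b) (hw : w.length < C.κ)
    (hr : p ++ q ∈ C.R) (hq : C.pi (p ++ q) ≤ p.length) : hG.Hits X (p ++ q) := by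
  obtain ⟨t, v, t', o, h1, h2, h3, h4, h5⟩ := SC.Good.along_short (Rd_append.2 ⟨X, hX, hY⟩) hred hf hw
    hr (prefix_append _ _) hq
  exact SC.Good.hits_along h1 h2 h3 h4 hX h5

/-- Maximal reading in the old graph. -/
lemma Gr.exists_split (G : Gr α V) (a : V) (p : Word α) :
    ∃ m1 m2 c, p = m1 ++ m2 ∧ Rd G.E a m1 c ∧ ∀ l p' b, m2 = l :: p' → ¬ G.E c l b := by
  induction p generalizing a with
  | nil => exact ⟨[], [], a, rfl, rfl, by simp⟩
  | cons l p ih =>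
    by_cases h : ∃ b, G.E a l b
    · obtain ⟨b, hb⟩ := h
      obtain ⟨m1, m2, c, rfl, h1, h2⟩ := ih b
      exact ⟨l :: m1, m2, c, rfl, ⟨b, hb, h1⟩, h2⟩
    · refine ⟨[], l :: p, a, rfl, rfl, ?_⟩
      grind

/-- A relator read from an old vertex. -/
lemma SC.Good.hits_of_inc {a : V} {Y : hG.arcs.Nd} {p q : Word α}
    (hY : Rd hG.arcs.gr.E (hG.arcs.inc a) p Y) (hr : p ++ q ∈ C.R)
    (hq : 2 * C.pi (p ++ q) ≤ p.length + 1) : hG.Hits (hG.arcs.inc a) (p ++ q) := by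
  obtain ⟨m1, m2, c, rfl, h1, h2⟩ := G.exists_split a p
  by_cases h3 : C.pi (m1 ++ m2 ++ q) ≤ m1.length
  · refine ⟨a, c, m1, m2 ++ q, ?_, h1, h3⟩
    rw [append_assoc]
    exact Turn.refl _ _
  · obtain ⟨X, h4, h5⟩ := Rd_append.1 hY
    obtain rfl := hG.arcs.gr.rd_det h4 (Arcs.rd_inc h1)
    have ht : Turn hG.arcs.gr (hG.arcs.inc a) (m1 ++ m2 ++ q) (hG.arcs.inc c) (m2 ++ (q ++ m1)) := by
      have := (Turn.refl (G := hG.arcs.gr) (hG.arcs.inc a) (m1 ++ (m2 ++ q))).rot h4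
      grind
    refine SC.Good.Hits.of_turn (SC.Good.hits_short (w := []) rfl h5 ?_ (by simpa using h2)
      (by have := C.two_le; grind) (ht.mem hr) ?_) ht
    · exact (C.red1 (ht.mem hr)).infix ⟨[], q ++ m1, by simp⟩
    · rw [ht.pi_eq (C := C)]
      grind

lemma Arcs.exists_access {κ : ℕ} {S : Arcs G κ} {X Y : S.Nd} {l : α × Bool} (h : S.gr.E X l Y) :
    ∃ a w, Rd S.gr.E (S.inc a) w X := by
  rcases h with ⟨e, p, ⟨t, v, h1, h2⟩, rfl, h3⟩ | ⟨e, p, ⟨t, v, h1, h2⟩, rfl, h3⟩ |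
    ⟨a, b, h1, rfl, h2⟩
  · exact ⟨e, p, Arcs.rd_arc_prefix h1 ((prefix_append _ _).trans h2)⟩
  · exact ⟨e, _, Arcs.rd_arc_prefix h1 h2⟩
  · exact ⟨a, [], rfl⟩

/-- A shortest access path to a reading stays on one arc together with the reading. -/
lemma Arcs.access_prefix {κ : ℕ} {S : Arcs G κ} {X Y : S.Nd} {a : V} {w p : Word α}
    (hX : Rd S.gr.E (S.inc a) w X) (hY : Rd S.gr.E X p Y) (hred : IsReduced (w ++ p))
    (hw : w ≠ []) (hf : ∀ l p' b, w = l :: p' → ¬ G.E a l b) (hκ : κ ≤ w.length)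
    (hmin : ∀ p1 p2 Z b u, p = p1 ++ p2 → Rd S.gr.E X p1 Z → Rd S.gr.E (S.inc b) u Z →
      w.length ≤ u.length) : ∃ t v, S.A a t v ∧ w ++ p <+: t := by
  have k2 := S.two_le
  obtain ⟨t, v, hA, h | h⟩ := Arcs.follow hred (by simp [hw]) (Rd_append.2 ⟨X, hX, hY⟩) (by
    intro l p' b h
    obtain ⟨l', w', rfl⟩ := exists_cons_of_ne_nil hw
    simp only [cons_append, List.cons.injEq] at h
    obtain ⟨rfl, -⟩ := h
    grind)
  · exact ⟨t, v, hA, h⟩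
  exfalso
  have hl := S.len hA
  set n := t.length - κ + 1 with hn
  have hlen : (t.take n).length = n := by rw [length_take]; omega
  -- the point at depth `n` on the arc is close to the far end
  have hback : Rd S.gr.E (S.inc v) (invRev (t.drop n)) (S.nd a (t.take n)) := by
    refine S.gr.rd_symm ?_
    have h1 := Arcs.rd_arc hA
    rw [← take_append_drop n t, Rd_append] at h1
    obtain ⟨Z, h2, h3⟩ := h1
    obtain rfl := S.gr.rd_det h2 (Arcs.rd_arc_prefix hA (take_prefix n t))
    exact h3
  have hpre := Arcs.rd_arc_prefix hA (take_prefix n t)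
  rcases le_total n w.length with hnw | hnw
  · obtain ⟨s, hs⟩ : t.take n <+: w :=
      prefix_of_prefix_length_le h (prefix_append _ _) (by omega)
    rw [← hs, Rd_append] at hX
    obtain ⟨Z, h2, h3⟩ := hX
    obtain rfl := S.gr.rd_det h2 hpre
    have := hmin [] p X v (invRev (t.drop n) ++ s) rfl rfl (Rd_append.2 ⟨_, hback, h3⟩)
    have h5 := congrArg length hs
    simp at this h5
    omega
  · obtain ⟨s, hs⟩ : w <+: t.take n :=
      prefix_of_prefix_length_le (prefix_append _ _) h (by omega)
    obtain ⟨s', hs'⟩ := h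
    rw [← hs] at hs' hpre
    have hp : p = s ++ s' := by simpa using hs'.symm
    rw [Rd_append] at hpre
    obtain ⟨Z, h2, h3⟩ := hpre
    obtain rfl := S.gr.rd_det h2 hX
    have := hmin s s' _ v _ hp h3 (by rw [← hs] at hback; exact hback)
    simp at this
    omega

end Cells

section Cells

variable {C : SC α} {V : Type} {G : Gr α V} {hG : C.Good G}

lemma SC.Good.hits_long_of_along {a v : V} {X : hG.arcs.Nd} {w p q t : Word α}
    (hA : hG.arcs.A a t v) (hwp : w ++ p <+: t) (hr : p ++ q ∈ C.R)
    (hX : Rd hG.arcs.gr.E (hG.arcs.inc a) w X) (hq : C.pi (p ++ q) ≤ p.length) :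
    hG.Hits X (p ++ q) := by
  obtain ⟨t', o, h2, h3, h4, h5⟩ := SC.Good.along hA hwp hr (prefix_append _ _) hq
  exact SC.Good.hits_along hA h2 h3 h4 hX h5

/-- A relator read over a long segment after attaching the arcs comes from a cell overlapping
the old graph. -/
lemma SC.Good.hits_of_long {X Y : hG.arcs.Nd} {p q : Word α}
    (hY : Rd hG.arcs.gr.E X p Y) (hr : p ++ q ∈ C.R) (hq : 3 * C.pi (p ++ q) ≤ p.length) :
    hG.Hits X (p ++ q) := by
  classical
  have hpos := C.pos hr
  have hpred : IsReduced p := (C.red1 hr).infix ⟨[], q, by simp⟩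
  let P : ℕ → Prop := fun n => ∃ a w p1 p2 Z, p = p1 ++ p2 ∧ Rd hG.arcs.gr.E X p1 Z ∧
    Rd hG.arcs.gr.E Z p2 Y ∧ Rd hG.arcs.gr.E (hG.arcs.inc a) w Z ∧ w.length = n
  have hP : ∃ n, P n := by
    obtain ⟨l, p', rfl⟩ := exists_cons_of_ne_nil (show p ≠ [] by grind)
    obtain ⟨m, h1, -⟩ := id hY
    obtain ⟨a, w, hw⟩ := Arcs.exists_access h1
    exact ⟨_, a, w, [], _, X, rfl, rfl, hY, hw, rfl⟩
  obtain ⟨a, w0, p1, p2, Z, rfl, h1, h2, hw0, hn⟩ := Nat.find_spec hP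
  have hmin0 : ∀ n, P n → w0.length ≤ n := fun n h => by rw [hn]; exact Nat.find_min' hP h
  set w := FreeGroup.reduce w0 with hwdef
  have hw : Rd hG.arcs.gr.E (hG.arcs.inc a) w Z := hG.arcs.gr.rd_red hw0 FreeGroup.reduce.red
  have hwred : IsReduced w := IsReduced.of_reduce_eq FreeGroup.reduce.idem
  have hwle : w.length ≤ w0.length := (FreeGroup.reduce.red : Red w0 _).length_le
  have hmin : ∀ n, P n → w.length ≤ n := fun n h => hwle.trans (hmin0 n h)
  clear_value w
  -- rotated and inverted versions of the cell
  have t2 : Turn hG.arcs.gr X (p1 ++ p2 ++ q) Z (p2 ++ (q ++ p1)) := by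
    have := (Turn.refl (G := hG.arcs.gr) X (p1 ++ (p2 ++ q))).rot h1
    grind
  have t1 : Turn hG.arcs.gr X (p1 ++ p2 ++ q) Z (invRev p1 ++ invRev (p2 ++ q)) := by
    have := t2.inv
    simp_all
  have hp2 : IsReduced p2 := hpred.infix ⟨p1, [], by simp⟩
  have hp1 : IsReduced (invRev p1) := isReduced_invRev (hpred.infix ⟨[], p2, by simp⟩)
  rcases eq_or_ne w [] with rfl | hwne
  · -- the reading passes through an old vertex
    obtain rfl : hG.arcs.inc a = Z := hw
    let Q : ℕ → Prop := fun n => ∃ b s1 s2, p1 ++ p2 = s1 ++ s2 ∧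
      Rd hG.arcs.gr.E X s1 (hG.arcs.inc b) ∧ Rd hG.arcs.gr.E (hG.arcs.inc b) s2 Y ∧ s1.length = n
    have hQ : ∃ n, Q n := ⟨_, a, p1, p2, rfl, h1, h2, rfl⟩
    obtain ⟨b, s1, s2, hs, k1, k2, hn⟩ := Nat.find_spec hQ
    have hmin : ∀ n, Q n → s1.length ≤ n := fun n h => by rw [hn]; exact Nat.find_min' hQ h
    rw [hs] at hr hq hpred ⊢
    have t2 : Turn hG.arcs.gr X (s1 ++ s2 ++ q) (hG.arcs.inc b) (s2 ++ (q ++ s1)) := by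
      have := (Turn.refl (G := hG.arcs.gr) X (s1 ++ (s2 ++ q))).rot k1
      grind
    have t1 : Turn hG.arcs.gr X (s1 ++ s2 ++ q) (hG.arcs.inc b)
        (invRev s1 ++ invRev (s2 ++ q)) := by
      have := t2.inv
      simp_all
    by_cases hl : C.pi (s1 ++ s2 ++ q) ≤ s1.length
    · refine (SC.Good.hits_short (w := []) rfl (hG.arcs.gr.rd_symm k1)
        (isReduced_invRev (hpred.infix ⟨[], s2, by simp⟩)) ?_ (by have := C.two_le; simp; omega)
        (t1.mem hr) (by rw [t1.pi_eq (C := C), invRev_length]; exact hl)).of_turn t1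
      intro l p' c h hE
      have h3 : s1 = invRev p' ++ [linv l] := by
        rw [← invRev_cons', ← invRev_invRev (L₁ := s1), ← h]; simp
      rw [h3, Rd_append] at k1
      obtain ⟨Z', h4, h5⟩ := k1
      rw [Rd_singleton] at h5
      obtain rfl := hG.arcs.gr.det (by simpa using hG.arcs.gr.symm h5) (Arcs.inc_edge hE)
      have := hmin _ ⟨c, invRev p', linv l :: s2, by grind, h4, ⟨_, h5, k2⟩, rfl⟩
      grind
    · exact (SC.Good.hits_of_inc k2 (t2.mem hr) (by
        rw [t2.pi_eq (C := C)]; grind)).of_turn t2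
  · have hf : ∀ l p' b, w = l :: p' → ¬ G.E a l b := by
      rintro l p' b rfl hE
      obtain ⟨m, h3, h4⟩ := hw
      obtain rfl := hG.arcs.gr.det h3 (Arcs.inc_edge hE)
      have := hmin _ ⟨b, p', p1, p2, Z, rfl, h1, h2, h4, rfl⟩
      simp at this
    have hf' : ∀ s l p' b, w ++ s = l :: p' → ¬ G.E a l b := by
      intro s l p' b h
      obtain ⟨l', w', rfl⟩ := exists_cons_of_ne_nil hwne
      grind
    have hr2 : IsReduced (w ++ p2) := by
      refine isReduced_append_iff.2 ⟨hwred, hp2, ?_⟩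
      rintro w' l q' m rfl rfl rfl
      obtain ⟨Z1, h3, h4⟩ := Rd_append.1 hw
      rw [Rd_singleton] at h4
      obtain ⟨Z2, h5, h6⟩ := h2
      obtain rfl := hG.arcs.gr.det h5 (hG.arcs.gr.symm h4)
      have := hmin _ ⟨a, w', p1 ++ [linv l], q', Z2, by simp,
        Rd_append.2 ⟨Z, h1, Rd_singleton.2 h5⟩, h6, h3, rfl⟩
      simp at this
    have hr1 : IsReduced (w ++ invRev p1) := by
      refine isReduced_append_iff.2 ⟨hwred, hp1, ?_⟩
      rintro w' l q' m rfl hp rfl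
      obtain ⟨Z1, h3, h4⟩ := Rd_append.1 hw
      rw [Rd_singleton] at h4
      have h7 : p1 = invRev q' ++ [l] := by
        have := congrArg invRev hp
        rwa [invRev_invRev, invRev_cons', linv_linv] at this
      subst h7
      obtain ⟨Z2, h5, h6⟩ := Rd_append.1 h1
      rw [Rd_singleton] at h6
      obtain rfl := hG.arcs.gr.rd_det' (p := [l]) (Rd_singleton.2 h4) (Rd_singleton.2 h6)
      have := hmin _ ⟨a, w', invRev q', l :: p2, Z1, by simp, h5, ⟨Z, h6, h2⟩, h3, rfl⟩
      simp at this
    rcases lt_or_ge w.length C.κ with hκ | hκ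
    · by_cases hl : C.pi (p1 ++ p2 ++ q) ≤ p2.length
      · exact (SC.Good.hits_short hw h2 hr2 (hf' _) hκ (t2.mem hr)
          (by rw [t2.pi_eq (C := C)]; exact hl)).of_turn t2
      · refine (SC.Good.hits_short hw (hG.arcs.gr.rd_symm h1) hr1 (hf' _) hκ (t1.mem hr)
          (by rw [t1.pi_eq (C := C)]; simp only [length_append, invRev_length] at hq hl ⊢; omega)).of_turn t1
    · obtain ⟨t, v, hA, ht⟩ := Arcs.access_prefix hw h2 hr2 hwne hf hκ (by
        rintro s1 s2 Z' b u rfl h3 h4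
        rw [Rd_append] at h2
        obtain ⟨Z'', h5, h6⟩ := h2
        obtain rfl := hG.arcs.gr.rd_det h3 h5
        exact hmin _ ⟨b, u, p1 ++ s1, s2, Z', by simp, Rd_append.2 ⟨Z, h1, h3⟩, h6, h4, rfl⟩)
      obtain ⟨t', v', hA', ht'⟩ := Arcs.access_prefix hw (hG.arcs.gr.rd_symm h1) hr1 hwne hf hκ (by
        intro s1 s2 Z' b u hs h3 h4
        have hp : p1 = invRev s2 ++ invRev s1 := by
          rw [← invRev_append, ← hs, invRev_invRev]
        subst hp
        rw [Rd_append] at h1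
        obtain ⟨Z'', h5, h6⟩ := h1
        obtain rfl := hG.arcs.gr.rd_det' h6 (hG.arcs.gr.rd_symm h3)
        exact hmin _ ⟨b, u, invRev s2, invRev s1 ++ p2, Z'', by simp, h5,
          Rd_append.2 ⟨Z, h6, h2⟩, h4, rfl⟩)
      have htt : t = t' := by
        refine (hG.arcs.uniq hA hA' ?_).1
        obtain ⟨s, rfl⟩ := ht
        obtain ⟨s', rfl⟩ := ht'
        grind
      by_cases hl : C.pi (p1 ++ p2 ++ q) ≤ p2.length
      · exact (SC.Good.hits_long_of_along hA ht (t2.mem hr) hw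
          (by rw [t2.pi_eq (C := C)]; exact hl)).of_turn t2
      · exact (SC.Good.hits_long_of_along hA' ht' (t1.mem hr) hw
          (by rw [t1.pi_eq (C := C)]; simp only [length_append, invRev_length] at hq hl ⊢; omega)).of_turn t1

end Cells

section Cells

variable {C : SC α} {V : Type} {G : Gr α V}

lemma SC.Good.arcs_short {hG : C.Good G} {X Y : hG.arcs.Nd} {p q : Word α}
    (hr : p ++ q ∈ C.R) (hY : Rd hG.arcs.gr.E X p Y) (h : ¬ Rd hG.arcs.gr.E X (p ++ q) X) :
    p.length < 3 * C.pi (p ++ q) := by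
  by_contra hq
  exact h ((SC.Good.hits_of_long hY hr (not_lt.1 hq)).closed hr)

lemma SC.Good.arcs_good (hG : C.Good G) : C.Good hG.arcs.gr := by
  intro X Y p q hr hY h
  have h1 := SC.Good.arcs_short hr hY h
  have h2 := C.len hr
  have h3 := C.pi_le hr
  omega

end Cells

section Pend

variable {V : Type} {G : Gr α V}

/-- The points of a pendant path. -/
def pendAt (v : V) : Word α → V ⊕ Word α
  | [] => Sum.inl v
  | l :: p => Sum.inr (l :: p)

@[simp] lemma pendAt_nil (v : V) : pendAt (α := α) v [] = Sum.inl v := rfl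

lemma pendAt_of_ne {v : V} {p : Word α} (h : p ≠ []) : pendAt v p = Sum.inr p := by
  cases p with
  | nil => grind
  | cons => rfl

lemma pendAt_inj {v : V} {p q : Word α} (h : pendAt v p = pendAt v q) : p = q := by
  cases p <;> cases q <;> simp_all [pendAt]

lemma pendAt_eq_inl {v a : V} {p : Word α} (h : pendAt v p = Sum.inl a) :
    p = [] ∧ v = a := by
  cases p <;> simp_all [pendAt]

variable (G) in
/-- The edges after attaching a pendant path. -/
def PendE (v : V) (s : Word α) (X : V ⊕ Word α) (l : α × Bool)
    (Y : V ⊕ Word α) : Prop :=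
  (∃ a b, G.E a l b ∧ X = Sum.inl a ∧ Y = Sum.inl b) ∨
  (∃ p, p ++ [l] <+: s ∧ X = pendAt v p ∧ Y = pendAt v (p ++ [l])) ∨
  ∃ p, p ++ [linv l] <+: s ∧ X = pendAt v (p ++ [linv l]) ∧ Y = pendAt v p

lemma PendE.out_inl {v a : V} {s : Word α} {l : α × Bool} {Y : V ⊕ Word α}
    (h : PendE G v s (Sum.inl a) l Y) :
    (∃ b, G.E a l b ∧ Y = Sum.inl b) ∨ a = v ∧ [l] <+: s ∧ Y = pendAt v [l] := by
  rcases h with ⟨a', b, h1, h2, h3⟩ | ⟨p, h1, h2, h3⟩ | ⟨p, h1, h2, h3⟩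
  · grind
  · obtain ⟨rfl, rfl⟩ := pendAt_eq_inl h2.symm
    grind
  · simpa using (pendAt_eq_inl h2.symm).1

lemma PendE.out_at {v : V} {s u : Word α} (hu : u ≠ []) {l : α × Bool}
    {Y : V ⊕ Word α} (h : PendE G v s (pendAt v u) l Y) :
    (u ++ [l] <+: s ∧ Y = pendAt v (u ++ [l])) ∨
      ∃ u', u = u' ++ [linv l] ∧ u <+: s ∧ Y = pendAt v u' := by
  rcases h with ⟨a', b, h1, h2, h3⟩ | ⟨p, h1, h2, h3⟩ | ⟨p, h1, h2, h3⟩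
  · exact absurd (pendAt_eq_inl h2).1 hu
  · obtain rfl := pendAt_inj h2; grind
  · obtain rfl := pendAt_inj h2; grind

lemma prefix_snoc_unique {s u : Word α} {l m : α × Bool} (h : u ++ [l] <+: s)
    (h' : u ++ [m] <+: s) : l = m := by
  have := prefix_of_prefix_length_le h h' (by simp)
  simp_all

lemma not_prefix_back {s u : Word α} (hs : IsReduced s) {l : α × Bool}
    (h : u ++ [linv l] ++ [l] <+: s) : False := by
  obtain ⟨t, rfl⟩ := h
  exact not_isReduced_mid (p := u) (q := t) (l := linv l) (by simp_all)

variable (G) in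
/-- The graph with a pendant path attached. -/
def pend (v : V) (s : Word α) (hs : IsReduced s)
    (hf : ∀ l s' b, s = l :: s' → ¬ G.E v l b) : Gr α (V ⊕ Word α) where
  E := PendE G v s
  symm := by
    rintro X l Y (⟨a, b, h1, h2, h3⟩ | ⟨p, h1, h2, h3⟩ | ⟨p, h1, h2, h3⟩)
    · exact Or.inl ⟨b, a, G.symm h1, h3, h2⟩
    · exact Or.inr (Or.inr ⟨p, by simpa, by simpa, h2⟩)
    · exact Or.inr (Or.inl ⟨p, h1, h3, h2⟩)
  det := by
    have hf' : ∀ {l b}, [l] <+: s → ¬ G.E v l b := by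
      rintro l b ⟨t, rfl⟩
      grind
    intro X l Y Y' h h'
    have key : (∃ a, X = Sum.inl a) ∨ ∃ u, u ≠ [] ∧ X = pendAt v u := by
      rcases h with ⟨a, b, h1, h2, h3⟩ | ⟨p, h1, h2, h3⟩ | ⟨p, h1, h2, h3⟩
      · grind
      · rcases eq_or_ne p [] with rfl | hp
        · exact Or.inl ⟨v, h2⟩
        grind
      · exact Or.inr ⟨_, by simp, h2⟩
    rcases key with ⟨a, rfl⟩ | ⟨u, hu, rfl⟩
    · rcases h.out_inl with ⟨b, h1, rfl⟩ | ⟨rfl, h1, rfl⟩ <;>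
      rcases h'.out_inl with ⟨b', h2, rfl⟩ | ⟨h2, h3, rfl⟩
      · rw [G.det h1 h2]
      · grind
      · grind
      · rfl
    · rcases h.out_at hu with ⟨h1, rfl⟩ | ⟨u', rfl, h1, rfl⟩ <;>
      rcases h'.out_at hu with ⟨h2, rfl⟩ | ⟨u2, h2, h3, rfl⟩
      · rfl
      · subst h2; exact (not_prefix_back hs h1).elim
      · exact (not_prefix_back hs h2).elim
      · rw [append_cancel_right h2]

variable {v : V} {s : Word α} {hs : IsReduced s}
  {hf : ∀ l s' b, s = l :: s' → ¬ G.E v l b}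

lemma pend_edge {a b : V} {l : α × Bool} (h : G.E a l b) :
    (pend G v s hs hf).E (Sum.inl a) l (Sum.inl b) := Or.inl ⟨a, b, h, rfl, rfl⟩

lemma rd_pend_inl {a b : V} {p : Word α} (h : Rd G.E a p b) :
    Rd (pend G v s hs hf).E (Sum.inl a) p (Sum.inl b) := h.map _ fun _ _ _ => pend_edge

lemma rd_pend {p q : Word α} (h : p ++ q <+: s) :
    Rd (pend G v s hs hf).E (pendAt v p) q (pendAt v (p ++ q)) := by
  induction q generalizing p with
  | nil => simp
  | cons l q ih =>
    refine ⟨pendAt v (p ++ [l]), Or.inr (Or.inl ⟨p, ?_, rfl, rfl⟩), ?_⟩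
    · exact IsPrefix.trans ⟨q, by simp⟩ h
    grind

/-- Readings from an old vertex. -/
lemma rd_pend_from_inl {a : V} {p : Word α} {X : V ⊕ Word α} (hp : IsReduced p)
    (h : Rd (pend G v s hs hf).E (Sum.inl a) p X) :
    ∃ q1 q2 c, p = q1 ++ q2 ∧ Rd G.E a q1 c ∧
      ((q2 = [] ∧ X = Sum.inl c) ∨ (c = v ∧ q2 ≠ [] ∧ q2 <+: s ∧ X = pendAt v q2)) := by
  induction p using reverseRecOn generalizing X with
  | nil => simp_all
  | append_singleton p l ih =>
    obtain ⟨Y, h1, h2⟩ := Rd_append.1 h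
    rw [Rd_singleton] at h2
    obtain ⟨q1, q2, c, rfl, h3, ⟨rfl, rfl⟩ | ⟨rfl, h4, h5, rfl⟩⟩ := ih (hp.infix ⟨[], [l], by simp⟩) h1
    · rcases PendE.out_inl h2 with ⟨b, h5, rfl⟩ | ⟨rfl, h5, rfl⟩
      · exact ⟨q1 ++ [l], [], b, by simp, Rd_append.2 ⟨_, h3, Rd_singleton.2 h5⟩, Or.inl ⟨rfl, rfl⟩⟩
      grind
    · rcases PendE.out_at h4 h2 with ⟨h6, rfl⟩ | ⟨u', rfl, h6, rfl⟩
      · exact ⟨q1, q2 ++ [l], _, by simp, h3, Or.inr ⟨rfl, by simp, h6, rfl⟩⟩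
      · exact (not_isReduced_mid (p := q1 ++ u') (q := []) (l := linv l) (by simpa using hp)).elim

/-- Readings from a point of the pendant path. -/
lemma rd_pend_from_at {u p : Word α} {X : V ⊕ Word α} (hp : IsReduced p)
    (hu : u ≠ []) (h : Rd (pend G v s hs hf).E (pendAt v u) p X) :
    p = [] ∨ u ++ p <+: s ∨ (u <+: s ∧ ∃ u', u = u' ++ invRev p ∧ X = pendAt v u') ∨
      ∃ p', u <+: s ∧ p = invRev u ++ p' ∧ Rd (pend G v s hs hf).E (Sum.inl v) p' X := by
  suffices H : (p = [] ∧ X = pendAt v u) ∨ (p ≠ [] ∧ u ++ p <+: s ∧ X = pendAt v (u ++ p)) ∨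
      (p ≠ [] ∧ u <+: s ∧ ∃ u', u = u' ++ invRev p ∧ X = pendAt v u') ∨
      ∃ p', u <+: s ∧ p = invRev u ++ p' ∧ Rd (pend G v s hs hf).E (Sum.inl v) p' X by
    grind
  induction p using reverseRecOn generalizing X with
  | nil => simp_all
  | append_singleton p l ih =>
    right
    obtain ⟨Y, h1, h2⟩ := Rd_append.1 h
    have h2' := h2
    rw [Rd_singleton] at h2
    rcases ih (hp.infix ⟨[], [l], by simp⟩) h1 with ⟨rfl, rfl⟩ | ⟨h3, h4, rfl⟩ |
      ⟨h3, h4, u', h5, rfl⟩ | ⟨p', h4, rfl, h5⟩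
    · rcases PendE.out_at hu h2 with ⟨h6, rfl⟩ | ⟨u', rfl, h6, rfl⟩
      · grind
      · exact Or.inr (Or.inl ⟨by simp, h6, u', by simp [invRev, linv], rfl⟩)
    · rcases PendE.out_at (by simp [hu]) h2 with ⟨h6, rfl⟩ | ⟨u', h7, h6, rfl⟩
      · simp_all
      · obtain ⟨p', m, rfl⟩ := (eq_nil_or_concat p).resolve_left h3
        rw [concat_eq_append, ← append_assoc] at h7
        obtain ⟨rfl, h8⟩ := append_inj' h7 rfl
        obtain rfl : m = linv l := by grind
        exact (not_isReduced_mid (p := p') (q := []) (l := linv l) (by simpa using hp)).elim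
    · rcases eq_or_ne u' [] with rfl | hu'
      · simp_all
      · rcases PendE.out_at hu' h2 with ⟨h6, rfl⟩ | ⟨u2, rfl, h6, rfl⟩
        · obtain ⟨p', m, rfl⟩ := (eq_nil_or_concat p).resolve_left h3
          have h7 : u' ++ [linv m] <+: s := by
            refine IsPrefix.trans ?_ h4
            rw [h5, concat_eq_append, invRev_concat]
            exact ⟨invRev p', by simp⟩
          obtain rfl := prefix_snoc_unique h6 h7
          exact (not_isReduced_mid (p := p') (q := []) (l := m) (by grind)).elim
        · refine Or.inr (Or.inl ⟨by simp, h4, u2, ?_, rfl⟩)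
          rw [h5, invRev_concat]; simp
    · exact Or.inr (Or.inr ⟨p' ++ [l], h4, by simp, Rd_append.2 ⟨Y, h5, h2'⟩⟩)

/-- A reading consists of an old part between two segments of the pendant path. -/
lemma rd_pend_split {p : Word α} {X Y : V ⊕ Word α} (hp : IsReduced p)
    (h : Rd (pend G v s hs hf).E X p Y) :
    p.length ≤ s.length ∨ ∃ u1 m u2 a c, p = u1 ++ m ++ u2 ∧ u1.length ≤ s.length ∧
      u2.length ≤ s.length ∧ Rd G.E a m c ∧ Rd (pend G v s hs hf).E X u1 (Sum.inl a) := by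
  rcases X with a | u
  · obtain ⟨q1, q2, c, rfl, h1, ⟨rfl, -⟩ | ⟨-, -, h3, -⟩⟩ := rd_pend_from_inl hp h
    · exact Or.inr ⟨[], q1, [], a, c, by simp, by simp, by simp, h1, rfl⟩
    · exact Or.inr ⟨[], q1, q2, a, c, by simp, by simp, h3.length_le, h1, rfl⟩
  · rcases eq_or_ne p [] with rfl | hp0
    · simp
    rcases eq_or_ne u [] with rfl | hu
    · obtain ⟨l, p', rfl⟩ := exists_cons_of_ne_nil hp0
      obtain ⟨Z, h1, -⟩ := h
      rcases h1 with ⟨a', b, h1, h2, h3⟩ | ⟨p, h1, h2, h3⟩ | ⟨p, h1, h2, h3⟩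
      · cases h2
      · cases p <;> simp [pendAt] at h2
      · cases p <;> simp [pendAt] at h2
    rw [← pendAt_of_ne (v := v) hu] at h
    rcases rd_pend_from_at hp hu h with h1 | h1 | ⟨h1, u', h2, -⟩ | ⟨p', h1, h2, h3⟩
    · grind
    · grind
    · have := h1.length_le; have h3 := congrArg length h2; simp at h3; omega
    · obtain ⟨q1, q2, c, rfl, h4, h5⟩ := rd_pend_from_inl
        (hp.infix ⟨invRev u, [], by simp [h2]⟩) h3
      refine Or.inr ⟨invRev u, q1, q2, v, c, by simp [h2], by simpa using h1.length_le, ?_, h4, ?_⟩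
      · grind
      · rw [← pendAt_of_ne (v := v) hu]
        have := (pend G v s hs hf).rd_symm (rd_pend (G := G) (v := v) (hs := hs) (hf := hf)
          (p := []) (q := u) (by grind))
        simp_all

end Pend

section Extend

variable {C : SC α} {V : Type} {G : Gr α V}

lemma SC.Good.pend_good (hG : C.Good G) {v : hG.arcs.Nd} {s : Word α} {hs : IsReduced s}
    {hf : ∀ l s' b, s = l :: s' → ¬ hG.arcs.gr.E v l b} (hl : s.length ≤ C.κ) :
    C.Good (pend hG.arcs.gr v s hs hf) := by
  intro X Y p q hr hp hn
  have h1 := C.len hr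
  have h2 := C.pi_le hr
  rcases rd_pend_split ((C.red1 hr).infix ⟨[], q, by simp⟩) hp with
    h3 | ⟨u1, m, u2, a, c, rfl, h3, h4, h5, h6⟩
  · omega
  · have h7 : m ++ (u2 ++ q ++ u1) ∈ C.R := by
      have := C.rot (p := u1) (q := m ++ u2 ++ q) (by grind)
      grind
    have h8 : C.pi (m ++ (u2 ++ q ++ u1)) = C.pi (u1 ++ m ++ u2 ++ q) := by
      have := C.pi_rot u1 (m ++ u2 ++ q)
      grind
    have h9 := SC.Good.arcs_short h7 h5 (by
      intro h
      apply hn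
      have h10 := (pend hG.arcs.gr v s hs hf).closed_rot (q := m ++ u2 ++ q) h6
      simp only [append_assoc] at h10 ⊢
      refine h10.2 ?_
      have := rd_pend_inl (v := v) (s := s) (hs := hs) (hf := hf) h
      grind)
    grind

/-- Every word can be read in some extension. -/
lemma SC.Good.exists_readable (hG : C.Good G) (v : V) (w : Word α) :
    ∃ (V' : Type) (G' : Gr α V') (f : V → V') (y : V'), C.Good G' ∧ Function.Injective f ∧
      (∀ a l b, G.E a l b → G'.E (f a) l (f b)) ∧ Rd G'.E (f v) w y := by
  induction w generalizing V with
  | nil => exact ⟨V, G, id, v, hG, Function.injective_id, fun _ _ _ h => h, rfl⟩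
  | cons l w ih =>
    by_cases h : ∃ b, G.E v l b
    · obtain ⟨b, hb⟩ := h
      obtain ⟨V', G', f, y, h1, h2, h3, h4⟩ := ih hG b
      exact ⟨V', G', f, y, h1, h2, h3, f b, h3 _ _ _ hb, h4⟩
    by_cases h : ∃ Y, hG.arcs.gr.E (hG.arcs.inc v) l Y
    · obtain ⟨b, hb⟩ := h
      obtain ⟨V', G', f, y, h1, h2, h3, h4⟩ := ih hG.arcs_good b
      exact ⟨V', G', f ∘ hG.arcs.inc, y, h1, h2.comp fun _ _ => Arcs.inc_inj,
        fun a l b h => h3 _ _ _ (Arcs.inc_edge h), f b, h3 _ _ _ hb, h4⟩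
    · have hP := hG.pend_good (v := hG.arcs.inc v) (s := [l]) (hs := IsReduced.singleton) (hf := by
          grind) (by have := C.two_le; simp; omega)
      obtain ⟨V', G', f, y, h1, h2, h3, h4⟩ := ih hP (pendAt (hG.arcs.inc v) [l])
      refine ⟨V', G', f ∘ Sum.inl ∘ hG.arcs.inc, y, h1,
        h2.comp (Sum.inl_injective.comp fun _ _ => Arcs.inc_inj),
        fun a l b h => h3 _ _ _ (pend_edge (Arcs.inc_edge h)), _, h3 _ _ _ ?_, h4⟩
      exact Or.inr (Or.inl ⟨[], prefix_rfl, rfl, rfl⟩)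

lemma SC.Good.closed_of_read (hG : C.Good G) {a b : V} {r : Word α} (hr : r ∈ C.R)
    (h : Rd G.E a r b) : Rd G.E a r a := by
  by_contra hn
  have := hG a b r [] (by grind) h (by grind)
  have := C.two_le
  grind

/-- A good graph embeds in the Cayley graph. -/
lemma SC.Good.eq_of_mem (hG : C.Good G) {v v' : V} {w : Word α} (h : Rd G.E v w v')
    (hw : FreeGroup.mk w ∈ Subgroup.normalClosure (FreeGroup.mk '' C.R)) : v = v' := by
  have key : ∀ x ∈ Subgroup.normalClosure (FreeGroup.mk '' C.R), ∃ W0, FreeGroup.mk W0 = x ∧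
      ∀ (V' : Type) (G' : Gr α V'), C.Good G' → ∀ a b, Rd G'.E a W0 b → a = b := by
    intro x hx
    induction hx using Subgroup.closure_induction with
    | mem x hx =>
      rw [Group.mem_conjugatesOfSet_iff] at hx
      obtain ⟨_, ⟨r, hr, rfl⟩, h⟩ := hx
      rw [isConj_iff] at h
      obtain ⟨g, rfl⟩ := h
      obtain ⟨u, rfl⟩ := Quot.exists_rep g
      refine ⟨u ++ r ++ invRev u, ?_, ?_⟩
      · rfl
      · intro V' G' hG' a b hab
        obtain ⟨m, hab, h3⟩ := Rd_append.1 hab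
        obtain ⟨m', h1, h2⟩ := Rd_append.1 hab
        obtain rfl := G'.rd_det h2 (hG'.closed_of_read hr h2)
        exact G'.rd_det (G'.rd_symm h1) h3
    | one => exact ⟨[], rfl, fun V' G' _ a b h => h⟩
    | mul x y _ _ hx hy =>
      obtain ⟨W1, rfl, h1⟩ := hx
      obtain ⟨W2, rfl, h2⟩ := hy
      refine ⟨W1 ++ W2, (mul_mk).symm, fun V' G' hG' a b h => ?_⟩
      obtain ⟨m, h3, h4⟩ := Rd_append.1 h
      grind
    | inv x _ hx =>
      obtain ⟨W1, rfl, h1⟩ := hx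
      refine ⟨invRev W1, (inv_mk).symm, fun V' G' hG' a b h => ?_⟩
      exact (h1 V' G' hG' _ _ (by simpa using G'.rd_symm h)).symm
  obtain ⟨W0, h1, h2⟩ := key _ hw
  obtain ⟨V', G', f, y, h3, h4, h5, h6⟩ := hG.exists_readable v W0
  obtain rfl := h2 V' G' h3 _ _ h6
  exact h4 (G'.rd_mk_eq h6 (h.map f h5) h1)

end Extend

section Group

variable (C : SC α)

/-- The group presented by the relators. -/
abbrev SC.Grp : Type := FreeGroup α ⧸ Subgroup.normalClosure (FreeGroup.mk '' C.R)

/-- The quotient map. -/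
abbrev SC.pr : FreeGroup α →* C.Grp := QuotientGroup.mk' _

/-- The value of a word in the quotient group. -/
def SC.ev (p : Word α) : C.Grp := C.pr (FreeGroup.mk p)

@[simp] lemma SC.ev_nil : C.ev [] = 1 := by
  rw [SC.ev, ← one_eq_mk, _root_.map_one]

lemma SC.ev_append (p q : Word α) : C.ev (p ++ q) = C.ev p * C.ev q := by
  rfl

lemma SC.ev_invRev (p : Word α) : C.ev (invRev p) = (C.ev p)⁻¹ := by
  rfl

lemma SC.ev_eq_one {p : Word α} :
    C.ev p = 1 ↔ FreeGroup.mk p ∈ Subgroup.normalClosure (FreeGroup.mk '' C.R) := by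
  rw [SC.ev]; exact QuotientGroup.eq_one_iff _

lemma SC.ev_rel {r : Word α} (hr : r ∈ C.R) : C.ev r = 1 :=
  C.ev_eq_one.2 (Subgroup.subset_normalClosure ⟨r, hr, rfl⟩)

lemma SC.ev_congr {p q : Word α} (h : FreeGroup.mk p = FreeGroup.mk q) :
    C.ev p = C.ev q := by rw [SC.ev, h, SC.ev]

/-- Words of minimal length among those with the same value. -/
def SC.Geo (p : Word α) : Prop := ∀ q, C.ev q = C.ev p → p.length ≤ q.length

/-- Words containing no long part of a relator. -/
def SC.Q (p : Word α) : Prop :=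
  ∀ s t, s ++ t ∈ C.R → s <:+: p → s.length + 3 * C.κ ≤ (s ++ t).length

variable {C}

lemma SC.Geo.infix {p q : Word α} (h : C.Geo p) (hq : q <:+: p) : C.Geo q := by
  obtain ⟨a, b, rfl⟩ := hq
  intro q' hq'
  have := h (a ++ q' ++ b) (by simp only [C.ev_append, hq'])
  grind

lemma SC.Geo.red {p : Word α} (h : C.Geo p) : IsReduced p := by
  rw [isReduced_iff_not_step]
  intro q hq
  have h1 := h q (C.ev_congr (Quot.sound hq).symm)
  have := hq.length
  omega

lemma SC.Geo.invRev {p : Word α} (h : C.Geo p) : C.Geo (invRev p) := by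
  intro q hq
  have := h (FreeGroup.invRev q) (by rw [C.ev_invRev, hq, C.ev_invRev, inv_inv])
  simp_all

lemma SC.Geo.rel {p s t : Word α} (h : C.Geo p) (hs : s <:+: p) (hr : s ++ t ∈ C.R) :
    2 * s.length ≤ (s ++ t).length := by
  have := h.infix hs (FreeGroup.invRev t) (by
    rw [C.ev_invRev, inv_eq_iff_mul_eq_one, ← C.ev_append]
    exact C.ev_rel (C.rot hr))
  simp at *
  omega

lemma SC.Geo.Q {p : Word α} (h : C.Geo p) : C.Q p := by
  intro s t hr hs
  have h1 := h.rel hs hr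
  have h2 := C.len hr
  omega

lemma SC.exists_geo (x : C.Grp) : ∃ p, C.Geo p ∧ C.ev p = x := by
  have hne : ∃ n, ∃ p, C.ev p = x ∧ p.length = n := by
    obtain ⟨g, rfl⟩ := QuotientGroup.mk_surjective x
    obtain ⟨p, rfl⟩ := Quot.exists_rep g
    exact ⟨_, p, rfl, rfl⟩
  classical
  obtain ⟨p, hp, hl⟩ := Nat.find_spec hne
  refine ⟨p, fun q hq => ?_, hp⟩
  rw [hl]
  exact Nat.find_min' hne ⟨q, hq.trans hp, rfl⟩

end Group

section Potentials

variable {C : SC α} {V : Type} {G : Gr α V}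

lemma Gr.Pot.ev {φ : V → C.Grp} (h : G.Pot C.pr φ) {a b : V} {p : Word α}
    (hp : Rd G.E a p b) : φ b = φ a * C.ev p := h.rd hp

lemma SC.Good.eq_of_ev (hG : C.Good G) {a b : V} {p : Word α} (hp : Rd G.E a p b)
    (h : C.ev p = 1) : a = b := hG.eq_of_mem hp (C.ev_eq_one.1 h)

lemma SC.Good.eq_of_rd (hG : C.Good G) {a b c : V} {p q : Word α} (hp : Rd G.E a p b)
    (hq : Rd G.E a q c) (h : C.ev p = C.ev q) : b = c := by
  refine hG.eq_of_ev (p := invRev p ++ q) (Rd_append.2 ⟨a, G.rd_symm hp, hq⟩) ?_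
  rw [C.ev_append, C.ev_invRev, h, inv_mul_cancel]

lemma SC.Good.exists_pot {hG : C.Good G} {φ : V → C.Grp} (h : G.Pot C.pr φ) :
    ∃ ψ, hG.arcs.gr.Pot C.pr ψ ∧ ∀ e p, ψ (hG.arcs.nd e p) = φ e * C.ev p := by
  refine Arcs.exists_pot h ?_
  intro e t v hA
  obtain ⟨o, h1, h2, -⟩ := SC.Good.rd_cell hA
  have h3 := C.ev_rel h1
  rw [h.ev h2, mul_assoc, eq_comm]
  convert mul_one _
  exact mul_eq_one_comm.1 h3

lemma pend_pot {v : V} {s : Word α} {hs : IsReduced s}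
    {hf : ∀ l s' b, s = l :: s' → ¬ G.E v l b} {φ : V → C.Grp} (h : G.Pot C.pr φ) :
    ∃ ψ, (pend G v s hs hf).Pot C.pr ψ ∧ ∀ a, ψ (Sum.inl a) = φ a := by
  let ψ : V ⊕ Word α → C.Grp := Sum.elim φ (fun p => φ v * C.ev p)
  have hat : ∀ p, ψ (pendAt v p) = φ v * C.ev p := by
    intro p; cases p <;> simp [ψ, pendAt]
  refine ⟨ψ, ?_, fun a => rfl⟩
  rintro X l Y (⟨a, b, h1, rfl, rfl⟩ | ⟨p, h1, rfl, rfl⟩ | ⟨p, h1, rfl, rfl⟩)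
  · exact h _ _ _ h1
  · rw [hat, hat, C.ev_append, mul_assoc]; rfl
  · rw [hat, hat, C.ev_append, mul_assoc, mul_assoc]
    change _ = _ * (_ * (C.ev [linv l] * C.ev [l]))
    rw [← C.ev_append]
    have : C.ev ([linv l] ++ [l]) = 1 := by
      have : invRev [l] = [linv l] := by simp [invRev, linv]
      rw [C.ev_append, ← this, C.ev_invRev, inv_mul_cancel]
    rw [this, mul_one]

end Potentials

section Line

/-- The segment graph labelled by a reduced word. -/
def lineGr (Y : Word α) (hY : IsReduced Y) : Gr α ℕ where
  E i l j := (j = i + 1 ∧ Y[i]? = some l) ∨ (i = j + 1 ∧ Y[j]? = some (linv l))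
  symm := by
    rintro i l j (⟨h1, h2⟩ | ⟨h1, h2⟩)
    · simp_all
    grind
  det := by
    have key : ∀ i l, Y[i]? = some (linv l) → Y[i+1]? = some l → False := by
      intro i l h1 h2
      have h3 : Y = Y.take i ++ linv l :: l :: Y.drop (i + 2) := by
        rw [List.getElem?_eq_some_iff] at h1 h2
        obtain ⟨h1, h1'⟩ := h1
        obtain ⟨h2, h2'⟩ := h2
        rw [← h1', ← h2', ← drop_eq_getElem_cons, ← drop_eq_getElem_cons,
          take_append_drop]
      rw [h3] at hY
      have h4 := not_isReduced_mid (p := Y.take i) (q := Y.drop (i + 2)) (l := linv l)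
      rw [linv_linv] at h4
      grind
    grind

variable {Y : Word α} {hY : IsReduced Y}

lemma rd_line {i : ℕ} {p : Word α} (h : p <+: Y.drop i) :
    Rd (lineGr Y hY).E i p (i + p.length) := by
  induction p generalizing i with
  | nil => rfl
  | cons l p ih =>
    obtain ⟨q, hq⟩ := h
    refine ⟨i + 1, Or.inl ⟨rfl, ?_⟩, ?_⟩
    · have := congrArg (·[0]?) hq
      grind
    · have := ih (i := i + 1) ⟨q, by
        have := congrArg tail hq
        simpa using this⟩
      grind

lemma rd_line_all : Rd (lineGr Y hY).E 0 Y Y.length := by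
  simpa using rd_line (Y := Y) (hY := hY) (i := 0) (p := Y) (by simp)

lemma rd_line_cases {i j : ℕ} {p : Word α} (hp : IsReduced p)
    (h : Rd (lineGr Y hY).E i p j) :
    (p <+: Y.drop i ∧ j = i + p.length) ∨ (invRev p <+: Y.drop j ∧ i = j + p.length) := by
  induction p generalizing i with
  | nil => left; simp_all
  | cons l p ih =>
    obtain ⟨m, h1, h2⟩ := h
    have ih := ih (hp.infix ⟨[l], [], by simp⟩) h2
    rcases h1 with ⟨rfl, h1⟩ | ⟨rfl, h1⟩
    · rcases ih with ⟨h3, rfl⟩ | ⟨h3, h4⟩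
      · left
        refine ⟨?_, by simp; omega⟩
        rw [List.getElem?_eq_some_iff] at h1
        obtain ⟨h1, rfl⟩ := h1
        rw [drop_eq_getElem_cons h1, cons_prefix_cons]
        exact ⟨rfl, h3⟩
      · cases p with
        | nil =>
          left
          simp at h4; subst h4
          rw [List.getElem?_eq_some_iff] at h1
          obtain ⟨h1, rfl⟩ := h1
          refine ⟨?_, by simp⟩
          rw [drop_eq_getElem_cons h1, cons_prefix_cons]
          exact ⟨rfl, nil_prefix⟩
        | cons m p =>
          exfalso
          simp at h4
          have h5 : i = j + p.length := by omega
          subst h5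
          rw [invRev_cons'] at h3
          obtain ⟨q, hq⟩ := h3
          have h6 := congrArg (·[p.length]?) hq
          simp only [append_assoc, getElem?_drop, singleton_append] at h6
          rw [getElem?_append_right (by simp)] at h6
          simp only [invRev_length, tsub_self, getElem?_cons_zero] at h6
          rw [h1] at h6
          simp at h6
          rw [isReduced_cons_cons'] at hp
          apply hp.1
          rw [← h6]; simp
    · rcases ih with ⟨h3, h4⟩ | ⟨h3, h4⟩
      · cases p with
        | nil =>
          right
          simp at h4; subst h4
          rw [List.getElem?_eq_some_iff] at h1
          obtain ⟨h1, h1'⟩ := h1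
          refine ⟨?_, by simp⟩
          rw [drop_eq_getElem_cons h1, h1']
          simp [invRev, linv]
        | cons n p =>
          exfalso
          obtain ⟨q, hq⟩ := h3
          have h6 := congrArg (·[0]?) hq
          simp at h6
          rw [h1] at h6
          rw [isReduced_cons_cons'] at hp
          apply hp.1
          grind
      · right
        subst h4
        refine ⟨?_, by simp; omega⟩
        rw [invRev_cons']
        obtain ⟨q, hq⟩ := h3
        rw [List.getElem?_eq_some_iff] at h1
        obtain ⟨h1, h1'⟩ := h1
        have h7 : q = Y.drop (j + p.length) := by
          have := congrArg (drop p.length) hq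
          rw [drop_append_of_le_length (by simp), drop_eq_nil_of_le (by simp)] at this
          simpa [drop_drop] using this
        rw [drop_eq_getElem_cons h1, h1'] at h7
        exact ⟨Y.drop (j + p.length + 1), by rw [← hq, h7]; simp⟩

variable {C : SC α}

lemma rd_line_infix {i j : ℕ} {p : Word α} (hp : IsReduced p)
    (h : Rd (lineGr Y hY).E i p j) : p <:+: Y ∨ invRev p <:+: Y := by
  rcases rd_line_cases hp h with ⟨h, -⟩ | ⟨h, -⟩
  · exact Or.inl (h.isInfix.trans (drop_suffix _ _).isInfix)
  · exact Or.inr (h.isInfix.trans (drop_suffix _ _).isInfix)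

lemma SC.Q.good (h : C.Q Y) : C.Good (lineGr Y hY) := by
  intro i j p q hr hp _
  rcases rd_line_infix ((C.red1 hr).infix ⟨[], q, by simp⟩) hp with h1 | h1
  · exact h _ _ hr h1
  · have h2 : invRev p ++ invRev q ∈ C.R := by
      have := C.inv (C.rot hr)
      simp_all
    have := h _ _ h2 h1
    simp_all

lemma line_pot (g : C.Grp) : (lineGr Y hY).Pot C.pr fun i => g * C.ev (Y.take i) := by
  have key : ∀ i l, Y[i]? = some l → g * C.ev (Y.take (i + 1)) = g * C.ev (Y.take i) * C.ev [l] := by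
    intro i l h
    rw [take_add_one, h, C.ev_append, mul_assoc]; rfl
  rintro i l j (⟨rfl, h2⟩ | ⟨rfl, h2⟩)
  · exact key _ _ h2
  · change _ = _ * C.ev [l]
    change _ = g * C.ev (Y.take (j + 1)) * _
    rw [key _ _ h2, mul_assoc, ← C.ev_append]
    have : C.ev ([linv l] ++ [l]) = 1 := by
      have : invRev [l] = [linv l] := by simp [invRev, linv]
      rw [C.ev_append, ← this, C.ev_invRev, inv_mul_cancel]
    rw [this, mul_one]

/-- Dehn's algorithm: a nontrivial reduced word with trivial value contains a long part of a
relator. -/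
lemma SC.exists_of_ev_eq_one (hY : IsReduced Y) (hne : Y ≠ []) (h : C.ev Y = 1) :
    ∃ s t, s ++ t ∈ C.R ∧ s <:+: Y ∧ (s ++ t).length < s.length + 3 * C.κ := by
  by_contra hn
  have hQ : C.Q Y := by
    intro s t h1 h2
    grind
  have := (hQ.good (hY := hY)).eq_of_ev rd_line_all h
  grind

end Line

section

variable {C : SC α}

lemma SC.ne_one_of_infix {m z : Word α} (hr : m ++ z ∈ C.R) (hm : m ≠ [])
    (hl : m.length + 3 * C.κ ≤ (m ++ z).length) : C.ev m ≠ 1 := by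
  intro h
  obtain ⟨s, t, h1, ⟨a, b, rfl⟩, h3⟩ :=
    C.exists_of_ev_eq_one ((C.red1 hr).infix ⟨[], z, by simp⟩) hm h
  have h4 : s ++ (b ++ z ++ a) ∈ C.R := by
    have := C.rot (p := a) (q := s ++ b ++ z) (by simpa using hr)
    simpa using this
  have h5 := C.len h1
  have h7 := C.eq_of_prefix h1 h4 (prefix_append _ _) (prefix_append _ _)
    (by grind)
  grind

section Escape

variable {V : Type} {G : Gr α V}

lemma SC.Good.arc_of_pend (hG : C.Good G) {φ : V → C.Grp} (hφ : G.Pot C.pr φ) {x : hG.arcs.Nd}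
    {s g : Word α} {hs : IsReduced s}
    {hf : ∀ l s' b, s = l :: s' → ¬ hG.arcs.gr.E x l b} (hl : s.length = C.κ)
    (hE : C.Good (pend hG.arcs.gr x s hs hf)) (hgeo : C.Geo (s ++ g)) (hg : g ≠ [])
    {X : hE.arcs.Nd} (hX : Rd hE.arcs.gr.E (hE.arcs.inc (pendAt x s)) g X) :
    ∃ t v, hE.arcs.A (pendAt x s) t v ∧ g <+: t ∧ g.length + C.κ ≤ t.length := by
  have k2 := C.two_le
  have hs0 : s ≠ [] := by grind
  obtain ⟨t, v, hA, h⟩ := Arcs.follow (hgeo.red.infix ⟨s, [], by simp⟩) hg hX (by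
    rintro l p' b rfl hb
    rcases PendE.out_at hs0 hb with ⟨h1, -⟩ | ⟨u', h1, -⟩
    · grind
    · refine not_isReduced_mid (p := u') (q := p') (l := linv l) ?_
      have := hgeo.red
      simp_all)
  have hlen := hE.arcs.len hA
  by_contra hcon
  obtain ⟨T, T', rfl, hT, hp⟩ : ∃ T T', t = T ++ T' ∧ T'.length + 1 = C.κ ∧ T <+: g := by
    refine ⟨t.take (t.length - C.κ + 1), t.drop (t.length - C.κ + 1), by simp,
      by simp; omega, ?_⟩
    rcases h with h | h
    · by_cases hc : g.length + C.κ ≤ t.length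
      · grind
      · exact prefix_of_prefix_length_le (take_prefix _ _) h (by simp; omega)
    · exact h
  obtain ⟨o, h1, h2, h3⟩ := SC.Good.rd_cell hA
  have hpos := C.pos h1
  have hpi := C.pi_le h1
  have hrl := C.len h1
  have hor : IsReduced (invRev o) :=
    isReduced_invRev ((C.red1 h1).infix ⟨T ++ T', [], by simp⟩)
  have hg1 := hgeo.rel (s := T) (t := T' ++ o) (hp.isInfix.trans ⟨s, [], by simp⟩)
    (by simpa using h1)
  rcases rd_pend_from_at hor hs0 ((pend hG.arcs.gr x s hs hf).rd_symm h2) with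
    h4 | h4 | ⟨-, u', h4, -⟩ | ⟨p', -, h4, h5⟩
  · have := congrArg length h4
    rw [invRev_length, length_nil] at this
    omega
  · have := h4.length_le
    simp only [length_append, invRev_length] at *; omega
  · have := congrArg length h4
    simp only [length_append, invRev_length] at *
    omega
  · have ho : o = invRev p' ++ s := by
      have := congrArg invRev h4
      simpa [invRev_append] using this
    subst ho
    have hp'r : IsReduced p' := by
      refine hor.infix ⟨invRev s, [], ?_⟩
      simp
    have hst : (s ++ T) ++ (T' ++ invRev p') ∈ C.R := by
      have := C.rot (p := T ++ T' ++ invRev p') (q := s) (by simpa using h1)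
      simpa using this
    have hg2 := hgeo.rel ((prefix_append_right_inj s).2 hp).isInfix hst
    have hinv : p' ++ (invRev (T ++ T') ++ invRev s) ∈ C.R := by
      have := C.inv h1
      have := C.rot (p := invRev s) (q := p' ++ invRev (T ++ T'))
        (by simpa [invRev_append] using this)
      simpa using this
    have hncl : ¬ Rd hG.arcs.gr.E x (p' ++ (invRev (T ++ T') ++ invRev s)) x := by
      intro hc
      have hc1 : Rd (pend hG.arcs.gr x s hs hf).E (Sum.inl x) (p' ++ (invRev (T ++ T') ++ invRev s))
        (Sum.inl x) := rd_pend_inl hc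
      have hc2 : Rd (pend hG.arcs.gr x s hs hf).E (Sum.inl x) (s ++ (T ++ T' ++ invRev p'))
          (Sum.inl x) := by
        have := (pend hG.arcs.gr x s hs hf).rd_symm hc1
        simpa [invRev_append] using this
      obtain ⟨Z, hz1, hz2⟩ := Rd_append.1 hc2
      have hz3 := rd_pend (hs := hs) (hf := hf) (v := x) (p := []) (q := s) (s := s) (by simp)
      obtain rfl := (pend hG.arcs.gr x s hs hf).rd_det hz1 (by simpa using hz3)
      rcases hTT : T ++ T' with _ | ⟨l, t⟩
      · grind
      · rw [hTT] at hz2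
        obtain ⟨Z, hz4, -⟩ := hz2
        rw [hTT] at hA
        exact hE.arcs.first hA (by simpa using hz4)
    obtain ⟨q1, q2, c, rfl, h6, ⟨rfl, -⟩ | ⟨rfl, h7, h8, -⟩⟩ := rd_pend_from_inl hp'r h5
    · have := SC.Good.arcs_short hinv (by simpa using h6) hncl
      have e1 : C.pi (q1 ++ [] ++ (invRev (T ++ T') ++ invRev s)) = C.pi (T ++ T' ++ (invRev (q1 ++ []) ++ s)) := by
        have e2 : invRev (T ++ T' ++ (invRev (q1 ++ []) ++ s)) =
            invRev s ++ (q1 ++ [] ++ invRev (T ++ T')) := by simp [invRev_append]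
        rw [← C.pi_inv (T ++ T' ++ _), e2, C.pi_rot (invRev s)]
        simp
      simp only [length_append, invRev_length,
        length_nil] at *
      omega
    · obtain ⟨ψ, hψ, -⟩ := SC.Good.exists_pot (hG := hG) hφ
      have h9 := hψ.ev h6
      have hq1 : q1 ≠ [] := by
        rintro rfl
        rcases q2 with _ | ⟨l, q2⟩
        · exact h7 rfl
        obtain ⟨s', rfl⟩ := h8
        refine not_isReduced_mid (p := invRev q2) (q := q2 ++ s') (l := linv l) ?_
        have := (C.red1 h1).infix (L₁ := invRev ([] ++ l :: q2) ++ (l :: q2 ++ s')) ⟨T ++ T', [], by simp⟩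
        simpa [invRev_cons'] using this
      refine SC.ne_one_of_infix (C := C) (m := q1) (z := q2 ++ (invRev (T ++ T') ++ invRev s))
        (by simpa using hinv) hq1 ?_ (by simpa using h9.symm)
      simp only [length_append, invRev_length] at *
      omega

lemma SC.Good.escape {n : ℕ} : ∀ {V : Type} {G : Gr α V} (hG : C.Good G) {φ : V → C.Grp}
    (_ : G.Pot C.pr φ) {x : hG.arcs.Nd} {s w : Word α} {hs : IsReduced s}
    {hf : ∀ l s' b, s = l :: s' → ¬ hG.arcs.gr.E x l b} (_ : s.length = C.κ)
    (_ : C.Geo (s ++ w)) (_ : w.length ≤ n),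
    ∃ (V' : Type) (G' : Gr α V') (f : hG.arcs.Nd ⊕ Word α → V') (z : V'), C.Good G' ∧
      (∀ X l Y, (pend hG.arcs.gr x s hs hf).E X l Y → G'.E (f X) l (f Y)) ∧
      Rd G'.E (f (pendAt x s)) w z ∧ ∀ a, z ≠ f (Sum.inl a) := by
  have k2 := C.two_le
  induction n with
  | zero =>
    intro V G hG φ hφ x s w hs hf hl hgeo hn
    obtain rfl : w = [] := by grind
    refine ⟨_, _, id, _, hG.pend_good hl.le, fun _ _ _ h => h, rfl, ?_⟩
    intro a h
    have := (pendAt_eq_inl h).1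
    grind
  | succ n ih =>
    intro V G hG φ hφ x s w hs hf hl hgeo hn
    have hE := hG.pend_good (v := x) (hs := hs) (hf := hf) hl.le
    obtain ⟨ψ, hψ, -⟩ := SC.Good.exists_pot (hG := hG) hφ
    obtain ⟨χ, hχ, -⟩ := pend_pot (v := x) (hs := hs) (hf := hf) hψ
    have hs0 : s ≠ [] := by grind
    obtain ⟨g, w4, X2, rfl, hg, hg4⟩ := hE.arcs.gr.exists_split (hE.arcs.inc (pendAt x s)) w
    have hX2 : ∀ a, X2 ≠ hE.arcs.inc (Sum.inl a) := by
      have htip : ∀ a, pendAt x s ≠ Sum.inl a := fun a h => hs0 (pendAt_eq_inl h).1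
      intro a
      rcases eq_or_ne g [] with rfl | hg0
      · obtain rfl : _ = X2 := hg
        exact fun h => htip a (Arcs.inc_inj h)
      · obtain ⟨t, v, hA, ⟨q, rfl⟩, h2⟩ := SC.Good.arc_of_pend hG hφ hl hE
          (hgeo.infix (q := s ++ g) ⟨[], w4, by simp⟩) hg0 hg
        obtain rfl := hE.arcs.gr.rd_det (Arcs.rd_arc_prefix hA (prefix_append _ _)) hg
        intro h
        rcases (Arcs.std_of_arc hA (by simp at h2; omega)).eq_cases h with h | h
        · exact htip a h.1
        grind
    rcases eq_or_ne w4 [] with rfl | hw4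
    · exact ⟨_, _, hE.arcs.inc, X2, hE.arcs_good, fun _ _ _ h => Arcs.inc_edge h,
        by simpa using hg, hX2⟩
    have hs' : IsReduced (w4.take C.κ) :=
      hgeo.red.infix ⟨s ++ g, w4.drop C.κ, by simp⟩
    have hf' : ∀ l s' b, w4.take C.κ = l :: s' → ¬ hE.arcs.gr.E X2 l b := by
      intro l s' b h
      refine hg4 l (s' ++ w4.drop C.κ) b ?_
      conv_lhs => rw [← take_append_drop C.κ w4, h]
      simp
    have hpt : Rd (pend hE.arcs.gr X2 (w4.take C.κ) hs' hf').E (Sum.inl X2) (w4.take C.κ)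
        (pendAt X2 (w4.take C.κ)) := by
      simpa using rd_pend (G := hE.arcs.gr) (v := X2) (hs := hs') (hf := hf') (p := [])
        (q := w4.take C.κ) (by simp)
    rcases lt_or_ge w4.length C.κ with hlt | hge
    · refine ⟨_, _, fun X => Sum.inl (hE.arcs.inc X), pendAt X2 (w4.take C.κ),
        hE.pend_good (v := X2) (hs := hs') (hf := hf') (by simp),
        fun _ _ _ h => pend_edge (Arcs.inc_edge h), ?_, ?_⟩
      · refine Rd_append.2 ⟨_, rd_pend_inl hg, ?_⟩
        exact (congrArg (Rd _ _ · _) (take_of_length_le hlt.le)).mp hpt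
      · intro a h
        have := (pendAt_eq_inl h).1
        rw [take_eq_nil_iff] at this
        grind
    · obtain ⟨V', G', f', z, h1, h2, h3, h4⟩ := ih hE hχ (x := X2) (s := w4.take C.κ)
        (w := w4.drop C.κ) (hs := hs') (hf := hf') (by simp; omega)
        (hgeo.infix ⟨s ++ g, [], by simp⟩) (by simp at hn ⊢; omega)
      refine ⟨V', G', fun X => f' (Sum.inl (hE.arcs.inc X)), z, h1,
        fun _ _ _ h => h2 _ _ _ (pend_edge (Arcs.inc_edge h)), ?_, fun a => h4 _⟩
      rw [Rd_append]
      refine ⟨f' (Sum.inl X2), Rd.map f' h2 (rd_pend_inl hg), ?_⟩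
      rw [← take_append_drop C.κ w4, Rd_append]
      exact ⟨_, Rd.map f' h2 hpt, h3⟩

/-- A geodesic with the same ends as a path in a good graph is readable after attaching cells. -/
theorem SC.Good.geo_readable (hG : C.Good G) {φ : V → C.Grp} (hφ : G.Pot C.pr φ) {a b : V}
    {Y γ : Word α} (hY : Rd G.E a Y b) (hγ : C.Geo γ) (h : C.ev Y = C.ev γ) :
    Rd hG.arcs.gr.E (hG.arcs.inc a) γ (hG.arcs.inc b) := by
  obtain ⟨g, w, X, rfl, hg, hw⟩ := hG.arcs.gr.exists_split (hG.arcs.inc a) γ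
  rcases eq_or_ne w [] with rfl | hw0
  · rw [append_nil] at h ⊢
    rwa [hG.arcs_good.eq_of_rd (Arcs.rd_inc hY) hg h]
  exfalso
  have hs' : IsReduced (w.take C.κ) := hγ.red.infix ⟨g, w.drop C.κ, by simp⟩
  have hf' : ∀ l s' b, w.take C.κ = l :: s' → ¬ hG.arcs.gr.E X l b := by
    intro l s' b h
    refine hw l (s' ++ w.drop C.κ) b ?_
    conv_lhs => rw [← take_append_drop C.κ w, h]
    simp
  have hpt : Rd (pend hG.arcs.gr X (w.take C.κ) hs' hf').E (Sum.inl X) (w.take C.κ)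
      (pendAt X (w.take C.κ)) := by
    simpa using rd_pend (G := hG.arcs.gr) (v := X) (hs := hs') (hf := hf') (p := [])
      (q := w.take C.κ) (by simp)
  rcases lt_or_ge w.length C.κ with hlt | hge
  · have h1 := (hG.pend_good (v := X) (hs := hs') (hf := hf') (by simp)).eq_of_rd
      (rd_pend_inl (Arcs.rd_inc hY)) (Rd_append.2 ⟨_, rd_pend_inl hg, hpt⟩) (by
        rwa [take_of_length_le hlt.le])
    have := (pendAt_eq_inl h1.symm).1
    simp_all
  · obtain ⟨V', G', f, z, h1, h2, h3, h4⟩ := hG.escape hφ (x := X) (s := w.take C.κ)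
      (w := w.drop C.κ) (hs := hs') (hf := hf') (by simp; omega)
      (hγ.infix ⟨g, [], by simp⟩) le_rfl
    refine h4 _ (h1.eq_of_rd (Rd.map f h2 (rd_pend_inl (Arcs.rd_inc hY)))
      (q := g ++ (w.take C.κ ++ w.drop C.κ)) (Rd_append.2 ⟨f (Sum.inl X),
      Rd.map f h2 (rd_pend_inl hg), Rd_append.2 ⟨_, Rd.map f h2 hpt, h3⟩⟩) (by simpa using h)).symm

end Escape

end

section

variable {C : SC α}

section Norm

open Classical in
/-- The word length. -/
noncomputable def SC.nm (C : SC α) (x : C.Grp) : ℕ := (C.exists_geo x).choose.length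

lemma SC.exists_geo_nm (x : C.Grp) : ∃ p, C.Geo p ∧ C.ev p = x ∧ p.length = C.nm x :=
  ⟨_, (C.exists_geo x).choose_spec.1, (C.exists_geo x).choose_spec.2, rfl⟩

lemma SC.nm_ev_le (p : Word α) : C.nm (C.ev p) ≤ p.length := by
  obtain ⟨q, h1, h2, h3⟩ := C.exists_geo_nm (C.ev p)
  rw [← h3]
  exact h1 p h2.symm

lemma SC.Geo.nm {p : Word α} (h : C.Geo p) : C.nm (C.ev p) = p.length := by
  refine le_antisymm (C.nm_ev_le p) ?_
  obtain ⟨q, h1, h2, h3⟩ := C.exists_geo_nm (C.ev p)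
  rw [← h3]
  exact h q h2

@[simp] lemma SC.nm_one : C.nm (1 : C.Grp) = 0 := by
  have := C.nm_ev_le []
  simp_all

lemma SC.eq_one_of_nm {x : C.Grp} (h : C.nm x = 0) : x = 1 := by
  obtain ⟨q, h1, h2, h3⟩ := C.exists_geo_nm x
  simp_all

lemma SC.nm_inv (x : C.Grp) : C.nm x⁻¹ = C.nm x := by
  obtain ⟨q, h1, rfl, h3⟩ := C.exists_geo_nm x
  rw [← C.ev_invRev, h1.invRev.nm, h1.nm, invRev_length]

lemma SC.nm_mul_le (x y : C.Grp) : C.nm (x * y) ≤ C.nm x + C.nm y := by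
  obtain ⟨p, -, rfl, h1⟩ := C.exists_geo_nm x
  obtain ⟨q, -, rfl, h2⟩ := C.exists_geo_nm y
  rw [← C.ev_append, ← h1, ← h2, ← length_append]
  exact C.nm_ev_le _

/-- The word metric. -/
noncomputable def SC.dst (C : SC α) (x y : C.Grp) : ℕ := C.nm (x⁻¹ * y)

lemma SC.dst_self (x : C.Grp) : C.dst x x = 0 := by simp [SC.dst]

lemma SC.dst_comm (x y : C.Grp) : C.dst x y = C.dst y x := by
  rw [SC.dst, ← C.nm_inv, SC.dst]; group

lemma SC.dst_triangle (x y z : C.Grp) : C.dst x z ≤ C.dst x y + C.dst y z := by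
  have := C.nm_mul_le (x⁻¹ * y) (y⁻¹ * z)
  rwa [show x⁻¹ * y * (y⁻¹ * z) = x⁻¹ * z by group] at this

lemma SC.eq_of_dst {x y : C.Grp} (h : C.dst x y = 0) : x = y :=
  inv_mul_eq_one.1 (C.eq_one_of_nm h)

lemma SC.dst_mul_left (a x y : C.Grp) : C.dst (a * x) (a * y) = C.dst x y := by
  rw [SC.dst, SC.dst]; group

lemma SC.dst_ev_le (x : C.Grp) (p : Word α) : C.dst x (x * C.ev p) ≤ p.length := by
  have := C.nm_ev_le p
  rwa [SC.dst, inv_mul_cancel_left]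

lemma SC.Geo.dst {p : Word α} (h : C.Geo p) (x : C.Grp) :
    C.dst x (x * C.ev p) = p.length := by
  rw [SC.dst, inv_mul_cancel_left, h.nm]

lemma SC.dst_take_le (x : C.Grp) (p : Word α) {i j : ℕ} (h : i ≤ j) :
    C.dst (x * C.ev (p.take i)) (x * C.ev (p.take j)) ≤ j - i := by
  have h1 : p.take j = p.take i ++ (p.take j).drop i := by
    conv_lhs => rw [← take_append_drop i (p.take j), take_take, min_eq_left h]
  rw [h1, C.ev_append, ← mul_assoc]
  refine (C.dst_ev_le _ _).trans ?_
  simp; omega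

lemma SC.Geo.dst_take {p : Word α} (hp : C.Geo p) (x : C.Grp) {i j : ℕ} (h : i ≤ j)
    (hj : j ≤ p.length) : C.dst (x * C.ev (p.take i)) (x * C.ev (p.take j)) = j - i := by
  have h1 : p.take j = p.take i ++ (p.take j).drop i := by
    conv_lhs => rw [← take_append_drop i (p.take j), take_take, min_eq_left h]
  have h2 : C.Geo ((p.take j).drop i) :=
    hp.infix ((drop_suffix _ _).isInfix.trans (take_prefix _ _).isInfix)
  rw [h1, C.ev_append, ← mul_assoc, h2.dst]
  simp [hj]

/-- The Cayley graph. -/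
def SC.cay (C : SC α) : Gr α C.Grp where
  E x l y := y = x * C.ev [l]
  symm := by
    rintro x l y rfl
    have h : ([linv l] : Word α) = invRev [l] := by simp [invRev, linv]
    rw [h, C.ev_invRev, mul_inv_cancel_right]
  det := by grind

lemma SC.rd_cay {x y : C.Grp} {p : Word α} : Rd C.cay.E x p y ↔ y = x * C.ev p := by
  induction p generalizing x with
  | nil => simp [eq_comm]
  | cons l p ih =>
    have : C.ev (l :: p) = C.ev [l] * C.ev p := by rfl
    rw [Rd_cons, this]
    constructor
    · rintro ⟨m, h1, h2⟩
      rw [ih.1 h2, show m = _ from h1, mul_assoc]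
    · rintro rfl
      exact ⟨x * C.ev [l], rfl, ih.2 (by rw [mul_assoc])⟩

lemma Turn.cay {V : Type} {G : Gr α V} {φ : V → C.Grp} (hφ : G.Pot C.pr φ) {a b : V}
    {r s : Word α} (h : Turn G a r b s) : Turn C.cay (φ a) r (φ b) s := by
  induction h with
  | refl => exact .refl _ _
  | rot _ h2 ih => exact ih.rot (SC.rd_cay.2 (hφ.ev h2))
  | inv _ ih => exact ih.inv

lemma Turn.mul_left {x y : C.Grp} (a : C.Grp) {r s : Word α} (h : Turn C.cay x r y s) :
    Turn C.cay (a * x) r (a * y) s := by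
  induction h with
  | refl => exact .refl _ _
  | rot _ h2 ih => exact ih.rot (SC.rd_cay.2 (by rw [SC.rd_cay.1 h2, mul_assoc]))
  | inv _ ih => exact ih.inv

lemma Turn.vertex {x y : C.Grp} {r s : Word α} (hr : C.ev r = 1)
    (h : Turn C.cay x r y s) : C.ev s = 1 ∧
      ∀ w z, s = w ++ z → ∃ u v, r = u ++ v ∧ y * C.ev w = x * C.ev u := by
  induction h with
  | refl => grind
  | @rot y' u' v' h1 z' h2 ih =>
    obtain ⟨h3, h4⟩ := ih
    obtain rfl := SC.rd_cay.1 h2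
    refine ⟨by rw [C.ev_append] at h3 ⊢; exact mul_eq_one_comm.1 h3, ?_⟩
    intro w z h
    rcases append_eq_append_iff.1 h with ⟨a, rfl, rfl⟩ | ⟨a, rfl, rfl⟩
    · obtain ⟨u, v, h5, h6⟩ := h4 a (z ++ v') (by simp)
      refine ⟨u, v, h5, ?_⟩
      rw [← h6, mul_assoc, ← C.ev_append, ← append_assoc, C.ev_append, h3, one_mul]
    · obtain ⟨u, v, h5, h6⟩ := h4 (u' ++ w) a (by simp)
      exact ⟨u, v, h5, by rw [← h6, C.ev_append, mul_assoc]⟩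
  | @inv y' s' h1 ih =>
    obtain ⟨h3, h4⟩ := ih
    refine ⟨by rw [C.ev_invRev, h3, inv_one], ?_⟩
    intro w z h
    have h0 := congrArg FreeGroup.invRev h
    rw [invRev_invRev, invRev_append] at h0
    obtain ⟨u, v, h5, h6⟩ := h4 _ _ h0
    refine ⟨u, v, h5, ?_⟩
    rw [← h6]
    rw [h0, C.ev_append, C.ev_invRev w, mul_inv_eq_one] at h3
    rw [h3]

lemma Turn.dst_le {x y : C.Grp} {r s : Word α} (hr : C.ev r = 1)
    (h : Turn C.cay x r y s) : C.dst x y ≤ r.length := by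
  obtain ⟨u, v, rfl, h1⟩ := (h.vertex hr).2 [] s (by simp)
  rw [C.ev_nil, mul_one] at h1
  rw [h1]
  exact (C.dst_ev_le _ _).trans (by simp)

end Norm

end

section

variable {C : SC α}

section Point

variable {V : Type} {G : Gr α V} {κ : ℕ} {S : Arcs G κ}

variable (S) in
/-- A description of minimal depth of a point on an arc. -/
def Arcs.On (X : S.Nd) (e : V) (p : Word α) : Prop :=
  X = S.nd e p ∧ S.Std e p ∧ (p = [] ∨ ∃ t v, S.A e t v ∧ p <+: t)

lemma Arcs.exists_on {X Y : S.Nd} {l : α × Bool} (h : S.gr.E X l Y) : ∃ e p, S.On X e p := by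
  obtain ⟨e, p, rfl, hs⟩ := S.exists_std X
  refine ⟨e, p, rfl, hs, ?_⟩
  rcases hs.out h with ⟨⟨t, v, hA, hp⟩, -⟩ | ⟨p', rfl, ⟨t, v, hA, hp⟩, -⟩ | ⟨b, h1, -⟩
  · exact Or.inr ⟨t, v, hA, (prefix_append _ _).trans hp⟩
  · grind
  grind

lemma Arcs.exists_on_end {X Y : S.Nd} {p : Word α} (h : Rd S.gr.E X p Y) (hp : p ≠ []) :
    ∃ e q, S.On Y e q := by
  have h1 := S.gr.rd_symm h
  rcases hq : invRev p with _ | ⟨l, q⟩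
  · exact absurd (by simpa using congrArg length hq) hp
  · rw [hq] at h1
    obtain ⟨Z, h2, -⟩ := h1
    exact Arcs.exists_on h2

lemma Arcs.on_inc (a : V) : S.On (S.inc a) a [] := ⟨rfl, Arcs.std_nil a, Or.inl rfl⟩

/-- Adjacent points have descriptions from the same end, adjacent ends or opposite ends. -/
lemma Arcs.On.edge {X Y : S.Nd} {l : α × Bool} {e e' : V} {p p' : Word α}
    (hX : S.On X e p) (hY : S.On Y e' p') (h : S.gr.E X l Y) :
    e = e' ∨ (∃ m, G.E e m e') ∨ ∃ t, S.A e t e' := by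
  obtain ⟨rfl, hX, -⟩ := hX
  obtain ⟨h1, hY, -⟩ := hY
  have key : ∀ q, Y = S.nd e q → e = e' ∨ ∃ t, S.A e t e' := by
    rintro q rfl
    rcases hY.eq_cases h1.symm with ⟨h2, -⟩ | ⟨h2, -⟩
    · grind
    · exact Or.inr ⟨_, S.inv h2⟩
  rcases hX.out h with ⟨-, h2⟩ | ⟨p', -, -, h2⟩ | ⟨b, -, h3, h2⟩
  · grind
  · grind
  · subst h2
    rcases hY.eq_cases h1.symm with ⟨rfl, -⟩ | ⟨h2, -⟩
    · grind
    · have := h2.len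
      have h4 := S.two_le
      rcases hY with h5 | h5
      · grind
      grind

end Point

section Near

variable {Y γ : Word α} {L : ℕ}

lemma SC.line_near_aux (hL : ∀ r ∈ C.R, r.length ≤ L) (hY : IsReduced Y) (hQ : C.Q Y)
    {ψ : (hQ.good (hY := hY)).arcs.Nd → C.Grp}
    (hψ : ∀ e p, ψ ((hQ.good (hY := hY)).arcs.nd e p) = C.ev (Y.take e) * C.ev p)
    {X : (hQ.good (hY := hY)).arcs.Nd} {e : ℕ} {p : Word α}
    (h : (hQ.good (hY := hY)).arcs.On X e p) : C.dst (ψ X) (C.ev (Y.take e)) ≤ L := by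
  obtain ⟨rfl, -, h⟩ := h
  rw [hψ, C.dst_comm]
  refine (C.dst_ev_le _ _).trans ?_
  rcases h with rfl | ⟨t, v, hA, hp⟩
  · simp
  · obtain ⟨o, h1, -⟩ := SC.Good.rd_cell hA
    grind

/-- Geodesics stay close to reduced words without long relator parts, and conversely. -/
lemma SC.line_near (hL : ∀ r ∈ C.R, r.length ≤ L) (hY : IsReduced Y) (hQ : C.Q Y)
    (hγ : C.Geo γ) (h : C.ev Y = C.ev γ) :
    ∃ f : ℕ → ℕ, f 0 = 0 ∧ f γ.length = Y.length ∧
      (∀ j < γ.length, f (j + 1) ≤ f j + (L + 1) ∧ f j ≤ f (j + 1) + (L + 1)) ∧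
      ∀ j ≤ γ.length, C.dst (C.ev (γ.take j)) (C.ev (Y.take (f j))) ≤ L := by
  have hG := hQ.good (hY := hY)
  have hpot := line_pot (Y := Y) (hY := hY) (C := C) 1
  have hrd := hG.geo_readable hpot rd_line_all hγ h
  obtain ⟨ψ, hψ, hψ'⟩ := SC.Good.exists_pot (hG := hG) hpot
  simp only [one_mul] at hψ'
  have hX : ∀ j, ∃ X, Rd hG.arcs.gr.E (hG.arcs.inc 0) (γ.take j) X ∧
      Rd hG.arcs.gr.E X (γ.drop j) (hG.arcs.inc Y.length) := fun j =>
    Rd_append.1 (by simp_all)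
  choose X hX1 hX2 using hX
  have h0 : X 0 = hG.arcs.inc 0 := (hX1 0).symm
  have hl : X γ.length = hG.arcs.inc Y.length := by simpa using hX2 γ.length
  have hed : ∀ j < γ.length, ∃ l, hG.arcs.gr.E (X j) l (X (j + 1)) := by
    intro j hj
    have h1 := hX1 (j + 1)
    rw [take_add_one, getElem?_eq_getElem hj, Rd_append] at h1
    obtain ⟨Z, h2, h3⟩ := h1
    obtain rfl := hG.arcs.gr.rd_det h2 (hX1 j)
    exact ⟨_, Rd_singleton.1 h3⟩
  have hval : ∀ j, ψ (X j) = C.ev (γ.take j) := by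
    intro j
    have h1 := hψ' 0 []
    rw [take_zero, C.ev_nil, one_mul] at h1
    rw [hψ.ev (hX1 j), Arcs.inc, h1, one_mul]
  have hon : ∀ j, ∃ e, j ≤ γ.length → (j = 0 → e = 0) ∧ (j = γ.length → e = Y.length) ∧
      ∃ p, hG.arcs.On (X j) e p := by
    intro j
    by_cases hj : j ≤ γ.length
    swap
    · exact ⟨0, fun h => absurd h hj⟩
    rcases Nat.eq_zero_or_pos j with rfl | hj0
    · refine ⟨0, fun _ => ⟨fun _ => rfl, ?_, [], h0 ▸ Arcs.on_inc 0⟩⟩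
      intro h1
      rw [← h1, h0] at hl
      exact Arcs.inc_inj hl
    rcases hj.eq_or_lt with rfl | hj
    · exact ⟨Y.length, fun _ => ⟨fun h => by omega, fun _ => rfl, [], hl ▸ Arcs.on_inc _⟩⟩
    · obtain ⟨l, hl⟩ := hed j hj
      obtain ⟨e, p, h⟩ := Arcs.exists_on hl
      exact ⟨e, fun _ => ⟨fun h => by omega, fun h => by omega, p, h⟩⟩
  choose f hf using hon
  refine ⟨f, (hf 0 (Nat.zero_le _)).1 rfl, (hf _ le_rfl).2.1 rfl, ?_, ?_⟩
  · intro j hj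
    obtain ⟨-, -, p, hp⟩ := hf j hj.le
    obtain ⟨-, -, p', hp'⟩ := hf (j + 1) hj
    obtain ⟨l, hl⟩ := hed j hj
    rcases hp.edge hp' hl with h1 | ⟨m, h1⟩ | ⟨t, h1⟩
    · omega
    · rcases h1 with ⟨h1, -⟩ | ⟨h1, -⟩ <;> omega
    · obtain ⟨o, h2, h3, -⟩ := SC.Good.rd_cell h1
      have h4 := hL _ h2
      have h5 := rd_line_cases ((C.red1 h2).infix ⟨t, [], by simp⟩) h3
      simp only [length_append] at h4
      omega
  · intro j hj
    obtain ⟨-, -, p, hp⟩ := hf j hj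
    rw [← hval]
    exact C.line_near_aux hL hY hQ hψ' hp

lemma Nat.exists_near {f : ℕ → ℕ} {m n c i : ℕ} (h0 : f 0 = 0) (hm : f m = n)
    (h : ∀ j < m, f (j + 1) ≤ f j + c) (hi : i ≤ n) : ∃ j ≤ m, f j ≤ i ∧ i ≤ f j + c := by
  classical
  induction m generalizing n with
  | zero => grind
  | succ m ih =>
    grind

lemma SC.near_line (hL : ∀ r ∈ C.R, r.length ≤ L) (hY : IsReduced Y) (hQ : C.Q Y)
    (hγ : C.Geo γ) (h : C.ev Y = C.ev γ) {i : ℕ} (hi : i ≤ Y.length) :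
    ∃ j ≤ γ.length, C.dst (C.ev (γ.take j)) (C.ev (Y.take i)) ≤ 2 * L + 1 := by
  obtain ⟨f, h1, h2, h3, h4⟩ := C.line_near hL hY hQ hγ h
  obtain ⟨j, h5, h6, h7⟩ := Nat.exists_near h1 h2 (fun j hj => (h3 j hj).1) hi
  refine ⟨j, h5, ?_⟩
  have h8 := h4 j h5
  have h9 := C.dst_take_le 1 Y h6
  simp only [one_mul] at h9
  have := C.dst_triangle (C.ev (γ.take j)) (C.ev (Y.take (f j))) (C.ev (Y.take i))
  omega

/-- A long relator part on a geodesic is seen on any other reduced word without long relator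
parts. -/
lemma SC.relator_near (hY : IsReduced Y) (hQ : C.Q Y)
    (hγ : C.Geo γ) (h : C.ev Y = C.ev γ) {γ1 p γ2 q : Word α} (hs : γ = γ1 ++ p ++ γ2)
    (hr : p ++ q ∈ C.R) (hp : 3 * C.pi (p ++ q) ≤ p.length) :
    ∃ i o s, i ≤ Y.length ∧ o <+: Y.drop i ∧ C.pi (p ++ q) ≤ o.length ∧
      Turn C.cay (C.ev γ1) (p ++ q) (C.ev (Y.take i)) (o ++ s) := by
  have hG := hQ.good (hY := hY)
  have hpot := line_pot (Y := Y) (hY := hY) (C := C) 1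
  have hrd := hG.geo_readable hpot rd_line_all hγ h
  obtain ⟨ψ, hψ, hψ'⟩ := SC.Good.exists_pot (hG := hG) hpot
  simp only [one_mul] at hψ'
  rw [hs, append_assoc, Rd_append] at hrd
  obtain ⟨X, h1, h2⟩ := hrd
  obtain ⟨Z, h2, -⟩ := Rd_append.1 h2
  obtain ⟨c, d, o, s, h3, h4, h5⟩ := SC.Good.hits_of_long h2 hr hp
  have hX : ψ X = C.ev γ1 := by
    have h1' := hψ' 0 []
    rw [take_zero, C.ev_nil, one_mul] at h1'
    rw [hψ.ev h1, Arcs.inc, h1', one_mul]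
  have hψc : ∀ c, ψ (hG.arcs.inc c) = C.ev (Y.take c) := fun c => by
    rw [Arcs.inc, hψ', C.ev_nil, mul_one]
  have hos := h3.mem hr
  have hpos := C.pos hr
  have hle : ∀ {c : ℕ} {o : Word α}, o <+: Y.drop c → C.pi (p ++ q) ≤ o.length →
      c ≤ Y.length := by
    grind
  rcases rd_line_cases ((C.red1 hos).infix ⟨[], s, by simp⟩) h4 with ⟨h6, -⟩ | ⟨h6, -⟩
  · refine ⟨c, o, s, hle h6 h5, h6, h5, ?_⟩
    rw [← hX, ← hψc]
    exact h3.cay hψ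
  · refine ⟨d, invRev o, invRev s, hle h6 (by simpa using h5), h6, by simpa using h5, ?_⟩
    rw [← hX, ← hψc]
    refine Turn.cay hψ ?_
    have := (h3.rot (Arcs.rd_inc h4)).inv
    simp_all

end Near

end

section

variable {C : SC α}

section Forward

variable {V : Type} {G : Gr α V} {κ : ℕ} {S : Arcs G κ}

lemma Arcs.forward {e v0 b : V} {p w t0 : Word α} (hA : S.A e t0 v0) (hp : p <+: t0)
    (hne : p ≠ []) (hred : IsReduced (p ++ w)) (hw : Rd S.gr.E (S.nd e p) w (S.inc b)) :
    ∃ t v, S.A e t v ∧ t.take (t.length - κ + 1) <+: p ++ w := by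
  have hX : Rd S.gr.E (S.inc e) (p ++ w) (S.inc b) :=
    Rd_append.2 ⟨_, Arcs.rd_arc_prefix hA hp, hw⟩
  obtain ⟨t, v, h1, h2⟩ := Arcs.follow hred (by simp [hne]) hX (by
    rintro l p' c h
    rcases p with _ | ⟨m, p⟩
    · grind
    · obtain ⟨rfl, -⟩ := List.cons.inj h
      obtain ⟨t', rfl⟩ := hp
      exact S.first hA)
  refine ⟨t, v, h1, ?_⟩
  rcases h2 with h2 | h2
  swap
  · exact h2
  have h3 := S.gr.rd_det (Arcs.rd_arc_prefix h1 h2) hX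
  rcases (Arcs.std_nil b).eq_cases h3.symm with ⟨-, h4⟩ | ⟨h4, -⟩
  · simp at h4; grind
  · have h5 : S.A e (p ++ w) b := by
      have := S.inv h4
      simp_all
    have h6 := S.len h5
    obtain ⟨u, rfl⟩ := h2
    have h7 := (S.uniq h1 h5 (by grind)).1
    grind

lemma isReduced_or {p a b : Word α} (hp : IsReduced p) (h : IsReduced (a ++ b)) :
    IsReduced (p ++ b) ∨ IsReduced (p ++ FreeGroup.invRev a) := by
  obtain ⟨ha, hb, h⟩ := isReduced_append_iff.1 h
  by_contra hc
  rw [not_or, isReduced_append_iff, isReduced_append_iff] at hc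
  simp only [not_and, not_forall] at hc
  obtain ⟨p1, l, q1, m, rfl, rfl, h1⟩ := hc.1 hp hb
  obtain ⟨p2, l', q2, m', h2, h3, h4⟩ := hc.2 hp (isReduced_invRev ha)
  simp only [ne_eq, not_not] at h1 h4
  obtain ⟨-, rfl⟩ : p1 = p2 ∧ l = l' := by simpa using h2
  have h5 := congrArg FreeGroup.invRev h3
  rw [invRev_invRev, invRev_cons'] at h5
  simp_all

lemma Arcs.On.cover {X : S.Nd} {e b b' : V} {p w w' : Word α} (hX : S.On X e p)
    (hp : p ≠ []) (hw : Rd S.gr.E X w (S.inc b)) (hw' : Rd S.gr.E X w' (S.inc b'))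
    (hred : IsReduced (FreeGroup.invRev w' ++ w)) (hpw : IsReduced (p ++ w)) :
    ∃ t v m x y z, S.A e t v ∧ p = m ++ x ∧ t = m ++ (x ++ y) ++ z ∧
      x <:+ FreeGroup.invRev w' ∧ y <+: w ∧ t.length + 2 ≤ x.length + y.length + 2 * κ := by
  have k2 := S.two_le
  obtain ⟨rfl, hs, h⟩ := hX
  obtain ⟨t0, v0, hA, hp0⟩ := h.resolve_left hp
  obtain ⟨t, v, h1, h2⟩ := Arcs.forward hA hp0 hp hpw hw
  have hl := S.len h1
  rcases lt_or_ge p.length κ with hlt | hge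
  · obtain ⟨y, hy⟩ : p <+: t.take (t.length - κ + 1) :=
      prefix_of_prefix_length_le (prefix_append _ _) h2 (by simp; omega)
    refine ⟨t, v, p, [], y, t.drop (t.length - κ + 1), h1, by simp, ?_, nil_suffix, ?_, ?_⟩
    · simp_all
    · rw [← hy] at h2
      exact (prefix_append_right_inj p).1 h2
    grind
  obtain ⟨p2, rfl⟩ := hp0
  have htt : p ++ p2 = t ∧ v0 = v := by
    refine S.uniq hA h1 ?_
    have e1 := (prefix_iff_eq_take.1 h2)
    have e2 : t.take κ = (t.take (t.length - κ + 1)).take κ := by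
      rw [take_take, min_eq_left (by omega)]
    grind
  obtain ⟨rfl, rfl⟩ := htt
  have hp2 : κ ≤ p2.length := by
    rcases hs with hs | hs
    · omega
    · have := hs (v0, FreeGroup.invRev p2) (by simpa [Arcs.Dual] using hA)
      simpa using this
  obtain ⟨y, hy⟩ : p <+: (p ++ p2).take ((p ++ p2).length - κ + 1) :=
    prefix_of_prefix_length_le (prefix_append _ _) h2 (by simp; omega)
  have hyl := congrArg length hy
  have hyw : y <+: w := by
    rw [← hy] at h2
    exact (prefix_append_right_inj p).1 h2
  obtain ⟨z, rfl⟩ : y <+: p2 := by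
    rw [← prefix_append_right_inj p, hy]
    grind
  simp only [length_take, length_append] at hyl hl hp2
  have hA' := S.inv hA
  have hnd : S.nd e p = S.nd v0 (FreeGroup.invRev (y ++ z)) := Arcs.nd_dual (by simpa using hA)
  rw [hnd] at hw'
  have hred' : IsReduced (FreeGroup.invRev (y ++ z) ++ w') := by
    have h3 : IsReduced (FreeGroup.invRev w' ++ (y ++ z)) := by
      rw [isReduced_append_iff]
      obtain ⟨ha, hb, hc⟩ := isReduced_append_iff.1 hred
      refine ⟨ha, (S.red hA).infix ⟨p, [], by simp⟩, ?_⟩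
      rintro p' l q' m hm1 hm2
      rcases y with _ | ⟨m', y⟩
      · simp only [length_nil] at hyl hp2 hl; omega
      · obtain ⟨w0, rfl⟩ := hyw
        grind
    have := isReduced_invRev h3
    simpa [invRev_append] using this
  obtain ⟨t', v', h3, h4⟩ := Arcs.forward hA' ⟨FreeGroup.invRev p, by simp [invRev_append]⟩
    (by intro h; have := congrArg length h; simp at this; grind) hred' hw'
  have hl' := S.len h3
  obtain ⟨rfl, rfl⟩ : FreeGroup.invRev (p ++ (y ++ z)) = t' ∧ e = v' := by
    refine S.uniq hA' h3 ?_
    have e1 := (prefix_iff_eq_take.1 h4)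
    have e2 : t'.take κ = (t'.take (t'.length - κ + 1)).take κ := by
      rw [take_take, min_eq_left (by omega)]
    rw [e2, e1, take_take, min_eq_left (by simp; omega), invRev_append,
      take_append_of_le_length (by simp; omega),
      take_append_of_le_length (by simp; omega)]
  obtain ⟨x, hx⟩ : FreeGroup.invRev (y ++ z) <+:
      (FreeGroup.invRev (p ++ (y ++ z))).take ((FreeGroup.invRev (p ++ (y ++ z))).length - κ + 1) := by
    refine prefix_of_prefix_length_le (prefix_append _ _) h4 ?_
    simp only [length_take, length_append, invRev_length]
    omega
  have hxl := congrArg length hx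
  simp only [length_take, length_append, invRev_length] at hxl
  have hxw : x <+: w' := by
    rw [← hx] at h4
    exact (prefix_append_right_inj _).1 h4
  obtain ⟨m, hm⟩ : x <+: FreeGroup.invRev p := by
    rw [← prefix_append_right_inj (FreeGroup.invRev (y ++ z)), hx, ← invRev_append]
    grind
  have hm' : p = FreeGroup.invRev m ++ FreeGroup.invRev x := by
    rw [← invRev_append, hm, invRev_invRev]
  refine ⟨_, v0, FreeGroup.invRev m, FreeGroup.invRev x, y, z, hA, hm', ?_, ?_, hyw, ?_⟩
  · rw [hm']; simp
  · obtain ⟨w0, rfl⟩ := hxw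
    simp
  · simp only [length_append, invRev_length] at *
    omega

end Forward

section Gap

variable {Y γ : Word α} {L : ℕ}

/-- Away from relators having long parts on `γ` or `Y`, the geodesic `γ` runs along `Y`. -/
lemma SC.gap_near (hL : ∀ r ∈ C.R, r.length ≤ L) (hY : IsReduced Y) (hQ : C.Q Y)
    (hγ : C.Geo γ) (h : C.ev Y = C.ev γ) {γ1 γ2 : Word α} (hs : γ = γ1 ++ γ2) :
    (∃ i ≤ Y.length, C.ev γ1 = C.ev (Y.take i)) ∨ ∃ Z, (Z = γ ∨ Z = Y) ∧
      ∃ d p d' q, Z = d ++ p ++ d' ∧ p ++ q ∈ C.R ∧ 3 * C.pi (p ++ q) ≤ p.length ∧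
        C.dst (C.ev d) (C.ev γ1) ≤ L := by
  have hG := hQ.good (hY := hY)
  have hpot := line_pot (Y := Y) (hY := hY) (C := C) 1
  have hrd := hG.geo_readable hpot rd_line_all hγ h
  obtain ⟨ψ, hψ, hψ'⟩ := SC.Good.exists_pot (hG := hG) hpot
  simp only [one_mul] at hψ'
  have hψc : ∀ c, ψ (hG.arcs.inc c) = C.ev (Y.take c) := fun c => by
    rw [Arcs.inc, hψ', C.ev_nil, mul_one]
  rw [hs, Rd_append] at hrd
  obtain ⟨X, h1, h2⟩ := hrd
  have hX : ψ X = C.ev γ1 := by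
    rw [hψ.ev h1, hψc, take_zero, C.ev_nil, one_mul]
  rcases eq_or_ne γ1 [] with rfl | hγ1
  · grind
  obtain ⟨e, p, hon⟩ := Arcs.exists_on_end h1 hγ1
  rcases eq_or_ne p [] with rfl | hp
  · left
    have : C.ev γ1 = C.ev (Y.take e) := by rw [← hX, hon.1]; exact hψc e
    grind
  right
  -- the dichotomy for an arc through the point
  have arc : ∀ {t v m x z o : Word α} {w : ℕ}, t ++ o ∈ C.R → C.ev γ1 = C.ev (Y.take e) * C.ev p →
      p = m ++ x → p <+: t → Rd (lineGr Y hY).E w o e → 3 * C.pi (t ++ o) ≤ o.length →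
      ∃ d p d' q, Y = d ++ p ++ d' ∧ p ++ q ∈ C.R ∧ 3 * C.pi (p ++ q) ≤ p.length ∧
        C.dst (C.ev d) (C.ev γ1) ≤ L := by
    rintro t _ m x _ o w h3 h4 - ⟨t', rfl⟩ h5 h6
    have h7 := hL _ h3
    simp only [length_append] at h7
    have h8 := (line_pot (Y := Y) (hY := hY) (C := C) 1).ev h5
    simp only [one_mul] at h8
    rcases rd_line_cases ((C.red1 h3).infix ⟨p ++ t', [], by simp⟩) h5 with ⟨⟨u, h9⟩, -⟩ | ⟨⟨u, h9⟩, -⟩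
    · refine ⟨Y.take w, o, u, p ++ t', ?_, C.rot h3, by rwa [C.pi_rot], ?_⟩
      · simp_all
      · rw [h4, h8, mul_assoc, ← C.ev_append]
        refine (C.dst_ev_le _ _).trans ?_
        simp only [length_append]; omega
    · refine ⟨Y.take e, invRev o, u, invRev (p ++ t'), ?_, ?_, ?_, ?_⟩
      · simp_all
      · rw [← invRev_append]; exact C.inv h3
      · rw [← invRev_append, C.pi_inv]; simpa using h6
      · rw [h4]
        refine (C.dst_ev_le _ _).trans ?_
        omega
  have hval : C.ev γ1 = C.ev (Y.take e) * C.ev p := by rw [← hX, hon.1, hψ']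
  have hpred : IsReduced p := by
    obtain ⟨t, v, hA, hpt⟩ := hon.2.2.resolve_left hp
    exact (hG.arcs.red hA).infix hpt.isInfix
  have h1' := hG.arcs.gr.rd_symm h1
  have fin : ∀ {w w' : Word α} {b b' : ℕ}, Rd hG.arcs.gr.E X w (hG.arcs.inc b) →
      Rd hG.arcs.gr.E X w' (hG.arcs.inc b') → IsReduced (invRev w' ++ w) → IsReduced (p ++ w) →
      (∃ d p d' q, Y = d ++ p ++ d' ∧ p ++ q ∈ C.R ∧ 3 * C.pi (p ++ q) ≤ p.length ∧
        C.dst (C.ev d) (C.ev γ1) ≤ L) ∨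
      ∃ x y q, x <:+ invRev w' ∧ y <+: w ∧ (x ++ y) ++ q ∈ C.R ∧
        3 * C.pi ((x ++ y) ++ q) ≤ (x ++ y).length := by
    intro w w' b b' hw hw' hr1 hr2
    obtain ⟨t, v, m, x, y, z, hA, h3, h4, h5, h6, h7⟩ := hon.cover hp hw hw' hr1 hr2
    obtain ⟨o, h8, h9, -⟩ := SC.Good.rd_cell hA
    by_cases h10 : 3 * C.pi (t ++ o) ≤ o.length
    · left
      exact arc (v := []) (z := []) h8 hval h3 (by rw [h3, h4]; exact ⟨y ++ z, by simp⟩) h9 h10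
    · right
      refine ⟨x, y, z ++ o ++ m, h5, h6, ?_, ?_⟩
      · have := C.rot (p := m) (q := x ++ y ++ z ++ o) (by rw [h4] at h8; simpa using h8)
        simpa using this
      · have e1 : C.pi (x ++ y ++ (z ++ o ++ m)) = C.pi (t ++ o) := by
          have := C.pi_rot m (x ++ y ++ z ++ o)
          rw [h4]
          simpa [eq_comm] using this
        have e2 := C.len h8
        have e3 := C.pi_le h8
        simp only [length_append] at *
        omega
  have hdist : ∀ {x u : Word α}, γ1 = u ++ x → x.length ≤ L →
      C.dst (C.ev u) (C.ev γ1) ≤ L := by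
    rintro x u rfl hx
    exact (C.dst_ev_le _ _).trans hx
  rcases isReduced_or hpred (hs ▸ hγ.red) with hred | hred
  · rcases fin h2 h1' (by rw [invRev_invRev, ← hs]; exact hγ.red) hred with
      h3 | ⟨x, y, q, ⟨u, hx⟩, ⟨u', hy⟩, h5, h6⟩
    · exact ⟨Y, Or.inr rfl, h3⟩
    · rw [invRev_invRev] at hx
      refine ⟨γ, Or.inl rfl, u, x ++ y, u', q, ?_, h5, h6, hdist hx.symm ?_⟩
      · rw [hs, ← hx, ← hy]; simp
      · have := hL _ h5
        simp only [length_append] at this; omega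
  · rcases fin h1' h2 (by rw [← invRev_append, ← hs]; exact isReduced_invRev hγ.red) hred with
      h3 | ⟨x, y, q, ⟨u, hx⟩, ⟨u', hy⟩, h5, h6⟩
    · exact ⟨Y, Or.inr rfl, h3⟩
    · have hx' := congrArg invRev hx
      have hy' := congrArg invRev hy
      rw [invRev_invRev, invRev_append] at hx' hy'
      refine ⟨γ, Or.inl rfl, invRev u', invRev y ++ invRev x, invRev u, invRev q, ?_, ?_, ?_,
        hdist hy'.symm ?_⟩
      · rw [hs, ← hx', ← hy']; simp
      · rw [← invRev_append, ← invRev_append]; exact C.inv (C.rot h5)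
      · rw [← invRev_append, ← invRev_append, C.pi_inv, C.pi_rot]
        simpa [add_comm] using h6
      · have := hL _ h5
        simp only [length_append, invRev_length] at *; omega

end Gap

end

section

variable {C : SC α}

lemma isReduced_join {p q r : Word α} (h1 : IsReduced (p ++ q)) (h2 : IsReduced (q ++ r))
    (hq : q ≠ []) : IsReduced (p ++ (q ++ r)) := by
  rw [isReduced_append_iff] at h1 ⊢
  refine ⟨h1.1, h2, fun p' l q' m hp hqr => ?_⟩
  obtain ⟨a, q, rfl⟩ := exists_cons_of_ne_nil hq
  grind

lemma isReduced_invRev_concat {p t s : Word α} (hp : IsReduced p) (hst : IsReduced (s ++ t))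
    (h : ∀ p' l t', p = p' ++ [l] → t ≠ t' ++ [l]) : IsReduced (p ++ invRev t) := by
  rw [isReduced_append_iff]
  refine ⟨hp, isReduced_invRev (hst.infix ⟨s, [], by simp⟩), fun p' l q' m hp' hq' hm => ?_⟩
  have : t = invRev q' ++ [l] := by
    have := congrArg invRev hq'
    rw [invRev_invRev, invRev_cons', hm, linv_linv] at this
    grind
  grind

/-- A cell overlapping both sides of a corner is read once more only inside its far side. -/
lemma SC.corner_aligned {α1 s1 s2 v' t q A B σ τ : Word α}
    (hred : IsReduced (α1 ++ (s1 ++ s2) ++ v')) (hs : s1 ++ s2 ≠ [])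
    (hr : (s1 ++ s2) ++ t ∈ C.R) (hσ : σ ++ τ ∈ C.R) (hq : A ++ q ++ B = invRev t)
    (hqσ : ∃ x y, σ = x ++ q ++ y ∧ (x = [] ∨ A = []) ∧ (y = [] ∨ B = []) ∧
      x <:+ α1 ++ A ∧ y <+: B ++ v')
    (hl : C.pi ((s1 ++ s2) ++ t) ≤ q.length ∨ C.pi (σ ++ τ) ≤ q.length) : σ.length ≤ t.length := by
  obtain ⟨x, y, rfl, hx, hy, hxs, hys⟩ := hqσ
  generalize hs0 : s1 ++ s2 = s at *
  have e1 : q ++ (B ++ invRev s ++ A) ∈ C.R := by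
    have := C.rot (p := invRev s ++ A) (q := q ++ B) (by
      have := C.inv (C.rot hr)
      simp_all)
    grind
  have e2 : q ++ (y ++ τ ++ x) ∈ C.R := by
    have := C.rot (p := x) (q := q ++ y ++ τ) (by grind)
    grind
  have hpi : C.pi (q ++ (B ++ invRev s ++ A)) = C.pi (s ++ t) := by
    have h1 : q ++ (B ++ invRev s ++ A) = (q ++ B ++ invRev s) ++ A := by simp
    have h2 : A ++ (q ++ B ++ invRev s) = invRev (s ++ t) := by
      rw [invRev_append, ← hq]; simp
    rw [h1, C.pi_rot, h2, C.pi_inv]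
  have hpi' : C.pi (q ++ (y ++ τ ++ x)) = C.pi (x ++ q ++ y ++ τ) := by
    have := C.pi_rot (q ++ y ++ τ) x
    grind
  have e3 : q ++ (B ++ invRev s ++ A) = q ++ (y ++ τ ++ x) := by
    rcases hl with hl | hl
    · exact C.eq_of_prefix e1 e2 ⟨_, rfl⟩ ⟨_, rfl⟩ (by omega)
    · exact (C.eq_of_prefix e2 e1 ⟨_, rfl⟩ ⟨_, rfl⟩ (by omega)).symm
  rw [append_cancel_left_eq] at e3
  have hlq : (A ++ q ++ B).length = t.length := by rw [hq]; simp
  have hx0 : x = [] := by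
    rcases eq_nil_or_concat x with h | ⟨x', l, h⟩
    · exact h
    exfalso
    have hA : A = [] := hx.resolve_left (by simp [h])
    subst hA
    obtain ⟨s', m, rfl⟩ : ∃ s' m, s = m :: s' := by
      obtain ⟨m, s', h⟩ := exists_cons_of_ne_nil hs; grind
    rw [h, invRev_cons', append_nil, concat_eq_append, ← append_assoc, ← append_assoc] at e3
    have hm := (append_inj' e3 rfl).2
    obtain ⟨α1', hα⟩ := hxs
    rw [h, append_nil, concat_eq_append, ← hm] at hα
    rw [← hα] at hred
    apply not_isReduced_mid (p := α1' ++ x') (l := linv m) (q := s' ++ v')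
    rw [linv_linv]
    simpa using hred
  have hy0 : y = [] := by
    rcases y with - | ⟨l, y'⟩
    · rfl
    exfalso
    have hB : B = [] := hy.resolve_left (by simp)
    subst hB
    rcases eq_nil_or_concat s with h | ⟨s', m, h⟩
    · exact hs h
    rw [h, concat_eq_append, invRev_concat] at e3
    simp only [nil_append, cons_append, List.cons.injEq] at e3
    obtain ⟨v'', hv⟩ := hys
    rw [← e3.1] at hv
    rw [h, ← nil_append v', ← hv] at hred
    apply not_isReduced_mid (p := α1 ++ s') (l := m) (q := y' ++ v'')
    simpa using hred
  grind

/-- The corner between a shortest connecting segment and a line can be cut off by one cell. -/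
lemma SC.exists_corner {L N : ℕ} {a v : Word α} (hL : ∀ r ∈ C.R, r.length ≤ L)
    (ha : C.Geo a) (hv : IsReduced v) (hQ : C.Q v) (hN : L < N) (hNv : N ≤ v.length)
    (hg : C.Geo (v.take N)) (hmin : ∀ j ≤ N, a.length ≤ C.nm (C.ev a * C.ev (v.take j))) :
    ∃ a1 t b, a1 <+: a ∧ 2 * b ≤ L ∧ b ≤ N ∧ t.length ≤ L ∧ (a = [] → t = [] ∧ b = 0) ∧
      IsReduced (a1 ++ (t ++ v.drop b)) ∧ C.Q (a1 ++ (t ++ v.drop b)) ∧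
      C.ev (a1 ++ t) = C.ev a * C.ev (v.take b) := by
  have hav : IsReduced (a ++ v) := by
    rw [isReduced_append_iff]
    refine ⟨ha.red, hv, fun a' l v' m h1 h2 h3 => ?_⟩
    have h4 := hmin 1 (by omega)
    rw [h2, take_succ_cons, take_zero, h1, C.ev_append, mul_assoc, ← C.ev_append, h3] at h4
    have h5 : C.ev ([l] ++ [linv l]) = 1 := by
      have : invRev [l] = [linv l] := by simp [invRev, linv]
      rw [C.ev_append, ← this, C.ev_invRev, mul_inv_cancel]
    rw [h5, mul_one] at h4
    have := C.nm_ev_le a'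
    grind
  by_cases hq : C.Q (a ++ v)
  · exact ⟨a, [], 0, prefix_rfl, by omega, by omega, by simp, by simp, by simpa, by simpa, by simp⟩
  have hex : ∃ n, ∃ s t, s ++ t ∈ C.R ∧ s <:+: a ++ v ∧ (s ++ t).length < s.length + 3 * C.κ ∧
      s.length = n := by
    simp only [SC.Q, not_forall, not_le] at hq
    grind
  classical
  obtain ⟨n, ⟨s, t, hr, hs, hlt, rfl⟩, hmax⟩ : ∃ n, (∃ s t, s ++ t ∈ C.R ∧ s <:+: a ++ v ∧
      (s ++ t).length < s.length + 3 * C.κ ∧ s.length = n) ∧ ∀ m, n < m →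
      ¬ ∃ s t, s ++ t ∈ C.R ∧ s <:+: a ++ v ∧ (s ++ t).length < s.length + 3 * C.κ ∧
        s.length = m := by
    obtain ⟨n, hn⟩ := hex
    have hb : n ≤ (a ++ v).length := by
      grind
    exact ⟨_, Nat.findGreatest_spec (P := fun n => ∃ s t, s ++ t ∈ C.R ∧ s <:+: a ++ v ∧
      (s ++ t).length < s.length + 3 * C.κ ∧ s.length = n) hb hn, fun m hm h => by
        have h' := h
        obtain ⟨s, t, -, h1, -, rfl⟩ := h'
        exact Nat.findGreatest_is_greatest hm h1.length_le h⟩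
  have hlen := C.len hr
  have hLr := hL _ hr
  rcases infix_append_iff_ne_nil.1 hs with h | h | ⟨s1, s2, hs1, hs2, rfl, ⟨a1, rfl⟩, ⟨v', rfl⟩⟩
  · have := ha.Q s t hr h; omega
  · have := hQ s t hr h; omega
  have hs2N : s2.length ≤ N := by simp only [length_append] at *; omega
  have htk : (s2 ++ v').take N = s2 ++ v'.take (N - s2.length) := by
    rw [take_append, take_of_length_le hs2N]
  have hs2g := hg.rel (s := s2) (t := t ++ s1) ⟨[], v'.take (N - s2.length), by simp [htk]⟩ (by
    have := C.rot (p := s1) (q := s2 ++ t) (by simpa using hr)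
    simpa using this)
  have hev : C.ev (s1 ++ s2) = C.ev (invRev t) := by
    rw [C.ev_invRev, eq_inv_iff_mul_eq_one, ← C.ev_append]; exact C.ev_rel hr
  have h1 := hmin s2.length hs2N
  have htk2 : (s2 ++ v').take s2.length = s2 := by simp
  rw [htk2, ← C.ev_append, append_assoc, C.ev_append, hev, ← C.ev_append] at h1
  have h2 := C.nm_ev_le (a1 ++ invRev t)
  have hred1 : IsReduced (a1 ++ invRev t) := by
    refine isReduced_invRev_concat (hav.infix ⟨[], s1 ++ (s2 ++ v'), by simp⟩) (C.red1 hr)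
      fun a' l t' hal htl => ?_
    subst hal htl
    refine hmax (l :: (s1 ++ s2)).length (by simp) ⟨l :: (s1 ++ s2), t', ?_, ⟨a', v', by simp⟩, ?_, rfl⟩
    · have := C.rot (p := s1 ++ s2 ++ t') (q := [l]) (by simpa using hr)
      simpa using this
    · simp only [length_append, length_cons, length_nil] at *; omega
  have hred2 : IsReduced (invRev t ++ v') := by
    have : IsReduced (invRev v' ++ invRev (invRev t)) := by
      refine isReduced_invRev_concat (s := invRev (s1 ++ s2))
        (isReduced_invRev (hav.infix ⟨a1 ++ s1 ++ s2, [], by simp⟩)) ?_ fun w l t' hvl htl => ?_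
      · have := C.red1 (C.inv (C.rot hr))
        rwa [invRev_append] at this
      · have hvl' := congrArg invRev hvl
        have htl' := congrArg invRev htl
        rw [invRev_concat, invRev_invRev] at hvl' htl'
        refine hmax (s1 ++ s2 ++ [linv l]).length (by simp)
          ⟨s1 ++ s2 ++ [linv l], invRev t', ?_, ⟨a1, invRev w, by simp [hvl']⟩, ?_, rfl⟩
        · rw [htl'] at hr; simpa using hr
        · rw [htl'] at hlt
          simp only [length_append, length_cons, length_nil] at *; omega
    have := isReduced_invRev this
    simpa [invRev_append] using this
  have htl : C.pi (s1 ++ s2 ++ t) < t.length := by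
    simp only [length_append, invRev_length] at *; omega
  have hredY : IsReduced (a1 ++ (invRev t ++ v')) := by
    refine isReduced_join hred1 hred2 fun h => ?_
    have := congrArg length h
    simp only [invRev_length, length_nil] at this
    omega
  have hdrop : (s2 ++ v').drop s2.length = v' := by simp
  refine ⟨a1, invRev t, s2.length, ⟨s1, rfl⟩, ?_, hs2N, ?_, ?_, ?_, ?_, ?_⟩
  · simp only [length_append] at *; omega
  · simp only [length_append, invRev_length] at *; omega
  · grind
  · rwa [hdrop]
  · rw [hdrop]
    have hav' : IsReduced (a1 ++ (s1 ++ s2) ++ v') := by simpa using hav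
    have hne : s1 ++ s2 ≠ [] := by simp [hs1]
    have hvy : ∀ y z, y <+: v' → y ++ z ∈ C.R → 2 * y.length ≤ (y ++ z).length := by
      intro y z hy hyz
      have hLp := hL _ hyz
      have hin : y.take (L / 2 + 1) <:+: (s2 ++ v').take N := by
        have h3 : s2 ++ y.take (L / 2 + 1) <+: (s2 ++ v').take N := by
          rw [prefix_take_iff]
          refine ⟨(prefix_append_right_inj _).2 ((take_prefix _ _).trans hy), ?_⟩
          simp only [length_append, length_take] at *; omega
        exact (suffix_append s2 _).isInfix.trans h3.isInfix
      have h3 := hg.rel (t := y.drop (L / 2 + 1) ++ z) hin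
        (by rwa [← append_assoc, take_append_drop])
      rw [← append_assoc, take_append_drop, length_take] at h3
      omega
    have hal : ∀ q A B σ τ, σ ++ τ ∈ C.R → σ.length + 3 * C.κ > (σ ++ τ).length →
        A ++ q ++ B = invRev t → (∃ x y, σ = x ++ q ++ y ∧ (x = [] ∨ A = []) ∧ (y = [] ∨ B = []) ∧
          x <:+ a1 ++ A ∧ y <+: B ++ v') →
        q.length < C.pi ((s1 ++ s2) ++ t) ∧ q.length < C.pi (σ ++ τ) := by
      intro q A B σ τ h3 h4 h5 h6
      by_contra hcon
      have := SC.corner_aligned hav' hne hr h3 h5 h6 (by omega)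
      have := C.len h3
      simp only [length_append] at *; omega
    intro σ τ hστ hσ
    by_contra hcon
    rw [not_le] at hcon
    have hlσ := C.len hστ
    rcases infix_append_iff_ne_nil.1 hσ with h | h | ⟨x, w, hx, hw, rfl, hxa, hwp⟩
    · have := ha.Q σ τ hστ (h.trans ⟨[], s1, by simp⟩); omega
    · rcases infix_append_iff_ne_nil.1 h with h | h | ⟨q, y, hq, hy, rfl, ⟨A, hA⟩, hyv⟩
      · have := h.length_le
        simp only [length_append, invRev_length] at *; omega
      · have := hQ σ τ hστ (h.trans ⟨s2, [], by simp⟩); omega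
      · have h3 := hal q A [] (q ++ y) τ hστ hcon (by simpa using hA)
          ⟨[], y, by simp, Or.inl rfl, Or.inr rfl, nil_suffix, by simpa using hyv⟩
        have h4 := hvy y (τ ++ q) hyv (by
          have := C.rot (p := q) (q := y ++ τ) (by simpa using hστ)
          simpa using this)
        simp only [length_append] at *; omega
    · obtain ⟨w', hw'⟩ := hwp
      rcases append_eq_append_iff.1 hw' with ⟨B, hB, -⟩ | ⟨y, rfl, hy⟩
      · have h3 := hal w [] B (x ++ w) τ hστ hcon (by simpa using hB.symm)
          ⟨x, [], by simp, Or.inr rfl, Or.inl rfl, by simpa using hxa, nil_prefix⟩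
        have h4 := ha.rel (s := x) (t := w ++ τ) (hxa.isInfix.trans ⟨[], s1, by simp⟩)
          (by simpa using hστ)
        simp only [length_append] at *; omega
      · have h3 := hal (invRev t) [] [] (x ++ (invRev t ++ y)) τ hστ hcon (by simp)
          ⟨x, y, by simp, Or.inr rfl, Or.inr rfl, by simpa using hxa, ⟨w', by simpa using hy.symm⟩⟩
        rw [invRev_length] at h3
        omega
  · rw [htk2, ← C.ev_append, C.ev_append, ← hev]
    simp only [C.ev_append, mul_assoc]

end

section

variable {C : SC α} {L : ℕ}

lemma SC.proj_word {a v : Word α} (hL : ∀ r ∈ C.R, r.length ≤ L)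
    (ha : C.Geo a) (hv : C.Geo v)
    (hmin : ∀ j ≤ v.length, a.length ≤ C.nm (C.ev a * C.ev (v.take j))) :
    a.length + v.length ≤ C.nm (C.ev a * C.ev v) + (6 * L + 2) := by
  by_cases hvL : v.length ≤ L
  · have := hmin v.length le_rfl
    rw [take_length] at this
    omega
  obtain ⟨a1, t, b, ⟨s1, rfl⟩, h1, h2, h3, -, h4, h5, h6⟩ := SC.exists_corner (N := v.length) hL ha hv.red
    hv.Q (by omega) le_rfl (by rwa [take_length]) hmin
  obtain ⟨γ, hγ, hγe, hγl⟩ := C.exists_geo_nm (C.ev (a1 ++ s1) * C.ev v)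
  have hev : C.ev (a1 ++ (t ++ v.drop b)) = C.ev γ := by
    rw [hγe, ← append_assoc, C.ev_append (a1 ++ t), h6, mul_assoc, ← C.ev_append,
      take_append_drop]
  obtain ⟨j, hj, h7⟩ := SC.near_line hL h4 h5 hγ hev (i := a1.length) (by simp)
  rw [take_left] at h7
  have h8 : (a1 ++ s1).length ≤ a1.length + t.length := by
    have := hmin b h2
    rw [← h6] at this
    simpa using this.trans (C.nm_ev_le _)
  have e1 := hγ.dst_take 1 (Nat.zero_le j) hj
  have e2 := hγ.dst_take 1 hj le_rfl
  have e3 := (ha.infix (q := a1) ⟨[], s1, by simp⟩).dst 1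
  have e4 := hv.dst (C.ev (a1 ++ s1))
  have e5 := C.dst_ev_le (C.ev a1) s1
  rw [← C.ev_append] at e5
  simp only [take_zero, take_length, C.ev_nil, one_mul, mul_one, ← hγe] at *
  have e6 := C.dst_triangle 1 (C.ev (γ.take j)) (C.ev a1)
  have e7 := C.dst_triangle (C.ev (a1 ++ s1)) (C.ev a1) (C.ev γ)
  have e8 := C.dst_triangle (C.ev a1) (C.ev (γ.take j)) (C.ev γ)
  have e9 := C.dst_comm (C.ev a1) (C.ev (γ.take j))
  have e10 := C.dst_comm (C.ev a1) (C.ev (a1 ++ s1))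
  simp only [length_append] at *
  omega

/-- Nearest points on geodesics are almost gates. -/
lemma SC.exists_proj (hL : ∀ r ∈ C.R, r.length ≤ L) (x g : C.Grp) {u : Word α}
    (hu : C.Geo u) : ∃ i ≤ u.length,
      (∀ j ≤ u.length, C.dst x (g * C.ev (u.take i)) ≤ C.dst x (g * C.ev (u.take j))) ∧
      (∀ j ≤ u.length, C.dst x (g * C.ev (u.take i)) + (j - i) + (i - j) ≤
        C.dst x (g * C.ev (u.take j)) + (6 * L + 2)) := by
  obtain ⟨i, hi, hmin⟩ := exists_min_image (Finset.range (u.length + 1))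
    (fun i => C.dst x (g * C.ev (u.take i))) ⟨0, by simp⟩
  simp only [Finset.mem_range, Nat.lt_succ_iff] at hi hmin
  refine ⟨i, hi, hmin, fun j hj => ?_⟩
  obtain ⟨a, ha, hae, hal⟩ := C.exists_geo_nm (x⁻¹ * (g * C.ev (u.take i)))
  have key : ∀ v, C.Geo v → (∀ m ≤ v.length, ∃ m' ≤ u.length,
      C.ev (u.take i) * C.ev (v.take m) = C.ev (u.take m')) → a.length + v.length ≤
      C.dst x (g * (C.ev (u.take i) * C.ev v)) + (6 * L + 2) := by
    intro v hv h
    have := SC.proj_word hL ha hv fun m hm => by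
      obtain ⟨m', hm', h1⟩ := h m hm
      have := hmin m' hm'
      rwa [hae, hal, mul_assoc, mul_assoc, h1]
    rwa [hae, mul_assoc, mul_assoc] at this
  change a.length = C.dst x (g * C.ev (u.take i)) at hal
  rcases le_total i j with h | h
  · have := key ((u.take j).drop i) (hu.infix ((drop_suffix _ _).isInfix.trans
      (take_prefix _ _).isInfix)) fun m hm => ⟨i + m, ?_, ?_⟩
    · rw [← C.ev_append, show u.take i = (u.take j).take i by rw [take_take, min_eq_left h],
        take_append_drop] at this
      simp only [length_drop, length_take] at this
      omega
    · simp only [length_drop, length_take] at hm; omega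
    · simp only [length_drop, length_take] at hm
      rw [← C.ev_append, take_add, drop_take, take_take]
      congr 3; omega
  · have := key (invRev ((u.take i).drop j)) (hu.infix ((drop_suffix _ _).isInfix.trans
      (take_prefix _ _).isInfix)).invRev fun m hm => ⟨i - m, by omega, ?_⟩
    · rw [C.ev_invRev] at this
      have e : C.ev (u.take i) = C.ev (u.take j) * C.ev ((u.take i).drop j) := by
        rw [← C.ev_append, show u.take j = (u.take i).take j by rw [take_take, min_eq_left h],
          take_append_drop]
      rw [e, mul_inv_cancel_right] at this
      simp only [invRev_length, length_drop, length_take] at this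
      omega
    · simp only [invRev_length, length_drop, length_take] at hm
      have e1 : u.take i = u.take (i - m) ++ (u.take i).drop (i - m) := by
        conv_lhs => rw [← take_append_drop (i - m) (u.take i)]
        rw [take_take, min_eq_left (by omega)]
      have e2 : (invRev ((u.take i).drop j)).take m = invRev ((u.take i).drop (i - m)) := by
        have : (u.take i).drop j = ((u.take i).drop j).take (i - m - j) ++ (u.take i).drop (i - m) := by
          conv_lhs => rw [← take_append_drop (i - m - j) ((u.take i).drop j)]
          rw [drop_drop]; congr 2; omega
        rw [this, invRev_append, take_left']
        simp only [invRev_length, length_drop, length_take]; omega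
      rw [e2, C.ev_invRev]
      conv_lhs => rw [e1, C.ev_append]
      rw [← e1, mul_inv_cancel_right]

/-- The four point condition. -/
lemma SC.four_point (hL : ∀ r ∈ C.R, r.length ≤ L) (x k g h : C.Grp) :
    C.dst x k + C.dst g h ≤ max (C.dst x g + C.dst k h) (C.dst x h + C.dst k g) + (12 * L + 4) := by
  obtain ⟨u, hu, hue, hul⟩ := C.exists_geo_nm (g⁻¹ * h)
  change u.length = C.dst g h at hul
  obtain ⟨i, hi, -, hx⟩ := SC.exists_proj hL x g hu
  obtain ⟨j, hj, -, hk⟩ := SC.exists_proj hL k g hu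
  have e1 := hx 0 (Nat.zero_le _)
  have e2 := hx _ le_rfl
  have e3 := hk 0 (Nat.zero_le _)
  have e4 := hk _ le_rfl
  simp only [take_zero, take_length, C.ev_nil, mul_one, hue, mul_inv_cancel_left] at *
  have e5 := C.dst_triangle x (g * C.ev (u.take i)) k
  have e6 := C.dst_triangle (g * C.ev (u.take i)) (g * C.ev (u.take j)) k
  have e7 := C.dst_comm (g * C.ev (u.take j)) k
  rcases le_total i j with h' | h'
  · have := C.dst_take_le g u h'
    omega
  · have := C.dst_take_le g u h'
    have := C.dst_comm (g * C.ev (u.take i)) (g * C.ev (u.take j))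
    omega

end

section

variable {C : SC α} {L K : ℕ}

lemma SC.Q.invRev {Y : Word α} (h : C.Q Y) : C.Q (invRev Y) := by
  rintro s t hst ⟨x, y, hxy⟩
  have h1 := C.inv (C.rot hst)
  rw [invRev_append] at h1
  have h2 := h _ _ h1 ⟨FreeGroup.invRev y, FreeGroup.invRev x, by
    rw [← invRev_invRev (L₁ := Y), ← hxy]; simp⟩
  simpa using h2

lemma SC.far_connector {x g g' z : C.Grp} {a a1 t : Word α} (ha : C.Geo a)
    (hz : z = g' * C.ev a) (hd : C.dst g' z + C.dst z g ≤ C.dst g' g + (6 * L + 2))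
    (hg : g = g' ∨ C.dst g g' + K ≤ C.dst x g + C.dst x g') (h0 : g = g' → a = [])
    (h1 : a1 <+: a) (ht : t.length ≤ L) (h2 : a = [] → t = []) (hne : a1 ++ t ≠ []) (k : ℕ) :
    K ≤ 2 * C.dst x (g' * C.ev ((a1 ++ t).take k)) + 8 * L + 2 := by
  obtain ⟨a2, rfl⟩ := h1
  have hg' : C.dst g g' + K ≤ C.dst x g + C.dst x g' := by
    refine hg.resolve_left fun h => hne ?_
    rw [h2 (h0 h), (append_eq_nil_iff.1 (h0 h)).1]; rfl
  have e1 : ∃ k' ≤ (a1 ++ a2).length, C.dst (g' * C.ev ((a1 ++ t).take k))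
      (g' * C.ev ((a1 ++ a2).take k')) ≤ L := by
    rcases le_total k a1.length with h | h
    · refine ⟨k, by simp; omega, ?_⟩
      rw [take_append_of_le_length h, take_append_of_le_length h, C.dst_self]
      exact Nat.zero_le _
    · refine ⟨a1.length, by simp, ?_⟩
      rw [take_left, take_append, take_of_length_le h, C.ev_append, ← mul_assoc,
        C.dst_comm]
      refine (C.dst_ev_le _ _).trans ?_
      simp; omega
  obtain ⟨k', hk', e2⟩ := e1
  have e3 := ha.dst_take g' (Nat.zero_le k') hk'
  have e4 := ha.dst_take g' hk' le_rfl
  have e5 := ha.dst g'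
  simp only [take_zero, take_length, C.ev_nil, mul_one, ← hz] at e3 e4 e5
  generalize hy : g' * C.ev ((a1 ++ a2).take k') = y at *
  generalize g' * C.ev ((a1 ++ t).take k) = w at *
  have := C.dst_triangle x y g
  have := C.dst_triangle y z g
  have := C.dst_triangle x y g'
  have := C.dst_triangle x w y
  have := C.dst_comm g g'
  have := C.dst_comm y g'
  omega

/-- A geodesic whose endpoints look like those of a given geodesic from far inside sees the same
relators. -/
lemma SC.reads_of_far (hL : ∀ r ∈ C.R, r.length ≤ L) (hK : 100 * L + 100 ≤ K) {g h g' h' x : C.Grp}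
    {u γ γ1 p q γ2 : Word α} (hu : C.Geo u) (huh : h = g * C.ev u) (hγ : C.Geo γ)
    (hγh : h' = g' * C.ev γ) (hs : γ = γ1 ++ p ++ γ2) (hr : p ++ q ∈ C.R)
    (hp : 3 * C.pi (p ++ q) ≤ p.length) (hx : C.dst x (g' * C.ev γ1) ≤ L)
    (hg : g = g' ∨ C.dst g g' + K ≤ C.dst x g + C.dst x g')
    (hh : h = h' ∨ C.dst h h' + K ≤ C.dst x h + C.dst x h') :
    ∃ i o s, i ≤ u.length ∧ o <+: u.drop i ∧ C.pi (p ++ q) ≤ o.length ∧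
      Turn C.cay (g' * C.ev γ1) (p ++ q) (g * C.ev (u.take i)) (o ++ s) := by
  by_cases hboth : g = g' ∧ h = h'
  · obtain ⟨rfl, rfl⟩ := hboth
    obtain ⟨i, o, s, h1, h2, h3, h4⟩ := SC.relator_near hu.red hu.Q hγ
      (mul_left_cancel (huh.symm.trans hγh)) hs hr hp
    exact ⟨i, o, s, h1, h2, h3, h4.mul_left g⟩
  obtain ⟨i, hi, hi1, hi2⟩ := SC.exists_proj hL g' g hu
  obtain ⟨j, hj, hj1, hj2⟩ := SC.exists_proj hL h' g hu
  obtain ⟨T, hT, -, hT2⟩ := SC.exists_proj hL x g hu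
  have hun : C.dst g h = u.length := by rw [huh, hu.dst]
  have hin : C.dst g' h' + 2 * L ≥ C.dst x g' + C.dst x h' := by
    have e1 : C.dst g' h' = γ.length := by rw [hγh, hγ.dst]
    have e2 := C.dst_take_le g' γ (Nat.zero_le γ1.length)
    have e3 := C.dst_take_le g' γ (show γ1.length ≤ γ.length by rw [hs]; simp)
    have e4 : γ.take γ1.length = γ1 := by rw [hs]; simp
    have e5 : γ1.length ≤ γ.length := by rw [hs]; simp
    rw [e4] at e2 e3
    simp only [take_zero, take_length, C.ev_nil, mul_one, ← hγh] at e2 e3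
    have := C.dst_triangle x (g' * C.ev γ1) g'
    have := C.dst_triangle x (g' * C.ev γ1) h'
    have := C.dst_comm (g' * C.ev γ1) g'
    omega
  have hzero : ∀ i, (∀ j ≤ u.length, C.dst g' (g * C.ev (u.take i)) ≤ C.dst g' (g * C.ev (u.take j))) →
      g = g' → g' = g * C.ev (u.take i) := by
    intro i hi h
    have := hi 0 (Nat.zero_le _)
    simp only [take_zero, C.ev_nil, mul_one, h, C.dst_self] at this
    exact C.eq_of_dst (by rw [h]; omega)
  have hgi : g = g' → i = 0 := by
    intro h
    have e1 := hzero i hi1 h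
    have e2 := hu.dst_take g (Nat.zero_le i) hi
    rw [← e1, take_zero, C.ev_nil, mul_one, h, C.dst_self] at e2
    omega
  have hhj' : h = h' → h' = g * C.ev (u.take j) := by
    intro h
    have := hj1 _ le_rfl
    rw [take_length, ← huh, h, C.dst_self] at this
    exact C.eq_of_dst (by omega)
  have hhj : h = h' → j = u.length := by
    intro h
    have e2 := hu.dst_take g hj le_rfl
    rw [← hhj' h, take_length, ← huh, h, C.dst_self] at e2
    omega
  have ei0 := hi2 0 (Nat.zero_le _)
  have ejn := hj2 _ le_rfl
  have eT0 := hT2 0 (Nat.zero_le _)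
  have eTn := hT2 _ le_rfl
  simp only [take_zero, take_length, C.ev_nil, mul_one, ← huh] at ei0 ejn eT0 eTn
  have hord : i + (3 * L + 3) ≤ j := by
    have f2 := SC.four_point hL x g g' h
    have f3 := SC.four_point hL x h g' h'
    have t1 := C.dst_triangle x (g * C.ev (u.take T)) g'
    have t2 := C.dst_triangle x (g * C.ev (u.take T)) h'
    have t3 := C.dst_triangle (g * C.ev (u.take T)) (g * C.ev (u.take i)) g'
    have t4 := C.dst_triangle (g * C.ev (u.take T)) (g * C.ev (u.take j)) h'
    have t5 := C.dst_triangle x (g * C.ev (u.take T)) g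
    have t6 := C.dst_triangle x (g * C.ev (u.take T)) h
    have t7 : C.dst (g * C.ev (u.take T)) g ≤ T := by
      have := C.dst_take_le g u (Nat.zero_le T)
      rw [take_zero, C.ev_nil, mul_one] at this
      rw [C.dst_comm]; exact this
    have t8 : C.dst (g * C.ev (u.take T)) h ≤ u.length - T := by
      have := C.dst_take_le g u hT
      rwa [take_length, ← huh] at this
    have t9 : ∀ a b, C.dst (g * C.ev (u.take a)) (g * C.ev (u.take b)) ≤ (a - b) + (b - a) := by
      intro a b
      rcases le_total a b with h | h
      · have := C.dst_take_le g u h; omega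
      · have := C.dst_take_le g u h
        rw [C.dst_comm] at this; omega
    have t10 := t9 T i
    have t11 := t9 T j
    have s1 := C.dst_comm g g'
    have s2 := C.dst_comm h h'
    have s3 := C.dst_comm g h
    have s4 := C.dst_comm g' h
    have s5 := C.dst_comm g h'
    have s6 := C.dst_comm g' h'
    have s7 := C.dst_comm (g * C.ev (u.take i)) g'
    have s8 := C.dst_comm (g * C.ev (u.take j)) h'
    have hxu : C.dst x g + C.dst x h ≤ C.dst g h + 26 * L + 8 := by
      rcases hg with rfl | hg <;> rcases hh with rfl | hh
      · exact absurd ⟨rfl, rfl⟩ hboth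
      all_goals omega
    rcases hg with rfl | hg
    · have := hgi rfl
      rcases hh with rfl | hh
      · exact absurd ⟨rfl, rfl⟩ hboth
      clear f2 f3
      omega
    · rcases hh with rfl | hh
      · have := hhj rfl
        clear f2 f3
        omega
      · clear f2 f3
        omega
  clear eT0 eTn hT2
  obtain ⟨a, ha, hae, hal⟩ := C.exists_geo_nm (g'⁻¹ * (g * C.ev (u.take i)))
  obtain ⟨b, hb, hbe, hbl⟩ := C.exists_geo_nm (h'⁻¹ * (g * C.ev (u.take j)))
  have hae' : g * C.ev (u.take i) = g' * C.ev a := by rw [hae, mul_inv_cancel_left]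
  have hbe' : g * C.ev (u.take j) = h' * C.ev b := by rw [hbe, mul_inv_cancel_left]
  obtain ⟨v, hv⟩ : ∃ v, u.take j = u.take i ++ v :=
    ⟨(u.take j).drop i, by
      conv_lhs => rw [← take_append_drop i (u.take j), take_take, min_eq_left (by omega)]⟩
  have hvu : u = u.take i ++ v ++ u.drop j := by rw [← hv, take_append_drop]
  have hvg : C.Geo v := hu.infix ⟨_, _, hvu.symm⟩
  have hvl : v.length = j - i := by
    have := congrArg length hv
    simp only [length_append, length_take] at this; omega
  have huv : ∀ m ≤ v.length, u.take (i + m) = u.take i ++ v.take m := by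
    intro m hm
    rw [show u.take (i + m) = (u.take j).take (i + m) by rw [take_take, min_eq_left (by omega)],
      hv, take_append, take_of_length_le (by simp)]
    congr 2; simp; omega
  obtain ⟨a1, t, m0, ha1, hm0, hm0', ht, hat, hred1, hQ1, hev1⟩ := SC.exists_corner (N := v.length) hL ha
    hvg.red hvg.Q (by omega) le_rfl (by rwa [take_length]) (by
      intro m hm
      rw [hal, hae, mul_assoc, mul_assoc, ← C.ev_append, ← huv m hm]
      exact hi1 _ (by omega))
  obtain ⟨v0, v1, rfl, rfl⟩ : ∃ v0 v1, v = v0 ++ v1 ∧ v0.length = m0 :=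
    ⟨_, _, (take_append_drop m0 v).symm, by simp; omega⟩
  rw [drop_left] at hred1 hQ1
  rw [take_left] at hev1
  simp only [length_append] at hvl huv
  have hv1g : C.Geo v1 := hvg.infix ⟨v0, [], by simp⟩
  have hinvQ : C.Q (invRev (a1 ++ (t ++ v1))) := hQ1.invRev
  obtain ⟨b1, s, m1, hb1, hm1, hm1', hsl, hbs, hred2, hQ2, hev2⟩ := SC.exists_corner (N := v1.length)
    hL hb (isReduced_invRev hred1) hinvQ (by omega) (by simp)
    (by
      rw [← append_assoc, invRev_append, take_left' (by simp)]
      exact hv1g.invRev)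
    (by
      intro m hm
      have e1 : (invRev (a1 ++ (t ++ v1))).take m = invRev (v1.drop (v1.length - m)) := by
        have : a1 ++ (t ++ v1) = (a1 ++ t ++ v1.take (v1.length - m)) ++ v1.drop (v1.length - m) := by
          simp
        rw [this, invRev_append, take_left']
        simp; omega
      have e2 : u.take j = u.take (j - m) ++ v1.drop (v1.length - m) := by
        rw [hv, show j - m = i + (v0.length + (v1.length - m)) by omega, huv _ (by omega),
          take_append, take_of_length_le (l := v0) (by omega)]
        simp
      have e3 := hj1 (j - m) (by omega)
      rw [hbl, hbe, e1, e2, C.ev_append, C.ev_invRev, mul_assoc, mul_assoc, mul_inv_cancel_right]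
      rw [e2, C.ev_append] at e3
      exact e3)
  obtain ⟨w, w', rfl, rfl⟩ : ∃ w w', v1 = w ++ w' ∧ w'.length = m1 :=
    ⟨_, _, (take_append_drop (v1.length - m1) v1).symm, by simp; omega⟩
  rw [show invRev (a1 ++ (t ++ (w ++ w'))) = invRev w' ++ invRev (a1 ++ t ++ w) by
    simp [invRev_append]] at hred2 hQ2 hev2
  rw [drop_left' (by simp)] at hred2 hQ2
  rw [take_left' (by simp)] at hev2
  obtain ⟨P, hP⟩ : ∃ P, P = a1 ++ t := ⟨_, rfl⟩
  obtain ⟨E, hE⟩ : ∃ E, E = b1 ++ s := ⟨_, rfl⟩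
  have hY : invRev (b1 ++ (s ++ invRev (a1 ++ t ++ w))) = P ++ (w ++ invRev E) := by
    simp [invRev_append, hP, hE]
  have hYr := isReduced_invRev hred2
  have hYQ := hQ2.invRev
  rw [hY] at hYr hYQ
  have hPe : g' * C.ev P = g * C.ev (u.take (i + v0.length)) := by
    rw [huv _ (by omega), take_left, C.ev_append, ← mul_assoc, hae', mul_assoc, ← hev1, hP]
  have hEe : h' * C.ev E = g * C.ev (u.take (i + v0.length)) * C.ev w := by
    rw [hE, hev2, ← mul_assoc, ← hbe', hv, huv _ (by omega), take_left, C.ev_invRev]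
    simp only [C.ev_append]; group
  have hYe : C.ev (P ++ (w ++ invRev E)) = C.ev γ := by
    apply mul_left_cancel (a := g')
    rw [← hγh, C.ev_append, ← mul_assoc, hPe, C.ev_append, C.ev_invRev, ← mul_assoc, ← hEe,
      mul_inv_cancel_right]
  obtain ⟨i0, o, s', hi0, ho, hol, hturn⟩ := SC.relator_near hYr hYQ hγ hYe hs hr hp
  have hturn' := hturn.mul_left g'
  have hol' : o.length ≤ L := by
    have := hL _ (hturn.mem hr)
    simp only [length_append] at this; omega
  have hxi : C.dst x (g' * C.ev ((P ++ (w ++ invRev E)).take i0)) ≤ 2 * L := by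
    have e1 := hturn'.dst_le (C.ev_rel hr)
    have e2 := hL _ hr
    have := C.dst_triangle x (g' * C.ev γ1) (g' * C.ev ((P ++ (w ++ invRev E)).take i0))
    omega
  have hzi := hu.dst_take g (Nat.zero_le i) hi
  have hzj := hu.dst_take g hj le_rfl
  rw [take_zero, C.ev_nil, mul_one, C.dst_comm] at hzi
  rw [take_length, ← huh] at hzj
  have hiP : P.length ≤ i0 := by
    by_contra hcon
    have := SC.far_connector ha hae' (x := x) (by omega) hg
      (fun h => eq_nil_of_length_eq_zero (by rw [hal, hgi h]; simp [h]))
      ha1 ht (fun h => (hat h).1) (by rw [← hP]; rintro rfl; simp at hcon) i0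
    rw [take_append_of_le_length (by omega), hP] at hxi
    omega
  have hoY := ho.length_le
  rw [length_drop] at hoY
  have hiE : i0 + o.length ≤ P.length + w.length := by
    by_contra hcon
    obtain ⟨i1, hi1'⟩ : ∃ i1, i1 = max i0 (P.length + w.length) := ⟨_, rfl⟩
    have hYl : (P ++ (w ++ invRev E)).length = P.length + w.length + E.length := by simp; omega
    have e1 := SC.far_connector (t := s) hb hbe' (x := x) (by omega) hh
      (fun h => eq_nil_of_length_eq_zero (by
        rw [hbl, ← hhj' h]; simp))
      hb1 hsl (fun h => (hbs h).1)
      (by rw [← hE]; rintro rfl; simp only [length_nil] at hYl; omega)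
      ((P ++ (w ++ invRev E)).length - i1)
    rw [← hE] at e1
    have e2 : (P ++ (w ++ invRev E)).take i1 ++
        invRev (E.take ((P ++ (w ++ invRev E)).length - i1)) = P ++ (w ++ invRev E) := by
      have e3 : P ++ (w ++ invRev E) = (P ++ (w ++ invRev (E.drop (P.length + w.length + E.length - i1)))) ++
          invRev (E.take (P.length + w.length + E.length - i1)) := by
        conv_lhs => rw [← take_append_drop (P.length + w.length + E.length - i1) E, invRev_append]
        simp
      rw [hYl]
      conv_lhs => rw [e3]
      rw [take_left' (by simp; omega), ← e3]
    have e4 : g' * C.ev ((P ++ (w ++ invRev E)).take i1) =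
        h' * C.ev (E.take ((P ++ (w ++ invRev E)).length - i1)) := by
      rw [hγh, ← hYe]
      have e5 := congrArg C.ev e2
      rw [C.ev_append, C.ev_invRev] at e5
      rw [mul_assoc, ← e5, inv_mul_cancel_right]
    rw [← e4] at e1
    have e5 := C.dst_take_le g' (P ++ (w ++ invRev E)) (show i0 ≤ i1 by omega)
    have := C.dst_triangle x (g' * C.ev ((P ++ (w ++ invRev E)).take i0))
      (g' * C.ev ((P ++ (w ++ invRev E)).take i1))
    omega
  obtain ⟨k, rfl⟩ := Nat.exists_eq_add_of_le hiP
  simp only [length_append] at huv hvl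
  refine ⟨i + (v0.length + k), o, s', by omega, ?_, hol, ?_⟩
  · have e1 : (P ++ (w ++ invRev E)).drop (P.length + k) = w.drop k ++ invRev E := by
      rw [← drop_drop, drop_left, drop_append_of_le_length (by omega)]
    rw [e1] at ho
    have e2 : o <+: w.drop k := prefix_of_prefix_length_le ho (prefix_append _ _) (by
      rw [length_drop]; omega)
    have e3 : u.drop (i + (v0.length + k)) = w.drop k ++ (w' ++ u.drop j) := by
      conv_lhs => rw [hvu]
      have e4 : u.take i ++ (v0 ++ (w ++ w')) ++ u.drop j =
        (u.take i ++ (v0 ++ w.take k)) ++ (w.drop k ++ (w' ++ u.drop j)) := by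
        have e5 := take_append_drop k w
        generalize w.take k = wa at *
        generalize w.drop k = wb at *
        rw [← e5]
        simp only [append_assoc]
      rw [e4, drop_left' (by simp; omega)]
    rw [e3]
    exact e2.trans (prefix_append _ _)
  · convert hturn' using 1
    rw [take_append, take_of_length_le (l := P) (by omega), C.ev_append, ← mul_assoc, hPe,
      mul_assoc, ← C.ev_append, huv _ (by omega), huv _ (by omega), take_left]
    congr 2
    rw [Nat.add_sub_cancel_left, append_assoc, take_append, take_of_length_le (l := v0) (by omega),
      take_append_of_le_length (by omega)]
    simp only [Nat.add_sub_cancel_left, append_cancel_left_eq]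
    rw [take_append_of_le_length (by omega)]

end

/-- `p` and `q` coincide or have large Gromov product as seen from `x`. -/
def Near {G : Type} (d : G → G → ℕ) (K : ℕ) (x p q : G) : Prop :=
  p = q ∨ d p q + K ≤ d x p + d x q

/-- A discrete hyperbolic geometry on a group, with a ternary relation `W x g h` saying that
the point `x` is marked by a geodesic from `g` to `h`. -/
structure Geom (G : Type) [Group G] where
  d : G → G → ℕ
  d_self : ∀ x, d x x = 0
  d_comm : ∀ x y, d x y = d y x
  d_tri : ∀ x y z, d x z ≤ d x y + d y z
  d_left : ∀ a x y, d (a * x) (a * y) = d x y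
  D : ℕ
  D_pos : 0 < D
  four : ∀ x k g h, 2 * (d x k + d g h) ≤ 2 * max (d x g + d k h) (d x h + d k g) + D
  W : G → G → G → Prop
  W_left : ∀ a {x g h}, W x g h → W (a * x) (a * g) (a * h)
  W_symm : ∀ {x g h}, W x g h → W x h g
  P : ℕ
  near : ∀ {x g h g' h'}, W x g' h' → Near d (13 * D) x g g' → Near d (13 * D) x h h' →
    d g x + d x h ≤ d g h + D
  count : ∀ g h a, ∃ B : Finset G, B.card ≤ P ∧ ∀ {x g' h'}, W x g' h' →
    Near d (13 * D) x g g' → Near d (13 * D) x h h' → a ≤ d g x → d g x ≤ a + D → x ∈ B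

namespace Geom

variable {G : Type} [Group G] (M : Geom G)

open Classical in
noncomputable def pre (x p q : G) : NNReal :=
  if p = q then 0 else (1 / 2) ^ ((M.d x p + M.d x q - M.d p q) / M.D)

lemma pre_self (x p : G) : M.pre x p p = 0 := by simp [pre]

lemma pre_comm (x p q : G) : M.pre x p q = M.pre x q p := by
  by_cases h : p = q
  · rw [h]
  · simp only [pre, M.d_comm p q, if_neg h, if_neg (Ne.symm h), add_comm (M.d x p)]

lemma pre_left (a x p q : G) : M.pre (a * x) (a * p) (a * q) = M.pre x p q := by
  by_cases h : p = q
  · simp [pre, h]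
  · simp [pre, M.d_left, h]

lemma pre_le_of {x p q : G} {n : ℕ} (h : M.d p q + n * M.D ≤ M.d x p + M.d x q) :
    M.pre x p q ≤ (1 / 2) ^ n := by
  unfold pre
  split_ifs
  · simp
  · apply pow_le_pow_of_le_one (by simp) (by simp_all)
    rw [Nat.le_div_iff_mul_le M.D_pos]; omega

lemma near_of_pre {x p q : G} {n : ℕ} (h : M.pre x p q ≤ (1 / 2) ^ n) :
    Near M.d (n * M.D) x p q := by
  unfold pre at h
  split_ifs at h with h1
  · exact Or.inl h1
  · right
    have : n ≤ (M.d x p + M.d x q - M.d p q) / M.D := by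
      by_contra hc
      push Not at hc
      have := pow_lt_pow_right_of_lt_one₀ (a := (1 / 2 : NNReal)) (by simp)
        (by norm_num) hc
      grind
    rw [Nat.le_div_iff_mul_le M.D_pos] at this
    have := M.d_tri p x q
    have := M.d_comm p x
    omega

lemma pre_ineq (x p q r s : G) :
    M.pre x p s ≤ 2 * max (M.pre x p q) (max (M.pre x q r) (M.pre x r s)) := by
  obtain ⟨m, hm⟩ : ∃ m, m = max (M.pre x p q) (max (M.pre x q r) (M.pre x r s)) := ⟨_, rfl⟩
  have h1 : M.pre x p q ≤ m := by grind
  have h2 : M.pre x q r ≤ m := by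
    grind
  have h3 : M.pre x r s ≤ m := by
    grind
  rw [← hm]
  have h0 : m = 0 ∨ ∃ n : ℕ, m = (1 / 2) ^ n := by
    have : ∀ u v, M.pre x u v = 0 ∨ ∃ n : ℕ, M.pre x u v = (1 / 2) ^ n := by
      intro u v; unfold pre; grind
    grind
  rcases h0 with h0 | ⟨n, hn⟩
  · have hz : ∀ u v, M.pre x u v ≤ m → u = v := by
      intro u v h
      by_contra hne
      rw [h0] at h
      unfold pre at h
      rw [if_neg hne] at h
      exact absurd h (not_le.2 (by positivity))
    rw [hz _ _ h1, hz _ _ h2, hz _ _ h3, M.pre_self]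
    simp
  · rw [hn] at h1 h2 h3 ⊢
    cases n with
    | zero =>
      refine le_trans (M.pre_le_of (n := 0) ?_) (by norm_num)
      have := M.d_tri p x s
      have := M.d_comm p x
      omega
    | succ n =>
      have e : (2 : NNReal) * (1 / 2) ^ (n + 1) = (1 / 2) ^ n := by
        rw [pow_succ]; field_simp
      rw [e]
      rcases M.near_of_pre h1 with rfl | h1
      · rcases M.near_of_pre h2 with rfl | h2
        · exact h3.trans (pow_le_pow_of_le_one (by simp) (by simp [NNReal.inv_le]) (by omega))
        · rcases M.near_of_pre h3 with rfl | h3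
          · apply M.pre_le_of; grind
          · apply M.pre_le_of
            rw [add_mul] at *
            have := M.four x r p s
            have := M.d_comm r p
            grind
      · rcases M.near_of_pre h2 with rfl | h2
        · rcases M.near_of_pre h3 with rfl | h3
          · apply M.pre_le_of; grind
          · apply M.pre_le_of
            rw [add_mul] at *
            have := M.four x q p s
            have := M.d_comm q p
            omega
        · rcases M.near_of_pre h3 with rfl | h3
          · apply M.pre_le_of
            rw [add_mul] at *
            have := M.four x q p r
            have := M.d_comm q p
            omega
          · apply M.pre_le_of
            rw [add_mul] at *
            have := M.four x q p r
            have := M.d_comm q p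
            have := M.four x r p s
            have := M.d_comm r p
            omega

/-- The visual metric based at `x`. -/
noncomputable def rho (x p q : G) : ℝ :=
  (PseudoMetricSpace.ofPreNNDist (M.pre x) (M.pre_self x) (M.pre_comm x)).dist p q

lemma rho_le (x p q : G) : M.rho x p q ≤ M.pre x p q :=
  PseudoMetricSpace.dist_ofPreNNDist_le _ _ _ _ _

lemma le_rho (x p q : G) : (M.pre x p q : ℝ) ≤ 2 * M.rho x p q :=
  PseudoMetricSpace.le_two_mul_dist_ofPreNNDist _ _ _ (M.pre_ineq x) _ _

lemma rho_nonneg (x p q : G) : 0 ≤ M.rho x p q :=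
  @dist_nonneg _ (PseudoMetricSpace.ofPreNNDist (M.pre x) (M.pre_self x) (M.pre_comm x)) p q

lemma rho_tri (x p q r : G) : M.rho x p r ≤ M.rho x p q + M.rho x q r :=
  @dist_triangle _ (PseudoMetricSpace.ofPreNNDist (M.pre x) (M.pre_self x) (M.pre_comm x)) p q r

lemma rho_comm (x p q : G) : M.rho x p q = M.rho x q p :=
  @dist_comm _ (PseudoMetricSpace.ofPreNNDist (M.pre x) (M.pre_self x) (M.pre_comm x)) p q

lemma rho_left (a x p q : G) : M.rho (a * x) (a * p) (a * q) = M.rho x p q := by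
  have key : ∀ a x p q, M.rho (a * x) (a * p) (a * q) ≤ M.rho x p q := by
    intro a x p q
    change ((_ : NNReal) : ℝ) ≤ ((_ : NNReal) : ℝ)
    rw [NNReal.coe_le_coe]
    refine le_ciInf fun l => ?_
    refine (ciInf_le (OrderBot.bddBelow _) (l.map (a * ·))).trans_eq ?_
    congr 1
    have : a * p :: l.map (a * ·) = (p :: l).map (a * ·) := rfl
    rw [this, show l.map (a * ·) ++ [a * q] = (l ++ [q]).map (a * ·) by simp,
      zipWith_map]
    congr 1
    funext u v
    exact M.pre_left a x u v
  refine le_antisymm (key _ _ _ _) ?_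
  have := key a⁻¹ (a * x) (a * p) (a * q)
  simpa using this

/-- Distance from `(g,h)` to the set of pairs of points marking `x`. -/
noncomputable def tau (x g h : G) : ℝ :=
  sInf (insert 1 {t | ∃ g' h', M.W x g' h' ∧ t = max (M.rho x g g') (M.rho x h h')})

lemma tau_bdd (x g h : G) : BddBelow
    (insert 1 {t | ∃ g' h', M.W x g' h' ∧ t = max (M.rho x g g') (M.rho x h h')}) := by
  refine ⟨0, ?_⟩
  rintro t (rfl | ⟨g', h', _, rfl⟩)
  · grind
  · exact le_max_of_le_left (M.rho_nonneg _ _ _)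

lemma tau_lt {x g h : G} {T : ℝ} (hT : T ≤ 1) :
    M.tau x g h < T ↔ ∃ g' h', M.W x g' h' ∧ M.rho x g g' < T ∧ M.rho x h h' < T := by
  unfold tau
  rw [csInf_lt_iff (M.tau_bdd x g h) ⟨_, Set.mem_insert _ _⟩]
  grind

lemma tau_le (x g h k : G) : M.tau x g h ≤ M.tau x g k + M.rho x h k := by
  rw [← sub_le_iff_le_add]
  refine le_csInf ⟨_, Set.mem_insert _ _⟩ ?_
  rintro t (rfl | ⟨g', h', h1, rfl⟩)
  · have : M.tau x g h ≤ 1 := csInf_le (M.tau_bdd _ _ _) (Set.mem_insert _ _)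
    have := M.rho_nonneg x h k
    linarith
  · rw [sub_le_iff_le_add]
    refine (csInf_le (M.tau_bdd _ _ _) (Or.inr ⟨g', h', h1, rfl⟩)).trans ?_
    have := M.rho_tri x h k h'
    have := le_max_left (M.rho x g g') (M.rho x k h')
    have := le_max_right (M.rho x g g') (M.rho x k h')
    have := M.rho_nonneg x h k
    grind

/-- The points marked by pairs that are visually `T`-close to `(g,h)`. -/
def cyl (T : ℝ) (g h : G) : Set G := {x | M.tau x g h < T}

lemma cyl_left {T : ℝ} (hT : T ≤ 1) (a : G) {x g h : G} :
    a * x ∈ M.cyl T (a * g) (a * h) ↔ x ∈ M.cyl T g h := by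
  have key : ∀ (a : G) {x g h : G}, x ∈ M.cyl T g h → a * x ∈ M.cyl T (a * g) (a * h) := by
    intro a x g h
    simp only [cyl, Set.mem_ofPred_eq, M.tau_lt hT]
    rintro ⟨g', h', h1, h2, h3⟩
    exact ⟨a * g', a * h', M.W_left a h1, by rwa [M.rho_left], by rwa [M.rho_left]⟩
  refine ⟨fun h => ?_, key a⟩
  simpa using key a⁻¹ h

lemma cyl_symm {T : ℝ} (hT : T ≤ 1) {x g h : G} (hx : x ∈ M.cyl T g h) : x ∈ M.cyl T h g := by
  simp only [cyl, Set.mem_ofPred_eq, M.tau_lt hT] at *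
  obtain ⟨g', h', h1, h2, h3⟩ := hx
  exact ⟨h', g', M.W_symm h1, h3, h2⟩

lemma near_of_rho {x p q : G} (h : M.rho x p q < 2 * (1 / 2) ^ 15) :
    Near M.d (13 * M.D) x p q := by
  apply M.near_of_pre
  have := M.le_rho x p q
  rw [← NNReal.coe_le_coe]
  push_cast
  linarith

lemma rho_of_near {x p q : G} (h : Near M.d (16 * M.D) x p q) :
    M.rho x p q < (1 / 2) ^ 15 := by
  rcases h with rfl | h
  · have h1 := M.rho_le x p p
    rw [M.pre_self] at h1
    refine lt_of_le_of_lt h1 ?_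
    norm_num
  · have h1 := M.rho_le x p q
    have h2 := M.pre_le_of (n := 16) h
    rw [← NNReal.coe_le_coe] at h2
    push_cast at h2
    linarith

end Geom

section

open MeasureTheory

lemma exists_avoid {ι : Type*} (s : Finset ι) (a b w : ι → ℝ) (hw : ∀ i ∈ s, |a i - b i| ≤ w i)
    {c : ℝ} (hc : ∑ i ∈ s, w i < c) :
    ∃ T, c < T ∧ T ≤ 2 * c ∧ ∀ i ∈ s, a i < T ↔ b i < T := by
  have h1 : volume (⋃ i ∈ s, Set.Ioc (min (a i) (b i)) (max (a i) (b i))) <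
      volume (Set.Ioc c (2 * c)) := by
    refine (measure_biUnion_finset_le _ _).trans_lt ?_
    have : ∀ i ∈ s, volume (Set.Ioc (min (a i) (b i)) (max (a i) (b i))) ≤ ENNReal.ofReal (w i) := by
      intro i hi
      rw [Real.volume_Ioc]
      apply ENNReal.ofReal_le_ofReal
      grind
    refine (Finset.sum_le_sum this).trans_lt ?_
    have hnn : ∀ i ∈ s, 0 ≤ w i := fun i hi => (abs_nonneg _).trans (hw i hi)
    rw [← ENNReal.ofReal_sum_of_nonneg hnn, Real.volume_Ioc,
      ENNReal.ofReal_lt_ofReal_iff_of_nonneg (Finset.sum_nonneg hnn)]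
    linarith
  have h2 : ¬ Set.Ioc c (2 * c) ⊆ ⋃ i ∈ s, Set.Ioc (min (a i) (b i)) (max (a i) (b i)) :=
    fun h => absurd (measure_mono h) (not_le.2 h1)
  obtain ⟨T, hT, hT'⟩ := Set.not_subset.1 h2
  refine ⟨T, hT.1, hT.2, fun i hi => ?_⟩
  simp only [Set.mem_iUnion, not_exists, Set.mem_Ioc, not_and_or, not_lt, not_le] at hT'
  grind

namespace Geom

variable {G : Type} [Group G] (M : Geom G)

lemma exists_threshold (Tr : Finset (G × G × G)) {Q : ℕ} (hQ : Tr.card ≤ Q) :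
    ∃ T : ℝ, (1 / 2) ^ 15 < T ∧ T ≤ 2 * (1 / 2) ^ 15 ∧ ∀ t ∈ Tr, ∀ x,
      2 * M.d t.1 x + M.d t.2.1 t.2.2 + 2 * ((Q * M.P + 20) * M.D) ≤
        M.d t.1 t.2.1 + M.d t.1 t.2.2 →
      (x ∈ M.cyl T t.1 t.2.1 ↔ x ∈ M.cyl T t.1 t.2.2) := by
  classical
  obtain ⟨m, hm⟩ : ∃ m, m = Q * M.P + 20 := ⟨_, rfl⟩
  choose B hB1 hB2 using M.count
  obtain ⟨e, he⟩ : ∃ e : G × G × G → ℕ, e = fun t =>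
    (M.d t.1 t.2.1 + M.d t.1 t.2.2 - M.d t.2.1 t.2.2) / 2 - m * M.D := ⟨_, rfl⟩
  let I : Finset (Σ _ : G × G × G, Σ _ : ℕ, G) :=
    Tr.sigma fun t => (Finset.range (e t + 1)).sigma fun j =>
      (B t.1 t.2.1 (e t - (j + 1) * M.D) ∪ B t.1 t.2.2 (e t - (j + 1) * M.D)).filter
        fun x => M.pre x t.2.1 t.2.2 ≤ (1 / 2) ^ (m + j)
  obtain ⟨T, hT1, hT2, hT3⟩ := exists_avoid I
    (fun i => M.tau i.2.2 i.1.1 i.1.2.1) (fun i => M.tau i.2.2 i.1.1 i.1.2.2)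
    (fun i => (1 / 2) ^ (m + i.2.1)) (c := (1 / 2) ^ 15) (by
      rintro ⟨t, j, x⟩ hi
      simp only [I, Finset.mem_sigma, Finset.mem_filter] at hi
      have h1 := hi.2.2.2
      have h2 := M.rho_le x t.2.1 t.2.2
      have h3 := M.tau_le x t.1 t.2.1 t.2.2
      have h4 := M.tau_le x t.1 t.2.2 t.2.1
      rw [M.rho_comm x t.2.2] at h4
      rw [abs_sub_le_iff]
      constructor <;> linarith) (by
      simp only [I, sum_sigma]
      have h1 : ∀ t ∈ Tr, (∑ j ∈ Finset.range (e t + 1), ∑ _x ∈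
          (B t.1 t.2.1 (e t - (j + 1) * M.D) ∪ B t.1 t.2.2 (e t - (j + 1) * M.D)).filter
          (fun x => M.pre x t.2.1 t.2.2 ≤ (1 / 2) ^ (m + j)), ((1 / 2 : ℝ)) ^ (m + j))
          ≤ 4 * M.P * (1 / 2) ^ m := by
        intro t _
        have h2 : ∀ j ∈ Finset.range (e t + 1), (∑ _x ∈
          (B t.1 t.2.1 (e t - (j + 1) * M.D) ∪ B t.1 t.2.2 (e t - (j + 1) * M.D)).filter
          (fun x => M.pre x t.2.1 t.2.2 ≤ (1 / 2) ^ (m + j)), ((1 / 2 : ℝ)) ^ (m + j))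
          ≤ (2 * M.P * (1 / 2) ^ m) * (1 / 2) ^ j := by
          intro j _
          rw [sum_const, nsmul_eq_mul, show 2 * (M.P : ℝ) * (1 / 2) ^ m * (1 / 2) ^ j =
            2 * M.P * (1 / 2) ^ (m + j) by ring]
          gcongr
          have h3 := card_filter_le
            (B t.1 t.2.1 (e t - (j + 1) * M.D) ∪ B t.1 t.2.2 (e t - (j + 1) * M.D))
            (fun x => M.pre x t.2.1 t.2.2 ≤ (1 / 2) ^ (m + j))
          have h4 := card_union_le (B t.1 t.2.1 (e t - (j + 1) * M.D))
            (B t.1 t.2.2 (e t - (j + 1) * M.D))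
          have h5 := hB1 t.1 t.2.1 (e t - (j + 1) * M.D)
          have h6 := hB1 t.1 t.2.2 (e t - (j + 1) * M.D)
          have h7 := h3.trans (h4.trans (by omega : _ ≤ 2 * M.P))
          exact_mod_cast h7
        refine (Finset.sum_le_sum h2).trans ?_
        rw [← mul_sum]
        have h3 := sum_geometric_two_le (e t + 1)
        have h4 : (0 : ℝ) ≤ 2 * M.P * (1 / 2) ^ m := by positivity
        nlinarith
      refine (Finset.sum_le_sum h1).trans_lt ?_
      rw [sum_const, nsmul_eq_mul]
      have h3 : ((Q * M.P : ℕ) : ℝ) < 2 ^ (Q * M.P) := by exact_mod_cast Nat.lt_two_pow_self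
      have h4 : (Tr.card : ℝ) * (4 * M.P * (1 / 2) ^ m) ≤ Q * (4 * M.P * (1 / 2) ^ m) := by
        gcongr
      refine h4.trans_lt ?_
      rw [hm, pow_add, one_div_pow, one_div_pow, one_div_pow]
      push_cast at h3
      have h5 : (0 : ℝ) < 2 ^ (Q * M.P) := by simp
      rw [show (Q : ℝ) * (4 * M.P * (1 / 2 ^ (Q * M.P) * (1 / 2 ^ 20))) =
        (Q * M.P) / 2 ^ (Q * M.P) * (1 / 2 ^ 18) by ring]
      have h6 : (Q * M.P : ℝ) / 2 ^ (Q * M.P) < 1 := (div_lt_one h5).2 h3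
      linarith)
  refine ⟨T, hT1, hT2, ?_⟩
  have hT4 : T ≤ 1 := hT2.trans (by norm_num)
  intro t ht x hx
  have hD := M.D_pos
  obtain ⟨E, hE⟩ : ∃ E, E = e t := ⟨_, rfl⟩
  obtain ⟨mD, hmD⟩ : ∃ mD, mD = m * M.D := ⟨_, rfl⟩
  rw [← hm] at hx
  have hEv : E = (M.d t.1 t.2.1 + M.d t.1 t.2.2 - M.d t.2.1 t.2.2) / 2 - mD := by
    rw [hE, he, hmD]
  obtain ⟨j, hj⟩ : ∃ j, j = (E - M.d t.1 x) / M.D := ⟨_, rfl⟩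
  have hj1 : j * M.D ≤ E - M.d t.1 x := by rw [hj]; exact Nat.div_mul_le_self _ _
  have hj2 : E - M.d t.1 x < (j + 1) * M.D := by
    rw [hj, mul_comm]; exact Nat.lt_mul_div_succ _ hD
  have hj3 : (j + 1) * M.D = j * M.D + M.D := by ring
  have hjE : j ≤ E := by
    have : j * 1 ≤ j * M.D := Nat.mul_le_mul_left _ hD
    omega
  have hpre : M.pre x t.2.1 t.2.2 ≤ (1 / 2) ^ (m + j) := by
    apply M.pre_le_of
    have := M.d_tri t.1 x t.2.1
    have := M.d_tri t.1 x t.2.2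
    grind
  have key : ∀ y, (y = t.2.1 ∨ y = t.2.2) → x ∈ M.cyl T t.1 y →
      x ∈ B t.1 y (E - (j + 1) * M.D) := by
    intro y _ hxy
    obtain ⟨g', h', h1, h2, h3⟩ := (M.tau_lt hT4).1 hxy
    exact hB2 _ _ _ h1 (M.near_of_rho (h2.trans_le hT2)) (M.near_of_rho (h3.trans_le hT2))
      (by omega) (by omega)
  by_cases hmem : x ∈ B t.1 t.2.1 (E - (j + 1) * M.D) ∪ B t.1 t.2.2 (E - (j + 1) * M.D)
  · refine hT3 ⟨t, j, x⟩ ?_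
    grind
  grind

end Geom

end

lemma eq_of_pairwise_lt {β : Type*} {f : β → ℕ} {l l' : List β}
    (h : l.Pairwise (f · < f ·)) (h' : l'.Pairwise (f · < f ·)) (hm : ∀ x, x ∈ l ↔ x ∈ l') :
    l = l' := by
  have hn : ∀ {l : List β}, l.Pairwise (f · < f ·) → l.Nodup := fun h =>
    h.imp fun hab he => by grind
  have hp : l.Perm l' := (perm_ext_iff_of_nodup (hn h) (hn h')).2 hm
  exact hp.eq_of_pairwise (fun a b _ _ h1 h2 => absurd h1 (by omega)) h h'

lemma exists_sorted {β : Type*} [DecidableEq β] (s : Finset β) (f : β → ℕ)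
    (hf : ∀ x ∈ s, ∀ y ∈ s, f x = f y → x = y) :
    ∃ l : List β, l.Pairwise (f · < f ·) ∧ ∀ x, x ∈ l ↔ x ∈ s := by
  induction s using strongInduction with
  | _ s ih =>
    rcases s.eq_empty_or_nonempty with rfl | hne
    · exact ⟨[], List.Pairwise.nil, by simp⟩
    · obtain ⟨m, hm, hmin⟩ := s.exists_min_image f hne
      obtain ⟨l, hl, hl'⟩ := ih (s.erase m) (erase_ssubset hm) (fun x hx y hy =>
        hf x (Finset.mem_of_mem_erase hx) y (Finset.mem_of_mem_erase hy))
      refine ⟨m :: l, List.pairwise_cons.2 ⟨fun x hx => ?_, hl⟩, fun x => ?_⟩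
      · grind
      grind

lemma filter_append_filter {β : Type*} (f : β → ℕ) (n : ℕ) {l : List β}
    (h : l.Pairwise (f · < f ·)) :
    l = l.filter (f · ≤ n) ++ l.filter (n < f ·) := by
  induction l with
  | nil => rfl
  | cons a l ih =>
    rw [List.pairwise_cons] at h
    by_cases ha : f a ≤ n
    · grind
    · have h1 : l.filter (f · ≤ n) = [] := by
        rw [filter_eq_nil_iff]
        grind
      grind

namespace Geom

variable {G : Type} [Group G] (M : Geom G)

/-- `x` comes well before `y` when seen from `g`. -/
def Ll (g x y : G) : Prop := 4 * M.D ≤ M.d x y ∧ M.d g x < M.d g y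

variable {M} in
lemma Ll.left {g x y : G} (a : G) : M.Ll (a * g) (a * x) (a * y) ↔ M.Ll g x y := by
  simp [Ll, M.d_left]

/-- The points of `S` are near the geodesics from `g` to `h`. -/
def Thin (g h : G) (S : Finset G) : Prop := ∀ x ∈ S, M.d g x + M.d x h ≤ M.d g h + M.D

section
variable {M} {g h : G} {S : Finset G} (hS : M.Thin g h S)
include hS

lemma Thin.symm : M.Thin h g S := fun x hx => by
  have := hS x hx
  rw [M.d_comm h x, M.d_comm x g, M.d_comm h g]; omega

lemma Thin.d_le {x y : G} (hx : x ∈ S) (hy : y ∈ S) (hxy : M.d g x ≤ M.d g y) :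
    M.d x y + M.d g x ≤ M.d g y + 2 * M.D := by
  have h1 := hS x hx
  have h2 := hS y hy
  have h3 := M.four x y g h
  have := M.d_comm g x
  have := M.d_comm g y
  omega

lemma Thin.ll_symm {x y : G} (hx : x ∈ S) (hy : y ∈ S) : M.Ll h y x ↔ M.Ll g x y := by
  have key : ∀ {g h : G}, M.Thin g h S → ∀ {x y : G}, x ∈ S → y ∈ S → M.Ll g x y → M.Ll h y x := by
    intro g h hS x y hx hy ⟨h1, h2⟩
    have h3 := hS.d_le hx hy h2.le
    have h4 := hS y hy
    have h5 := M.d_tri g x h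
    have := M.d_comm h x
    have := M.d_comm h y
    exact ⟨by rw [M.d_comm]; exact h1, by omega⟩
  exact ⟨key hS.symm hy hx, key hS hx hy⟩

lemma Thin.ll_trans {x y z : G} (hx : x ∈ S) (hy : y ∈ S) (h1 : M.Ll g x y)
    (h2 : M.Ll g y z) (hz : z ∈ S) : M.Ll g x z := by
  have h3 := hS.d_le hx hy h1.2.le
  have h4 := hS.d_le hy hz h2.2.le
  have h5 := M.d_tri g x z
  have := h1.1
  have := h2.1
  have := h1.2
  have := h2.2
  exact ⟨by omega, by omega⟩

end

open Classical in
/-- The level of a point of `S` seen from `g`. -/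
noncomputable def lev (g : G) (S : Finset G) (x : G) : ℕ :=
  (S.filter (M.Ll g · x)).card + (S.filter (¬ M.Ll g x ·)).card

open Classical in
noncomputable def level (g : G) (S : Finset G) (n : ℕ) : Finset G := S.filter (M.lev g S · = n)

section
variable {M} {g h : G} {S : Finset G} (hS : M.Thin g h S)
include hS

lemma Thin.lev_symm {x : G} (hx : x ∈ S) : M.lev h S x + M.lev g S x = 2 * S.card := by
  classical
  have h1 : S.filter (M.Ll h · x) = S.filter (M.Ll g x ·) :=
    Finset.filter_congr fun y hy => hS.ll_symm hx hy
  have h2 : S.filter (¬ M.Ll h x ·) = S.filter (¬ M.Ll g · x) :=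
    Finset.filter_congr fun y hy => not_congr (hS.ll_symm hy hx)
  have h3 := card_filter_add_card_filter_not (s := S) (M.Ll g x ·)
  have h4 := card_filter_add_card_filter_not (s := S) (M.Ll g · x)
  unfold lev
  grind

lemma Thin.lev_lt {x y : G} (hx : x ∈ S) (hy : y ∈ S) (hxy : M.Ll g x y) :
    M.lev g S x < M.lev g S y := by
  classical
  apply add_lt_add_of_lt_of_le
  · apply card_lt_card
    rw [ssubset_iff_of_subset]
    · refine ⟨x, Finset.mem_filter.2 ⟨hx, hxy⟩, fun h => ?_⟩
      exact absurd (Finset.mem_filter.1 h).2.2 (lt_irrefl _)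
    · intro z hz
      rw [Finset.mem_filter] at *
      exact ⟨hz.1, hS.ll_trans hz.1 hx hz.2 hxy hy⟩
  · apply card_le_card
    intro z hz
    rw [Finset.mem_filter] at *
    exact ⟨hz.1, fun h => hz.2 (hS.ll_trans hx hy hxy h hz.1)⟩

/-- Points in order of level are in order along the geodesic, up to a bounded error. -/
lemma Thin.d_le_of_lev {x y : G} (hx : x ∈ S) (hy : y ∈ S) (hxy : M.lev g S x ≤ M.lev g S y) :
    M.d x y + M.d g x ≤ M.d g y + 8 * M.D := by
  have h1 : ¬ M.Ll g y x := fun h => absurd (hS.lev_lt hy hx h) (not_lt.2 hxy)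
  by_cases h2 : M.d g x ≤ M.d g y
  · have := hS.d_le hx hy h2; omega
  · have h3 : M.d y x < 4 * M.D := by
      by_contra h3
      exact h1 ⟨by omega, by omega⟩
    have := M.d_tri g y x
    have := M.d_comm x y
    omega

end

lemma lev_left (a g : G) (S T : Finset G) (x : G) (hT : ∀ y, a * y ∈ T ↔ y ∈ S) :
    M.lev (a * g) T (a * x) = M.lev g S x := by
  classical
  unfold lev
  congr 1
  · symm
    refine card_bij (fun y _ => a * y) ?_ ?_ ?_
    · intro y hy; rw [Finset.mem_filter] at *; exact ⟨(hT y).2 hy.1, (Ll.left a).2 hy.2⟩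
    · simp_all
    · intro z hz
      refine ⟨a⁻¹ * z, ?_, by simp⟩
      rw [Finset.mem_filter] at *
      refine ⟨(hT _).1 (by simp_all), (Ll.left a).1 (by simp_all)⟩
  · symm
    refine card_bij (fun y _ => a * y) ?_ ?_ ?_
    · intro y hy; rw [Finset.mem_filter] at *
      exact ⟨(hT y).2 hy.1, fun h => hy.2 ((Ll.left a).1 h)⟩
    · simp_all
    · intro z hz
      refine ⟨a⁻¹ * z, ?_, by simp⟩
      rw [Finset.mem_filter] at *
      refine ⟨(hT _).1 (by simp_all), fun h => hz.2 ?_⟩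
      have := (Ll.left a).2 h
      simp_all

/-- An equivariant choice of an element in every nonempty finite set. -/
structure Cen (G : Type) [Group G] where
  cen : Finset G → G
  mem : ∀ {s}, s.Nonempty → cen s ∈ s
  left : ∀ (a : G) {s t : Finset G}, s.Nonempty → (∀ y, a * y ∈ t ↔ y ∈ s) → cen t = a * cen s

variable (c : Cen G)

/-- The centres of the levels of `S`. -/
def IsPath (g : G) (S : Finset G) (l : List G) : Prop :=
  l.Pairwise (M.lev g S · < M.lev g S ·) ∧
    ∀ x, x ∈ l ↔ x ∈ S ∧ x = c.cen (M.level g S (M.lev g S x))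

lemma exists_isPath (g : G) (S : Finset G) : ∃ l, M.IsPath c g S l := by
  classical
  obtain ⟨l, hl, hl'⟩ := exists_sorted (S.filter fun x => x = c.cen (M.level g S (M.lev g S x)))
    (M.lev g S) (by
      grind)
  exact ⟨l, hl, fun x => by grind⟩

noncomputable def path (g : G) (S : Finset G) : List G := (M.exists_isPath c g S).choose

lemma isPath (g : G) (S : Finset G) : M.IsPath c g S (M.path c g S) :=
  (M.exists_isPath c g S).choose_spec

variable {M c}

lemma IsPath.unique {g : G} {S : Finset G} {l l' : List G} (h : M.IsPath c g S l)
    (h' : M.IsPath c g S l') : l = l' :=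
  eq_of_pairwise_lt h.1 h'.1 fun x => by rw [h.2, h'.2]

lemma IsPath.complete {g : G} {S : Finset G} {l : List G} (h : M.IsPath c g S l) {x : G}
    (hx : x ∈ S) : ∃ y ∈ l, M.lev g S y = M.lev g S x := by
  classical
  have hne : (M.level g S (M.lev g S x)).Nonempty := ⟨x, Finset.mem_filter.2 ⟨hx, rfl⟩⟩
  have h1 := c.mem hne
  have h2 := Finset.mem_filter.1 h1
  exact ⟨_, (h.2 _).2 ⟨h2.1, by rw [h2.2]⟩, h2.2⟩

lemma path_left (a g : G) {S T : Finset G} (hT : ∀ y, a * y ∈ T ↔ y ∈ S) :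
    M.path c (a * g) T = (M.path c g S).map (a * ·) := by
  classical
  refine (M.isPath c (a * g) T).unique ⟨?_, fun x => ?_⟩
  · rw [pairwise_map]
    refine (M.isPath c g S).1.imp fun {x y} h => ?_
    rwa [M.lev_left a g S T _ hT, M.lev_left a g S T _ hT]
  · have hlev : ∀ x ∈ S, c.cen (M.level (a * g) T (M.lev g S x)) =
        a * c.cen (M.level g S (M.lev g S x)) := by
      intro x hx
      refine c.left a ⟨x, Finset.mem_filter.2 ⟨hx, rfl⟩⟩ fun y => ?_
      unfold level
      rw [Finset.mem_filter, Finset.mem_filter, hT, M.lev_left a g S T _ hT]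
    rw [List.mem_map]
    constructor
    · rintro ⟨y, hy, rfl⟩
      have h1 := ((M.isPath c g S).2 y).1 hy
      refine ⟨(hT y).2 h1.1, ?_⟩
      rw [M.lev_left a g S T _ hT, hlev y h1.1, ← h1.2]
    · rintro ⟨h1, h2⟩
      have hx : a * (a⁻¹ * x) = x := by simp
      rw [← hx, hT] at h1
      refine ⟨a⁻¹ * x, ((M.isPath c g S).2 _).2 ⟨h1, ?_⟩, hx⟩
      rw [← hx, M.lev_left a g S T _ hT, hlev _ h1] at h2
      exact mul_left_cancel h2

lemma Thin.path_symm {g h : G} {S : Finset G} (hS : M.Thin g h S) :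
    M.path c h S = (M.path c g S).reverse := by
  classical
  refine (M.isPath c h S).unique ⟨?_, fun x => ?_⟩
  · rw [pairwise_reverse]
    refine List.Pairwise.imp_of_mem ?_ (M.isPath c g S).1
    intro x y hx hy hxy
    have h1 := hS.lev_symm (((M.isPath c g S).2 _).1 hx).1
    have h2 := hS.lev_symm (((M.isPath c g S).2 _).1 hy).1
    omega
  · rw [mem_reverse, (M.isPath c g S).2]
    refine and_congr_right fun hx => ?_
    have : M.level h S (M.lev h S x) = M.level g S (M.lev g S x) := by
      refine Finset.filter_congr fun y hy => ?_
      have := hS.lev_symm hx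
      have := hS.lev_symm hy
      omega
    rw [this]

end Geom

namespace Geom

variable {G : Type} [Group G] {M : Geom G} {c : Cen G}

/-- No point of `S` lies strictly between two consecutive centres. -/
lemma Thin.not_between {g h : G} {S : Finset G} (hS : M.Thin g h S) {l1 l2 : List G}
    (hl : M.path c g S = l1 ++ l2) {x : G} (hx : x ∈ S)
    (h1 : ∀ l p, l1 = l ++ [p] → M.Ll g p x) (h2 : ∀ q l, l2 = q :: l → M.Ll g x q) : False := by
  have hp := M.isPath c g S
  rw [hl] at hp
  obtain ⟨y, hy, hyx⟩ := hp.complete hx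
  have hpw := pairwise_append.1 hp.1
  rcases mem_append.1 hy with h | h
  · rcases eq_nil_or_concat l1 with rfl | ⟨l, p, rfl⟩
    · simp at h
    · rw [concat_eq_append] at *
      have hpS := ((hp.2 p).1 (by simp)).1
      have h3 := hS.lev_lt hpS hx (h1 _ _ rfl)
      grind
  · cases l2 with
    | nil => simp at h
    | cons q l =>
      have hqS := ((hp.2 q).1 (by simp)).1
      have h3 := hS.lev_lt hx hqS (h2 _ _ rfl)
      rcases List.mem_cons.1 h with rfl | h
      · omega
      · have := (List.pairwise_cons.1 hpw.2.1).1 y h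
        omega

section agree

variable {g : G} {S T : Finset G} {t : ℕ}

lemma lev_le_of_agree (hST : ∀ x, M.d g x ≤ t → x ∈ S → x ∈ T) {x : G}
    (hx : M.d g x + 4 * M.D ≤ t) (hTS : ∀ x, M.d g x ≤ t → x ∈ T → x ∈ S) :
    M.lev g S x = M.lev g T x := by
  classical
  unfold lev
  congr 2
  · ext y
    rw [Finset.mem_filter, Finset.mem_filter]
    refine and_congr_left fun hy => ?_
    have : M.d g y ≤ t := by have := hy.2; omega
    grind
  · ext y
    rw [Finset.mem_filter, Finset.mem_filter]
    refine and_congr_left fun hy => ?_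
    have : M.d g y ≤ t := by
      by_contra hc
      have := M.d_tri g x y
      exact hy ⟨by omega, by omega⟩
    grind

lemma level_subset_of_agree {h : G} (hS : M.Thin g h S)
    (hST : ∀ x, M.d g x ≤ t → x ∈ S → x ∈ T) (hTS : ∀ x, M.d g x ≤ t → x ∈ T → x ∈ S)
    {z : G} (hz : z ∈ S) (hzt : M.d g z + 12 * M.D ≤ t) {x : G} (hx : x ∈ S)
    (hxz : M.lev g S x ≤ M.lev g S z) :
    M.d g x + 8 * M.D ≤ t ∧ x ∈ T ∧ M.lev g T x = M.lev g S x := by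
  have h1 : M.d g x + 8 * M.D ≤ t := by
    by_contra hc
    have := M.d_tri g z x
    have : M.Ll g z x := ⟨by omega, by omega⟩
    have := hS.lev_lt hz hx this
    omega
  refine ⟨h1, hST _ (by omega) hx, (lev_le_of_agree hST (by omega) hTS).symm⟩

lemma filter_path_of_agree {h k : G} (hS : M.Thin g h S) (hT : M.Thin g k T)
    (hST : ∀ x, M.d g x ≤ t → x ∈ S → x ∈ T) (hTS : ∀ x, M.d g x ≤ t → x ∈ T → x ∈ S)
    {z : G} (hz : z ∈ S) (hzt : M.d g z + 12 * M.D ≤ t) :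
    (M.path c g S).filter (M.lev g S · ≤ M.lev g S z) =
      (M.path c g T).filter (M.lev g T · ≤ M.lev g S z) := by
  classical
  have hzT : z ∈ T := hST _ (by omega) hz
  have hlz : M.lev g S z = M.lev g T z := lev_le_of_agree hST (by omega) hTS
  have e1 : ∀ {x}, x ∈ S → M.lev g S x ≤ M.lev g S z →
      M.d g x + 8 * M.D ≤ t ∧ x ∈ T ∧ M.lev g T x = M.lev g S x :=
    fun hx => level_subset_of_agree hS hST hTS hz hzt hx
  have e2 : ∀ {x}, x ∈ T → M.lev g T x ≤ M.lev g S z →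
      M.d g x + 8 * M.D ≤ t ∧ x ∈ S ∧ M.lev g S x = M.lev g T x := fun hx h =>
    level_subset_of_agree hT hTS hST hzT hzt hx (by omega)
  have e3 : ∀ n ≤ M.lev g S z, M.level g S n = M.level g T n := by
    intro n hn
    ext x
    simp only [level, Finset.mem_filter]
    grind
  have p1 := M.isPath c g S
  have p2 := M.isPath c g T
  refine eq_of_pairwise_lt (f := M.lev g S) (p1.1.filter _) ?_ fun x => ?_
  · refine List.Pairwise.imp_of_mem ?_ (p2.1.filter _)
    intro x y hx hy hxy
    rw [List.mem_filter, p2.2, decide_eq_true_iff] at hx hy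
    grind
  · rw [List.mem_filter, List.mem_filter, p1.2, p2.2, decide_eq_true_iff, decide_eq_true_iff]
    grind

lemma path_agree {h k : G} (hS : M.Thin g h S) (hT : M.Thin g k T)
    (hST : ∀ x, M.d g x ≤ t → (x ∈ S ↔ x ∈ T)) :
    ∃ l s s', M.path c g S = l ++ s ∧ M.path c g T = l ++ s' ∧
      (∀ p ∈ l, M.d g p + 8 * M.D ≤ t) ∧ (∀ q ∈ s, t < M.d g q + 12 * M.D) ∧
      (∀ q ∈ s', t < M.d g q + 12 * M.D) := by
  classical
  have h1 : ∀ x, M.d g x ≤ t → x ∈ S → x ∈ T := fun x hx => (hST x hx).1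
  have h2 : ∀ x, M.d g x ≤ t → x ∈ T → x ∈ S := fun x hx => (hST x hx).2
  have p1 := M.isPath c g S
  have p2 := M.isPath c g T
  rcases (S.filter fun x => M.d g x + 12 * M.D ≤ t).eq_empty_or_nonempty with he | hne
  · have he' : ∀ x ∈ S, t < M.d g x + 12 * M.D := by
      simp_all
    refine ⟨[], M.path c g S, M.path c g T, rfl, rfl, by simp, fun q hq => ?_, fun q hq => ?_⟩
    · exact he' q ((p1.2 q).1 hq).1
    · by_contra hc
      exact hc (he' q (h2 q (by omega) ((p2.2 q).1 hq).1))
  · obtain ⟨z, hz, hmax⟩ := exists_max_image _ (M.lev g S) hne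
    obtain ⟨hzS, hzt⟩ := Finset.mem_filter.1 hz
    have e := filter_path_of_agree (c := c) hS hT h1 h2 hzS hzt
    refine ⟨_, _, (M.path c g T).filter (M.lev g S z < M.lev g T ·),
      filter_append_filter _ (M.lev g S z) p1.1, ?_, ?_, ?_, ?_⟩
    · rw [e]; exact filter_append_filter _ (M.lev g S z) p2.1
    · intro p hp
      rw [List.mem_filter, p1.2, decide_eq_true_iff] at hp
      exact (level_subset_of_agree hS h1 h2 hzS hzt hp.1.1 hp.2).1
    · intro q hq
      rw [List.mem_filter, p1.2, decide_eq_true_iff] at hq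
      grind
    · intro q hq
      rw [List.mem_filter, p2.2, decide_eq_true_iff] at hq
      by_contra hc
      have hqS := h2 q (by omega) hq.1.1
      have := hmax q (Finset.mem_filter.2 ⟨hqS, by omega⟩)
      have := lev_le_of_agree h1 (x := q) (by omega) h2
      omega

end agree

end Geom

section

variable {C : SC α}

lemma take_invRev (p : Word α) (k : ℕ) :
    (invRev p).take k = invRev (p.drop (p.length - k)) := by
  simp [invRev, take_reverse, map_drop]

lemma drop_invRev (p : Word α) (k : ℕ) :
    (invRev p).drop k = invRev (p.take (p.length - k)) := by
  simp [invRev, drop_reverse, map_take]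

lemma SC.letter_inj {l m : α × Bool} (h : C.ev [l] = C.ev [m]) : l = m := by
  by_contra hne
  have hred : IsReduced [linv l, m] := by
    rw [isReduced_cons_cons', linv_linv]
    exact ⟨fun h => hne h.symm, by simp⟩
  obtain ⟨s, t, h1, h2, h3⟩ := SC.exists_of_ev_eq_one hred (by simp) (by
    have : [linv l, m] = invRev [l] ++ [m] := by rw [invRev_cons']; simp
    rw [this, C.ev_append, C.ev_invRev, h, inv_mul_cancel])
  have h4 := h2.length_le
  have h5 := C.len h1
  grind

/-- Two geodesics with the same origin and a large Gromov product of the endpoints pass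
through the same vertices, except near a cell. -/
lemma SC.gap_fellow {L : ℕ} (hL : ∀ r ∈ C.R, r.length ≤ L) {e e' : Word α}
    (he : C.Geo e) (he' : C.Geo e') {i : ℕ}
    (hi : 2 * (i + 30 * L + 10) + C.dst (C.ev e) (C.ev e') ≤ e.length + e'.length) :
    C.ev (e.take i) = C.ev (e'.take i) ∨ ∃ Z, (Z = e ∨ Z = e') ∧
      ∃ d p d' q, Z = d ++ p ++ d' ∧ p ++ q ∈ C.R ∧ 3 * C.pi (p ++ q) ≤ p.length ∧
        C.dst (C.ev d) (C.ev (e'.take i)) ≤ L := by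
  have n1 : ∀ {p}, C.Geo p → ∀ {j}, j ≤ p.length → C.nm (C.ev (p.take j)) = j := by
    intro p hp j hj
    rw [(hp.infix (take_prefix _ _).isInfix).nm, length_take, min_eq_left hj]
  have n2 : ∀ x, C.dst 1 x = C.nm x := fun x => by simp [SC.dst]
  obtain ⟨m, hm⟩ : ∃ m, m = i + 30 * L + 10 := ⟨_, rfl⟩
  have hq : e.length ≤ e'.length + C.dst (C.ev e) (C.ev e') := by
    have := C.dst_triangle 1 (C.ev e') (C.ev e)
    rw [n2, n2, he.nm, he'.nm, C.dst_comm] at this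
    exact this
  have hq' : e'.length ≤ e.length + C.dst (C.ev e) (C.ev e') := by
    have := C.dst_triangle 1 (C.ev e) (C.ev e')
    rw [n2, n2, he.nm, he'.nm] at this
    exact this
  have hme : m ≤ e.length := by omega
  have hme' : m ≤ e'.length := by omega
  obtain ⟨x, hx⟩ : ∃ x, x = C.ev (e'.take m) := ⟨_, rfl⟩
  have hxn : C.dst 1 x = m := by grind
  have hclose : C.dst x (C.ev (e.take m)) ≤ 24 * L + 8 := by
    have f1 := SC.four_point hL 1 (C.ev e) (C.ev (e.take m)) x
    have f2 := SC.four_point hL 1 (C.ev e') x (C.ev e)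
    have d1 : C.dst (C.ev (e.take m)) (C.ev e) = e.length - m := by
      have := he.dst_take 1 hme le_rfl
      rwa [take_length, one_mul, one_mul] at this
    have d2 : C.dst x (C.ev e') = e'.length - m := by
      have := he'.dst_take 1 hme' le_rfl
      rwa [take_length, one_mul, one_mul, ← hx] at this
    have d3 : C.dst 1 (C.ev e) = e.length := by rw [n2, he.nm]
    have d4 : C.dst 1 (C.ev e') = e'.length := by rw [n2, he'.nm]
    have d5 : C.dst 1 (C.ev (e.take m)) = m := by rw [n2, n1 he hme]
    have := C.dst_comm (C.ev e') x
    have := C.dst_comm (C.ev e) x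
    have := C.dst_comm (C.ev e) (C.ev e')
    have := C.dst_comm (C.ev e) (C.ev (e.take m))
    have := C.dst_comm x (C.ev (e.take m))
    omega
  obtain ⟨j, hj, hjmin⟩ := exists_min_image (Finset.range (e.length + 1))
    (fun j => C.dst x (C.ev (e.take j))) ⟨0, by simp⟩
  rw [Finset.mem_range] at hj
  have hjmin' : ∀ k ≤ e.length, C.dst x (C.ev (e.take j)) ≤ C.dst x (C.ev (e.take k)) :=
    fun k hk => hjmin k (Finset.mem_range.2 (by omega))
  obtain ⟨a, ha, hae, hal⟩ := C.exists_geo_nm (x⁻¹ * C.ev (e.take j))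
  change a.length = C.dst x (C.ev (e.take j)) at hal
  have hal' : a.length ≤ 24 * L + 8 := by have := hjmin' m hme; omega
  have hjd : m ≤ j + a.length := by
    have := C.dst_triangle 1 (C.ev (e.take j)) x
    rw [n2 (C.ev (e.take j)), n1 he (by omega)] at this
    have := C.dst_comm (C.ev (e.take j)) x
    omega
  have hgj : C.Geo (e.take j) := he.infix (take_prefix _ _).isInfix
  have hlj : (e.take j).length = j := by rw [length_take]; omega
  have hlv : (invRev (e.take j)).length = j := by rw [invRev_length, hlj]
  obtain ⟨a1, t, b, h1, h2, h3, h4, -, h6, h7, h8⟩ := SC.exists_corner (N := j)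
    (v := invRev (e.take j)) hL ha hgj.invRev.red hgj.invRev.Q (by omega) hlv.ge
    (hgj.invRev.infix (take_prefix _ _).isInfix) (by
      intro k hk
      have e1 : C.ev a * C.ev ((invRev (e.take j)).take k) = x⁻¹ * C.ev (e.take (j - k)) := by
        rw [take_invRev, C.ev_invRev, hae, hlj, mul_assoc]
        congr 1
        rw [mul_inv_eq_iff_eq_mul, ← C.ev_append]
        conv_lhs => rw [← take_append_drop (j - k) (e.take j)]
        rw [take_take, min_eq_left (by omega)]
      rw [e1, hal]
      exact hjmin' _ (by omega))
  rw [drop_invRev, hlj, take_take, min_eq_left (by omega)] at h6 h7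
  obtain ⟨c, hc⟩ : ∃ c, c = invRev (a1 ++ t) := ⟨_, rfl⟩
  have hYinv : invRev (a1 ++ (t ++ invRev (e.take (j - b)))) = e.take (j - b) ++ c := by
    rw [hc, ← append_assoc, invRev_append, FreeGroup.invRev_invRev]
  have hYr : IsReduced (e.take (j - b) ++ c) := hYinv ▸ isReduced_invRev h6
  have hYQ : C.Q (e.take (j - b) ++ c) := hYinv ▸ h7.invRev
  have hcl : c.length ≤ a.length + L := by
    rw [hc, invRev_length, length_append]
    have := h1.length_le
    omega
  have hYe : C.ev (e.take (j - b) ++ c) = C.ev (e'.take m) := by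
    rw [← hx, hc, C.ev_append, C.ev_invRev, h8, hae, take_invRev, C.ev_invRev, hlj]
    have : C.ev (e.take j) = C.ev (e.take (j - b)) * C.ev ((e.take j).drop (j - b)) := by
      rw [← C.ev_append]
      conv_lhs => rw [← take_append_drop (j - b) (e.take j)]
      rw [take_take, min_eq_left (by omega)]
    rw [this]; group
  have hlt : (e.take (j - b)).length = j - b := by rw [length_take]; omega
  have hfar : ∀ k, j - b ≤ k → m ≤ C.nm (C.ev ((e.take (j - b) ++ c).take k)) + a.length + L := by
    intro k hk
    have f1 := C.dst_take_le 1 (e.take (j - b) ++ c) (show k ≤ k + c.length by omega)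
    rw [one_mul, one_mul, take_of_length_le (i := k + c.length)
      (by rw [length_append, hlt]; omega), hYe, ← hx] at f1
    have f2 := C.dst_triangle 1 (C.ev ((e.take (j - b) ++ c).take k)) x
    rw [n2 (C.ev _)] at f2
    omega
  have hγg : C.Geo (e'.take m) := he'.infix (take_prefix _ _).isInfix
  have hnear : ∀ k ≤ j - b, C.nm (C.ev ((e.take (j - b) ++ c).take k)) = k := by
    grind
  have hi' : C.nm (C.ev (e'.take i)) = i := n1 he' (by omega)
  have hsplit : e'.take m = e'.take i ++ (e'.take m).drop i := by
    conv_lhs => rw [← take_append_drop i (e'.take m)]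
    rw [take_take, min_eq_left (by omega)]
  rcases SC.gap_near hL hYr hYQ hγg hYe hsplit with ⟨k, hk, hke⟩ | ⟨Z, hZ, d, p, d', q, hd, hr, hp, hdi⟩
  · left
    by_cases hkj : k ≤ j - b
    · grind
    grind
  · right
    rcases hZ with rfl | rfl
    · refine ⟨e', Or.inr rfl, d, p, d' ++ e'.drop m, q, ?_, hr, hp, hdi⟩
      rw [← append_assoc, ← hd, take_append_drop]
    · have hdle : d.length + p.length ≤ j - b := by
        have hpL : p.length ≤ L := by
          have := hL _ hr
          rw [length_append] at this; omega
        have hdt : C.ev d = C.ev ((e.take (j - b) ++ c).take d.length) := by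
          rw [hd, append_assoc, take_left]
        have f1 := C.dst_triangle 1 (C.ev (e'.take i)) (C.ev d)
        rw [n2, n2, hi'] at f1
        have := C.dst_comm (C.ev (e'.take i)) (C.ev d)
        by_cases hdj : d.length ≤ j - b
        · grind
        grind
      have e1 : d ++ p = e.take (d.length + p.length) := by
        have := congrArg (take (d.length + p.length)) hd
        rw [take_append_of_le_length (by omega), take_take, min_eq_left hdle,
          take_left' (by simp)] at this
        exact this.symm
      refine ⟨e, Or.inl rfl, d, p, e.drop (d.length + p.length), q, ?_, hr, hp, hdi⟩
      rw [e1, take_append_drop]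

end

section

variable {C : SC α}

lemma flatten_replicate_comm {β : Type*} (u v : List β) (p : ℕ) :
    (replicate p (v ++ u)).flatten ++ v = v ++ (replicate p (u ++ v)).flatten := by
  induction p with
  | zero => simp
  | succ p ih => grind

/-- A factor of a power of `u` is a prefix of a power of a rotation of `u`. -/
lemma exists_rotation_of_prefix {β : Type*} {u s : List β} {p : ℕ} (hu : u ≠ [])
    (h : s <:+: (replicate p u).flatten) :
    ∃ u1 u2, u = u1 ++ u2 ∧ s <+: (replicate p (u2 ++ u1)).flatten := by
  obtain ⟨a, b, h⟩ := h
  induction p generalizing a with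
  | zero =>
    simp only [replicate_zero, flatten_nil, append_eq_nil_iff] at h
    exact ⟨[], u, rfl, by grind⟩
  | succ p ih =>
    by_cases ha : u.length ≤ a.length
    · obtain ⟨a', rfl⟩ : u <+: a := by
        refine prefix_of_prefix_length_le ?_ ⟨s ++ b, by rw [← append_assoc, h]⟩ ha
        grind
      rw [replicate_succ, flatten_cons] at h
      obtain ⟨u1, u2, h1, h2⟩ := ih a' (by simpa using h)
      refine ⟨u1, u2, h1, h2.trans ?_⟩
      rw [replicate_succ', flatten_concat]
      grind
    · obtain ⟨u2, rfl⟩ : a <+: u := by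
        refine prefix_of_prefix_length_le ⟨s ++ b, by rw [← append_assoc, h]⟩ ?_ (by omega)
        grind
      refine ⟨a, u2, rfl, ?_⟩
      rw [replicate_succ, flatten_cons, append_assoc, append_assoc,
        append_cancel_left_eq, ← flatten_replicate_comm] at h
      rw [replicate_succ', flatten_concat]
      grind

/-- Words of minimal length in their conjugacy class. -/
def SC.Cyc (C : SC α) (u : Word α) : Prop :=
  ∀ g w, C.ev w = g * C.ev u * g⁻¹ → u.length ≤ w.length

lemma SC.Cyc.rot {u v : Word α} (h : C.Cyc (u ++ v)) : C.Cyc (v ++ u) := by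
  intro g w hw
  have := h (g * (C.ev u)⁻¹) w (by rw [hw, C.ev_append, C.ev_append]; group)
  simpa [add_comm] using this

lemma SC.Cyc.geo {u : Word α} (h : C.Cyc u) : C.Geo u := fun w hw =>
  h 1 w (by simp_all)

lemma SC.Cyc.red {u : Word α} (h : C.Cyc u) : IsCyclicallyReduced u := by
  refine ⟨h.geo.red, fun a ha b hb h1 => ?_⟩
  by_contra h2
  obtain ⟨p, rfl⟩ := getLast?_eq_some_iff.1 ha
  obtain ⟨q, hq⟩ := head?_eq_some_iff.1 hb
  have h3 : a = linv b := by
    rcases a with ⟨a1, a2⟩; rcases b with ⟨b1, b2⟩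
    simp only [linv, Prod.mk.injEq] at *
    exact ⟨h1, by cases a2 <;> cases b2 <;> simp_all⟩
  rcases p with _ | ⟨b', p⟩
  · grind
  · simp only [cons_append, List.cons.injEq] at hq
    obtain ⟨rfl, rfl⟩ := hq
    have h4 := (SC.Cyc.rot (u := b' :: p) h).geo.red
    simp_all

lemma SC.pow_eq_one {x : C.Grp} {p : ℕ} (hp : p ≠ 0) (hx : x ^ p = 1) : x = 1 := by
  classical
  have hex : ∃ n, ∃ g u, C.ev u = g * x * g⁻¹ ∧ u.length = n := by
    obtain ⟨u, -, hu⟩ := C.exists_geo x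
    exact ⟨_, 1, u, by simpa using hu, rfl⟩
  obtain ⟨g, u, hu, hn⟩ := Nat.find_spec hex
  have hmin : C.Cyc u := by
    intro a w hw
    rw [hn]
    exact Nat.find_min' hex ⟨a * g, w, by rw [hw, hu]; group, rfl⟩
  have hne : u = [] := by
    by_contra hne
    have hev : ∀ k, C.ev (replicate k u).flatten = C.ev u ^ k := by
      intro k
      induction k with
      | zero => simp
      | succ k ih => rw [replicate_succ, flatten_cons, C.ev_append, ih, pow_succ']
    obtain ⟨s, t, hr, hs, hl⟩ := SC.exists_of_ev_eq_one (hmin.red.flatten_replicate p).isReduced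
      (by
        simp_all)
      (by rw [hev, hu, conj_pow, hx]; group)
    obtain ⟨u1, u2, rfl, hs'⟩ := exists_rotation_of_prefix hne hs
    obtain ⟨v, hv⟩ : ∃ v, v = u2 ++ u1 := ⟨_, rfl⟩
    have hvc : C.Cyc v := hv ▸ hmin.rot
    have hvne : v ≠ [] := by rw [hv]; simpa [and_comm] using hne
    rw [← hv] at hs'
    obtain ⟨k, rfl⟩ := Nat.exists_eq_succ_of_ne_zero hp
    have hlen := C.len hr
    have hvp : v <+: (replicate (k + 1) v).flatten := by
      grind
    rcases le_total s.length v.length with hsv | hsv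
    · have h1 := prefix_of_prefix_length_le hs' hvp hsv
      have h2 := hvc.geo.rel h1.isInfix hr
      omega
    · obtain ⟨s', rfl⟩ := prefix_of_prefix_length_le hvp hs' hsv
      have h1 : s' <+: v ++ s' := by
        refine prefix_of_prefix_length_le (l₃ := (replicate (k + 1) v).flatten) ?_ hs'
          (by simp)
        rw [replicate_succ, flatten_cons, prefix_append_right_inj] at hs'
        refine hs'.trans ?_
        rw [replicate_succ', flatten_concat]
        exact prefix_append _ _
      have h2 : v ++ (s' ++ t) ∈ C.R := by rwa [← append_assoc]
      have h3 := hvc.geo.rel infix_rfl h2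
      have h4 : C.pi (v ++ s' ++ t) ≤ s'.length := by
        grind
      have h5 := C.eq_of_prefix hr (C.rot h2) (h1.trans (prefix_append _ _))
        (by rw [append_assoc]; exact prefix_append _ _) h4
      have h6 := C.pos hr
      refine C.prim h2 hvne ?_ ?_
      · grind
      · rw [← h5, append_assoc]
  rw [hne, C.ev_nil] at hu
  have : x = g⁻¹ * (g * x * g⁻¹) * g := by group
  rw [this, ← hu]; group

lemma SC.eq_one_of_mul_mem {s : Finset C.Grp} (hs : s.Nonempty) {a : C.Grp}
    (h : ∀ y ∈ s, a * y ∈ s) : a = 1 := by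
  obtain ⟨y, hy⟩ := hs
  have h1 : ∀ n : ℕ, a ^ n * y ∈ s := by
    intro n
    induction n with
    | zero => simpa
    | succ n ih => rw [pow_succ', mul_assoc]; exact h _ ih
  by_contra ha
  have h2 : ¬ IsOfFinOrder a := by
    rw [isOfFinOrder_iff_pow_eq_one]
    rintro ⟨n, h3, h4⟩
    exact ha (SC.pow_eq_one h3.ne' h4)
  rw [← injective_pow_iff_not_isOfFinOrder] at h2
  have h5 : Function.Injective fun n : ℕ => (⟨a ^ n * y, h1 n⟩ : s) := by
    intro m n h6
    simp only [Subtype.mk.injEq, mul_left_inj] at h6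
    exact h2 h6
  exact not_injective_infinite_finite _ h5

/-- Translates of finite sets. -/
def transl (G : Type) [Group G] : Setoid (Finset G) where
  r s t := ∃ a : G, ∀ y, a * y ∈ t ↔ y ∈ s
  iseqv :=
    { refl := fun s => ⟨1, by simp⟩
      symm := by
        rintro s t ⟨a, h⟩
        exact ⟨a⁻¹, fun y => by rw [← h, mul_inv_cancel_left]⟩
      trans := by
        rintro s t u ⟨a, h⟩ ⟨b, h'⟩
        exact ⟨b * a, fun y => by grind⟩ }

/-- Equivariant choice of a point in each finite subset of a torsion-free group. -/
noncomputable def SC.cen (C : SC α) : Geom.Cen C.Grp := by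
  classical
  have hr : ∀ s : Finset C.Grp, ∃ a, ∀ y, a * y ∈ s ↔
      y ∈ (Quotient.mk (transl C.Grp) s).out := fun s =>
    Quotient.exact (Quotient.out_eq (Quotient.mk (transl C.Grp) s))
  have hne : ∀ {s : Finset C.Grp}, s.Nonempty → (Quotient.mk (transl C.Grp) s).out.Nonempty := by
    rintro s ⟨y, hy⟩
    obtain ⟨a, h⟩ := hr s
    exact ⟨a⁻¹ * y, (h _).1 (by simpa)⟩
  let pick : Finset C.Grp → C.Grp := fun t => if h : t.Nonempty then h.choose else 1
  have hpick : ∀ {t}, t.Nonempty → pick t ∈ t := by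
    grind
  refine ⟨fun s => (hr s).choose * pick (Quotient.mk (transl C.Grp) s).out, ?_, ?_⟩
  · grind
  · intro a s t hs hst
    have h1 : Quotient.mk (transl C.Grp) s = Quotient.mk (transl C.Grp) t :=
      Quotient.sound ⟨a, hst⟩
    have h2 := (hr s).choose_spec
    have h3 := (hr t).choose_spec
    obtain ⟨b, hb⟩ : ∃ b, b = (hr s).choose := ⟨_, rfl⟩
    obtain ⟨b', hb'⟩ : ∃ b', b' = (hr t).choose := ⟨_, rfl⟩
    rw [← hb] at h2 ⊢
    rw [← hb'] at h3 ⊢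
    rw [← h1] at h3 ⊢
    have h4 : b'⁻¹ * a * b = 1 := SC.eq_one_of_mul_mem (hne hs) fun y hy => by
      rw [← h3, mul_assoc, mul_assoc, mul_inv_cancel_left, hst, h2]
      exact hy
    rw [← mul_assoc]
    congr 1
    rw [mul_assoc, inv_mul_eq_one] at h4
    exact h4

/-- Geodesic words chosen compatibly with inversion. -/
structure Om (C : SC α) where
  w : C.Grp → Word α
  geo : ∀ a, C.Geo (w a)
  ev : ∀ a, C.ev (w a) = a
  inv : ∀ a, w a⁻¹ = invRev (w a)

lemma SC.exists_om (C : SC α) : Nonempty (Om C) := by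
  classical
  choose f h1 h2 h3 using C.exists_geo_nm
  let S : Setoid C.Grp :=
    { r := fun a b => a = b ∨ a = b⁻¹
      iseqv :=
        { refl := fun a => Or.inl rfl
          symm := by
            rintro a b (rfl | rfl)
            · grind
            simp_all
          trans := by
            rintro a b c (rfl | rfl) (rfl | rfl)
            · grind
            · grind
            · grind
            simp_all } }
  have hS : ∀ a : C.Grp, Quotient.mk S a⁻¹ = Quotient.mk S a := fun a =>
    Quotient.sound (Or.inr rfl)
  have ho : ∀ a : C.Grp, (Quotient.mk S a).out = a ∨ (Quotient.mk S a).out = a⁻¹ := fun a =>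
    Quotient.exact (Quotient.out_eq (Quotient.mk S a))
  refine ⟨⟨fun a => if (Quotient.mk S a).out = a then f a else invRev (f a⁻¹), ?_, ?_, ?_⟩⟩
  · intro a
    split_ifs
    · exact h1 a
    · exact (h1 _).invRev
  · intro a
    split_ifs
    · exact h2 a
    · rw [C.ev_invRev, h2, inv_inv]
  · intro a
    simp only [hS, inv_inv]
    by_cases ha : a = a⁻¹
    · have : a = 1 := SC.pow_eq_one (p := 2) (by simp) (by rw [pow_two]; nth_rewrite 1 [ha]; simp)
      subst this
      have h4 : f 1 = [] := by
        rw [← length_eq_zero_iff, h3, C.nm_one]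
      simp [h4]
    · rcases ho a with h4 | h4
      · grind
      · rw [if_pos h4, if_neg (by grind), FreeGroup.invRev_invRev]

end

section

variable {C : SC α}

lemma eq_nil_of_invRev_eq {u : Word α} (hu : IsReduced u) (h : invRev u = u) : u = [] := by
  by_contra hne
  obtain ⟨v, p, hvp, hp⟩ : ∃ v p : Word α, v.length = p.length ∧
      (u = p ++ v ∨ ∃ l, u = p ++ l :: v) := by
    rcases Nat.even_or_odd' u.length with ⟨k, hk | hk⟩
    · exact ⟨u.drop k, u.take k, by grind, Or.inl (take_append_drop _ _).symm⟩
    · refine ⟨u.drop (k + 1), u.take k, by grind, Or.inr ⟨u[k], ?_⟩⟩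
      simp_all
  rcases hp with rfl | ⟨l, rfl⟩
  · rw [invRev_append] at h
    have h1 := (append_inj h (by simp_all)).1
    rcases v with _ | ⟨m, w⟩
    · grind
    · rw [← h1, invRev_cons'] at hu
      have := not_isReduced_mid (p := invRev w) (l := linv m) (q := w)
      simp_all
  · rw [invRev_append, invRev_cons', append_assoc] at h
    have h1 := (append_inj h (by simp_all)).2
    simp only [singleton_append, List.cons.injEq] at h1
    exact linv_ne l h1.1

lemma Turn.shape {x y : C.Grp} {r s : Word α} (hr : C.ev r = 1)
    (h : Turn C.cay x r y s) : ∃ u v, r = u ++ v ∧ y = x * C.ev u ∧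
      (s = v ++ u ∨ s = invRev u ++ invRev v) := by
  induction h with
  | refl => exact ⟨[], r, rfl, by simp, Or.inl (by simp)⟩
  | @rot y a b h1 z h2 ih =>
    obtain ⟨u, v, rfl, rfl, h3⟩ := ih
    obtain rfl := SC.rd_cay.1 h2
    rw [C.ev_append] at hr
    rcases h3 with h3 | h3
    · rcases append_eq_append_iff.1 h3 with ⟨w, rfl, rfl⟩ | ⟨w, rfl, rfl⟩
      · exact ⟨u ++ a, w, by simp, by rw [C.ev_append, mul_assoc], Or.inl (by simp)⟩
      · refine ⟨w, b ++ v, by simp, ?_, Or.inl (by simp)⟩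
        rw [C.ev_append v w, ← mul_assoc, mul_assoc x, hr, mul_one]
    · rcases append_eq_append_iff.1 h3 with ⟨w, h4, h5⟩ | ⟨w, h4, h5⟩
      · have h6 : u = invRev w ++ invRev a := by
          rw [← FreeGroup.invRev_invRev (L₁ := u), h4, invRev_append]
        refine ⟨invRev w, invRev a ++ v, by rw [h6]; simp, ?_, Or.inr ?_⟩
        · rw [h6, C.ev_append, C.ev_invRev a]; group
        simp_all
      · have h6 : v = invRev b ++ invRev w := by
          rw [← FreeGroup.invRev_invRev (L₁ := v), h5, invRev_append]
        refine ⟨u ++ invRev b, invRev w, by rw [h6]; simp, ?_, Or.inr ?_⟩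
        · rw [h6, C.ev_append] at hr
          rw [h4, C.ev_append, C.ev_append, C.ev_invRev u]
          have : C.ev (invRev b) = (C.ev u)⁻¹ * (C.ev (invRev w))⁻¹ := by
            have h7 : C.ev (invRev b) = (C.ev u)⁻¹ *
              (C.ev u * (C.ev (invRev b) * C.ev (invRev w))) * (C.ev (invRev w))⁻¹ := by group
            rw [h7, hr, mul_one]
          rw [this, C.ev_invRev w]; group
        simp_all
  | inv h1 ih =>
    obtain ⟨u, v, rfl, rfl, h3 | h3⟩ := ih
    · exact ⟨u, v, rfl, rfl, Or.inr (by simp_all)⟩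
    · exact ⟨u, v, rfl, rfl, Or.inl (by simp_all)⟩

lemma Turn.symm {x y : C.Grp} {r s : Word α} (hr : C.ev r = 1)
    (h : Turn C.cay x r y s) : Turn C.cay y s x r := by
  obtain ⟨u, v, rfl, rfl, h3⟩ := h.shape hr
  have h4 : Turn C.cay (x * C.ev u) (v ++ u) x (u ++ v) :=
    (Turn.refl _ _).rot (SC.rd_cay.2 (by
      rw [mul_assoc, ← C.ev_append, hr, mul_one]))
  rcases h3 with rfl | rfl
  · exact h4
  · refine Turn.trans (s := v ++ u) (b := x * C.ev u) ?_ h4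
    have := (Turn.refl (G := C.cay) (x * C.ev u) (invRev u ++ invRev v)).inv
    simp_all

lemma Turn.base_unique {x y : C.Grp} {r : Word α} (hr : r ∈ C.R)
    (h : Turn C.cay x r y r) : x = y := by
  obtain ⟨u, v, rfl, rfl, h3⟩ := h.shape (C.ev_rel hr)
  rcases h3 with h3 | h3
  · by_cases hu : u = []
    · simp [hu]
    by_cases hv : v = []
    · subst hv
      rw [append_nil] at hr
      rw [C.ev_rel hr, mul_one]
    · exact absurd h3.symm (C.prim hr hu hv)
  · have h4 := append_inj h3 (by simp)
    rw [eq_nil_of_invRev_eq ((C.red1 hr).infix (prefix_append _ _).isInfix) h4.1.symm]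
    simp

/-- Rotation and inversion of words. -/
inductive Step : Word α → Word α → Prop
  | rot (u v) : Step (u ++ v) (v ++ u)
  | inv (u) : Step u (invRev u)

/-- A representative of a word up to rotation and inversion. -/
noncomputable def rep (r : Word α) : Word α := (Quot.mk Step r).out

lemma Turn.rep_eq {x y : C.Grp} {r s : Word α} (h : Turn C.cay x r y s) :
    rep s = rep r := by
  induction h with
  | refl => rfl
  | @rot y u v h1 z h2 ih =>
    rw [← ih, rep, rep, Quot.sound (Step.rot u v)]
  | @inv y s h1 ih => rw [← ih, rep, rep, Quot.sound (Step.inv s)]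

lemma exists_turn_rep (C : SC α) (y : C.Grp) (r : Word α) :
    ∃ x, Turn C.cay y r x (rep r) := by
  have h1 : Quot.mk Step (rep r) = Quot.mk Step r := Quot.out_eq _
  have h2 := Quot.eqvGen_exact h1
  have key : ∀ {s t : Word α}, Relation.EqvGen Step s t → ∀ y : C.Grp,
      (∃ x, Turn C.cay y s x t) ∧ ∃ x, Turn C.cay y t x s := by
    intro s t h
    induction h with
    | rel s t h =>
      intro y
      cases h with
      | rot u v => exact ⟨⟨_, (Turn.refl _ _).rot (SC.rd_cay.2 rfl)⟩,
          ⟨_, (Turn.refl _ _).rot (SC.rd_cay.2 rfl)⟩⟩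
      | inv u =>
        refine ⟨⟨_, (Turn.refl _ _).inv⟩, ⟨y, ?_⟩⟩
        have := (Turn.refl (G := C.cay) y (invRev s)).inv
        simp_all
    | refl s => exact fun y => ⟨⟨y, .refl _ _⟩, ⟨y, .refl _ _⟩⟩
    | symm s t _ ih => simp_all
    | trans s t u _ _ ih1 ih2 =>
      intro y
      constructor
      · obtain ⟨x, hx⟩ := (ih1 y).1
        obtain ⟨z, hz⟩ := (ih2 x).1
        exact ⟨z, hx.trans hz⟩
      · obtain ⟨x, hx⟩ := (ih2 y).2
        obtain ⟨z, hz⟩ := (ih1 x).2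
        exact ⟨z, hx.trans hz⟩
  simp_all

/-- `x` is the base point of a cell running along a geodesic from `g` to `h`. -/
def SC.Mk (C : SC α) (x g h : C.Grp) : Prop :=
  ∃ γ1 p γ2 q, C.Geo (γ1 ++ p ++ γ2) ∧ h = g * C.ev (γ1 ++ p ++ γ2) ∧ p ++ q ∈ C.R ∧
    3 * C.pi (p ++ q) ≤ p.length ∧ Turn C.cay (g * C.ev γ1) (p ++ q) x (rep (p ++ q))

lemma SC.Mk.left {x g h : C.Grp} (a : C.Grp) (H : C.Mk x g h) : C.Mk (a * x) (a * g) (a * h) := by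
  obtain ⟨γ1, p, γ2, q, h1, h2, h3, h4, h5⟩ := H
  exact ⟨γ1, p, γ2, q, h1, by rw [h2, mul_assoc], h3, h4, by rw [mul_assoc]; exact h5.mul_left a⟩

lemma SC.Mk.symm {x g h : C.Grp} (H : C.Mk x g h) : C.Mk x h g := by
  obtain ⟨γ1, p, γ2, q, h1, h2, h3, h4, h5⟩ := H
  have h6 : invRev (γ1 ++ p ++ γ2) = invRev γ2 ++ invRev p ++ invRev γ1 := by
    simp_all
  have h7 : invRev p ++ invRev q ∈ C.R := by
    rw [← invRev_append]; exact C.inv (C.rot h3)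
  have h8 : Turn C.cay (g * C.ev γ1) (p ++ q) (h * C.ev (invRev γ2)) (invRev p ++ invRev q) := by
    rw [← invRev_append]
    have : h * C.ev (invRev γ2) = g * C.ev γ1 * C.ev p := by
      rw [h2, C.ev_append, C.ev_append, C.ev_invRev]; group
    rw [this]
    exact ((Turn.refl _ _).rot (SC.rd_cay.2 rfl)).inv
  refine ⟨invRev γ2, invRev p, invRev γ1, invRev q, h6 ▸ h1.invRev, ?_, h7, ?_, ?_⟩
  · rw [← h6, C.ev_invRev, h2]; group
  · rw [h8.pi_eq (C := C), invRev_length]; exact h4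
  · rw [h8.rep_eq]
    exact (h8.symm (C.ev_rel h3)).trans h5

/-- `x` is the base point of a cell running along `u` from the position `i`. -/
def SC.Hit (C : SC α) (g : C.Grp) (u : Word α) (i : ℕ) (x : C.Grp) : Prop :=
  ∃ o s, o <+: u.drop i ∧ o ++ s ∈ C.R ∧ C.pi (o ++ s) ≤ o.length ∧
    Turn C.cay (g * C.ev (u.take i)) (o ++ s) x (rep (o ++ s))

lemma SC.Hit.eq {g : C.Grp} {u : Word α} {i j : ℕ} {x y : C.Grp} (h : C.Hit g u i x)
    (h' : C.Hit g u j y) (hij : i ≤ j) (hj : j ≤ i + C.η) : x = y := by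
  obtain ⟨k, rfl⟩ := Nat.exists_eq_add_of_le hij
  obtain ⟨o, s, h1, h2, h3, h4⟩ := h
  obtain ⟨o', s', h1', h2', h3', h4'⟩ := h'
  have hlt := C.lt_pi h2
  obtain ⟨a, b, rfl, ha⟩ : ∃ a b, o = a ++ b ∧ a.length = k :=
    ⟨o.take k, o.drop k, (take_append_drop _ _).symm, by simp; omega⟩
  have hb : b <+: u.drop (i + k) := by
    obtain ⟨z, hz⟩ := h1
    refine ⟨z, ?_⟩
    rw [← drop_drop, ← hz, append_assoc, ← ha, drop_left]
  have hta : u.take (i + k) = u.take i ++ a := by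
    obtain ⟨z, hz⟩ := h1
    grind
  have h2r : b ++ (s ++ a) ∈ C.R := by
    rw [← append_assoc]
    rw [append_assoc] at h2
    exact C.rot h2
  have h5 : Turn C.cay (g * C.ev (u.take i)) (a ++ b ++ s) (g * C.ev (u.take (i + k)))
      (b ++ (s ++ a)) := by
    rw [hta, C.ev_append, ← mul_assoc, ← append_assoc]
    rw [append_assoc]
    exact (Turn.refl _ _).rot (SC.rd_cay.2 rfl)
  have hpi := h5.pi_eq (C := C)
  have heq : b ++ (s ++ a) = o' ++ s' := by
    by_contra hne
    rcases le_total b.length o'.length with hl | hl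
    · have h6 := prefix_of_prefix_length_le hb h1' hl
      have := C.piece h2r h2' hne (prefix_append _ _) (h6.trans (prefix_append _ _))
      grind
    · have h6 := prefix_of_prefix_length_le h1' hb hl
      have := C.piece h2' h2r (Ne.symm hne) (prefix_append _ _)
        (h6.trans (prefix_append _ _))
      omega
  have h6 := (h5.symm (C.ev_rel h2)).trans h4
  rw [← heq] at h4'
  have h7 := (h6.symm (C.ev_rel h2r)).trans h4'
  rw [← h5.rep_eq] at h7
  have h8 : rep (b ++ (s ++ a)) ∈ C.R := h4'.mem h2r
  exact Turn.base_unique h8 h7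

lemma SC.exists_hit {L K : ℕ} (hL : ∀ r ∈ C.R, r.length ≤ L) (hK : 100 * L + 100 ≤ K)
    {g h g' h' x : C.Grp} {u : Word α} (hu : C.Geo u) (huh : h = g * C.ev u)
    (hx : C.Mk x g' h') (hg : Near C.dst K x g g') (hh : Near C.dst K x h h') :
    ∃ i ≤ u.length, C.Hit g u i x ∧ C.dst x (g * C.ev (u.take i)) ≤ L := by
  obtain ⟨γ1, p, γ2, q, h1, h2, h3, h4, h5⟩ := hx
  have h6 : C.dst x (g' * C.ev γ1) ≤ L := by
    rw [C.dst_comm]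
    exact (h5.dst_le (C.ev_rel h3)).trans (hL _ h3)
  obtain ⟨i, o, s, h7, h8, h9, h10⟩ := SC.reads_of_far hL hK hu huh h1 h2 rfl h3 h4 h6 hg hh
  have h11 : o ++ s ∈ C.R := h10.mem h3
  have h12 : Turn C.cay (g * C.ev (u.take i)) (o ++ s) x (rep (o ++ s)) := by
    rw [h10.rep_eq]
    exact (h10.symm (C.ev_rel h3)).trans h5
  refine ⟨i, h7, ⟨o, s, h8, h11, by rw [h10.pi_eq (C := C)]; exact h9, h12⟩, ?_⟩
  rw [C.dst_comm]
  exact (h12.dst_le (C.ev_rel h11)).trans (hL _ h11)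

/-- The geometry of a small cancellation group. -/
noncomputable def SC.geom (C : SC α) {L : ℕ} (hL : ∀ r ∈ C.R, r.length ≤ L) : Geom C.Grp where
  d := C.dst
  d_self := C.dst_self
  d_comm := C.dst_comm
  d_tri := C.dst_triangle
  d_left := C.dst_mul_left
  D := 24 * L + 8
  D_pos := by omega
  four x k g h := by
    have := SC.four_point hL x k g h
    omega
  W := C.Mk
  W_left a _ _ _ h := h.left a
  W_symm h := h.symm
  P := (26 * L + 8) / (C.η + 1) + 1
  near := by
    intro x g h g' h' hx hg hh
    obtain ⟨u, hu, hue, hul⟩ := C.exists_geo_nm (g⁻¹ * h)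
    obtain ⟨i, hi, -, h1⟩ := SC.exists_hit hL (by omega) hu (by rw [hue]; group) hx hg hh
    have e1 := hu.dst_take g (Nat.zero_le i) hi
    have e2 := hu.dst_take g hi le_rfl
    have e3 : g * C.ev u = h := by rw [hue]; group
    rw [take_length, e3] at e2
    rw [take_zero, C.ev_nil, mul_one] at e1
    change u.length = C.dst g h at hul
    have := C.dst_triangle g (g * C.ev (u.take i)) x
    have := C.dst_triangle x (g * C.ev (u.take i)) h
    have := C.dst_comm x (g * C.ev (u.take i))
    omega
  count := by
    intro g h a
    obtain ⟨u, hu, hue, hul⟩ := C.exists_geo_nm (g⁻¹ * h)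
    have key : ∀ x, (∃ g' h', C.Mk x g' h' ∧ Near C.dst (13 * (24 * L + 8)) x g g' ∧
        Near C.dst (13 * (24 * L + 8)) x h h' ∧ a ≤ C.dst g x ∧ C.dst g x ≤ a + (24 * L + 8)) →
        ∃ i, C.Hit g u i x ∧ a - L ≤ i ∧ i ≤ (a - L) + (26 * L + 8) := by
      rintro x ⟨g', h', hx, hg, hh, h1, h2⟩
      obtain ⟨i, hi, h3, h4⟩ := SC.exists_hit hL (by omega) hu (by rw [hue]; group) hx hg hh
      have e1 := hu.dst_take g (Nat.zero_le i) hi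
      rw [take_zero, C.ev_nil, mul_one] at e1
      have := C.dst_triangle g (g * C.ev (u.take i)) x
      have := C.dst_triangle g x (g * C.ev (u.take i))
      have := C.dst_comm x (g * C.ev (u.take i))
      grind
    classical
    choose! f hf using key
    obtain ⟨S, hS⟩ : ∃ S : Set C.Grp, S = {x | ∃ g' h', C.Mk x g' h' ∧
        Near C.dst (13 * (24 * L + 8)) x g g' ∧ Near C.dst (13 * (24 * L + 8)) x h h' ∧
        a ≤ C.dst g x ∧ C.dst g x ≤ a + (24 * L + 8)} := ⟨_, rfl⟩
    obtain ⟨n, hn⟩ : ∃ n, n = (26 * L + 8) / (C.η + 1) + 1 := ⟨_, rfl⟩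
    have hmaps : Set.MapsTo (fun x => (f x - (a - L)) / (C.η + 1)) S (Finset.range n) := by
      intro x hx
      rw [hS] at hx
      have := (hf x hx).2
      simp only [coe_range, Set.mem_Iio]
      rw [hn, Nat.lt_add_one_iff]
      exact Nat.div_le_div_right (by omega)
    have hinj : Set.InjOn (fun x => (f x - (a - L)) / (C.η + 1)) S := by
      intro x hx y hy hxy
      rw [hS] at hx hy
      have h1 := hf x hx
      have h2 := hf y hy
      simp only at hxy
      have h3 := Nat.div_add_mod (f x - (a - L)) (C.η + 1)
      have h4 := Nat.div_add_mod (f y - (a - L)) (C.η + 1)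
      have h5 := Nat.mod_lt (f x - (a - L)) (Nat.succ_pos C.η)
      have h6 := Nat.mod_lt (f y - (a - L)) (Nat.succ_pos C.η)
      rw [hxy] at h3
      simp only [Nat.succ_eq_add_one] at h5 h6
      rcases le_total (f x) (f y) with h | h
      · exact h1.1.eq h2.1 h (by omega)
      · exact (h2.1.eq h1.1 h (by omega)).symm
    have hfin : S.Finite := Set.Finite.of_injOn hmaps hinj (Finset.finite_toSet _)
    refine ⟨hfin.toFinset, ?_, ?_⟩
    · have := card_le_card_of_injOn (s := hfin.toFinset) (t := Finset.range n)
        (fun x => (f x - (a - L)) / (C.η + 1)) (by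
          intro x hx
          exact hmaps (by simpa using hx)) (by
          rw [Set.Finite.coe_toFinset]; exact hinj)
      rwa [card_range, hn] at this
    · intro x g' h' hx hg hh h1 h2
      rw [Set.Finite.mem_toFinset, hS]
      exact ⟨g', h', hx, hg, hh, h1, h2⟩

end

section

variable {C : SC α}

/-- Products of at most `n` conjugates of relators. -/
def SC.Ar (C : SC α) (n : ℕ) (x : FreeGroup α) : Prop :=
  ∃ l : List (FreeGroup α × Word α), l.length ≤ n ∧ (∀ y ∈ l, y.2 ∈ C.R) ∧
    x = (l.map fun y => y.1 * FreeGroup.mk y.2 * y.1⁻¹).prod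

namespace SC.Ar

variable {m n : ℕ} {x y : FreeGroup α}

lemma mono (h : C.Ar m x) (hmn : m ≤ n) : C.Ar n x := by
  obtain ⟨l, h1, h2⟩ := h
  exact ⟨l, h1.trans hmn, h2⟩

lemma one : C.Ar n 1 := ⟨[], by simp⟩

lemma mul (hx : C.Ar m x) (hy : C.Ar n y) : C.Ar (m + n) (x * y) := by
  obtain ⟨l, h1, h2, rfl⟩ := hx
  obtain ⟨l', h1', h2', rfl⟩ := hy
  refine ⟨l ++ l', by grind, fun z hz => ?_, by simp⟩
  grind

lemma conj (g : FreeGroup α) (hx : C.Ar n x) : C.Ar n (g * x * g⁻¹) := by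
  obtain ⟨l, h1, h2, rfl⟩ := hx
  refine ⟨l.map fun y => (g * y.1, y.2), by simpa, fun y hy => ?_, ?_⟩
  · grind
  rw [← MulAut.conj_apply, map_list_prod, List.map_map, List.map_map]
  congr 2
  ext y
  simp [mul_assoc]

lemma of_rel {r : Word α} (hr : r ∈ C.R) : C.Ar 1 (FreeGroup.mk r) :=
  ⟨[(1, r)], by simp, by simpa, by simp⟩

lemma ev {w : Word α} (h : C.Ar n (FreeGroup.mk w)) : C.ev w = 1 := by
  obtain ⟨l, -, h2, h3⟩ := h
  rw [C.ev_eq_one, h3]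
  refine Subgroup.list_prod_mem _ fun y hy => ?_
  obtain ⟨z, hz, rfl⟩ := List.mem_map.1 hy
  have h4 : FreeGroup.mk z.2 ∈ Subgroup.normalClosure (FreeGroup.mk '' C.R) :=
    Subgroup.subset_normalClosure ⟨_, h2 z hz, rfl⟩
  exact Subgroup.normalClosure_normal.conj_mem _ h4 _

end SC.Ar

/-- Linear isoperimetric inequality. -/
lemma SC.exists_ar {w : Word α} (h : C.ev w = 1) :
    ∃ n, C.Ar n (FreeGroup.mk w) ∧ n * (2 * C.η) ≤ w.length := by
  induction hn : w.length using Nat.strong_induction_on generalizing w with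
  | _ N ih =>
  subst hn
  by_cases hred : IsReduced w
  · rcases eq_or_ne w [] with rfl | hne
    · exact ⟨0, by exact SC.Ar.one, by simp⟩
    obtain ⟨s, t, h1, ⟨a, b, rfl⟩, h3⟩ := SC.exists_of_ev_eq_one hred hne h
    have hlen := C.len h1
    have hlt := C.lt_pi h1
    have hev : C.ev s = (C.ev t)⁻¹ := by
      have := C.ev_rel h1
      rwa [C.ev_append, mul_eq_one_iff_eq_inv] at this
    have hmk : FreeGroup.mk (a ++ s ++ b) = FreeGroup.mk a * FreeGroup.mk (s ++ t) *
        (FreeGroup.mk a)⁻¹ * FreeGroup.mk (a ++ invRev t ++ b) := by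
      simp only [← mul_mk, ← inv_mk]; group
    simp only [length_append] at hlen h3
    obtain ⟨n, h4, h5⟩ := ih _ (by
      simp only [length_append, invRev_length]; omega) (w := a ++ invRev t ++ b) (by
        rw [C.ev_append, C.ev_append, C.ev_invRev, ← hev, ← C.ev_append, ← C.ev_append, h]) rfl
    refine ⟨1 + n, ?_, ?_⟩
    · rw [hmk]
      exact ((SC.Ar.of_rel h1).conj _).mul h4
    · simp only [length_append, invRev_length] at h5 ⊢
      rw [add_mul]; omega
  · rw [isReduced_iff_not_step] at hred
    push Not at hred
    obtain ⟨v, hv⟩ := hred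
    have h1 : FreeGroup.mk w = FreeGroup.mk v := Quot.sound hv
    have h2 := hv.length
    obtain ⟨n, h4, h5⟩ := ih v.length (by omega) (by rw [← C.ev_congr h1, h]) rfl
    grind

variable (Ω : Om C)

/-- The path word through a list of vertices. -/
def Om.pw : C.Grp → List C.Grp → Word α
  | _, [] => []
  | v, v' :: l => Ω.w (v⁻¹ * v') ++ Om.pw v' l

namespace Om

variable {Ω}

@[simp] lemma pw_nil (v : C.Grp) : Ω.pw v [] = [] := rfl

lemma pw_cons (v v' : C.Grp) (l : List C.Grp) :
    Ω.pw v (v' :: l) = Ω.w (v⁻¹ * v') ++ Ω.pw v' l := rfl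

lemma pw_append (v x : C.Grp) (l l' : List C.Grp) :
    Ω.pw v (l ++ x :: l') = Ω.pw v (l ++ [x]) ++ Ω.pw x l' := by
  induction l generalizing v with
  | nil => simp [pw_cons]
  | cons y l ih => simp only [cons_append, pw_cons, ih, append_assoc]

lemma ev_pw (v x : C.Grp) (l : List C.Grp) : v * C.ev (Ω.pw v (l ++ [x])) = x := by
  induction l generalizing v with
  | nil => simp [pw_cons, Ω.ev]
  | cons y l ih =>
    rw [cons_append, pw_cons, C.ev_append, Ω.ev, ← mul_assoc, mul_inv_cancel_left, ih]

lemma pw_left (a v : C.Grp) (l : List C.Grp) : Ω.pw (a * v) (l.map (a * ·)) = Ω.pw v l := by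
  induction l generalizing v with
  | nil => rfl
  | cons y l ih =>
    rw [List.map_cons, pw_cons, pw_cons, ih]
    group

lemma invRev_pw (v x : C.Grp) (l : List C.Grp) :
    invRev (Ω.pw v (l ++ [x])) = Ω.pw x (l.reverse ++ [v]) := by
  induction l generalizing v with
  | nil => simp [pw_cons, ← Ω.inv]
  | cons y l ih =>
    have h1 := pw_append (Ω := Ω) x y l.reverse [v]
    rw [cons_append, pw_cons, invRev_append, ih, ← Ω.inv, reverse_cons, append_assoc,
      singleton_append, h1, pw_cons, pw_nil, append_nil, mul_inv_rev, inv_inv]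

lemma length_w (v x : C.Grp) : (Ω.w (v⁻¹ * x)).length = C.dst v x := by
  have := (Ω.geo (v⁻¹ * x)).nm
  rw [Ω.ev] at this
  exact this.symm

lemma seg_left (v x : C.Grp) {i : ℕ} (hi : i ≤ (Ω.w (v⁻¹ * x)).length) :
    C.dst v (v * C.ev ((Ω.w (v⁻¹ * x)).take i)) = i := by
  have := (Ω.geo (v⁻¹ * x)).dst_take v (Nat.zero_le i) hi
  simpa using this

lemma seg_right (v x : C.Grp) {i : ℕ} (hi : i ≤ (Ω.w (v⁻¹ * x)).length) :
    C.dst (v * C.ev ((Ω.w (v⁻¹ * x)).take i)) x = C.dst v x - i := by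
  have := (Ω.geo (v⁻¹ * x)).dst_take v hi le_rfl
  rwa [take_length, Ω.ev, mul_inv_cancel_left, length_w] at this

/-- Every point of a path lies on a segment between consecutive vertices. -/
lemma exists_seg {v : C.Grp} {l : List C.Grp} (hl : l ≠ []) {b : ℕ} (hb : b ≤ (Ω.pw v l).length) :
    ∃ l1 l2 x x', v :: l = l1 ++ x :: x' :: l2 ∧
      C.dst x (v * C.ev ((Ω.pw v l).take b)) + C.dst (v * C.ev ((Ω.pw v l).take b)) x' =
        C.dst x x' := by
  induction l generalizing v b with
  | nil => grind
  | cons v' l ih =>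
    obtain ⟨E, hE⟩ : ∃ E, E = (Ω.w (v⁻¹ * v')).length := ⟨_, rfl⟩
    by_cases hbE : b ≤ E
    · refine ⟨[], l, v, v', rfl, ?_⟩
      rw [pw_cons, take_append_of_le_length (by omega), seg_left v v' (by omega),
        seg_right v v' (by omega)]
      rw [length_w] at hE
      omega
    · have hl' : l ≠ [] := by
        rintro rfl
        rw [pw_cons, pw_nil, append_nil, ← hE] at hb
        omega
      rw [pw_cons, length_append] at hb
      obtain ⟨l1, l2, x, x', h1, h2⟩ := ih hl' (v := v') (b := b - E) (by omega)
      refine ⟨v :: l1, l2, x, x', by rw [h1]; rfl, ?_⟩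
      rw [pw_cons, take_append, ← hE, take_of_length_le (by omega), C.ev_append, Ω.ev,
        ← mul_assoc, mul_inv_cancel_left, h2]

section
variable {g : C.Grp} {B : ℕ}

lemma le_take {v : C.Grp} {l : List C.Grp} (hl : l ≠ [])
    (hR : (v :: l).Pairwise fun p q => C.dst p q + C.dst g p ≤ C.dst g q + B) {y : C.Grp}
    (hy : ∀ x ∈ v :: l, C.dst g y ≤ C.dst g x + B) {b : ℕ} (hb : b ≤ (Ω.pw v l).length) :
    C.dst g y ≤ C.dst g (v * C.ev ((Ω.pw v l).take b)) + 2 * B := by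
  obtain ⟨l1, l2, x, x', h1, h2⟩ := exists_seg hl hb
  rw [h1, pairwise_append, List.pairwise_cons] at hR
  have h3 := hR.2.1.1 x' (by simp)
  have h4 := hy x (by rw [h1]; simp)
  have h5 := C.dst_triangle g (v * C.ev ((Ω.pw v l).take b)) x'
  omega

/-- Paths with monotone vertices are quasi-geodesic. -/
lemma exists_between {v : C.Grp} {l : List C.Grp}
    (hR : (v :: l).Pairwise fun p q => C.dst p q + C.dst g p ≤ C.dst g q + B) {a b : ℕ}
    (hab : a ≤ b) (hb : b ≤ (Ω.pw v l).length) :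
    ∃ ms : List C.Grp, Sublist ms l ∧
      b + C.dst g (v * C.ev ((Ω.pw v l).take a)) ≤
        a + C.dst g (v * C.ev ((Ω.pw v l).take b)) + B * (ms.length + 1) ∧
      ∀ x ∈ ms, C.dst g (v * C.ev ((Ω.pw v l).take a)) ≤ C.dst g x + 2 * B ∧
        C.dst g x ≤ C.dst g (v * C.ev ((Ω.pw v l).take b)) + 2 * B := by
  induction l generalizing v a b with
  | nil => simp_all
  | cons v' l ih =>
    obtain ⟨E, hE⟩ : ∃ E, E = (Ω.w (v⁻¹ * v')).length := ⟨_, rfl⟩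
    rw [pw_cons, length_append] at hb
    have hEd : E = C.dst v v' := by rw [hE, length_w]
    have hR1 := (List.pairwise_cons.1 hR).1 v' (by simp)
    have hR2 := (List.pairwise_cons.1 hR).2
    have hlow : ∀ i ≤ E, (Ω.pw v (v' :: l)).take i = (Ω.w (v⁻¹ * v')).take i := fun i hi => by
      rw [pw_cons, take_append_of_le_length (by omega)]
    have hhigh : ∀ i, E ≤ i → v * C.ev ((Ω.pw v (v' :: l)).take i) =
        v' * C.ev ((Ω.pw v' l).take (i - E)) := fun i hi => by
      rw [pw_cons, take_append, ← hE, take_of_length_le (by omega), C.ev_append, Ω.ev,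
        ← mul_assoc, mul_inv_cancel_left]
    have hseg : ∀ i ≤ E, C.dst g (v * C.ev ((Ω.pw v (v' :: l)).take i)) ≤ C.dst g v + i ∧
        C.dst g v' ≤ C.dst g (v * C.ev ((Ω.pw v (v' :: l)).take i)) + (E - i) := fun i hi => by
      rw [hlow i hi]
      have h1 := seg_left (Ω := Ω) v v' (i := i) (by omega)
      have h2 := seg_right (Ω := Ω) v v' (i := i) (by omega)
      have h3 := C.dst_triangle g v (v * C.ev ((Ω.w (v⁻¹ * v')).take i))
      have h4 := C.dst_triangle g (v * C.ev ((Ω.w (v⁻¹ * v')).take i)) v'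
      omega
    by_cases hbE : b ≤ E
    · refine ⟨[], by simp, ?_, by simp⟩
      grind
    by_cases haE : E ≤ a
    · obtain ⟨ms, h1, h2, h3⟩ := ih hR2 (a := a - E) (b := b - E) (by omega) (by omega)
      rw [hhigh a haE, hhigh b (by omega)]
      exact ⟨ms, h1.cons _, by omega, h3⟩
    · obtain ⟨ms, h1, h2, h3⟩ := ih hR2 (a := 0) (b := b - E) (by omega) (by omega)
      rw [hhigh b (by omega)]
      have h4 := hseg a (by omega)
      rw [take_zero, C.ev_nil, mul_one] at h2 h3
      have hl' : l ≠ [] := by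
        rintro rfl
        rw [pw_nil, length_nil] at hb
        omega
      have h5 := le_take (Ω := Ω) hl' hR2 (y := v') (by
        intro x hx
        rcases List.mem_cons.1 hx with rfl | hx
        · omega
        · have := (List.pairwise_cons.1 hR2).1 x hx
          omega) (b := b - E) (by omega)
      refine ⟨v' :: ms, h1.cons_cons _, ?_, ?_⟩
      · rw [length_cons, mul_add, mul_one]
        omega
      · intro x hx
        rcases List.mem_cons.1 hx with rfl | hx
        · exact ⟨by omega, h5⟩
        · have := (List.pairwise_cons.1 hR2).1 x (h1.subset hx)
          exact ⟨by omega, (h3 x hx).2⟩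

end

end Om

end

namespace Geom

variable {G : Type} [Group G] {M : Geom G} {T : ℝ}

section
variable (hT : T ≤ 2 * (1 / 2) ^ 15)
include hT

lemma exists_near {x g h : G} (hx : x ∈ M.cyl T g h) : ∃ g' h', M.W x g' h' ∧
    Near M.d (13 * M.D) x g g' ∧ Near M.d (13 * M.D) x h h' := by
  have h1 : T ≤ 1 := hT.trans (by norm_num)
  simp only [cyl, Set.mem_ofPred_eq, M.tau_lt h1] at hx
  obtain ⟨g', h', h2, h3, h4⟩ := hx
  exact ⟨g', h', h2, M.near_of_rho (h3.trans_le hT), M.near_of_rho (h4.trans_le hT)⟩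

lemma cyl_thin {x g h : G} (hx : x ∈ M.cyl T g h) : M.d g x + M.d x h ≤ M.d g h + M.D := by
  obtain ⟨g', h', h1, h2, h3⟩ := exists_near hT hx
  exact M.near h1 h2 h3

lemma cyl_window (g h : G) (a n : ℕ) : ∃ B : Finset G, B.card ≤ n * M.P ∧
    ∀ x ∈ M.cyl T g h, a ≤ M.d g x → M.d g x < a + n * M.D → x ∈ B := by
  classical
  induction n with
  | zero => simp_all
  | succ n ih =>
    obtain ⟨B, h1, h2⟩ := ih
    obtain ⟨B', h3, h4⟩ := M.count g h (a + n * M.D)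
    refine ⟨B ∪ B', ?_, fun x hx h5 h6 => ?_⟩
    · grind
    · rw [mem_union]
      by_cases h7 : M.d g x < a + n * M.D
      · grind
      · obtain ⟨g', h', h8, h9, h10⟩ := exists_near hT hx
        grind

lemma cyl_finite (g h : G) : (M.cyl T g h).Finite := by
  obtain ⟨B, -, hB⟩ := cyl_window (M := M) hT g h 0 (M.d g h + M.D + 1)
  refine B.finite_toSet.subset fun x hx => hB x hx (Nat.zero_le _) ?_
  have h1 := cyl_thin hT hx
  have h2 : M.d g h + M.D + 1 ≤ (M.d g h + M.D + 1) * M.D := Nat.le_mul_of_pos_right _ M.D_pos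
  omega

end

variable (M T) in
open Classical in
/-- The cylinder as a finite set. -/
noncomputable def slc (g h : G) : Finset G :=
  if hf : (M.cyl T g h).Finite then hf.toFinset else ∅

section
variable (hT : T ≤ 2 * (1 / 2) ^ 15)
include hT

lemma mem_slc {g h x : G} : x ∈ M.slc T g h ↔ x ∈ M.cyl T g h := by
  rw [slc, dif_pos (cyl_finite hT g h), Set.Finite.mem_toFinset]

lemma slc_thin (g h : G) : M.Thin g h (M.slc T g h) := fun _ hx => cyl_thin hT ((mem_slc hT).1 hx)

lemma slc_left (a g h : G) (x : G) : a * x ∈ M.slc T (a * g) (a * h) ↔ x ∈ M.slc T g h := by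
  rw [mem_slc hT, mem_slc hT, M.cyl_left (hT.trans (by norm_num))]

lemma slc_symm (g h : G) : M.slc T h g = M.slc T g h := by
  ext x
  rw [mem_slc hT, mem_slc hT]
  have h1 : T ≤ 1 := hT.trans (by norm_num)
  exact ⟨M.cyl_symm h1, M.cyl_symm h1⟩

lemma length_le_of_window {g h : G} {l : List G} (hn : l.Nodup) {a n : ℕ}
    (hl : ∀ x ∈ l, x ∈ M.slc T g h ∧ a ≤ M.d g x ∧ M.d g x < a + n * M.D) :
    l.length ≤ n * M.P := by
  classical
  obtain ⟨B, h1, h2⟩ := cyl_window (M := M) hT g h a n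
  rw [← toFinset_card_of_nodup hn]
  refine (card_le_card fun x hx => ?_).trans h1
  obtain ⟨h3, h4, h5⟩ := hl x (by simpa using hx)
  exact h2 x ((mem_slc hT).1 h3) h4 h5

end

variable {c : Cen G} {g h : G} {S : Finset G}

lemma mem_of_mem_path {x : G} (hx : x ∈ M.path c g S) : x ∈ S :=
  (((M.isPath c g S).2 x).1 hx).1

lemma nodup_path : (M.path c g S).Nodup :=
  (M.isPath c g S).1.imp fun h e => absurd h (by grind)

lemma Thin.pairwise (hS : M.Thin g h S) : (g :: (M.path c g S ++ [h])).Pairwise fun p q =>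
    M.d p q + M.d g p ≤ M.d g q + 8 * M.D := by
  rw [List.pairwise_cons, pairwise_append]
  refine ⟨fun q _ => by rw [M.d_self]; omega, ?_, pairwise_singleton _ _, ?_⟩
  · refine List.Pairwise.imp_of_mem (fun {p q} hp hq hpq => ?_) (M.isPath c g S).1
    exact hS.d_le_of_lev (mem_of_mem_path hp) (mem_of_mem_path hq) hpq.le
  · intro p hp q hq
    obtain rfl := List.mem_singleton.1 hq
    have := hS p (mem_of_mem_path hp)
    omega

/-- Consecutive vertices of a path see no intermediate marked point. -/
lemma no_cell (h0 : (1 / 2) ^ 15 < T) (hT : T ≤ 2 * (1 / 2) ^ 15) {l s l1 s1 : List G}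
    (hl : M.path c g (M.slc T g h) = l ++ s) {p q x : G} (hp : g :: l = l1 ++ [p])
    (hq : s ++ [h] = q :: s1) (hx : M.W x p q) (h1 : 20 * M.D ≤ M.d p x)
    (h2 : 20 * M.D ≤ M.d x q) : False := by
  have hS := slc_thin (M := M) hT g h
  have h3 := M.near hx (Or.inl rfl) (Or.inl rfl)
  have hdec : g :: (M.path c g (M.slc T g h) ++ [h]) = l1 ++ p :: q :: s1 := by
    grind
  have h4 := hS.pairwise (c := c)
  rw [hdec, pairwise_append, List.pairwise_cons] at h4
  replace h4 := h4.2.1.1 q (by simp)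
  have hdec' : h :: (M.path c h (M.slc T g h) ++ [g]) = s1.reverse ++ q :: p :: l1.reverse := by
    have := congrArg reverse hdec
    rw [hS.path_symm]
    simpa using this
  have h5 := hS.symm.pairwise (c := c)
  rw [hdec', pairwise_append, List.pairwise_cons] at h5
  replace h5 := h5.2.1.1 p (by simp)
  have h6 := M.d_tri g x q
  have h7 := M.d_tri h x p
  have h8 := M.d_comm q p
  have h9 := M.d_comm x p
  have h10 := M.d_comm x g
  have h11 := M.d_comm x h
  have h13 := M.d_comm q h
  have h14 := M.d_tri g q h
  have hD := M.D_pos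
  have h15 : x ∈ M.slc T g h := by
    rw [mem_slc hT, cyl, Set.mem_ofPred_eq, M.tau_lt (hT.trans (by norm_num))]
    refine ⟨p, q, hx, (M.rho_of_near (Or.inr ?_)).trans h0, (M.rho_of_near (Or.inr ?_)).trans h0⟩
    · omega
    · omega
  have h16 := hS x h15
  refine hS.not_between hl h15 (fun l' p' he => ?_) fun q' l' he => ?_
  · have : p' = p := by
      grind
    subst this
    exact ⟨by omega, by omega⟩
  · have : q' = q := by
      grind
    subst this
    exact ⟨by omega, by omega⟩

/-- Transfer of Gromov products along thin position. -/
lemma product_le {t : ℕ} {h k q q' : G} (h1 : 2 * t + M.d h k ≤ M.d g h + M.d g k)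
    (h2 : M.d g q + M.d q h ≤ M.d g h + M.D) (h3 : M.d g q' + M.d q' k ≤ M.d g k + M.D)
    (h4 : t < M.d g q + 12 * M.D) (h5 : t < M.d g q' + 12 * M.D) :
    2 * t + M.d q q' ≤ M.d g q + M.d g q' + 27 * M.D := by
  have h6 := M.four g k h q'
  have h7 := M.four g h q q'
  have := M.d_comm h q
  have := M.d_comm k h
  have := M.d_comm k q'
  grind

end Geom

section

variable {C : SC α}

lemma SC.drop_take_eq {e e' : Word α} {a n : ℕ} (hn : n ≤ e.length)
    (hn' : n ≤ e'.length)
    (H : ∀ i, a ≤ i → i ≤ n → C.ev (e.take i) = C.ev (e'.take i)) :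
    (e.take n).drop a = (e'.take n).drop a := by
  refine ext_getElem (by simp; omega) fun i h1 h2 => ?_
  simp only [length_drop, length_take] at h1 h2
  rw [getElem_drop, getElem_drop, getElem_take, getElem_take]
  have key : ∀ {f : Word α} (h : a + i < f.length),
      C.ev (f.take (a + i + 1)) = C.ev (f.take (a + i)) * C.ev [f[a + i]] := fun h => by
    rw [← C.ev_append, take_concat_get' _ _ h]
  apply SC.letter_inj (C := C)
  have h3 := H (a + i + 1) (by omega) (by omega)
  rw [key (by omega), key (by omega), H (a + i) (by omega) (by omega)] at h3
  exact mul_left_cancel h3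

lemma SC.exists_ar_le {w : Word α} (h : C.ev w = 1) {D E N : ℕ} (hD : 0 < D)
    (hE : D ≤ E * C.η) (hw : w.length ≤ 2 * N * D) : C.Ar (N * E) (FreeGroup.mk w) := by
  obtain ⟨m, hm, hm'⟩ := SC.exists_ar h
  refine hm.mono ?_
  have h2 : 0 < C.η := by
    grind
  refine Nat.le_of_mul_le_mul_right (c := 2 * C.η) ?_ (by omega)
  have h3 := Nat.mul_le_mul_left (2 * N) hE
  grind

variable {L : ℕ} (hL : ∀ r ∈ C.R, r.length ≤ L) (Ω : Om C) (T : ℝ)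

/-- The canonical word from `g` to `h`. -/
noncomputable def SC.tr (g h : C.Grp) : Word α :=
  Ω.pw g ((C.geom hL).path C.cen g ((C.geom hL).slc T g h) ++ [h])

variable {Ω T}

lemma Om.pw_split (g : C.Grp) (l : List C.Grp) : ∃ l1 p, g :: l = l1 ++ [p] ∧
    g * C.ev (Ω.pw g l) = p ∧
    ∀ q s, Ω.pw g (l ++ q :: s) = Ω.pw g l ++ Ω.w (p⁻¹ * q) ++ Ω.pw q s := by
  rcases eq_nil_or_concat l with rfl | ⟨l', p, rfl⟩
  · exact ⟨[], g, rfl, by simp_all, fun q s => by simp [pw_cons]⟩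
  · refine ⟨g :: l', p, by simp, ?_, fun q s => ?_⟩
    · rw [concat_eq_append, ev_pw]
    · rw [concat_eq_append, append_assoc, singleton_append, pw_append,
        pw_cons, append_assoc]

include hL in
/-- A marked point on a segment is not an intermediate marked point. -/
lemma SC.exists_mk {p q : C.Grp} {d p0 d' q0 : Word α}
    (h1 : Ω.w (p⁻¹ * q) = d ++ p0 ++ d') (h2 : p0 ++ q0 ∈ C.R)
    (h3 : 3 * C.pi (p0 ++ q0) ≤ p0.length) :
    ∃ x, C.Mk x p q ∧ C.dst (p * C.ev d) x ≤ L := by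
  obtain ⟨x, hx⟩ := exists_turn_rep C (p * C.ev d) (p0 ++ q0)
  refine ⟨x, ⟨d, p0, d', q0, h1 ▸ Ω.geo _, ?_, h2, h3, hx⟩, (hx.dst_le (C.ev_rel h2)).trans
    (hL _ h2)⟩
  rw [← h1, Ω.ev, mul_inv_cancel_left]

lemma SC.tr_thin (hT : T ≤ 2 * (1 / 2) ^ 15) {g h : C.Grp} {u : Word α}
    (hu : u <+: C.tr hL Ω T g h) :
    C.dst g (g * C.ev u) + C.dst (g * C.ev u) h ≤ C.dst g h + 9 * (24 * L + 8) := by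
  have hS := Geom.slc_thin (M := C.geom hL) hT g h
  have hp := hS.pairwise (c := C.cen)
  have hD : (C.geom hL).D = 24 * L + 8 := rfl
  have hd : (C.geom hL).d = C.dst := rfl
  have hne : (C.geom hL).path C.cen g ((C.geom hL).slc T g h) ++ [h] ≠ [] := by simp
  obtain ⟨l1, l2, x, x', h1, h2⟩ := Om.exists_seg (Ω := Ω) hne hu.length_le
  have h3 : Ω.pw g ((C.geom hL).path C.cen g ((C.geom hL).slc T g h) ++ [h]) =
    C.tr hL Ω T g h := rfl
  rw [h3, ← prefix_iff_eq_take.1 hu] at h2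
  have hx' : C.dst g x' + C.dst x' h ≤ C.dst g h + (24 * L + 8) := by
    have : x' ∈ (C.geom hL).path C.cen g ((C.geom hL).slc T g h) ++ [h] := by
      rcases l1 with _ | ⟨y, l1⟩
      · grind
      · rw [cons_append, List.cons.injEq] at h1
        rw [h1.2]; simp
    rcases mem_append.1 this with h4 | h4
    · exact hS _ (Geom.mem_of_mem_path h4)
    · obtain rfl := List.mem_singleton.1 h4
      rw [C.dst_self]; omega
  rw [h1, pairwise_append, List.pairwise_cons] at hp
  have h4 := hp.2.1.1 x' (by simp)
  rw [hd, hD] at h4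
  have := C.dst_triangle g x (g * C.ev u)
  have := C.dst_triangle (g * C.ev u) x' h
  omega

set_option maxHeartbeats 1000000 in
/-- Two canonical words from `g` agree, up to bounded area, as long as the cylinders agree. -/
lemma SC.corner (h0 : (1 / 2) ^ 15 < T) (hT : T ≤ 2 * (1 / 2) ^ 15) {E : ℕ}
    (hE : 24 * L + 8 ≤ E * C.η) {g h k : C.Grp} {t : ℕ}
    (ht : 2 * t + C.dst h k ≤ C.dst g h + C.dst g k)
    (H : ∀ x, C.dst g x ≤ t → (x ∈ (C.geom hL).slc T g h ↔ x ∈ (C.geom hL).slc T g k)) :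
    ∃ u u', u <+: C.tr hL Ω T g h ∧ u' <+: C.tr hL Ω T g k ∧
      C.Ar (23 * E) ((FreeGroup.mk u)⁻¹ * FreeGroup.mk u') ∧
      t ≤ C.dst g (g * C.ev u) + 63 * (24 * L + 8) := by
  have hS := Geom.slc_thin (M := C.geom hL) hT g h
  have hS' := Geom.slc_thin (M := C.geom hL) hT g k
  have hD : (C.geom hL).D = 24 * L + 8 := rfl
  have hd : (C.geom hL).d = C.dst := rfl
  obtain ⟨l, s, s', hl, hl', hlt, hs, hs'⟩ := Geom.path_agree (c := C.cen) hS hS' H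
  obtain ⟨l1, p, hp, hpu, hsp⟩ := Om.pw_split (Ω := Ω) g l
  obtain ⟨q, s1, hq⟩ : ∃ q s1, s ++ [h] = q :: s1 := by
    cases s with
    | nil => exact ⟨_, _, rfl⟩
    | cons => exact ⟨_, _, rfl⟩
  obtain ⟨q', s1', hq'⟩ : ∃ q s1, s' ++ [k] = q :: s1 := by
    cases s' with
    | nil => exact ⟨_, _, rfl⟩
    | cons => exact ⟨_, _, rfl⟩
  have hP : C.tr hL Ω T g h = Ω.pw g l ++ Ω.w (p⁻¹ * q) ++ Ω.pw q s1 := by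
    rw [← hsp, ← hq, ← append_assoc, ← hl]; rfl
  have hP' : C.tr hL Ω T g k = Ω.pw g l ++ Ω.w (p⁻¹ * q') ++ Ω.pw q' s1' := by
    rw [← hsp, ← hq', ← append_assoc, ← hl']; rfl
  rw [hD, hd] at hlt hs hs'
  obtain ⟨D, hDD⟩ : ∃ D, D = 24 * L + 8 := ⟨_, rfl⟩
  rw [← hDD] at hD hlt hs hs' hE ⊢
  by_cases hbig : t ≤ C.dst g p + 63 * D
  · exact ⟨Ω.pw g l, Ω.pw g l, ⟨_, by rw [hP, append_assoc]⟩,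
      ⟨_, by rw [hP', append_assoc]⟩, by rw [inv_mul_cancel]; exact SC.Ar.one,
      by rw [hpu]; exact hbig⟩
  have key : ∀ {h k q : C.Grp} {s s1 : List C.Grp}, 2 * t + C.dst h k ≤ C.dst g h + C.dst g k →
      (C.geom hL).Thin g h ((C.geom hL).slc T g h) →
      (C.geom hL).path C.cen g ((C.geom hL).slc T g h) = l ++ s → s ++ [h] = q :: s1 →
      (∀ q ∈ s, t < C.dst g q + 12 * D) →
      t < C.dst g q + 12 * D ∧ C.dst g q + C.dst q h ≤ C.dst g h + D ∧
      C.dst p q + C.dst g p ≤ C.dst g q + 8 * D := by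
    intro h k q s s1 ht hS hl hq hs
    have h1 : q ∈ s ++ [h] := by rw [hq]; simp
    have h2 : C.dst p q + C.dst g p ≤ C.dst g q + 8 * D := by
      have hp1 := hS.pairwise (c := C.cen)
      have hdec : g :: ((C.geom hL).path C.cen g ((C.geom hL).slc T g h) ++ [h]) =
          l1 ++ p :: q :: s1 := by
        rw [hl, append_assoc, hq, ← cons_append, hp]; simp
      rw [hdec, pairwise_append, List.pairwise_cons] at hp1
      have := hp1.2.1.1 q (by simp)
      rwa [hD] at this
    rcases mem_append.1 h1 with h1 | h1
    · refine ⟨hs q h1, ?_, h2⟩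
      have := hS q (Geom.mem_of_mem_path (c := C.cen) (g := g) (by rw [hl]; simp [h1]))
      rwa [hD] at this
    · obtain rfl := List.mem_singleton.1 h1
      have := C.dst_triangle g q k
      rw [C.dst_self]
      exact ⟨by omega, by omega, h2⟩
  obtain ⟨a1, a2, a3⟩ := key ht hS hl hq hs
  obtain ⟨b1, b2, b3⟩ := key (by rw [C.dst_comm k h]; omega) hS' hl' hq' hs'
  have hprod := Geom.product_le (M := C.geom hL) (g := g) (h := h) (k := k) (q := q) (q' := q')
    (t := t) ht (by rw [hD]; exact a2) (by rw [hD]; exact b2) (by rw [hD]; exact a1)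
    (by rw [hD]; exact b1)
  rw [hd, hD] at hprod
  have ta := C.dst_triangle g p q
  have tb := C.dst_triangle g p q'
  have le := Om.length_w (Ω := Ω) p q
  have le' := Om.length_w (Ω := Ω) p q'
  have hdq : C.dst (p⁻¹ * q) (p⁻¹ * q') = C.dst q q' := C.dst_mul_left _ _ _
  obtain ⟨n, hn⟩ : ∃ n, n = t - C.dst g p - 40 * D := ⟨_, rfl⟩
  have hcell : ∀ {h q : C.Grp} {s s1 : List C.Grp}, 
      (C.geom hL).path C.cen g ((C.geom hL).slc T g h) = l ++ s → s ++ [h] = q :: s1 →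
      t ≤ C.dst g p + C.dst p q + 12 * D → ∀ {i d p0 d' q0},
      Ω.w (p⁻¹ * q) = d ++ p0 ++ d' → p0 ++ q0 ∈ C.R → 3 * C.pi (p0 ++ q0) ≤ p0.length →
      ∀ z, C.dst p z = i → C.dst (p * C.ev d) z ≤ L → 23 * D ≤ i → i ≤ n → False := by
    intro h q s s1 hl hq hfar i d p0 d' q0 e1 e2 e3 z e4 e5 e6 e7
    obtain ⟨x, hx, hx'⟩ := SC.exists_mk hL e1 e2 e3
    have f1 := C.dst_triangle p x z
    have f2 := C.dst_triangle x (p * C.ev d) z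
    have f3 := C.dst_comm x (p * C.ev d)
    have f4 := C.dst_triangle p z x
    have f5 := C.dst_triangle z (p * C.ev d) x
    have f6 := C.dst_comm z (p * C.ev d)
    have f7 := C.dst_triangle p x q
    refine Geom.no_cell (M := C.geom hL) h0 hT hl hp hq hx ?_ ?_
    · change _ ≤ C.dst p x; omega
    · change _ ≤ C.dst x q; omega
  have hpos : ∀ i, 23 * D ≤ i → i ≤ n →
      C.ev ((Ω.w (p⁻¹ * q)).take i) = C.ev ((Ω.w (p⁻¹ * q')).take i) := by
    intro i hi hin
    have hz := Om.seg_left (Ω := Ω) p q' (i := i) (by omega)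
    rcases SC.gap_fellow hL (Ω.geo (p⁻¹ * q)) (Ω.geo (p⁻¹ * q')) (i := i) (by
      rw [Ω.ev, Ω.ev, hdq]; omega) with h1 | ⟨Z, rfl | rfl, d, p0, d', q0, e1, e2, e3, e4⟩
    · exact h1
    · exact (hcell hl hq (by omega) e1 e2 e3 _ hz (by rw [C.dst_mul_left]; exact e4) hi hin).elim
    · exact (hcell hl' hq' (by omega) e1 e2 e3 _ hz (by rw [C.dst_mul_left]; exact e4) hi hin).elim
  have hsplit : ∀ w : Word α, w.take n = w.take (23 * D) ++ (w.take n).drop (23 * D) := by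
    intro w
    conv_lhs => rw [← take_append_drop (23 * D) (w.take n), take_take,
      min_eq_left (by omega : 23 * D ≤ n)]
  have hdt := SC.drop_take_eq (C := C) (n := n) (a := 23 * D) (by omega) (by omega) hpos
  refine ⟨Ω.pw g l ++ (Ω.w (p⁻¹ * q)).take n, Ω.pw g l ++ (Ω.w (p⁻¹ * q')).take n, ?_, ?_, ?_, ?_⟩
  · rw [hP, append_assoc]
    exact (prefix_append_right_inj _).2 ((take_prefix _ _).trans (prefix_append _ _))
  · rw [hP', append_assoc]
    exact (prefix_append_right_inj _).2 ((take_prefix _ _).trans (prefix_append _ _))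
  · have hev : C.ev (invRev ((Ω.w (p⁻¹ * q)).take (23 * D)) ++
        (Ω.w (p⁻¹ * q')).take (23 * D)) = 1 := by
      rw [C.ev_append, C.ev_invRev, hpos _ le_rfl (by omega), inv_mul_cancel]
    have hm := SC.exists_ar_le hev (N := 23) (by omega : 0 < D) hE (by
      simp only [length_append, invRev_length, length_take]; omega)
    have e1 := hsplit (Ω.w (p⁻¹ * q))
    have e2 := hsplit (Ω.w (p⁻¹ * q'))
    rw [hdt] at e1
    generalize ((Ω.w (p⁻¹ * q')).take n).drop (23 * D) = v at e1 e2
    have h3 := hm.conj (FreeGroup.mk v)⁻¹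
    rw [e1, e2]
    refine (Eq.mp ?_ h3)
    simp only [← mul_mk, ← inv_mk]
    group
  · rw [C.ev_append, ← mul_assoc, hpu]
    have h1 := Om.seg_right (Ω := Ω) p q (i := n) (by omega)
    have h2 := C.dst_triangle g (p * C.ev ((Ω.w (p⁻¹ * q)).take n)) q
    omega

end

section

variable {C : SC α}

variable {L : ℕ} (hL : ∀ r ∈ C.R, r.length ≤ L) {Ω : Om C} {T : ℝ}

lemma SC.ev_tr (g h : C.Grp) : g * C.ev (C.tr hL Ω T g h) = h := Om.ev_pw _ _ _

lemma SC.geom_P_le {E : ℕ} (hE : 24 * L + 8 ≤ E * C.η) : (C.geom hL).P ≤ 2 * E + 1 := by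
  have h1 : (C.geom hL).P = (26 * L + 8) / (C.η + 1) + 1 := rfl
  refine Nat.succ_le_succ (Nat.le_of_lt_succ ((Nat.div_lt_iff_lt_mul (by omega)).2 ?_))
  grind

variable (hT : T ≤ 2 * (1 / 2) ^ 15)
include hT

lemma SC.tr_symm (g h : C.Grp) : C.tr hL Ω T h g = invRev (C.tr hL Ω T g h) := by
  have hS := Geom.slc_thin (M := C.geom hL) hT g h
  rw [SC.tr, SC.tr, Om.invRev_pw, Geom.slc_symm hT g h, hS.path_symm]

lemma SC.tr_left (a g h : C.Grp) : C.tr hL Ω T (a * g) (a * h) = C.tr hL Ω T g h := by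
  rw [SC.tr, SC.tr, Geom.path_left a g (Geom.slc_left (M := C.geom hL) hT a g h), ← Om.pw_left a g,
    map_append, List.map_singleton]

lemma SC.exists_between_tr {g h : C.Grp} {a b m : ℕ} (hab : a ≤ b)
    (hb : b ≤ (C.tr hL Ω T g h).length)
    (hm : C.dst g (g * C.ev ((C.tr hL Ω T g h).take b)) ≤
      C.dst g (g * C.ev ((C.tr hL Ω T g h).take a)) + m * (24 * L + 8)) :
    b ≤ a + (m + 8 * ((m + 33) * (C.geom hL).P + 2)) * (24 * L + 8) := by
  have hS := Geom.slc_thin (M := C.geom hL) hT g h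
  have hp := hS.pairwise (c := C.cen)
  have hD : (C.geom hL).D = 24 * L + 8 := rfl
  have hd : (C.geom hL).d = C.dst := rfl
  obtain ⟨D, hDD⟩ : ∃ D, D = 24 * L + 8 := ⟨_, rfl⟩
  rw [← hDD] at hD hm ⊢
  rw [hD, hd] at hp
  obtain ⟨ms, h1, h2, h3⟩ := Om.exists_between (Ω := Ω) hp hab hb
  change b + C.dst g (g * C.ev ((C.tr hL Ω T g h).take a)) ≤
    a + C.dst g (g * C.ev ((C.tr hL Ω T g h).take b)) + 8 * D * (ms.length + 1) at h2
  change ∀ x ∈ ms, C.dst g (g * C.ev ((C.tr hL Ω T g h).take a)) ≤ C.dst g x + 2 * (8 * D) ∧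
    C.dst g x ≤ C.dst g (g * C.ev ((C.tr hL Ω T g h).take b)) + 2 * (8 * D) at h3
  generalize C.dst g (g * C.ev ((C.tr hL Ω T g h).take a)) = fa at *
  obtain ⟨m1, m2, rfl, h4, h5⟩ := sublist_append_iff.1 h1
  have h6 := h5.length_le
  have h7 := Geom.length_le_of_window (M := C.geom hL) hT (g := g) (h := h) (l := m1)
    (h4.nodup Geom.nodup_path) (a := fa - 16 * D) (n := m + 33) (fun x hx => by
      have h8 := h3 x (by simp [hx])
      refine ⟨Geom.mem_of_mem_path (h4.subset hx), ?_, ?_⟩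
      · change _ ≤ C.dst g x; omega
      · rw [hD, add_mul]; change C.dst g x < _; omega)
  rw [length_append, length_singleton] at *
  have h9 : 8 * D * (m1.length + m2.length + 1) ≤ 8 * D * ((m + 33) * (C.geom hL).P + 2) :=
    Nat.mul_le_mul_left _ (by omega)
  grind

lemma SC.exists_mid {g h : C.Grp} {u w : Word α} (hu : u <+: C.tr hL Ω T g h)
    (hw : w <+: C.tr hL Ω T h g) {m : ℕ}
    (h1 : C.dst g (g * C.ev u) ≤ C.dst g (h * C.ev w) + m * (24 * L + 8))
    (h2 : C.dst g (h * C.ev w) ≤ C.dst g (g * C.ev u) + m * (24 * L + 8)) :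
    ∃ X, (FreeGroup.mk u)⁻¹ * FreeGroup.mk (C.tr hL Ω T g h) * FreeGroup.mk w = FreeGroup.mk X ∧
      X.length ≤ (m + 8 * ((m + 33) * (C.geom hL).P + 2)) * (24 * L + 8) := by
  rw [SC.tr_symm hL hT] at hw
  obtain ⟨r, hr⟩ := hw
  obtain ⟨v, hv, hP⟩ : ∃ v, v = invRev r ∧ C.tr hL Ω T g h = v ++ invRev w := by
    refine ⟨_, rfl, ?_⟩
    rw [← FreeGroup.invRev_invRev (L₁ := C.tr hL Ω T g h), ← hr, invRev_append]
  have hvp : h * C.ev w = g * C.ev v := by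
    rw [← SC.ev_tr hL (Ω := Ω) (T := T) g h, hP, C.ev_append, C.ev_invRev]; group
  rw [hvp] at h1 h2
  have hv' : v <+: C.tr hL Ω T g h := ⟨_, hP.symm⟩
  have eu := prefix_iff_eq_take.1 hu
  have evv := prefix_iff_eq_take.1 hv'
  have hmk : FreeGroup.mk (C.tr hL Ω T g h) * FreeGroup.mk w = FreeGroup.mk v := by
    rw [hP, ← mul_mk, ← inv_mk]; group
  rcases le_total u.length v.length with hle | hle
  · obtain ⟨X, rfl⟩ := prefix_of_prefix_length_le hu hv' hle
    refine ⟨X, ?_, ?_⟩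
    · rw [mul_assoc, hmk, ← mul_mk]; group
    · have := SC.exists_between_tr hL hT (Ω := Ω) (g := g) (h := h) (m := m) hle hv'.length_le
        (by rw [← eu, ← evv]; exact h2)
      rw [length_append] at this
      omega
  · obtain ⟨X, rfl⟩ := prefix_of_prefix_length_le hv' hu hle
    refine ⟨invRev X, ?_, ?_⟩
    · rw [mul_assoc, hmk, ← mul_mk, ← inv_mk]; group
    · have := SC.exists_between_tr hL hT (Ω := Ω) (g := g) (h := h) (m := m) hle hu.length_le
        (by rw [← eu, ← evv]; exact h1)
      rw [length_append] at this
      rw [invRev_length]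
      omega

omit hT in
/-- The cylinders seen from `g` towards `h` and `k` agree near `g`, up to `m` units. -/
def SC.Agree (T : ℝ) (m : ℕ) (g h k : C.Grp) : Prop :=
  ∀ x, 2 * C.dst g x + C.dst h k + 2 * (m * (24 * L + 8)) ≤ C.dst g h + C.dst g k →
    (x ∈ (C.geom hL).cyl T g h ↔ x ∈ (C.geom hL).cyl T g k)

lemma SC.corner_of_agree (h0 : (1 / 2) ^ 15 < T) {E : ℕ}
    (hE : 24 * L + 8 ≤ E * C.η) {g h k : C.Grp} {m : ℕ} (H : C.Agree hL T m g h k) :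
    ∃ u u', u <+: C.tr hL Ω T g h ∧ u' <+: C.tr hL Ω T g k ∧
      C.Ar (23 * E) ((FreeGroup.mk u)⁻¹ * FreeGroup.mk u') ∧ C.ev u = C.ev u' ∧
      C.dst g h + C.dst g k ≤ 2 * C.dst g (g * C.ev u) + C.dst h k +
        (2 * m + 128) * (24 * L + 8) ∧
      2 * C.dst g (g * C.ev u) + C.dst h k ≤ C.dst g h + C.dst g k + 18 * (24 * L + 8) ∧
      C.dst g (g * C.ev u) + C.dst (g * C.ev u) h ≤ C.dst g h + 9 * (24 * L + 8) ∧
      C.dst g (g * C.ev u) + C.dst (g * C.ev u) k ≤ C.dst g k + 9 * (24 * L + 8) := by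
  obtain ⟨D, hDD⟩ : ∃ D, D = 24 * L + 8 := ⟨_, rfl⟩
  have key : ∃ u u', u <+: C.tr hL Ω T g h ∧ u' <+: C.tr hL Ω T g k ∧
      C.Ar (23 * E) ((FreeGroup.mk u)⁻¹ * FreeGroup.mk u') ∧
      C.dst g h + C.dst g k ≤ 2 * C.dst g (g * C.ev u) + C.dst h k + (2 * m + 128) * D := by
    by_cases hbig : C.dst h k + 2 * (m * D) ≤ C.dst g h + C.dst g k
    · obtain ⟨t, ht⟩ : ∃ t, t = (C.dst g h + C.dst g k - C.dst h k - 2 * (m * D)) / 2 := ⟨_, rfl⟩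
      obtain ⟨u, u', h1, h2, h3, h4⟩ := SC.corner hL (Ω := Ω) h0 hT hE (g := g) (h := h) (k := k)
        (t := t) (by omega) (fun x hx => by
          rw [Geom.mem_slc hT, Geom.mem_slc hT]
          exact H x (by grind))
      grind
    · refine ⟨[], [], nil_prefix, nil_prefix, by exact SC.Ar.one, ?_⟩
      rw [add_mul, mul_assoc]; omega
  obtain ⟨u, u', h1, h2, h3, h4⟩ := key
  have h5 : C.ev u = C.ev u' := by
    have := h3.ev
    rwa [C.ev_append, C.ev_invRev, inv_mul_eq_one] at this
  have h6 := SC.tr_thin hL hT h1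
  have h7 := SC.tr_thin hL hT h2
  rw [← h5] at h7
  rw [← hDD] at h6 h7 ⊢
  have := C.dst_triangle h (g * C.ev u) k
  have := C.dst_comm h (g * C.ev u)
  exact ⟨u, u', h1, h2, h3, h5, h4, by omega, h6, h7⟩

/-- A bound for the area of a triangle. -/
def areaBound (E m : ℕ) : ℕ :=
  69 * E + 3 * ((2 * m + 160) + 8 * ((2 * m + 160 + 33) * (2 * E + 1) + 2)) * E

lemma SC.area_triangle (h0 : (1 / 2) ^ 15 < T) {E : ℕ} (hE : 24 * L + 8 ≤ E * C.η)
    {g h k : C.Grp} {m : ℕ} (H1 : C.Agree hL T m g k h) (H2 : C.Agree hL T m h g k)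
    (H3 : C.Agree hL T m k h g) :
    C.Ar (areaBound E m) (FreeGroup.mk (C.tr hL Ω T g h) * FreeGroup.mk (C.tr hL Ω T h k) *
      FreeGroup.mk (C.tr hL Ω T k g)) := by
  obtain ⟨D, hDD⟩ : ∃ D, D = 24 * L + 8 := ⟨_, rfl⟩
  obtain ⟨ug', ug, a1, a2, a3, a4, a5, a6, a7, a8⟩ := SC.corner_of_agree hL hT (Ω := Ω) h0 hE H1
  obtain ⟨uh', uh, b1, b2, b3, b4, b5, b6, b7, b8⟩ := SC.corner_of_agree hL hT (Ω := Ω) h0 hE H2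
  obtain ⟨uk', uk, c1, c2, c3, c4, c5, c6, c7, c8⟩ := SC.corner_of_agree hL hT (Ω := Ω) h0 hE H3
  have key : ∀ {g h k x y : C.Grp},
      C.dst g h + C.dst g k ≤ 2 * C.dst g x + C.dst h k + (2 * m + 128) * D →
      2 * C.dst g x + C.dst h k ≤ C.dst g h + C.dst g k + 18 * D →
      C.dst h g + C.dst h k ≤ 2 * C.dst h y + C.dst g k + (2 * m + 128) * D →
      2 * C.dst h y + C.dst g k ≤ C.dst h g + C.dst h k + 18 * D →
      C.dst h y + C.dst y g ≤ C.dst h g + 9 * D →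
      C.dst g x ≤ C.dst g y + (2 * m + 160) * D ∧ C.dst g y ≤ C.dst g x + (2 * m + 160) * D := by
    intro g h k x y e1 e2 e3 e4 e5
    have := C.dst_comm g h
    have := C.dst_comm y g
    have := C.dst_comm h y
    have := C.dst_triangle g y h
    rw [add_mul] at *
    constructor <;> omega
  rw [← hDD] at a5 a6 a7 b5 b6 b7 c5 c6 c7 hE
  have k1 := key (g := g) (h := h) (k := k) (x := g * C.ev ug') (y := h * C.ev uh')
    (by rw [C.dst_comm h k]; omega) (by rw [C.dst_comm h k]; omega) b5 b6 b7
  have k2 := key (g := h) (h := k) (k := g) (x := h * C.ev uh') (y := k * C.ev uk')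
    (by rw [C.dst_comm k g, C.dst_comm h g]; rw [C.dst_comm h g] at b5; omega)
    (by rw [C.dst_comm k g, C.dst_comm h g]; rw [C.dst_comm h g] at b6; omega) c5 c6 c7
  have k3 := key (g := k) (h := g) (k := h) (x := k * C.ev uk') (y := g * C.ev ug')
    (by rw [C.dst_comm g h]; omega)
    (by rw [C.dst_comm g h]; omega) a5 a6 a7
  rw [hDD] at k1 k2 k3
  obtain ⟨X1, hX1, lX1⟩ := SC.exists_mid hL hT a2 b1 (by rw [← a4]; exact k1.1)
    (by rw [← a4]; exact k1.2)
  obtain ⟨X2, hX2, lX2⟩ := SC.exists_mid hL hT b2 c1 (by rw [← b4]; exact k2.1)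
    (by rw [← b4]; exact k2.2)
  obtain ⟨X3, hX3, lX3⟩ := SC.exists_mid hL hT c2 a1 (by rw [← c4]; exact k3.1)
    (by rw [← c4]; exact k3.2)
  have hP := SC.geom_P_le hL (E := E) (by rw [← hDD]; exact hE)
  obtain ⟨N, hN⟩ : ∃ N, N = (2 * m + 160) + 8 * ((2 * m + 160 + 33) * (2 * E + 1) + 2) := ⟨_, rfl⟩
  have hNle : ((2 * m + 160) + 8 * ((2 * m + 160 + 33) * (C.geom hL).P + 2)) * (24 * L + 8) ≤
      N * D := by
    rw [hN, ← hDD]; gcongr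
  have hev1 : C.ev (X1 ++ X2 ++ X3) = 1 := by
    have e1 := congrArg C.pr hX1
    have e2 := congrArg C.pr hX2
    have e3 := congrArg C.pr hX3
    change (C.ev ug)⁻¹ * C.ev _ * C.ev uh' = C.ev X1 at e1
    change (C.ev uh)⁻¹ * C.ev _ * C.ev uk' = C.ev X2 at e2
    change (C.ev uk)⁻¹ * C.ev _ * C.ev ug' = C.ev X3 at e3
    have f1 := SC.ev_tr hL (Ω := Ω) (T := T) g h
    have f2 := SC.ev_tr hL (Ω := Ω) (T := T) h k
    have f3 := SC.ev_tr hL (Ω := Ω) (T := T) k g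
    rw [C.ev_append, C.ev_append, ← e1, ← e2, ← e3, ← a4, b4, c4, eq_inv_mul_of_mul_eq f1,
      eq_inv_mul_of_mul_eq f2, eq_inv_mul_of_mul_eq f3]
    group
  have hlen : (X1 ++ X2 ++ X3).length ≤ 2 * (3 * N) * D := by
    have : 2 * (3 * N) * D = 6 * (N * D) := by ring
    simp only [length_append]
    omega
  have hA := SC.exists_ar_le hev1 (by omega : 0 < D) hE hlen
  have hfin := (((b3.conj (FreeGroup.mk X1)).mul (c3.conj (FreeGroup.mk (X1 ++ X2)))).mul
    hA).mul a3
  have hfin := (hfin.mono (n := areaBound E m) (by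
    rw [areaBound, ← hN]
    omega)).conj (FreeGroup.mk ug)
  refine Eq.mp ?_ hfin
  simp only [← mul_mk]
  rw [← hX1, ← hX2, ← hX3]
  group

end

section

variable {C : SC α} {L : ℕ} (hL : ∀ r ∈ C.R, r.length ≤ L) {Ω : Om C} {T : ℝ}

lemma SC.Agree.mono {m n : ℕ} {g h k : C.Grp} (H : C.Agree hL T m g h k) (hmn : m ≤ n) :
    C.Agree hL T n g h k := by
  intro x hx
  refine H x (le_trans ?_ hx)
  gcongr

/-- All triangles of the fan over a product agree. -/
def SC.Fan (T : ℝ) (m : ℕ) (g g' : C.Grp) : Prop :=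
  C.Agree hL T m 1 g' g ∧ C.Agree hL T m g 1 g' ∧ C.Agree hL T m g' g 1

variable {k : ℕ} {b : Fin k → C.Grp}

lemma SC.area_fan (h0 : (1 / 2) ^ 15 < T) (hT : T ≤ 2 * (1 / 2) ^ 15) {E m : ℕ}
    (hE : 24 * L + 8 ≤ E * C.η) (l : List (Fin k × Bool)) (g : C.Grp)
    (H : ∀ l1 x l2, l = l1 ++ x :: l2 → C.Fan hL T m (g * FreeGroup.lift b (FreeGroup.mk l1))
      (g * FreeGroup.lift b (FreeGroup.mk (l1 ++ [x])))) :
    C.Ar (l.length * areaBound E m) (FreeGroup.mk (C.tr hL Ω T 1 g) *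
      FreeGroup.lift (fun i => FreeGroup.mk (C.tr hL Ω T 1 (b i))) (FreeGroup.mk l) *
      FreeGroup.mk (C.tr hL Ω T (g * FreeGroup.lift b (FreeGroup.mk l)) 1)) := by
  induction l generalizing g with
  | nil =>
    rw [← one_eq_mk, _root_.map_one, _root_.map_one, mul_one, mul_one, SC.tr_symm hL hT 1 g,
      ← inv_mk, mul_inv_cancel]
    exact SC.Ar.one
  | cons x l ih =>
    obtain ⟨a, ha⟩ : ∃ a, a = FreeGroup.lift b (FreeGroup.mk [x]) := ⟨_, rfl⟩
    have hx : FreeGroup.lift (fun i => FreeGroup.mk (C.tr hL Ω T 1 (b i))) (FreeGroup.mk [x]) =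
        FreeGroup.mk (C.tr hL Ω T g (g * a)) := by
      have h1 := SC.tr_left hL (Ω := Ω) hT g 1 a
      rw [mul_one] at h1
      rw [h1, ha]
      obtain ⟨i, e⟩ := x
      cases e
      · have h2 := SC.tr_left hL (Ω := Ω) hT (b i) 1 (b i)⁻¹
        rw [mul_inv_cancel, mul_one, SC.tr_symm hL hT 1 (b i)] at h2
        simp [inv_mk, h2]
      · simp
    have hcons : ∀ s : List (Fin k × Bool), FreeGroup.mk (x :: s) = FreeGroup.mk [x] *
        FreeGroup.mk s := fun s => rfl
    have h1 := H [] x l rfl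
    rw [nil_append, ← one_eq_mk, _root_.map_one, mul_one, ← ha] at h1
    have h2 := SC.area_triangle hL hT (Ω := Ω) h0 hE h1.1 h1.2.1 h1.2.2
    have h3 := ih (g * a) (fun l1 y l2 he => by
      have := H (x :: l1) y l2 (by rw [he]; rfl)
      rw [cons_append, hcons l1, hcons (l1 ++ [y]), _root_.map_mul, _root_.map_mul, ← ha, ← mul_assoc,
        ← mul_assoc] at this
      exact this)
    have h4 := (h2.mul h3).mono (n := (x :: l).length * areaBound E m) (by
      rw [length_cons, add_mul, one_mul, add_comm])
    refine Eq.mp ?_ h4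
    rw [hcons l, _root_.map_mul, _root_.map_mul, hx, ← ha, SC.tr_symm hL hT 1 (g * a),
      ← inv_mk, ← mul_assoc g a]
    group

/-- Every solution of a system lifts to a tuple at which the words of the system are products
of boundedly many conjugates of relators. -/
theorem SC.exists_lift_ar (C : SC α) {L : ℕ} (hL : ∀ r ∈ C.R, r.length ≤ L) {E : ℕ}
    (hE : 24 * L + 8 ≤ E * C.η) (V : Finset (FreeGroup (Fin k))) (b : Fin k → C.Grp)
    (hb : ∀ w ∈ V, FreeGroup.lift b w = 1) :
    ∃ c : Fin k → FreeGroup α, (∀ i, C.pr (c i) = b i) ∧ ∀ w ∈ V,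
      C.Ar ((∑ w ∈ V, w.toWord.length) *
        areaBound E (3 * (∑ w ∈ V, w.toWord.length) * (2 * E + 1) + 20)) (FreeGroup.lift c w) := by
  classical
  obtain ⟨Ω⟩ := C.exists_om
  obtain ⟨W, hW⟩ : ∃ W, W = ∑ w ∈ V, w.toWord.length := ⟨_, rfl⟩
  obtain ⟨f, hf⟩ : ∃ f : FreeGroup (Fin k) → ℕ → C.Grp, ∀ w j,
      f w j = FreeGroup.lift b (FreeGroup.mk (w.toWord.take j)) := ⟨_, fun _ _ => rfl⟩
  obtain ⟨Tr, hTrd⟩ : ∃ Tr : Finset (C.Grp × C.Grp × C.Grp), Tr = V.biUnion fun w =>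
    (Finset.range w.toWord.length).biUnion fun j => {(1, f w (j + 1), f w j),
      (f w j, 1, f w (j + 1)), (f w (j + 1), f w j, 1)} := ⟨_, rfl⟩
  have hTr : Tr.card ≤ 3 * W := by
    rw [hTrd, hW, mul_sum]
    refine card_biUnion_le.trans (Finset.sum_le_sum fun w _ => ?_)
    refine (card_biUnion_le_card_mul _ _ 3 fun j _ => card_le_three).trans ?_
    rw [card_range, mul_comm]
  obtain ⟨T, h0, hT, HT⟩ := (C.geom hL).exists_threshold Tr hTr
  obtain ⟨m, hme⟩ : ∃ m, m = 3 * W * (2 * E + 1) + 20 := ⟨_, rfl⟩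
  have hm : 3 * W * (C.geom hL).P + 20 ≤ m := by
    have := SC.geom_P_le hL hE
    rw [hme]
    gcongr
  refine ⟨fun i => FreeGroup.mk (C.tr hL Ω T 1 (b i)), fun i => ?_, fun w hw => ?_⟩
  · have := SC.ev_tr hL (Ω := Ω) (T := T) 1 (b i)
    rwa [one_mul] at this
  · have hag : ∀ t ∈ Tr, C.Agree hL T m t.1 t.2.1 t.2.2 :=
      fun t ht => SC.Agree.mono hL (fun x hx => HT t ht x hx) hm
    have hfan : ∀ l1 x l2, w.toWord = l1 ++ x :: l2 →
        C.Fan hL T m (1 * FreeGroup.lift b (FreeGroup.mk l1))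
          (1 * FreeGroup.lift b (FreeGroup.mk (l1 ++ [x]))) := by
      intro l1 x l2 he
      have hlt : l1.length < w.toWord.length := by rw [he]; simp
      have e1 : f w l1.length = FreeGroup.lift b (FreeGroup.mk l1) := by
        rw [hf, he, take_left]
      have e2 : f w (l1.length + 1) = FreeGroup.lift b (FreeGroup.mk (l1 ++ [x])) := by
        grind
      rw [one_mul, one_mul, ← e1, ← e2]
      have hmem : ∀ t, t ∈ ({(1, f w (l1.length + 1), f w l1.length),
          (f w l1.length, 1, f w (l1.length + 1)),
          (f w (l1.length + 1), f w l1.length, 1)} : Finset (C.Grp × C.Grp × C.Grp)) → t ∈ Tr :=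
        fun t ht => hTrd ▸ mem_biUnion.2 ⟨w, hw, mem_biUnion.2
          ⟨l1.length, Finset.mem_range.2 hlt, ht⟩⟩
      exact ⟨hag (1, f w (l1.length + 1), f w l1.length) (hmem _ (by simp)),
        hag (f w l1.length, 1, f w (l1.length + 1)) (hmem _ (by simp)),
        hag (f w (l1.length + 1), f w l1.length, 1) (hmem _ (by simp))⟩
    have h1 := SC.area_fan hL (Ω := Ω) h0 hT hE w.toWord 1 hfan
    have h11 : FreeGroup.mk (C.tr hL Ω T 1 1) = 1 := by
      have h2 : (FreeGroup.mk (C.tr hL Ω T 1 1)) ^ 2 = 1 := by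
        rw [sq, mul_eq_one_iff_eq_inv, inv_mk, ← SC.tr_symm hL hT 1 1]
      exact (pow_eq_one_iff_left two_ne_zero).1 h2
    rw [mk_toWord, hb w hw, mul_one, h11, one_mul, mul_one] at h1
    rw [← hW, ← hme]
    refine h1.mono (Nat.mul_le_mul_right _ ?_)
    rw [hW]
    exact Finset.single_le_sum (f := fun w => w.toWord.length) (fun _ _ => Nat.zero_le _) hw

end

/-- An interval translation `x ↦ x + t` on `a ≤ x < b`, acting on signed positions: the position
opposite to `x` is `-1 - x`. -/
structure Base where
  a : ℤ
  b : ℤ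
  t : ℤ

namespace Base

def Rel (β : Base) (x y : ℤ) : Prop :=
  (β.a ≤ x ∧ x < β.b ∧ y = x + β.t) ∨ (β.a ≤ -1 - x ∧ -1 - x < β.b ∧ y = x - β.t)

lemma Rel.bar {β : Base} {x y : ℤ} (h : β.Rel x y) : β.Rel (-1 - x) (-1 - y) := by
  unfold Rel at *; omega

def Bd (M : ℤ) (β : Base) : Prop :=
  ∀ x, β.a ≤ x → x < β.b → -M ≤ x ∧ x < M ∧ -M ≤ x + β.t ∧ x + β.t < M

/-- The last position `e` is moved. -/
def Top (e : ℤ) (β : Base) : Prop := β.b = e + 1 ∧ β.a ≤ e ∧ β.t < 0 ∧ -e - 1 < β.a + β.t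

lemma exists_normal {e : ℤ} {β : Base} (h : β.Bd (e + 1)) (hfix : ∀ x, ¬ β.Rel x (-1 - x)) :
    ∃ β' : Base, (β'.Bd e ∨ β'.Top e) ∧ (∀ x y, β.Rel x y → x = y ∨ β'.Rel x y ∨ β'.Rel y x) ∧
      ∀ x y, β'.Rel x y → β.Rel x y ∨ β.Rel y x := by
  obtain ⟨a, b, t⟩ := β
  by_cases hab : b ≤ a
  · exact ⟨⟨0, 0, 0⟩, Or.inl fun x h1 h2 => by grind,
      fun x y hxy => by simp only [Rel] at hxy; omega,
      fun x y hxy => by simp only [Rel] at hxy; omega⟩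
  have h1 := h a le_rfl (by grind)
  have h2 := h (b - 1) (by grind) (by simp)
  simp only at h1 h2
  by_cases ht : t = 0
  · exact ⟨⟨0, 0, 0⟩, Or.inl fun x h1 h2 => by grind,
      fun x y hxy => by simp only [Rel] at hxy; omega,
      fun x y hxy => by simp only [Rel] at hxy; omega⟩
  have key : ∀ a b t : ℤ, a < b → b = e + 1 → t < 0 → -e - 1 ≤ a + t →
      (∀ x, ¬ Rel ⟨a, b, t⟩ x (-1 - x)) →
      ∃ β' : Base, β'.Top e ∧ (∀ x y, Rel ⟨a, b, t⟩ x y → β'.Rel x y ∨ β'.Rel y x) ∧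
      ∀ x y, β'.Rel x y → Rel ⟨a, b, t⟩ x y := by
    intro a b t k1 k2 k3 k4 k5
    by_cases k6 : -e - 1 = a + t
    · have k7 : ¬ (e + a) % 2 = 0 := fun k7 => k5 ((e + a) / 2) (by simp only [Rel]; omega)
      refine ⟨⟨(e + 1 + a) / 2, e + 1, t⟩, ⟨rfl, ?_, k3, ?_⟩, fun x y hxy => ?_, fun x y hxy => ?_⟩
      · grind
      · grind
      · simp only [Rel] at hxy ⊢; omega
      · simp only [Rel] at hxy ⊢; omega
    · exact ⟨⟨a, b, t⟩, ⟨k2, by grind, k3, by grind⟩,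
        fun x y hxy => Or.inl hxy, fun x y hxy => hxy⟩
  by_cases c1 : b = e + 1
  · grind
  by_cases c2 : b + t = e + 1
  · obtain ⟨β', g1, g2, g3⟩ := key (a + t) (b + t) (-t) (by omega) c2 (by omega) (by omega)
      (fun x hx => hfix (-1 - x) (by simp only [Rel] at hx ⊢; omega))
    refine ⟨β', Or.inr g1, fun x y hxy => Or.inr (g2 y x ?_).symm, fun x y hxy =>
      Or.inr ?_⟩
    · simp only [Rel] at hxy ⊢; omega
    · have := g3 x y hxy
      simp only [Rel] at this ⊢; omega
  by_cases c3 : a = -e - 1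
  · obtain ⟨β', g1, g2, g3⟩ := key (-b) (-a) (-t) (by omega) (by omega) (by omega) (by omega)
      (fun x hx => hfix x (by simp only [Rel] at hx ⊢; omega))
    refine ⟨β', Or.inr g1, fun x y hxy => Or.inr (g2 x y ?_), fun x y hxy =>
      Or.inl ?_⟩
    · simp only [Rel] at hxy ⊢; omega
    · have := g3 x y hxy
      simp only [Rel] at this ⊢; omega
  by_cases c4 : a + t = -e - 1
  · obtain ⟨β', g1, g2, g3⟩ := key (-(b + t)) (-(a + t)) t (by omega) (by omega) (by omega) (by omega)
      (fun x hx => hfix (-1 - x) (by simp only [Rel] at hx ⊢; omega))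
    refine ⟨β', Or.inr g1, fun x y hxy => Or.inr (g2 y x ?_).symm, fun x y hxy =>
      Or.inr ?_⟩
    · simp only [Rel] at hxy ⊢; omega
    · have := g3 x y hxy
      simp only [Rel] at this ⊢; omega
  refine ⟨⟨a, b, t⟩, Or.inl fun x k1 k2 => ?_, fun x y hxy => Or.inr (Or.inl hxy),
    fun x y hxy => Or.inl hxy⟩
  grind

end Base

variable {ι : Type*}

/-- The equivalence relation generated by a family of bases. -/
def Cl (B : ι → Base) : ℤ → ℤ → Prop := Relation.EqvGen fun x y => ∃ i, (B i).Rel x y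

namespace Cl

variable {B B' : ι → Base} {x y z : ℤ}

lemma of (i : ι) (h : (B i).Rel x y) : Cl B x y := Relation.EqvGen.rel _ _ ⟨i, h⟩

lemma refl (x : ℤ) : Cl B x x := Relation.EqvGen.refl x

lemma symm (h : Cl B x y) : Cl B y x := Relation.EqvGen.symm _ _ h

lemma trans (h : Cl B x y) (h' : Cl B y z) : Cl B x z := Relation.EqvGen.trans _ _ _ h h'

lemma bar (h : Cl B x y) : Cl B (-1 - x) (-1 - y) := by
  induction h with
  | rel x y h => obtain ⟨i, h⟩ := h; exact of i h.bar
  | refl x => exact refl _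
  | symm x y _ ih => exact ih.symm
  | trans x y z _ _ h1 h2 => exact h1.trans h2

lemma map (f : ℤ → ℤ) {ι' : Type*} {B' : ι' → Base} (H : ∀ i x y, (B i).Rel x y → Cl B' (f x) (f y))
    (h : Cl B x y) : Cl B' (f x) (f y) := by
  induction h with
  | rel x y h => grind
  | refl x => exact refl _
  | symm x y _ ih => exact ih.symm
  | trans x y z _ _ h1 h2 => exact h1.trans h2

end Cl

/-- Elimination of the last position. -/
lemma exists_elim_one [Finite ι] {e : ℤ} {B : ι → Base} (h : ∀ i, (B i).Bd (e + 1))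
    (hfix : ∀ x, ¬ Cl B x (-1 - x)) :
    ∃ B' : ι → Base, (∀ i, (B' i).Bd e) ∧ (∀ x y, Cl B' x y → Cl B x y) ∧
      ∀ x y, -e ≤ x → x < e → -e ≤ y → y < e → Cl B x y → Cl B' x y := by
  classical
  have := Fintype.ofFinite ι
  choose N h1 h2 h3 using fun i => Base.exists_normal (h i) fun x hx => hfix x (Cl.of i hx)
  have hN : ∀ i x y, (N i).Rel x y → Cl B x y := fun i x y hxy =>
    (h3 i x y hxy).elim (Cl.of i) fun h => (Cl.of i h).symm
  by_cases htop : ∃ i, (N i).Top e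
  · obtain ⟨i0, hi0, hmin⟩ := (univ.filter fun i => (N i).Top e).exists_min_image
      (fun i => (N i).a) ⟨htop.choose, by simpa using htop.choose_spec⟩
    replace hi0 : (N i0).Top e := by simpa using hi0
    replace hmin : ∀ i, (N i).Top e → (N i0).a ≤ (N i).a := fun i hi => hmin i (by simpa using hi)
    obtain ⟨a0, t0⟩ : ∃ a0, a0 = (N i0).a := ⟨_, rfl⟩
    obtain ⟨t0', ht0⟩ : ∃ t, t = (N i0).t := ⟨_, rfl⟩
    have k1 := hi0.1
    have k2 := hi0.2.1
    have k3 := hi0.2.2.1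
    have k4 := hi0.2.2.2
    rw [← t0] at hmin k2 k4
    rw [← ht0] at k3 k4
    have hcar : ∀ x, a0 ≤ x → x ≤ e → Cl B x (x + t0') := fun x g1 g2 =>
      hN i0 _ _ (Or.inl ⟨by omega, by omega, by omega⟩)
    obtain ⟨B', hB'⟩ : ∃ B' : ι → Base, B' = fun i => if i = i0 then ⟨a0, e, t0'⟩ else
      if (N i).Top e then ⟨(N i).a + t0', e + 1 + t0', (N i).t - t0'⟩ else N i := ⟨_, rfl⟩
    have b1 : B' i0 = ⟨a0, e, t0'⟩ := by rw [hB']; simp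
    have b2 : ∀ i, i ≠ i0 → (N i).Top e → B' i = ⟨(N i).a + t0', e + 1 + t0', (N i).t - t0'⟩ := by
      intro i g1 g2
      grind
    have b3 : ∀ i, ¬ (N i).Top e → B' i = N i := by
      intro i g1
      grind
    have hbar : ∀ {B : ι → Base} {x y : ℤ}, Cl B (-1 - x) (-1 - y) → Cl B x y := fun {B x y} g => by
      have := g.bar
      simpa using this
    refine ⟨B', fun i => ?_, fun x y hxy => ?_, fun x y x1 x2 y1 y2 hxy => ?_⟩
    · by_cases g1 : i = i0
      · rw [g1, b1]
        intro x g2 g3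
        simp only at g2 g3 ⊢
        omega
      by_cases g2 : (N i).Top e
      · rw [b2 i g1 g2]
        intro x g3 g4
        have := hmin i g2
        obtain ⟨m1, m2, m3, m4⟩ := g2
        simp only at g3 g4 ⊢
        omega
      · grind
    · refine Cl.map id (fun i x y hxy => ?_) hxy
      by_cases g1 : i = i0
      · rw [g1, b1] at hxy
        rcases hxy with ⟨p1, p2, p3⟩ | ⟨p1, p2, p3⟩ <;> simp only at p1 p2 p3
        · rw [p3]; grind
        · refine hbar ?_
          have := hcar (-1 - x) p1 (by omega)
          rw [p3]
          grind
      by_cases g2 : (N i).Top e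
      · rw [b2 i g1 g2] at hxy
        have m := hmin i g2
        have key : ∀ x y, (N i).a + t0' ≤ x → x < e + 1 + t0' → y = x + ((N i).t - t0') →
            Cl B x y := by
          intro x y p1 p2 p3
          have q1 := hcar (x - t0') (by omega) (by omega)
          have q2 := hN i (x - t0') y (Or.inl ⟨by omega, by rw [g2.1]; omega, by omega⟩)
          rw [sub_add_cancel] at q1
          exact q1.symm.trans q2
        rcases hxy with ⟨p1, p2, p3⟩ | ⟨p1, p2, p3⟩ <;> simp only at p1 p2 p3
        · exact key x y p1 p2 p3
        · grind
      · grind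
    · obtain ⟨φ, hφ⟩ : ∃ φ : ℤ → ℤ, φ = fun x => if x = e then e + t0' else
        if x = -1 - e then -1 - (e + t0') else x := ⟨_, rfl⟩
      have f1 : φ e = e + t0' := by rw [hφ]; simp
      have f2 : φ (-1 - e) = -1 - (e + t0') := by
        rw [hφ]
        grind
      have f3 : ∀ x, x ≠ e → x ≠ -1 - e → φ x = x := fun x g1 g2 => by rw [hφ]; simp [g1, g2]
      have f4 : ∀ x, φ (-1 - x) = -1 - φ x := by
        intro x
        grind
      have hcar' : ∀ x, a0 ≤ x → x < e → Cl B' x (x + t0') := fun x g1 g2 =>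
        Cl.of i0 (by rw [b1]; exact Or.inl ⟨g1, g2, rfl⟩)
      have pos : ∀ i x y, (N i).a ≤ x → x < (N i).b → y = x + (N i).t → Cl B' (φ x) (φ y) := by
        intro i x y p1 p2 p3
        by_cases g2 : (N i).Top e
        · have m := hmin i g2
          have g3 := g2
          obtain ⟨m1, m2, m3, m4⟩ := g3
          have fy : φ y = y := f3 y (by omega) (by omega)
          have step : Cl B' (x + t0') y := by
            by_cases g1 : i = i0
            · subst g1
              rw [p3, ht0]; exact Cl.refl _
            · refine Cl.of i ?_
              rw [b2 i g1 g2]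
              exact Or.inl ⟨by simp only; omega, by simp only; omega, by simp only; omega⟩
          rw [fy]
          by_cases hx : x = e
          · rw [hx, f1]; grind
          · rw [f3 x hx (by omega)]
            exact (hcar' x (by omega) (by omega)).trans step
        · have g3 := (h1 i).resolve_right g2 x p1 p2
          rw [f3 x (by omega) (by omega), f3 y (by omega) (by omega)]
          refine Cl.of i ?_
          rw [b3 i g2]
          exact Or.inl ⟨p1, p2, p3⟩
      have all : ∀ i x y, (N i).Rel x y → Cl B' (φ x) (φ y) := by
        intro i x y hxy
        rcases hxy with ⟨p1, p2, p3⟩ | ⟨p1, p2, p3⟩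
        · exact pos i x y p1 p2 p3
        · grind
      have hfin : Cl B' (φ x) (φ y) := by
        refine Cl.map φ (fun i x y hxy => ?_) hxy
        rcases h2 i x y hxy with g | g | g
        · rw [g]; exact Cl.refl _
        · exact all i x y g
        · exact (all i y x g).symm
      rwa [f3 x (by omega) (by omega), f3 y (by omega) (by omega)] at hfin
  · refine ⟨N, fun i => (h1 i).resolve_right fun g => htop ⟨i, g⟩, fun x y hxy =>
      Cl.map id (fun i x y g => hN i x y g) hxy, fun x y _ _ _ _ hxy => ?_⟩
    refine Cl.map id (fun i x y g => ?_) hxy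
    rcases h2 i x y g with g | g | g
    · exact g ▸ Cl.refl _
    · exact Cl.of i g
    · exact (Cl.of i g).symm

/-- Elimination of all positions beyond `e`. -/
lemma exists_elim [Finite ι] {e : ℤ} (k : ℕ) {B : ι → Base} (h : ∀ i, (B i).Bd (e + k))
    (hfix : ∀ x, ¬ Cl B x (-1 - x)) :
    ∃ B' : ι → Base, (∀ i, (B' i).Bd e) ∧ (∀ x y, Cl B' x y → Cl B x y) ∧
      ∀ x y, -e ≤ x → x < e → -e ≤ y → y < e → Cl B x y → Cl B' x y := by
  induction k generalizing B with
  | zero => exact ⟨B, by grind, fun _ _ h => h, fun _ _ _ _ _ _ h => h⟩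
  | succ k ih =>
    obtain ⟨B1, h1, h2, h3⟩ := exists_elim_one (e := e + k) (B := B)
      (by grind) hfix
    obtain ⟨B2, k1, k2, k3⟩ := ih h1 (fun x hx => hfix x (h2 _ _ hx))
    exact ⟨B2, k1, fun x y hxy => h2 x y (k2 x y hxy), fun x y g1 g2 g3 g4 hxy =>
      k3 x y g1 g2 g3 g4 (h3 x y (by omega) (by omega) (by omega) (by omega) hxy)⟩

/-- The word read along the interval of length `n` starting at `a`. -/
def wd (lab : ℤ → α × Bool) (a : ℤ) (n : ℕ) : Word α :=
  (List.range n).map fun i : ℕ => lab (a + i)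

/-- The product of the values along the interval of length `n` starting at `a`. -/
def val {H : Type} [Group H] (ψ : ℤ → H) (a : ℤ) (n : ℕ) : H :=
  ((List.range n).map fun i : ℕ => ψ (a + i)).prod

section
variable {H : Type} [Group H] {ψ : ℤ → H} {lab : ℤ → α × Bool}

@[simp] lemma val_zero (a : ℤ) : val ψ a 0 = 1 := rfl

lemma val_add (a : ℤ) (n m : ℕ) : val ψ a (n + m) = val ψ a n * val ψ (a + n) m := by
  simp only [val, List.range_add, map_append, prod_append, List.map_map]
  congr 2
  refine map_congr_left fun i _ => ?_
  simp [add_assoc]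

lemma val_one (a : ℤ) : val ψ a 1 = ψ a := by simp [val]

lemma wd_add (a : ℤ) (n m : ℕ) : wd lab a (n + m) = wd lab a n ++ wd lab (a + n) m := by
  simp only [wd, List.range_add, map_append, List.map_map]
  congr 1
  refine map_congr_left fun i _ => ?_
  simp [add_assoc]

lemma wd_one (a : ℤ) : wd lab a 1 = [lab a] := by simp [wd]

@[simp] lemma length_wd (a : ℤ) (n : ℕ) : (wd lab a n).length = n := by simp [wd]

lemma mk_wd (a : ℤ) (n : ℕ) : mk (wd lab a n) = val (fun x => mk [lab x]) a n := by
  induction n with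
  | zero => rfl
  | succ n ih => rw [wd_add, val_add, ← mul_mk, ih, wd_one, val_one]

lemma val_cancel {b c : ℤ} (s : ℕ) (h : ∀ i < s, ψ (c + i) = (ψ (b - 1 - i))⁻¹) :
    val ψ (b - s) s * val ψ c s = 1 := by
  induction s with
  | zero => simp
  | succ s ih =>
    have h1 : val ψ (b - (s + 1 : ℕ)) (s + 1) = ψ (b - 1 - s) * val ψ (b - s) s := by
      rw [add_comm s 1, val_add, val_one]
      grind
    rw [h1, val_add, val_one, h s (by omega), mul_assoc, ← mul_assoc (val ψ (b - s) s),
      ih fun i hi => h i (by omega)]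
    simp

/-- Two occurrences of a word and its inverse. -/
def Base.Ok (M : ℤ) (lab : ℤ → α × Bool) (β : Base) : Prop :=
  β.Bd M ∧ ∀ x y, β.Rel x y → lab x = lab y

/-- The equations expressed by a list of bases. -/
structure Resp (Bs : List Base) (ψ : ℤ → H) : Prop where
  bar : ∀ x, ψ (-1 - x) = (ψ x)⁻¹
  rel : ∀ β ∈ Bs, ∀ x y, β.Rel x y → ψ x = ψ y

def flat (lab : ℤ → α × Bool) (S : List (ℤ × ℕ)) : Word α := S.flatMap fun I => wd lab I.1 I.2

structure Stack (M : ℤ) (lab : ℤ → α × Bool) (S : List (ℤ × ℕ)) : Prop where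
  pos : ∀ I ∈ S, 0 < I.2
  bd : ∀ I ∈ S, -M ≤ I.1 ∧ I.1 + I.2 ≤ M
  red : IsReduced (flat lab S)

lemma red_of_junction {u v : ℤ} {p q : ℕ} {w : Word α} (hp : 0 < p) (hq : 0 < q)
    (h1 : IsReduced (wd lab u p)) (h2 : IsReduced (wd lab v q ++ w))
    (h3 : lab v ≠ linv (lab (u + p - 1))) : IsReduced (wd lab u p ++ (wd lab v q ++ w)) := by
  refine isReduced_append_iff.2 ⟨h1, h2, fun p' l q' m e1 e2 => ?_⟩
  obtain ⟨p, rfl⟩ : ∃ k, p = k + 1 := ⟨p - 1, by omega⟩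
  obtain ⟨q, rfl⟩ : ∃ k, q = 1 + k := ⟨q - 1, by omega⟩
  rw [wd_add, wd_one] at e1 e2
  have e3 := append_inj_right' e1 rfl
  grind

lemma Stack.push {M : ℤ} {S : List (ℤ × ℕ)} (hS : Stack M lab S)
    (hlab : ∀ x, lab (-1 - x) = linv (lab x)) {a : ℤ} {n : ℕ} (hn : 0 < n) (h0 : -M ≤ a ∧ a + n ≤ M)
    (hr : IsReduced (wd lab a n)) :
    ∃ S' Bs, Stack M lab S' ∧ Bs.length + S'.length ≤ S.length + 2 ∧ (∀ β ∈ Bs, β.Ok M lab) ∧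
      ∀ ψ : ℤ → FreeGroup α, Resp Bs ψ →
        (S'.map fun I => val ψ I.1 I.2).prod = val ψ a n * (S.map fun I => val ψ I.1 I.2).prod := by
  induction S generalizing n with
  | nil => exact ⟨[(a, n)], [], ⟨by grind, by grind, by simpa [flat] using hr⟩,
      by simp, by simp, fun ψ _ => by simp⟩
  | cons J T ih =>
    obtain ⟨c, m⟩ := J
    have hc := hS.bd _ List.mem_cons_self
    have hred : IsReduced (wd lab c m ++ flat lab T) := by simpa [flat] using hS.red
    have hT : Stack M lab T := ⟨fun I hI => hS.pos I (by simp [hI]), fun I hI => hS.bd I (by simp [hI]),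
      (isReduced_append_iff.1 hred).2.1⟩
    obtain ⟨s, ⟨s1, s2, s3⟩, hmax⟩ : ∃ s : ℕ, (s ≤ n ∧ s ≤ m ∧
        ∀ i < s, lab (c + i) = linv (lab (a + n - 1 - i))) ∧
        (s < n → s < m → lab (c + s) ≠ linv (lab (a + n - 1 - s))) := by
      classical
      have hP : ∃ s : ℕ, ¬ (s < n ∧ s < m ∧ lab (c + s) = linv (lab (a + n - 1 - s))) :=
        ⟨n, by simp⟩
      have h1 := Nat.find_spec hP
      have h2 : ∀ i < Nat.find hP, _ := fun i hi => not_not.1 (Nat.find_min hP hi)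
      refine ⟨Nat.find hP, ⟨?_, ?_, fun i hi => (h2 i hi).2.2⟩, fun g1 g2 g3 => h1 ⟨g1, g2, g3⟩⟩
      · grind
      grind
    obtain ⟨n', rfl⟩ : ∃ k, n = k + s := ⟨n - s, by omega⟩
    obtain ⟨m', rfl⟩ : ∃ k, m = s + k := ⟨m - s, by omega⟩
    obtain ⟨β, hβ⟩ : ∃ β : Base, β = ⟨c, c + s, -(a + (n' + s : ℕ)) - c⟩ := ⟨_, rfl⟩
    have hok : β.Ok M lab := by
      subst hβ
      have hi : ∀ z, c ≤ z → z < c + s → lab z = lab (z + (-(a + (n' + s : ℕ)) - c)) := by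
        intro z g1 g2
        have := s3 (z - c).toNat (by omega)
        grind
      refine ⟨fun x h1 h2 => by simp only at h1 h2 ⊢; omega, fun x y hxy => ?_⟩
      rcases hxy with ⟨h1, h2, h3⟩ | ⟨h1, h2, h3⟩
      · rw [h3]; exact hi x h1 h2
      · have := congrArg linv (hi _ h1 h2)
        rw [← hlab, ← hlab] at this
        grind
    have hval : ∀ Bs, β ∈ Bs → ∀ ψ : ℤ → FreeGroup α, Resp Bs ψ → ∀ g,
        val ψ a (n' + s) * (val ψ c (s + m') * g) = val ψ a n' * (val ψ (c + s) m' * g) := by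
      intro Bs hBs ψ hψ g
      have h1 := val_cancel (ψ := ψ) (b := a + n' + s) (c := c) s fun i hi => by
        rw [← hψ.bar]
        refine hψ.rel β hBs _ _ (Or.inl ?_)
        grind
      rw [show a + n' + (s : ℤ) - s = a + n' by ring] at h1
      rw [val_add, val_add, mul_assoc, mul_assoc, ← mul_assoc (val ψ (a + n') s), h1, one_mul]
    have hI : IsReduced (wd lab a n') := by
      rw [wd_add] at hr; exact (isReduced_append_iff.1 hr).1
    have hJ : IsReduced (wd lab (c + s) m' ++ flat lab T) := by
      rw [wd_add, append_assoc] at hred; exact (isReduced_append_iff.1 hred).2.1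
    rcases Nat.eq_zero_or_pos m' with rfl | hm'
    · rcases Nat.eq_zero_or_pos n' with rfl | hn'
      · exact ⟨T, [β], hT, by simp; omega, by simpa using hok, fun ψ hψ => by
          simp only [List.map_cons, List.prod_cons]; rw [hval [β] (by simp) ψ hψ]; simp⟩
      · obtain ⟨S', Bs, k1, k2, k3, k4⟩ := ih hT hn' (by omega) hI
        refine ⟨S', β :: Bs, k1, by simp; omega, by simpa using ⟨hok, k3⟩, fun ψ hψ => ?_⟩
        rw [k4 ψ ⟨hψ.bar, fun β' h => hψ.rel β' (by simp [h])⟩]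
        rw [List.map_cons, List.prod_cons, hval (β :: Bs) (by simp) ψ hψ]; simp
    · have hJS : Stack M lab ((c + s, m') :: T) :=
        ⟨by simpa using ⟨hm', fun a b => hT.pos (a, b)⟩, fun I hI => by
          rcases List.mem_cons.1 hI with rfl | h
          · grind
          · exact hT.bd I h, by simpa [flat] using hJ⟩
      rcases Nat.eq_zero_or_pos n' with rfl | hn'
      · exact ⟨(c + s, m') :: T, [β], hJS, by simp; omega, by simpa using hok, fun ψ hψ => by
          simp only [List.map_cons, List.prod_cons]; rw [hval [β] (by simp) ψ hψ]; simp⟩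
      · refine ⟨(a, n') :: (c + s, m') :: T, [β], ⟨?_, ?_, ?_⟩, by simp; omega,
          by simpa using hok, fun ψ hψ => by
            grind⟩
        · intro I hI
          rcases List.mem_cons.1 hI with rfl | h
          · exact hn'
          · exact hJS.pos I h
        · intro I hI
          rcases List.mem_cons.1 hI with rfl | h
          · grind
          · exact hJS.bd I h
        · have := red_of_junction (w := flat lab T) hn' hm' hI hJ (by
            grind)
          simpa [flat] using this

/-- A product of words that is trivial in the free group is trivial by virtue of a bounded number of
matchings of inverse subwords. -/
lemma exists_bases {M : ℤ} (hlab : ∀ x, lab (-1 - x) = linv (lab x)) (Is : List (ℤ × ℕ))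
    (hM : ∀ I ∈ Is, -M ≤ I.1 ∧ I.1 + I.2 ≤ M) (hr : ∀ I ∈ Is, IsReduced (wd lab I.1 I.2))
    (h1 : (Is.map fun I => val (fun x => mk [lab x]) I.1 I.2).prod = 1) :
    ∃ Bs : List Base, Bs.length ≤ 2 * Is.length ∧ (∀ β ∈ Bs, β.Ok M lab) ∧
      ∀ ψ : ℤ → FreeGroup α, Resp Bs ψ → (Is.map fun I => val ψ I.1 I.2).prod = 1 := by
  have key : ∃ S Bs, Stack M lab S ∧ Bs.length + S.length ≤ 2 * Is.length ∧
      (∀ β ∈ Bs, β.Ok M lab) ∧ ∀ ψ : ℤ → FreeGroup α, Resp Bs ψ →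
        (S.map fun I => val ψ I.1 I.2).prod = (Is.map fun I => val ψ I.1 I.2).prod := by
    clear h1
    induction Is with
    | nil => exact ⟨[], [], ⟨by simp, by simp, by simp [flat]⟩, by simp, by simp, by simp⟩
    | cons I Is ih =>
      obtain ⟨S, Bs, k1, k2, k3, k4⟩ := ih (fun I h => hM I (by simp [h])) fun I h => hr I (by simp [h])
      rcases Nat.eq_zero_or_pos I.2 with h0 | h0
      · exact ⟨S, Bs, k1, by simp; omega, k3, fun ψ hψ => by simp [h0, k4 ψ hψ]⟩
      obtain ⟨S', Bs', l1, l2, l3, l4⟩ := k1.push hlab h0 (hM I (by simp)) (hr I (by simp))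
      refine ⟨S', Bs ++ Bs', l1, by simp; omega, fun β h => (mem_append.1 h).elim (k3 β) (l3 β),
        fun ψ hψ => ?_⟩
      rw [l4 ψ ⟨hψ.bar, fun β h => hψ.rel β (by simp [h])⟩,
        k4 ψ ⟨hψ.bar, fun β h => hψ.rel β (by simp [h])⟩]
      simp
  obtain ⟨S, Bs, k1, k2, k3, k4⟩ := key
  have h2 := k4 (fun x => mk [lab x]) ⟨fun x => by rw [hlab]; simp [invRev, linv],
    fun β h x y hxy => by rw [(k3 β h).2 x y hxy]⟩
  have h3 : mk (flat lab S) = 1 := by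
    rw [← h1, ← h2]
    clear * -
    induction S with
    | nil => rfl
    | cons I S ih =>
      simp only [flat, flatMap_cons, List.map_cons, List.prod_cons, ← mul_mk, mk_wd] at ih ⊢
      rw [ih]
  have h4 : flat lab S = [] := by
    classical
    have := congrArg toWord h3
    rwa [toWord_mk, k1.red.reduce_eq, toWord_one] at this
  have h5 : S = [] := by
    rcases S with _ | ⟨I, S⟩
    · rfl
    · have := k1.pos I (by simp)
      have := congrArg length h4
      simp [flat] at this
      omega
  grind

end

lemma val_congr {H : Type} [Group H] {ψ ψ' : ℤ → H} {a b : ℤ} {n : ℕ}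
    (h : ∀ i : ℕ, i < n → ψ (a + i) = ψ' (b + i)) : val ψ a n = val ψ' b n :=
  congrArg List.prod (map_congr_left fun i hi => h i (List.mem_range.1 hi))

lemma map_val {H K : Type} [Group H] [Group K] (f : H →* K) (ψ : ℤ → H) (a : ℤ) (n : ℕ) :
    f (val ψ a n) = val (fun x => f (ψ x)) a n := by
  simp [val, map_list_prod, Function.comp_def]

lemma exists_resp {ι : Type*} {B : ι → Base} {lab : ℤ → α × Bool} {G : Type} [Group G]
    (hlab : ∀ x, lab (-1 - x) = linv (lab x)) (hok : ∀ x y, Cl B x y → lab x = lab y)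
    (π : FreeGroup α →* G) {ℓ : ℕ} (J : Finset ℕ)
    (hπ : ∀ j ∈ J, π (mk (wd lab (j * ℓ : ℕ) ℓ)) = 1)
    (hpeel : ∀ J' ⊆ J, J'.Nonempty → ∃ j ∈ J', ∃ s < ℓ, ∀ i ∈ J', ∀ t < ℓ,
      Cl B (j * ℓ + s : ℕ) (i * ℓ + t : ℕ) ∨ Cl B (j * ℓ + s : ℕ) (-1 - (i * ℓ + t : ℕ)) →
        i = j ∧ t = s) :
    ∃ ψ : ℤ → FreeGroup α, (∀ x, ψ (-1 - x) = (ψ x)⁻¹) ∧ (∀ x y, Cl B x y → ψ x = ψ y) ∧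
      (∀ x, π (ψ x) = π (mk [lab x])) ∧ ∀ j ∈ J, val ψ (j * ℓ : ℕ) ℓ = 1 := by
  classical
  induction J using strongInduction with
  | H J ih =>
  rcases J.eq_empty_or_nonempty with rfl | hJ
  · exact ⟨fun x => mk [lab x], fun x => by simp only [hlab]; simp [invRev, linv],
      fun x y hxy => by simp only [hok x y hxy], fun _ => rfl, by simp⟩
  obtain ⟨j, hj, s, hs, huniq⟩ := hpeel J subset_rfl hJ
  obtain ⟨ψ, k1, k2, k3, k4⟩ := ih (J.erase j) (erase_ssubset hj)
    (fun i hi => hπ i (Finset.mem_of_mem_erase hi))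
    fun J' h1 h2 => hpeel J' (h1.trans (Finset.erase_subset _ _)) h2
  obtain ⟨p, hp⟩ : ∃ p : ℤ, p = (j * ℓ + s : ℕ) := ⟨_, rfl⟩
  rw [← hp] at huniq
  have hnb : ∀ x, Cl B p x → ¬ Cl B p (-1 - x) := fun x h1 h2 =>
    linv_ne (lab x) (by rw [← hlab, ← hok _ _ h1, ← hok _ _ h2])
  obtain ⟨q, rfl⟩ : ∃ q, ℓ = s + 1 + q := ⟨ℓ - s - 1, by omega⟩
  obtain ⟨z, hz⟩ : ∃ z, z = (val ψ (j * (s + 1 + q) : ℕ) s)⁻¹ * (val ψ (p + 1) q)⁻¹ := ⟨_, rfl⟩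
  obtain ⟨φ, hφ⟩ : ∃ φ : ℤ → FreeGroup α, φ = fun x =>
    if Cl B p x then z else if Cl B p (-1 - x) then z⁻¹ else ψ x := ⟨_, rfl⟩
  have f0 : ∀ x, ¬ Cl B p x → ¬ Cl B p (-1 - x) → φ x = ψ x := fun x h1 h2 => by
    rw [hφ]; simp only [h1, h2, if_false]
  have hsplit : ∀ χ : ℤ → FreeGroup α, val χ (j * (s + 1 + q) : ℕ) (s + 1 + q) =
      val χ (j * (s + 1 + q) : ℕ) s * χ p * val χ (p + 1) q := fun χ => by
    rw [val_add, val_add, val_one, hp]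
    congr 2
  have hz' : π z = π (mk [lab p]) := by
    have := hπ j hj
    rw [mk_wd, hsplit] at this
    have e : ∀ a n, π (val ψ a n) = π (val (fun x => mk [lab x]) a n) := fun a n => by
      rw [map_val, map_val]; exact val_congr fun i _ => k3 _
    rw [hz, _root_.map_mul, _root_.map_inv, _root_.map_inv, e, e]
    rw [_root_.map_mul, _root_.map_mul] at this
    exact (eq_inv_mul_iff_mul_eq.2 (mul_eq_one_iff_eq_inv.1 this)).symm
  have fsame : ∀ i t, i ∈ J → t < s + 1 + q → ¬ (i = j ∧ t = s) →
      φ (i * (s + 1 + q) + t : ℕ) = ψ (i * (s + 1 + q) + t : ℕ) := fun i t hi ht hne =>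
    f0 _ (fun h => hne (huniq i hi t ht (Or.inl h))) fun h => hne (huniq i hi t ht (Or.inr h))
  refine ⟨φ, fun x => ?_, fun x y hxy => ?_, fun x => ?_, fun i hi => ?_⟩
  · rw [hφ]
    by_cases h1 : Cl B p x
    · simp [h1, hnb x h1]
    · by_cases h2 : Cl B p (-1 - x)
      · simp [h1, h2]
      · simp [h1, h2, k1]
  · have e1 : Cl B p x ↔ Cl B p y := ⟨fun h => h.trans hxy, fun h => h.trans hxy.symm⟩
    have e2 : Cl B p (-1 - x) ↔ Cl B p (-1 - y) :=
      ⟨fun h => h.trans hxy.bar, fun h => h.trans hxy.symm.bar⟩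
    rw [hφ]
    simp only [e1, e2, k2 x y hxy]
  · by_cases h1 : Cl B p x
    · rw [hφ]; simp only [h1, if_true]
      rw [hz', hok _ _ h1]
    · by_cases h2 : Cl B p (-1 - x)
      · rw [hφ]; simp only [h1, h2, if_true, if_false]
        rw [_root_.map_inv, hz', hok _ _ h2, hlab, ← _root_.map_inv]
        simp [invRev, linv]
      · rw [f0 x h1 h2, k3]
  · by_cases hij : i = j
    · subst hij
      have g1 : val φ (i * (s + 1 + q) : ℕ) s = val ψ (i * (s + 1 + q) : ℕ) s :=
        val_congr fun t ht => by
          exact fsame i t hi (by omega) (by omega)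
      have g2 : val φ (p + 1) q = val ψ (p + 1) q := val_congr fun t ht => by
        have := fsame i (s + 1 + t) hi (by omega) (by omega)
        rw [hp]
        convert this using 2 <;> push_cast <;> ring
      rw [hsplit, g1, g2, show φ p = z by rw [hφ]; simp [Cl.refl], hz]
      group
    · rw [← k4 i (mem_erase.2 ⟨hij, hi⟩)]
      exact val_congr fun t ht => by
        exact fsame i t hi ht (by omega)

section
variable {lab : ℤ → α × Bool}

lemma wd_neg (hlab : ∀ x, lab (-1 - x) = linv (lab x)) (a : ℤ) (n : ℕ) :
    wd lab (-a - n) n = invRev (wd lab a n) := by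
  induction n with
  | zero => rfl
  | succ n ih =>
    rw [wd_add a, wd_one, invRev_concat, ← ih, add_comm n 1, wd_add, wd_one, ← hlab]
    grind

lemma val_neg {ψ : ℤ → FreeGroup α} (h : ∀ x, ψ (-1 - x) = (ψ x)⁻¹) (a : ℤ) (n : ℕ) :
    val ψ (-a - n) n = (val ψ a n)⁻¹ := by
  rw [eq_inv_iff_mul_eq_one, mul_eq_one_comm]
  have := val_cancel (ψ := ψ) (b := a + n) (c := -a - n) n fun i hi => by
    grind
  grind

/-- Disjoint copies of words on the line. -/
lemma exists_layout [Inhabited α] {ℓ : ℕ} (Rs Ws : List (Word α))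
    (hR : ∀ v ∈ Rs, v.length = ℓ) :
    ∃ (lab : ℤ → α × Bool) (M : ℕ), (∀ x, lab (-1 - x) = linv (lab x)) ∧ Rs.length * ℓ ≤ M ∧
      (∀ j (h : j < Rs.length), wd lab (j * ℓ : ℕ) ℓ = Rs[j]) ∧
      ∀ v ∈ Ws, ∃ o : ℕ, o + v.length ≤ M ∧ wd lab o v.length = v := by
  obtain ⟨U, hU⟩ : ∃ U, U = Rs.flatten ++ Ws.flatten := ⟨_, rfl⟩
  obtain ⟨lab, h0, h1⟩ : ∃ lab : ℤ → α × Bool, (∀ i : ℕ, lab i = U.getD i (default, true)) ∧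
      ∀ x, lab (-1 - x) = linv (lab x) := by
    refine ⟨fun x => if 0 ≤ x then U.getD x.toNat (default, true) else
      linv (U.getD (-1 - x).toNat (default, true)), fun i => by simp, fun x => ?_⟩
    by_cases hx : 0 ≤ x
    · grind
    · simp only [if_neg hx, if_pos (show 0 ≤ -1 - x by omega), linv_linv]
  have key : ∀ p v q, U = p ++ v ++ q → wd lab p.length v.length = v := by
    intro p v q h
    refine ext_getElem (by simp) fun i g1 g2 => ?_
    simp only [wd, getElem_map, getElem_range, ← Nat.cast_add, h0]
    rw [h, append_assoc, getD_append_right _ _ _ _ (by omega)]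
    simp [getElem?_append_left g2, g2]
  have hlen : ∀ L : List (Word α), (∀ v ∈ L, v.length = ℓ) → L.flatten.length = L.length * ℓ := by
    intro L hL
    induction L with
    | nil => simp
    | cons v L ih =>
      grind
  refine ⟨lab, U.length, h1, by rw [hU, length_append, hlen _ hR]; omega, fun j hj => ?_,
    fun v hv => ?_⟩
  · have := key (Rs.take j).flatten Rs[j] ((Rs.drop (j + 1)).flatten ++ Ws.flatten) (by
      have e : Rs.flatten = (Rs.take j).flatten ++ (Rs[j] ++ (Rs.drop (j + 1)).flatten) := by
        rw [← flatten_cons, ← drop_eq_getElem_cons hj, ← flatten_append,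
          take_append_drop]
      grind)
    rwa [hlen _ fun v hv => hR v (mem_of_mem_take hv), length_take, min_eq_left hj.le,
      hR _ (getElem_mem hj)] at this
  · obtain ⟨s, t, rfl⟩ := append_of_mem hv
    grind

end

lemma lift_eq_prod {β : Type} {G : Type} [Group G] [DecidableEq β] (c : β → G) (w : FreeGroup β) :
    FreeGroup.lift c w = (w.toWord.map fun z => cond z.2 (c z.1) (c z.1)⁻¹).prod := by
  conv_lhs => rw [← mk_toWord (x := w)]
  simp_all

/-- Products of at most `A` conjugates of relators. -/
def Ars {N : ℕ} (r : Fin N → FreeGroup α) (A : ℕ) (x : FreeGroup α) : Prop :=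
  ∃ l : List (FreeGroup α × Fin N × Bool), l.length ≤ A ∧
    x = (l.map fun y => y.1 * cond y.2.2 (r y.2.1) (r y.2.1)⁻¹ * y.1⁻¹).prod

/-- A pattern of matchings that determines each letter of `m` blocks from another one. -/
structure Stuck [DecidableEq α] {N : ℕ} (A q ℓ : ℕ) (r : Fin N → FreeGroup α) (m : ℕ)
    (ι : Fin m → Fin N) (pos : Fin m → Fin A) (B : Fin q → Base) : Prop where
  inj : Function.Injective ι
  free : ∀ i (s : Fin ℓ), ∃ j, ∃ t : Fin ℓ, (j, t) ≠ (i, s) ∧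
    (Cl B (pos i * ℓ + s : ℕ) (pos j * ℓ + t : ℕ) ∨
      Cl B (pos i * ℓ + s : ℕ) (-1 - (pos j * ℓ + t : ℕ)))
  eq : ∀ i (s : Fin ℓ) j (t : Fin ℓ), Cl B (pos i * ℓ + s : ℕ) (pos j * ℓ + t : ℕ) →
    (r (ι i)).toWord[s]? = (r (ι j)).toWord[t]?
  inv : ∀ i (s : Fin ℓ) j (t : Fin ℓ), Cl B (pos i * ℓ + s : ℕ) (-1 - (pos j * ℓ + t : ℕ)) →
    (r (ι i)).toWord[s]? = (r (ι j)).toWord[t]?.map linv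

def Base.Small (K : ℕ) (β : Base) : Prop :=
  (-K ≤ β.a ∧ β.a ≤ K) ∧ (-K ≤ β.b ∧ β.b ≤ K) ∧ -K ≤ β.t ∧ β.t ≤ K

lemma exists_small {ι : Type*} {B : ι → Base} {M : ℕ} (h : ∀ i, (B i).Bd M) :
    ∃ B' : ι → Base, (∀ i, (B' i).Small (2 * M)) ∧ ∀ x y, Cl B' x y ↔ Cl B x y := by
  classical
  refine ⟨fun i => if (B i).a < (B i).b then B i else ⟨0, 0, 0⟩, fun i => ?_, fun x y => ?_⟩
  · simp only
    split_ifs with h1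
    · have h2 := h i (B i).a le_rfl h1
      have h3 := h i ((B i).b - 1) (by omega) (by omega)
      unfold Base.Small
      grind
    · simp [Base.Small]
  · have : ∀ i x y, ((fun i => if (B i).a < (B i).b then B i else ⟨0, 0, 0⟩ : ι → Base) i).Rel x y ↔
        (B i).Rel x y := by
      intro i x y
      simp only
      split_ifs with h1
      · rfl
      · simp only [Base.Rel]; omega
    simp only [Cl, this]

def iv (o n : ℕ) (ε : Bool) : ℤ × ℕ := cond ε ((o : ℤ), n) (-(o : ℤ) - n, n)

lemma val_iv {ψ : ℤ → FreeGroup α} (h : ∀ x, ψ (-1 - x) = (ψ x)⁻¹) (o n : ℕ) (ε : Bool) :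
    val ψ (iv o n ε).1 (iv o n ε).2 = cond ε (val ψ o n) (val ψ o n)⁻¹ := by
  cases ε
  · exact val_neg h o n
  · rfl

theorem exists_solution [DecidableEq α] [Inhabited α] {N A ℓ k : ℕ} {G : Type} [Group G]
    {r : Fin N → FreeGroup α} (hr : ∀ i, (r i).toWord.length = ℓ) {V : Finset (FreeGroup (Fin k))}
    {c : Fin k → FreeGroup α} (hc : ∀ w ∈ V, Ars r A (FreeGroup.lift c w))
    (π : FreeGroup α →* G) (hπ : ∀ i, π (r i) = 1)
    (hns : ∀ m, 1 ≤ m → m ≤ V.card * A → ∀ ι (pos : Fin m → Fin (V.card * A))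
      (B : Fin (∑ w ∈ V, 2 * (3 * A + w.toWord.length)) → Base),
      (∀ i, (B i).Small (2 * (V.card * A * ℓ))) → ¬ Stuck _ _ ℓ r m ι pos B) :
    ∃ c' : Fin k → FreeGroup α, (∀ w ∈ V, FreeGroup.lift c' w = 1) ∧ ∀ i, π (c' i) = π (c i) := by
  choose! l hl1 hl2 using hc
  obtain ⟨J, hJ⟩ : ∃ J : Finset (Fin N), J = V.biUnion fun w => ((l w).map fun y => y.2.1).toFinset :=
    ⟨_, rfl⟩
  have hJm : ∀ w ∈ V, ∀ y ∈ l w, y.2.1 ∈ J := fun w hw y hy => by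
    rw [hJ, mem_biUnion]
    exact ⟨w, hw, mem_toFinset.2 (List.mem_map_of_mem hy)⟩
  have hJc : J.card ≤ V.card * A := by
    rw [hJ]
    exact card_biUnion_le_card_mul _ _ _ fun w hw =>
      (toFinset_card_le _).trans (by simpa using hl1 w hw)
  obtain ⟨L, hL⟩ : ∃ L, L = ofFn c ++ V.toList.flatMap fun w => (l w).map fun y => y.1 := ⟨_, rfl⟩
  have hLc : ∀ i, c i ∈ L := fun i => by rw [hL]; simp
  have hLg : ∀ w ∈ V, ∀ y ∈ l w, y.1 ∈ L := fun w hw y hy => by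
    rw [hL]
    refine mem_append_right _ (mem_flatMap.2 ⟨w, by simpa, List.mem_map_of_mem hy⟩)
  obtain ⟨lab, M, hlab, hM, hblock, hword⟩ := exists_layout (ℓ := ℓ)
    (ofFn fun j => (r (J.equivFin.symm j)).toWord) (L.map toWord) (by
      intro v hv
      grind)
  rw [length_ofFn] at hM
  have hblock' : ∀ j : Fin J.card, wd lab (j * ℓ : ℕ) ℓ = (r (J.equivFin.symm j)).toWord := fun j => by
    rw [hblock j (by simp)]; simp
  have hword' : ∀ x ∈ L, ∃ o : ℕ, o + x.toWord.length ≤ M ∧ wd lab o x.toWord.length = x.toWord :=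
    fun x hx => hword _ (List.mem_map_of_mem hx)
  choose! o ho1 ho2 using hword'
  have hρ : ∀ i ∈ J, ∃ p : ℕ, p + ℓ ≤ M ∧ wd lab p ℓ = (r i).toWord ∧ ∃ j < J.card, p = j * ℓ :=
    fun i hi => ⟨J.equivFin ⟨i, hi⟩ * ℓ, by
      have := Nat.mul_le_mul_right ℓ (J.equivFin ⟨i, hi⟩).2
      rw [Nat.succ_mul] at this
      exact this.trans hM, by rw [hblock']; simp, _, (J.equivFin ⟨i, hi⟩).2, rfl⟩
  choose! ρ hρ1 using hρ
  obtain ⟨Q, hQ⟩ : ∃ Q : FreeGroup (Fin k) → List (FreeGroup α × ℕ × Bool), Q = fun w =>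
    ((l w).flatMap fun y => [(y.1, o y.1, true), (r y.2.1, ρ y.2.1, y.2.2), (y.1, o y.1, false)]) ++
      (w⁻¹).toWord.map fun z => (c z.1, o (c z.1), z.2) := ⟨_, rfl⟩
  have hQl : ∀ w ∈ V, (Q w).length ≤ 3 * A + w.toWord.length := fun w hw => by
    have := hl1 w hw
    rw [hQ]
    simp [toWord_inv]
    omega
  have hQ1 : ∀ w ∈ V, ∀ a ∈ Q w, a.2.1 + a.1.toWord.length ≤ M ∧
      wd lab a.2.1 a.1.toWord.length = a.1.toWord := by
    intro w hw a ha
    rw [hQ, mem_append, mem_flatMap, List.mem_map] at ha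
    rcases ha with ⟨y, hy, ha⟩ | ⟨z, -, rfl⟩
    · simp only [List.mem_cons, not_mem_nil, or_false] at ha
      have h1 := hLg w hw y hy
      have h2 := hρ1 _ (hJm w hw y hy)
      rcases ha with rfl | rfl | rfl
      · exact ⟨ho1 _ h1, ho2 _ h1⟩
      · simpa only [hr] using ⟨h2.1, h2.2.1⟩
      · exact ⟨ho1 _ h1, ho2 _ h1⟩
    · exact ⟨ho1 _ (hLc _), ho2 _ (hLc _)⟩
  obtain ⟨Y, hY⟩ : ∃ Y : (ℤ → FreeGroup α) → FreeGroup α → ℕ → FreeGroup α, Y = fun ψ (x : FreeGroup α) (p : ℕ) =>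
    val ψ p x.toWord.length := ⟨_, rfl⟩
  have hprod : ∀ ψ : ℤ → FreeGroup α, (∀ x, ψ (-1 - x) = (ψ x)⁻¹) → ∀ w,
      (((Q w).map fun a => iv a.2.1 a.1.toWord.length a.2.2).map fun I => val ψ I.1 I.2).prod =
      ((l w).map fun y => Y ψ y.1 (o y.1) * cond y.2.2 (Y ψ (r y.2.1) (ρ y.2.1))
        (Y ψ (r y.2.1) (ρ y.2.1))⁻¹ * (Y ψ y.1 (o y.1))⁻¹).prod *
        (FreeGroup.lift (fun i => Y ψ (c i) (o (c i))) w)⁻¹ := by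
    intro ψ hψ w
    rw [← _root_.map_inv, lift_eq_prod, hQ, map_append, map_append, prod_append]
    simp only [List.map_map, Function.comp_def, val_iv hψ, hY]
    congr 1
    induction l w with
    | nil => rfl
    | cons y t ih =>
      simp only [flatMap_cons, map_append, prod_append, ih]
      simp [mul_assoc]
  have hloc : ∀ x (p : ℕ), wd lab p x.toWord.length = x.toWord → Y (fun z => mk [lab z]) x p = x :=
    fun x p h => by simp only [hY]; rw [← mk_wd, h, mk_toWord]
  have hlabm : ∀ x, (fun z => mk [lab z]) (-1 - x) = ((fun z => mk [lab z]) x)⁻¹ := fun x => by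
    simp only [hlab]; simp [invRev, linv]
  have hbases : ∀ w ∈ V, _ := fun w hw => exists_bases (M := M) hlab
    ((Q w).map fun a => iv a.2.1 a.1.toWord.length a.2.2)
    (fun I hI => by
      obtain ⟨a, ha, rfl⟩ := List.mem_map.1 hI
      have := (hQ1 w hw a ha).1
      rcases a with ⟨x, p, _ | _⟩ <;> simp only [iv, cond] at this ⊢ <;> omega)
    (fun I hI => by
      obtain ⟨a, ha, rfl⟩ := List.mem_map.1 hI
      have := (hQ1 w hw a ha).2
      rcases a with ⟨x, p, _ | _⟩ <;> simp only [iv, cond] at this ⊢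
      · rw [wd_neg hlab, this]; exact isReduced_invRev isReduced_toWord
      · rw [this]; exact isReduced_toWord)
    (by
      rw [hprod _ hlabm w, mul_inv_eq_one]
      have e1 : (fun i => Y (fun z => mk [lab z]) (c i) (o (c i))) = c :=
        funext fun i => hloc _ _ (ho2 _ (hLc i))
      rw [e1, hl2 w hw]
      congr 1
      refine map_congr_left fun y hy => ?_
      rw [hloc _ _ (ho2 _ (hLg w hw y hy)), hloc _ _ (by rw [hr]; exact (hρ1 _ (hJm w hw y hy)).2.1)])
  choose! Bs hBs1 hBs2 hBs3 using hbases
  obtain ⟨T, hT⟩ : ∃ T, T = V.toList.flatMap Bs := ⟨_, rfl⟩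
  have hTl : T.length ≤ ∑ w ∈ V, 2 * (3 * A + w.toWord.length) := by
    rw [hT, length_flatMap, ← sum_map_toList]
    refine List.sum_le_sum fun w hw => ?_
    have h1 := hBs1 w (by simpa using hw)
    have h2 := hQl w (by simpa using hw)
    rw [length_map] at h1
    omega
  obtain ⟨q, hq⟩ : ∃ q, q = ∑ w ∈ V, 2 * (3 * A + w.toWord.length) := ⟨_, rfl⟩
  rw [← hq] at hns hTl
  obtain ⟨B, hB1, hB2⟩ : ∃ B : Fin q → Base, (∀ i, B i ∈ T ∨ B i = ⟨0, 0, 0⟩) ∧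
      ∀ β ∈ T, ∃ i, B i = β := by
    refine ⟨fun i => T.getD i ⟨0, 0, 0⟩, fun i => ?_, fun β hβ => ?_⟩
    · by_cases h : (i : ℕ) < T.length
      · left; simp [h]
      · right; simp [not_lt.1 h]
    · obtain ⟨i, h, rfl⟩ := mem_iff_getElem.1 hβ
      exact ⟨⟨i, h.trans_le hTl⟩, by simp [h]⟩
  have hTok : ∀ β ∈ T, β.Ok M lab := fun β hβ => by
    rw [hT, mem_flatMap] at hβ
    obtain ⟨w, hw, h⟩ := hβ
    exact hBs2 w (by simpa using hw) β h
  have hBok : ∀ i, (B i).Ok M lab := fun i => (hB1 i).elim (hTok _) fun h => by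
    rw [h]
    exact ⟨fun x h1 h2 => by simp only at h1 h2; omega, fun x y h => by
      simp only [Base.Rel] at h; omega⟩
  have hcl : ∀ x y, Cl B x y → lab x = lab y := fun x y h => by
    induction h with
    | rel x y h => obtain ⟨i, h⟩ := h; exact (hBok i).2 x y h
    | refl x => rfl
    | symm x y _ ih => exact ih.symm
    | trans x y z _ _ h1 h2 => exact h1.trans h2
  obtain ⟨B1, k1, k2, k3⟩ := exists_elim (e := (J.card * ℓ : ℕ)) (M - J.card * ℓ) (B := B)
    (fun i => by
      have := (hBok i).1
      rwa [← Nat.cast_add, Nat.add_sub_cancel' hM])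
    fun x h => linv_ne (lab x) (by rw [← hlab, ← hcl _ _ h])
  have hJl := Nat.mul_le_mul_right ℓ hJc
  obtain ⟨B2, l1, l2⟩ := exists_small (M := V.card * A * ℓ) (B := B1) fun i x h1 h2 => by
    have := k1 i x h1 h2
    omega
  have hlt : ∀ j s : ℕ, j < J.card → s < ℓ → j * ℓ + s < J.card * ℓ := fun j s h1 h2 => by
    have := Nat.mul_le_mul_right ℓ h1
    rw [Nat.succ_mul] at this
    omega
  have hcl2 : ∀ x y, Cl B2 x y → lab x = lab y := fun x y h => hcl _ _ (k2 _ _ ((l2 x y).1 h))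
  have hlet : ∀ j : Fin J.card, ∀ s : Fin ℓ,
      (r (J.equivFin.symm j)).toWord[s]? = some (lab (j * ℓ + s : ℕ)) := fun j s => by
    have h1 : (s : ℕ) < (wd lab (j * ℓ : ℕ) ℓ).length := by simp
    rw [← hblock', Fin.getElem?_fin, getElem?_eq_getElem h1]
    simp [wd]
  obtain ⟨ψ, m1, m2, m3, m4⟩ := exists_resp (B := B) (ℓ := ℓ) hlab hcl π (Finset.range J.card)
    (fun j hj => by
      rw [hblock' ⟨j, Finset.mem_range.1 hj⟩, mk_toWord]; exact hπ _)
    (by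
      intro J' hJ' hne
      by_contra hcon
      push Not at hcon
      have hcard := card_le_card hJ'
      rw [card_range] at hcard
      have hmem : ∀ i : Fin J'.card, (J'.equivFin.symm i : ℕ) < J.card := fun i =>
        Finset.mem_range.1 (hJ' (J'.equivFin.symm i).2)
      refine hns J'.card hne.card_pos (hcard.trans hJc)
        (fun i => J.equivFin.symm ⟨J'.equivFin.symm i, hmem i⟩)
        (fun i => ⟨J'.equivFin.symm i, (hmem i).trans_le hJc⟩) B2 l1 ⟨fun i j hij => ?_,
          fun i s => ?_, fun i s j t h => ?_, fun i s j t h => ?_⟩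
      · have := J.equivFin.symm.injective (Subtype.ext hij)
        exact J'.equivFin.symm.injective (Subtype.ext (by simpa using this))
      · obtain ⟨j, hj, t, ht, h1, h2⟩ := hcon _ (J'.equivFin.symm i).2 s s.2
        refine ⟨J'.equivFin ⟨j, hj⟩, ⟨t, ht⟩, fun he => ?_, ?_⟩
        · rw [Prod.mk.injEq] at he
          refine h2 ?_ (congrArg Fin.val he.2)
          rw [← he.1]; simp
        · have g1 := hlt _ _ (hmem i) s.2
          have g2 := hlt _ _ (Finset.mem_range.1 (hJ' hj)) ht
          simp only [Equiv.symm_apply_apply, l2]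
          exact h1.imp (k3 _ _ (by omega) (by omega) (by omega) (by omega))
            (k3 _ _ (by omega) (by omega) (by omega) (by omega))
      · rw [hlet ⟨_, hmem i⟩, hlet ⟨_, hmem j⟩, hcl2 _ _ h]
      · rw [hlet ⟨_, hmem i⟩, hlet ⟨_, hmem j⟩, hcl2 _ _ h, hlab]; rfl)
  refine ⟨fun i => Y ψ (c i) (o (c i)), fun w hw => ?_, fun i => ?_⟩
  · have h1 := hBs3 w hw ψ ⟨m1, fun β hβ x y hxy => by
      obtain ⟨i, rfl⟩ := hB2 β (by rw [hT]; exact mem_flatMap.2 ⟨w, by simpa using hw, hβ⟩)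
      exact m2 x y (Cl.of i hxy)⟩
    rw [hprod ψ m1 w, mul_inv_eq_one] at h1
    rw [← h1]
    refine List.prod_eq_one fun x hx => ?_
    obtain ⟨y, hy, rfl⟩ := List.mem_map.1 hx
    obtain ⟨-, -, j, hj, hρj⟩ := hρ1 _ (hJm w hw y hy)
    have : Y ψ (r y.2.1) (ρ y.2.1) = 1 := by
      simp only [hY, hr, hρj]; exact m4 j (Finset.mem_range.2 hj)
    rw [this]
    simp
  · conv_rhs => rw [← hloc _ _ (ho2 _ (hLc i))]
    simp only [hY, map_val]
    exact val_congr fun j _ => m3 _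

lemma exists_core {w : Word α} (hw : IsReduced w) (hne : w ≠ []) :
    ∃ y c, w = y ++ c ++ invRev y ∧ c ≠ [] ∧ IsReduced (c ++ c) := by
  induction hn : w.length using Nat.strong_induction_on generalizing w with
  | _ N ih =>
  by_cases h : IsReduced (w ++ w)
  · exact ⟨[], w, by simp, hne, h⟩
  rw [isReduced_append_iff] at h
  push Not at h
  obtain ⟨p, l, q, m, h1, h2, rfl⟩ := h hw hw
  rcases eq_nil_or_concat q with rfl | ⟨v, l', rfl⟩
  · rw [h2] at h1
    have := append_inj_right' (s₁ := []) h1 rfl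
    exact absurd (List.singleton_inj.1 this) (linv_ne l)
  have h3 : w = linv l :: v ++ [l'] := by grind
  obtain rfl : l' = l := by
    rw [h3] at h1
    exact List.singleton_inj.1 (append_inj_right' h1 rfl)
  have hv : v ≠ [] := by
    rintro rfl
    rw [h3] at hw
    exact not_isReduced_mid (p := []) (q := []) (l := linv l') (by simpa using hw)
  obtain ⟨y, c, e1, e2, e3⟩ := ih v.length (by grind)
    (hw.infix ⟨[linv l'], [l'], by rw [h3]; simp⟩) hv rfl
  exact ⟨linv l' :: y, c, by rw [h3, invRev_cons', linv_linv, e1]; simp, e2, e3⟩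

/-- Positions of a cyclic window in a word of length `ℓ`, with tails of length `x` removed. -/
def cpos (ℓ x : ℕ) (o : Bool) (a t : ℕ) : ℕ :=
  x + ((cond o (a + t) (a - t) : ℤ) % (ℓ - 2 * x : ℕ)).toNat

lemma cpos_true (ℓ x a t : ℕ) : cpos ℓ x true a t = x + (a + t) % (ℓ - 2 * x) := by
  norm_cast

def Tail (ℓ : ℕ) (u : Word α) (x : ℕ) : Prop := ∀ t < x, u[ℓ - 1 - t]? = u[t]?.map linv

def Win (ℓ : ℕ) (u v : Word α) (x y a b : ℕ) (o : Bool) (m : ℕ) : Prop :=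
  ∀ t < m, u[cpos ℓ x true a t]? = (v[cpos ℓ y o b t]?).map (cond o id linv)

/-- Small cancellation in terms of positions. -/
structure Nice (ℓ κ η X : ℕ) {N : ℕ} (u : Fin N → Word α) : Prop where
  tail : ∀ i, ¬ Tail ℓ (u i) X
  two : ∀ i j, i ≠ j → ∀ x < X, ∀ y < X, ∀ a < ℓ, ∀ b < ℓ, ∀ o, Tail ℓ (u i) x →
    ¬ Win ℓ (u i) (u j) x y a b o (κ - x - η)
  one : ∀ i, ∀ x < X, ∀ a < ℓ - 2 * x, ∀ b < ℓ - 2 * x, ∀ o, (o = true → a ≠ b) → Tail ℓ (u i) x →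
    ¬ Win ℓ (u i) (u i) x x a b o (κ - x - η)

lemma getElem?_invRev {y : Word α} {t : ℕ} (h : t < y.length) :
    (invRev y)[t]? = y[y.length - 1 - t]?.map linv := by
  simp only [invRev]
  rw [getElem?_reverse (by grind)]
  simp
  rfl

lemma core_get {u y K : Word α} (hu : u = y ++ K ++ invRev y) {t : ℕ} (ht : t < K.length) :
    K[t]? = u[y.length + t]? := by
  grind

section
variable {u y K v : Word α} {ℓ : ℕ} (hu : u = y ++ K ++ invRev y) (hl : u.length = ℓ)
include hu hl

lemma core_length : K.length = ℓ - 2 * y.length := by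
  rw [← hl, hu]; simp; omega

lemma core_tail : Tail ℓ u y.length := by
  intro t ht
  have h2 : ℓ = y.length + K.length + y.length := by rw [← hl, hu]; simp; omega
  rw [hu, getElem?_append_right (by simp; omega), getElem?_invRev (by simp; omega),
    append_assoc, getElem?_append_left ht]
  grind

lemma core_rot (hK : K ≠ []) (h : v.IsRotated K) :
    ∃ a < ℓ - 2 * y.length, ∀ t < ℓ - 2 * y.length, v[t]? = u[cpos ℓ y.length true a t]? := by
  have h1 := core_length hu hl
  have h2 := length_pos_iff.2 hK
  obtain ⟨n, rfl⟩ := h.symm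
  rw [← h1]
  refine ⟨n % K.length, Nat.mod_lt _ h2, fun t ht => ?_⟩
  rw [getElem?_rotate ht, cpos_true, core_get hu (Nat.mod_lt _ h2), ← h1, Nat.mod_add_mod,
    add_comm t]

lemma core_rot_inv (hK : K ≠ []) (h : v.IsRotated (invRev K)) :
    ∃ b < ℓ - 2 * y.length, ∀ t < ℓ - 2 * y.length,
      v[t]? = (u[cpos ℓ y.length false b t]?).map linv := by
  have h1 := core_length hu hl
  have h2 := length_pos_iff.2 hK
  obtain ⟨n, rfl⟩ := h.symm
  rw [← h1]
  have hn := Nat.mod_lt n h2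
  refine ⟨K.length - 1 - n % K.length, by omega, fun t ht => ?_⟩
  have ht' : t < (invRev K).length := by simpa using ht
  have h3 := Nat.mod_lt (t + n) h2
  have h4 := Nat.mod_add_div (t + n) K.length
  have h5 := Nat.mod_add_div n K.length
  rw [getElem?_rotate ht', invRev_length, getElem?_invRev h3,
    core_get hu (by omega), cpos, ← h1]
  simp only [cond]
  have h6 : ((K.length - 1 - n % K.length : ℕ) : ℤ) - t = (K.length - 1 - (t + n) % K.length : ℕ) +
      ((n / K.length : ℕ) - ((t + n) / K.length : ℕ) : ℤ) * K.length := by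
    grind
  rw [h6, Int.add_mul_emod_self_right, Int.emod_eq_of_lt (by omega) (by omega), Int.toNat_natCast]

end

lemma isRotated_invRev {v K : Word α} (h : v.IsRotated K) : (invRev v).IsRotated (invRev K) := by
  obtain ⟨n, hn, rfl⟩ := isRotated_iff_mod.1 h
  rw [rotate_eq_drop_append_take hn]
  conv_lhs => rw [← take_append_drop n v]
  rw [invRev_append, invRev_append]
  exact isRotated_append

lemma isReduced_rot {p q : Word α} (h : IsReduced ((p ++ q) ++ (p ++ q))) :
    IsReduced ((q ++ p) ++ (q ++ p)) := by
  rcases eq_or_ne (p ++ q) [] with h0 | h0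
  · simp_all
  have := IsReduced.append_overlap (L₁ := q) (L₂ := p ++ q) (L₃ := p) (h.infix ⟨p, [], by simp⟩)
    (h.infix ⟨[], q, by simp⟩) h0
  grind

lemma isReduced_isRotated {v c : Word α} (h : v.IsRotated c) (hc : IsReduced (c ++ c)) :
    IsReduced (v ++ v) := by
  obtain ⟨n, hn, rfl⟩ := isRotated_iff_mod.1 h.symm
  rw [rotate_eq_drop_append_take hn]
  apply isReduced_rot
  simp_all

lemma mk_isRotated {v c : Word α} (h : v.IsRotated c) :
    ∃ g : FreeGroup α, FreeGroup.mk v = g * FreeGroup.mk c * g⁻¹ := by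
  obtain ⟨n, hn, rfl⟩ := isRotated_iff_mod.1 h.symm
  rw [rotate_eq_drop_append_take hn]
  refine ⟨(FreeGroup.mk (c.take n))⁻¹, ?_⟩
  have : FreeGroup.mk c = FreeGroup.mk (c.take n) * FreeGroup.mk (c.drop n) := by
    simp_all
  rw [this, ← mul_mk]
  group

/-- Nice relators give a small cancellation presentation. -/
lemma Nice.exists_sc {N ℓ κ η X : ℕ} {u : Fin N → Word α} (hu : Nice ℓ κ η X u)
    (hr : ∀ i, IsReduced (u i)) (hl : ∀ i, (u i).length = ℓ) (hκ : 8 * κ ≤ ℓ) (h2 : 2 ≤ κ)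
    (hX : X + η ≤ κ) : ∃ C : SC α, C.η = η ∧ (∀ v ∈ C.R, v.length ≤ ℓ) ∧
      (∀ v ∈ C.R, ∃ i o, ∃ g : FreeGroup α,
        FreeGroup.mk v = g * cond o (FreeGroup.mk (u i)) (FreeGroup.mk (u i))⁻¹ * g⁻¹) ∧
      ∀ i, ∃ v ∈ C.R, ∃ g : FreeGroup α, FreeGroup.mk (u i) = g * FreeGroup.mk v * g⁻¹ := by
  have hex : ∀ i, ∃ y K, u i = y ++ K ++ invRev y ∧ K ≠ [] ∧ IsReduced (K ++ K) := fun i =>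
    exists_core (hr i) (ne_nil_of_length_pos (by grind))
  choose y K hy hK0 hKr using hex
  have hx : ∀ i, (y i).length < X := by
    intro i
    by_contra h
    exact hu.tail i fun t ht => core_tail (hy i) (hl i) t (by omega)
  obtain ⟨T, hT⟩ : ∃ T : Fin N → Bool → Word α, T = fun i o => cond o (K i) (invRev (K i)) :=
    ⟨_, rfl⟩
  have hTinv : ∀ i o, invRev (T i o) = T i (!o) := by simp_all
  have hlen : ∀ {v : Word α} {i o}, v.IsRotated (T i o) → v.length = ℓ - 2 * (y i).length := by
    intro v i o h
    rw [h.perm.length_eq, ← core_length (hy i) (hl i), hT]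
    cases o <;> simp
  have hpos : ∀ {v : Word α} {i o}, v.IsRotated (T i o) → ∃ a < ℓ - 2 * (y i).length,
      ∀ t < ℓ - 2 * (y i).length, v[t]? = ((u i)[cpos ℓ (y i).length o a t]?).map (cond o id linv) := by
    rintro v i (_ | _) h
    · exact core_rot_inv (hy i) (hl i) (hK0 i) (by grind)
    · simpa using core_rot (hy i) (hl i) (hK0 i) (by grind)
  have hinv : ∀ {v : Word α} {i o}, v.IsRotated (T i o) → (invRev v).IsRotated (T i (!o)) := by
    intro v i o h
    rw [← hTinv]
    exact isRotated_invRev h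
  have hdir : ∀ {r s p : Word α} {i j o}, r.IsRotated (T i true) → s.IsRotated (T j o) → r ≠ s → p <+: r →
      p <+: s → p.length < κ - (y i).length - η := by
    intro r s p i j o h1 h2 hne h3 h4
    obtain ⟨a, ha, ha'⟩ := hpos h1
    obtain ⟨b, hb, hb'⟩ := hpos h2
    simp only [cond, Option.map_id_fun, id] at ha'
    have e1 := hlen h1
    have e2 := hlen h2
    have e4 := h4.length_le
    by_contra hp
    have hw : Win ℓ (u i) (u j) (y i).length (y j).length a b o (κ - (y i).length - η) := by
      intro t ht
      rw [← ha' t (by omega), ← hb' t (by omega), prefix_iff_getElem?.1 h3 t (by omega),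
        prefix_iff_getElem?.1 h4 t (by omega)]
    rcases eq_or_ne i j with rfl | hij
    · refine hu.one i _ (hx i) a ha b hb o ?_ (core_tail (hy i) (hl i)) hw
      rintro rfl rfl
      refine hne (ext_getElem? fun t => ?_)
      rcases lt_or_ge t (ℓ - 2 * (y i).length) with ht | ht
      · rw [ha' t ht, hb' t ht]; simp
      grind
    · exact hu.two i j hij _ (hx i) _ (hx j) a (by omega) b (by omega) o
        (core_tail (hy i) (hl i)) hw
  have hprim : ∀ {p q : Word α} {i}, (p ++ q).IsRotated (T i true) → p ≠ [] → q ≠ [] → q ++ p ≠ p ++ q := by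
    intro p q i h1 hp hq he
    obtain ⟨a, ha, ha'⟩ := hpos h1
    have e1 := hlen h1
    have e2 := length_pos_iff.2 hp
    have e3 := length_pos_iff.2 hq
    rw [length_append] at e1
    refine hu.one i _ (hx i) ((a + p.length) % (ℓ - 2 * (y i).length)) (Nat.mod_lt _ (by omega)) a ha
      true ?_ (core_tail (hy i) (hl i)) ?_
    · intro _ h
      rcases lt_or_ge (a + p.length) (ℓ - 2 * (y i).length) with h3 | h3
      · rw [Nat.mod_eq_of_lt h3] at h; omega
      · rw [Nat.mod_eq_sub_mod h3, Nat.mod_eq_of_lt (by omega)] at h; omega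
    · intro t ht
      have ht' : t < ℓ - 2 * (y i).length := by omega
      have e5 : (q ++ p)[t]? = (p ++ q)[(t + p.length) % (p ++ q).length]? := by
        rw [← rotate_append_length_eq p q, getElem?_rotate (by simp; omega)]
      rw [he, ha' t ht', length_append, e1, ha' _ (Nat.mod_lt _ (by omega)), cpos_true, cpos_true,
        Nat.add_mod_mod, ← add_assoc, add_right_comm] at e5
      simpa [cpos_true] using e5.symm
  refine ⟨⟨{v | ∃ i o, v.IsRotated (T i o)}, fun v => κ - (ℓ - v.length) / 2, κ, η, h2, ?_, ?_, ?_, ?_,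
    ?_, ?_, ?_, ?_, ?_, ?_⟩, rfl, ?_, ?_, ?_⟩
  · rintro p q ⟨i, o, h⟩
    exact ⟨i, o, isRotated_append.trans h⟩
  · grind
  · rintro p ⟨i, o, h⟩
    refine isReduced_isRotated h ?_
    cases o
    · simpa [hT] using isReduced_invRev (hKr i)
    grind
  · grind
  · simp
  · grind
  · grind
  · grind
  · rintro r s p ⟨i, o, h1⟩ ⟨j, o', h2⟩ hne h3 h4
    have hlt : p.length < κ - (y i).length - η := by
      cases o
      · obtain ⟨q, rfl⟩ := h3
        obtain ⟨q', rfl⟩ := h4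
        have h1' := hinv h1
        have h2' := hinv h2
        rw [invRev_append] at h1' h2'
        have := hdir (isRotated_append.trans h1') (isRotated_append.trans h2')
          (p := invRev p) (by
            intro h
            exact hne (by rw [invRev_injective (append_cancel_left h)]))
          (prefix_append _ _) (prefix_append _ _)
        simpa using this
      grind
    rw [hlen h1]; omega
  · rintro p q ⟨i, o, h⟩ hp hq he
    cases o
    · have h' := hinv h
      rw [invRev_append] at h'
      refine hprim h' (by simpa using invRev_injective.ne hq) (by simpa using invRev_injective.ne hp) ?_
      rw [← invRev_append, ← invRev_append, he]
    · exact hprim h hp hq he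
  · grind
  · rintro r ⟨i, o, h⟩
    obtain ⟨g, hg⟩ := mk_isRotated h
    refine ⟨i, o, g * (FreeGroup.mk (y i))⁻¹, ?_⟩
    rw [hg, hT, hy i]
    cases o <;> simp [← mul_mk, ← inv_mk, mul_assoc]
  · intro i
    refine ⟨K i, ⟨i, true, by simp [hT, IsRotated.refl]⟩, FreeGroup.mk (y i), ?_⟩
    rw [inv_mk, mul_mk, mul_mk, ← hy i]

lemma exists_lift_of_nice [DecidableEq α] [Inhabited α] {N ℓ κ η X E A k : ℕ}
    {r : Fin N → FreeGroup α} (hr : ∀ i, (r i).toWord.length = ℓ)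
    (hu : Nice ℓ κ η X fun i => (r i).toWord) (hκ : 8 * κ ≤ ℓ) (h2 : 2 ≤ κ) (hX : X + η ≤ κ)
    (hE : 24 * ℓ + 8 ≤ E * η) (V : Finset (FreeGroup (Fin k)))
    (hA : A = (∑ w ∈ V, w.toWord.length) *
      areaBound E (3 * (∑ w ∈ V, w.toWord.length) * (2 * E + 1) + 20))
    (hns : ∀ m, 1 ≤ m → m ≤ V.card * A → ∀ ι (pos : Fin m → Fin (V.card * A))
      (B : Fin (∑ w ∈ V, 2 * (3 * A + w.toWord.length)) → Base),
      (∀ i, (B i).Small (2 * (V.card * A * ℓ))) → ¬ Stuck _ _ ℓ r m ι pos B)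
    (b : Fin k → FreeGroup α ⧸ Subgroup.normalClosure (Set.range r))
    (hb : ∀ w ∈ V, FreeGroup.lift b w = 1) :
    ∃ c : Fin k → FreeGroup α, (∀ w ∈ V, FreeGroup.lift c w = 1) ∧
      ∀ i, QuotientGroup.mk' (Subgroup.normalClosure (Set.range r)) (c i) = b i := by
  obtain ⟨C, rfl, hL, h3, h4⟩ := hu.exists_sc (fun i => FreeGroup.isReduced_toWord) hr hκ h2 hX
  have hle : Subgroup.normalClosure (FreeGroup.mk '' C.R) ≤ Subgroup.normalClosure (Set.range r) := by
    refine Subgroup.normalClosure_le_normal ?_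
    rintro _ ⟨v, hv, rfl⟩
    obtain ⟨i, o, g, hg⟩ := h3 v hv
    have h5 := Subgroup.subset_normalClosure (Set.mem_range_self (f := r) i)
    rw [hg]
    refine Subgroup.normalClosure_normal.conj_mem _ ?_ g
    cases o <;> simpa [mk_toWord] using h5
  have hge : Subgroup.normalClosure (Set.range r) ≤ Subgroup.normalClosure (FreeGroup.mk '' C.R) := by
    refine Subgroup.normalClosure_le_normal ?_
    rintro _ ⟨i, rfl⟩
    obtain ⟨v, hv, g, hg⟩ := h4 i
    rw [mk_toWord] at hg
    rw [hg]
    exact Subgroup.normalClosure_normal.conj_mem _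
      (Subgroup.subset_normalClosure (Set.mem_image_of_mem _ hv)) g
  obtain ⟨π, hπ⟩ : ∃ π : FreeGroup α →* FreeGroup α ⧸ Subgroup.normalClosure (Set.range r),
      π = QuotientGroup.mk' (Subgroup.normalClosure (Set.range r)) := ⟨_, rfl⟩
  have hker : ∀ x, π x = 1 ↔ x ∈ Subgroup.normalClosure (Set.range r) := fun x => by
    rw [hπ]; exact QuotientGroup.eq_one_iff x
  have hker' : ∀ x, C.pr x = 1 ↔ x ∈ Subgroup.normalClosure (FreeGroup.mk '' C.R) := fun x =>
    QuotientGroup.eq_one_iff x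
  choose b' hb' using fun i => QuotientGroup.mk'_surjective (Subgroup.normalClosure (Set.range r)) (b i)
  rw [← hπ] at hb' ⊢
  have hlift : ∀ {H : Type} [Group H] (f : FreeGroup α →* H) w,
      FreeGroup.lift (fun i => f (b' i)) w = f (FreeGroup.lift b' w) := by
    intro H _ f w
    have : FreeGroup.lift (fun i => f (b' i)) = f.comp (FreeGroup.lift b') := by ext; simp
    rw [this]; rfl
  obtain ⟨c, hc1, hc2⟩ := C.exists_lift_ar (fun v hv => hL v hv) hE V (fun i => C.pr (b' i)) (by
    intro w hw
    rw [hlift, hker']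
    apply hge
    rw [← hker, ← hlift, funext hb', hb w hw])
  rw [← hA] at hc2
  obtain ⟨c', h5, h6⟩ := exists_solution (c := c) (A := A) hr (by
    intro w hw
    obtain ⟨l, e1, e2, e3⟩ := hc2 w hw
    rcases eq_or_ne l [] with rfl | hl
    · exact ⟨[], by simp, by simpa using e3⟩
    obtain ⟨y₀, hy₀⟩ := exists_mem_of_ne_nil l hl
    obtain ⟨i₀, -⟩ := h3 _ (e2 y₀ hy₀)
    have : Nonempty (Fin N) := ⟨i₀⟩
    choose! i o g hg using h3
    refine ⟨l.map fun y => (y.1 * g y.2, i y.2, o y.2), by simpa, ?_⟩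
    rw [e3, List.map_map]
    refine congrArg _ (map_congr_left fun y hy => ?_)
    rw [hg y.2 (e2 y hy)]
    simp [mk_toWord, mul_assoc]) π (fun i => by
      rw [hker]; exact Subgroup.subset_normalClosure ⟨i, rfl⟩) hns
  refine ⟨c', h5, fun i => ?_⟩
  rw [h6, ← hb', ← mul_inv_eq_one, ← _root_.map_inv, ← _root_.map_mul, hker]
  apply hle
  rw [← hker', _root_.map_mul, _root_.map_inv, hc1, mul_inv_cancel]

section Counting

variable {n : ℕ}

open scoped Classical in
lemma card_letters {w : List (Fin n × Bool)} (hw : IsReduced w) (h : w ≠ []) :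
    (univ.filter fun l => IsReduced (w ++ [l])).card = 2 * n - 1 := by
  obtain ⟨v, m, rfl⟩ := eq_nil_or_concat w |>.resolve_left h
  have : (univ.filter fun l => IsReduced (v.concat m ++ [l])) = univ.erase (linv m) := by
    ext l
    simp only [isReduced_append_iff (q := [l]), mem_filter_univ, mem_erase,
      mem_univ, and_true]
    refine ⟨fun h => h.2.2 v m [] l (by simp) rfl, fun h => ⟨hw, by simp, ?_⟩⟩
    intro p' l' q' m' h1 h2
    rw [concat_eq_append] at h1
    obtain rfl := List.singleton_inj.1 (append_inj_right' h1 rfl)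
    obtain ⟨rfl, -⟩ := cons_eq_cons.1 h2
    exact h
  rw [this, card_erase_of_mem (mem_univ _)]
  simp [mul_comm]

open scoped Classical in
/-- Words with some letters determined by the preceding ones are rare. -/
lemma card_le_of_determined (hn : 1 ≤ n) {ℓ : ℕ} (hℓ : 1 ≤ ℓ) {Z : Finset (List (Fin n × Bool))}
    (hZ : ∀ u ∈ Z, IsReduced u ∧ u.length = ℓ) {D : Finset ℕ} (hD : ∀ p ∈ D, p < ℓ ∧
      ∀ u ∈ Z, ∀ v ∈ Z, u.take p = v.take p → u[p]? = v[p]?) :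
    Z.card * (2 * n - 1) ^ D.card ≤ 2 * n * (2 * n - 1) ^ ℓ := by
  have key : ∀ j, 1 ≤ j → j ≤ ℓ → (Z.image (take j)).card *
      (2 * n - 1) ^ (D.filter (· < j)).card ≤ 2 * n * (2 * n - 1) ^ j := by
    intro j hj
    induction j, hj using Nat.le_induction with
    | base =>
      intro h1
      refine Nat.mul_le_mul ?_ (Nat.pow_le_pow_right (by omega) ?_)
      · calc (Z.image (take 1)).card ≤ (univ.image fun l : Fin n × Bool => [l]).card := by
              refine card_le_card fun w hw => ?_
              obtain ⟨u, hu, rfl⟩ := mem_image.1 hw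
              obtain ⟨l, hl⟩ := length_eq_one_iff.1
                (show (u.take 1).length = 1 by rw [length_take, (hZ u hu).2]; omega)
              rw [hl]
              exact mem_image_of_mem _ (mem_univ l)
          _ ≤ 2 * n := card_image_le.trans (by simp [mul_comm])
      · refine (card_le_card (t := {0}) fun p hp => ?_).trans (by simp)
        have := (Finset.mem_filter.1 hp).2
        simp only [Finset.mem_singleton]; omega
    | succ j hj ih =>
      intro hjl
      specialize ih (by omega)
      have himg : (Z.image (take (j + 1))).image (take j) = Z.image (take j) := by
        rw [image_image]
        refine image_congr fun u _ => ?_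
        simp [take_take]
      have hstep : ∀ u ∈ Z, ∃ l, u[j]? = some l ∧ u.take (j + 1) = u.take j ++ [l] := by
        intro u hu
        have h1 : j < u.length := by rw [(hZ u hu).2]; omega
        exact ⟨u[j], getElem?_eq_getElem h1, take_succ_eq_append_getElem h1⟩
      have hcard := fun k => card_le_mul_card_image (f := take j) (Z.image (take (j + 1))) k
      rw [himg] at hcard
      by_cases hjD : j ∈ D
      · have h1 : D.filter (· < j + 1) = insert j (D.filter (· < j)) := by
          ext p; simp only [Finset.mem_filter, mem_insert]
          constructor
          · rintro ⟨h, h'⟩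
            rcases eq_or_ne p j with h2 | h2
            · exact Or.inl h2
            · exact Or.inr ⟨h, by omega⟩
          · rintro (rfl | ⟨h, h'⟩)
            · exact ⟨hjD, by omega⟩
            · exact ⟨h, by omega⟩
        rw [h1, card_insert_of_notMem (by simp), pow_succ, pow_succ, ← mul_assoc, ← mul_assoc]
        refine Nat.mul_le_mul_right _ ((Nat.mul_le_mul_right _ ?_).trans ih)
        have := hcard 1 fun w _ => ?_
        · simpa using this
        rw [card_le_one]
        intro x hx y hy
        obtain ⟨hx, e1⟩ := Finset.mem_filter.1 hx
        obtain ⟨hy, e2⟩ := Finset.mem_filter.1 hy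
        obtain ⟨u, hu, rfl⟩ := mem_image.1 hx
        obtain ⟨v, hv, rfl⟩ := mem_image.1 hy
        obtain ⟨l, h2, h3⟩ := hstep u hu
        obtain ⟨l', h4, h5⟩ := hstep v hv
        have h6 : u.take j = v.take j := by
          rw [← e2] at e1
          simpa [take_take] using e1
        have := (hD j hjD).2 u hu v hv h6
        rw [h2, h4, Option.some_inj] at this
        rw [h3, h5, h6, this]
      · have h1 : D.filter (· < j + 1) = D.filter (· < j) := by
          refine Finset.filter_congr fun p hp => ⟨fun h => ?_, fun h => by omega⟩
          have : p ≠ j := by rintro rfl; exact hjD hp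
          omega
        rw [h1, pow_succ, ← mul_assoc, mul_comm _ (2 * n - 1)]
        refine (Nat.mul_le_mul_right _ (hcard (2 * n - 1) fun w hw => ?_)).trans ?_
        · obtain ⟨u, hu, rfl⟩ := mem_image.1 hw
          have hr := (hZ u hu).1
          rw [← card_letters (hr.infix (take_prefix j u).isInfix) (by
            apply ne_nil_of_length_pos
            rw [length_take, (hZ u hu).2]; omega)]
          refine (card_le_card (t := (univ.filter fun l =>
            IsReduced (u.take j ++ [l])).image fun l => u.take j ++ [l]) fun x hx => ?_).trans
              card_image_le
          obtain ⟨hx, e1⟩ := Finset.mem_filter.1 hx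
          obtain ⟨v, hv, rfl⟩ := mem_image.1 hx
          obtain ⟨l, h2, h3⟩ := hstep v hv
          have h6 : v.take j = u.take j := by simpa [take_take] using e1
          rw [h6] at h3
          refine mem_image.2 ⟨l, ?_, h3.symm⟩
          rw [mem_filter_univ, ← h3]
          exact (hZ v hv).1.infix (take_prefix _ v).isInfix
        · rw [mul_assoc]
          exact Nat.mul_le_mul_left _ ih
  have := key ℓ hℓ le_rfl
  rw [filter_true_of_mem fun p hp => (hD p hp).1] at this
  rwa [card_image_of_injOn] at this
  intro u hu v hv h
  simpa [take_of_length_le, (hZ u hu).2, (hZ v hv).2] using h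

/-- The words of length `ℓ`. -/
noncomputable def sphere (n ℓ : ℕ) : Finset (FreeGroup (Fin n)) :=
  ((finite_length_eq (Fin n × Bool) ℓ).preimage toWord_injective.injOn).toFinset

@[simp] lemma mem_sphere {ℓ : ℕ} {g : FreeGroup (Fin n)} : g ∈ sphere n ℓ ↔ g.toWord.length = ℓ := by
  simp [sphere]

lemma le_card_sphere {ℓ : ℕ} (hℓ : 1 ≤ ℓ) :
    2 * n * (2 * n - 1) ^ (ℓ - 1) ≤ (sphere n ℓ).card := by
  induction ℓ, hℓ using Nat.le_induction with
  | base =>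
    calc _ = (univ : Finset (Fin n × Bool)).card := by simp [mul_comm]
      _ = (univ.image fun l : Fin n × Bool => FreeGroup.mk [l]).card := by
        rw [card_image_of_injective]
        intro l m h
        simpa using congrArg toWord h
      _ ≤ _ := card_le_card fun g hg => by
        obtain ⟨l, -, rfl⟩ := mem_image.1 hg
        simp
  | succ ℓ hℓ ih =>
    classical
    have hmk : ∀ {w : List (Fin n × Bool)}, IsReduced w → (FreeGroup.mk w).toWord = w := fun h => by
      rw [toWord_mk, h.reduce_eq]
    have h1 := mul_card_image_le_card_of_maps_to
      (f := fun g : FreeGroup (Fin n) => FreeGroup.mk (g.toWord.take ℓ)) (s := sphere n (ℓ + 1))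
      (t := sphere n ℓ) (fun g hg => by
        simp only [mem_sphere] at hg ⊢
        rw [hmk (isReduced_toWord.infix (take_prefix _ _).isInfix), length_take]; omega)
      (2 * n - 1) (fun g hg => by
        rw [mem_sphere] at hg
        rw [← card_letters (w := g.toWord) isReduced_toWord (ne_nil_of_length_pos (by omega)),
          ← card_image_of_injOn (f := fun l => FreeGroup.mk (g.toWord ++ [l]))]
        · refine card_le_card fun x hx => ?_
          obtain ⟨l, hl, rfl⟩ := mem_image.1 hx
          rw [mem_filter_univ] at hl
          simp [hmk hl, hg, mk_toWord]
        · intro l hl m hm h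
          simp only [coe_filter, mem_univ, true_and, Set.mem_ofPred_eq] at hl hm
          have := congrArg toWord h
          simpa [hmk hl, hmk hm] using this)
    calc _ = (2 * n - 1) * (2 * n * (2 * n - 1) ^ (ℓ - 1)) := by
          obtain ⟨k, rfl⟩ := Nat.exists_eq_add_of_le' hℓ
          simp [pow_succ]; ring
      _ ≤ _ := (Nat.mul_le_mul_left _ ih).trans h1

end Counting

section Probability

variable {n ℓ N : ℕ}

open scoped Classical in
lemma relProb_eq (P : (Fin N → FreeGroup (Fin n)) → Prop) : relProb n ℓ N P =
    (((Fintype.piFinset fun _ : Fin N => sphere n ℓ).filter P).card : ℝ) / (sphere n ℓ).card ^ N := by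
  have h : relTuples n ℓ N = (Fintype.piFinset fun _ : Fin N => sphere n ℓ : Finset _) := by
    ext r; simp [relTuples]
  have h' : {r ∈ relTuples n ℓ N | P r} =
      ((Fintype.piFinset fun _ : Fin N => sphere n ℓ).filter P : Finset _) := by
    rw [h]; ext r; simp
  rw [relProb, h', h, Set.ncard_coe_finset, Set.ncard_coe_finset, Fintype.card_piFinset_const]
  simp

open scoped Classical in
lemma relProb_or_le (P Q : (Fin N → FreeGroup (Fin n)) → Prop) :
    relProb n ℓ N (fun r => P r ∨ Q r) ≤ relProb n ℓ N P + relProb n ℓ N Q := by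
  simp only [relProb_eq, ← add_div]
  gcongr
  norm_cast
  refine (card_le_card fun r hr => ?_).trans (card_union_le _ _)
  simpa [← and_or_left] using hr

open scoped Classical in
lemma relProb_mono {P Q : (Fin N → FreeGroup (Fin n)) → Prop}
    (h : ∀ r, (∀ i, (r i).toWord.length = ℓ) → P r → Q r) :
    relProb n ℓ N P ≤ relProb n ℓ N Q := by
  simp only [relProb_eq]
  gcongr ((?_ : ℕ) : ℝ) / _
  refine card_le_card fun r hr => ?_
  simp only [Finset.mem_filter, Fintype.mem_piFinset, mem_sphere] at hr ⊢
  exact ⟨hr.1, h r hr.1 hr.2⟩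

lemma relProb_true (h : 0 < (sphere n ℓ).card) : relProb n ℓ N (fun _ => True) = 1 := by
  classical
  rw [relProb_eq, Finset.filter_true, Fintype.card_piFinset_const, Nat.cast_pow,
    div_self (by positivity)]

lemma relProb_exists_le {ι : Type*} (s : Finset ι) {Q : ι → (Fin N → FreeGroup (Fin n)) → Prop} {B : ℝ}
    (h : ∀ a ∈ s, relProb n ℓ N (Q a) ≤ B) :
    relProb n ℓ N (fun r => ∃ a ∈ s, Q a r) ≤ s.card * B := by
  classical
  induction s using Finset.induction_on with
  | empty => simp [relProb]
  | insert a s ha ih =>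
    simp only [exists_mem_insert, card_insert_of_notMem ha, Nat.cast_add, Nat.cast_one]
    have := relProb_or_le (ℓ := ℓ) (Q a) (fun r => ∃ a ∈ s, Q a r)
    have h1 := h a (Finset.mem_insert_self a s)
    have h2 := ih fun b hb => h b (Finset.mem_insert_of_mem hb)
    linarith

lemma relProb_le_of_comp {m : ℕ} {ι : Fin m → Fin N} (hι : Function.Injective ι)
    {Q : (Fin N → FreeGroup (Fin n)) → Prop} (hW : 0 < (sphere n ℓ).card)
    {Z : Finset (Fin m → FreeGroup (Fin n))}
    (hZ : ∀ r, (∀ i, (r i).toWord.length = ℓ) → Q r → r ∘ ι ∈ Z) :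
    relProb n ℓ N Q ≤ Z.card / (sphere n ℓ).card ^ m := by
  classical
  rw [relProb_eq, div_le_div_iff₀ (by positivity) (by positivity)]
  norm_cast
  rw [← Fintype.card_piFinset_const (sphere n ℓ) m, ← Fintype.card_piFinset_const (sphere n ℓ) N,
    ← card_product,
    ← card_product]
  refine card_le_card_of_injOn (fun x => (x.1 ∘ ι, Function.extend ι x.2 x.1)) ?_ ?_
  · rintro ⟨r, g⟩ h
    simp only [coe_product, Set.mem_prod, mem_coe, Finset.mem_filter,
      Fintype.mem_piFinset, mem_sphere] at h ⊢
    refine ⟨hZ r h.1.1 h.1.2, fun i => ?_⟩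
    by_cases hi : ∃ j, ι j = i
    · obtain ⟨j, rfl⟩ := hi
      rw [hι.extend_apply]; exact h.2 j
    · rw [Function.extend_apply' _ _ _ hi]; exact h.1.1 i
  · rintro ⟨r, g⟩ - ⟨r', g'⟩ - h
    obtain ⟨h1, h2⟩ := Prod.mk.inj h
    refine Prod.ext (funext fun i => ?_) (funext fun j => ?_)
    · by_cases hi : ∃ j, ι j = i
      · obtain ⟨j, rfl⟩ := hi
        exact congrFun h1 j
      · have := congrFun h2 i
        rwa [Function.extend_apply' _ _ _ hi, Function.extend_apply' _ _ _ hi] at this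
    · have := congrFun h2 (ι j)
      rwa [hι.extend_apply, hι.extend_apply] at this

end Probability

section Probability

variable {n ℓ N : ℕ}

lemma relProb_le_of_update (hW : 0 < (sphere n ℓ).card) (i : Fin N)
    {Q : (Fin N → FreeGroup (Fin n)) → Prop} [DecidablePred Q] {p : ℝ}
    (h : ∀ r, (∀ i, (r i).toWord.length = ℓ) →
      (((sphere n ℓ).filter fun u => Q (Function.update r i u)).card : ℝ) ≤ p * (sphere n ℓ).card) :
    relProb n ℓ N Q ≤ p := by
  classical
  rw [relProb_eq, div_le_iff₀ (by positivity), ← mul_le_mul_iff_left₀ (Nat.cast_pos.2 hW)]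
  calc _ ≤ ∑ r ∈ Fintype.piFinset fun _ : Fin N => sphere n ℓ,
        (((sphere n ℓ).filter fun u => Q (Function.update r i u)).card : ℝ) := by
        norm_cast
        rw [← card_product, ← card_sigma]
        refine card_le_card_of_injOn (fun x => ⟨Function.update x.1 i x.2, x.1 i⟩) ?_ ?_
        · rintro ⟨r, u⟩ hx
          simp only [coe_product, Set.mem_prod, mem_coe, Finset.mem_filter,
            Fintype.mem_piFinset, mem_sphere, Finset.mem_sigma] at hx ⊢
          refine ⟨fun j => ?_, hx.1.1 i, by simpa using hx.1.2⟩
          rcases eq_or_ne j i with rfl | hj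
          · simpa using hx.2
          · simpa [hj] using hx.1.1 j
        · rintro ⟨r, u⟩ - ⟨r', u'⟩ - he
          simp only [Sigma.mk.injEq, heq_eq_eq] at he
          obtain ⟨h1, h2⟩ := he
          refine Prod.ext (funext fun j => ?_) (by simpa using congrFun h1 i)
          rcases eq_or_ne j i with rfl | hj
          · exact h2
          · simpa [hj] using congrFun h1 j
    _ ≤ ∑ r ∈ Fintype.piFinset fun _ : Fin N => sphere n ℓ, p * (sphere n ℓ).card :=
        Finset.sum_le_sum fun r hr => h r (by simpa using hr)
    _ = _ := by
        rw [sum_const, Fintype.card_piFinset_const, nsmul_eq_mul]; push_cast; ring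

lemma rpow_le_card_sphere (hn : 1 ≤ n) (hℓ : 1 ≤ ℓ) :
    (2 * n : ℝ) * (2 * (n : ℝ) - 1) ^ ℓ ≤ (2 * (n : ℝ) - 1) * (sphere n ℓ).card := by
  obtain ⟨k, rfl⟩ := Nat.exists_eq_add_of_le' hℓ
  have h : ((2 * n * (2 * n - 1) ^ k : ℕ) : ℝ) ≤ (sphere n (k + 1)).card :=
    Nat.cast_le.2 (le_card_sphere hℓ)
  push_cast [Nat.cast_sub (show 1 ≤ 2 * n by omega)] at h
  have hn' : (1 : ℝ) ≤ n := by exact_mod_cast hn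
  calc _ = (2 * (n : ℝ) - 1) * (2 * n * (2 * (n : ℝ) - 1) ^ k) := by ring
    _ ≤ _ := mul_le_mul_of_nonneg_left h (by linarith)

lemma card_sphere_pos (hn : 1 ≤ n) (hℓ : 1 ≤ ℓ) : 0 < (sphere n ℓ).card :=
  lt_of_lt_of_le (Nat.mul_pos (by omega) (Nat.pow_pos (by omega))) (le_card_sphere hℓ)

lemma relProb_le_of_determined (hn : 1 ≤ n) (hℓ : 1 ≤ ℓ) (i : Fin N)
    {Q : (Fin N → FreeGroup (Fin n)) → Prop} {M : ℝ} (h : ∀ r, ∃ D : Finset ℕ, M ≤ D.card ∧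
      ∀ p ∈ D, p < ℓ ∧ ∀ u v : FreeGroup (Fin n), u.toWord.length = ℓ → v.toWord.length = ℓ →
        Q (Function.update r i u) → Q (Function.update r i v) →
        (∀ t < p, u.toWord[t]? = v.toWord[t]?) → u.toWord[p]? = v.toWord[p]?) :
    relProb n ℓ N Q ≤ (2 * (n : ℝ) - 1) ^ (1 - M) := by
  classical
  refine relProb_le_of_update (card_sphere_pos hn hℓ) i fun r _ => ?_
  obtain ⟨D, hM, hD⟩ := h r
  have hn' : (1 : ℝ) ≤ n := by exact_mod_cast hn
  have h0 : 0 < 2 * (n : ℝ) - 1 := by linarith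
  have h1 := card_le_of_determined hn hℓ
    (Z := ((sphere n ℓ).filter fun u => Q (Function.update r i u)).image toWord) (D := D)
    (by
      intro w hw
      obtain ⟨u, hu, rfl⟩ := mem_image.1 hw
      exact ⟨isReduced_toWord, mem_sphere.1 (Finset.mem_filter.1 hu).1⟩)
    fun p hp => ⟨(hD p hp).1, by
      intro w hw w' hw' hww
      obtain ⟨u, hu, rfl⟩ := mem_image.1 hw
      obtain ⟨v, hv, rfl⟩ := mem_image.1 hw'
      rw [Finset.mem_filter, mem_sphere] at hu hv
      refine (hD p hp).2 u v hu.1 hv.1 hu.2 hv.2 fun t ht => ?_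
      have := congrArg (·[t]?) hww
      simpa [getElem?_take, ht] using this⟩
  rw [card_image_of_injective _ toWord_injective, ← Nat.cast_le (α := ℝ)] at h1
  push_cast [Nat.cast_sub (show 1 ≤ 2 * n by omega)] at h1
  have h2 := h1.trans (rpow_le_card_sphere hn hℓ)
  calc _ ≤ (2 * (n : ℝ) - 1) ^ (1 - (D.card : ℝ)) * (sphere n ℓ).card := by
        rw [Real.rpow_sub h0, Real.rpow_one, Real.rpow_natCast, div_mul_eq_mul_div,
          le_div_iff₀ (by positivity)]
        exact h2
    _ ≤ _ := by
        gcongr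
        linarith

lemma card_image_tail {x : ℕ} (h : 2 * x < ℓ) :
    ((Finset.range x).image fun t => ℓ - 1 - t).card = x := by
  rw [card_image_of_injOn, card_range]
  intro t ht s hs e
  simp only [coe_range, Set.mem_Iio] at ht hs e
  omega

lemma Tail.determined {u v : List (Fin n × Bool)} {x p : ℕ} (h : 2 * x < ℓ) (hu : Tail ℓ u x)
    (hv : Tail ℓ v x) (hp : p ∈ (Finset.range x).image fun t => ℓ - 1 - t)
    (huv : ∀ t < p, u[t]? = v[t]?) : u[p]? = v[p]? := by
  obtain ⟨t, ht, rfl⟩ := mem_image.1 hp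
  rw [Finset.mem_range] at ht
  rw [hu t ht, hv t ht, huv t (by omega)]

lemma relProb_tail_le (hn : 1 ≤ n) {x : ℕ} (h : 2 * x < ℓ) (i : Fin N) :
    relProb n ℓ N (fun r => Tail ℓ (r i).toWord x) ≤ (2 * (n : ℝ) - 1) ^ (1 - (x : ℝ)) := by
  refine relProb_le_of_determined hn (by omega) i fun r =>
    ⟨_, (Nat.cast_le (α := ℝ)).2 (card_image_tail h).ge, fun p hp => ⟨?_, fun u v _ _ hu hv huv => ?_⟩⟩
  · obtain ⟨t, ht, rfl⟩ := mem_image.1 hp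
    omega
  · simp only [Function.update_self] at hu hv
    exact hu.determined h hv hp huv

lemma cpos_mem (ℓ : ℕ) {x : ℕ} (h : 2 * x < ℓ) (o : Bool) (a t : ℕ) :
    x ≤ cpos ℓ x o a t ∧ cpos ℓ x o a t < ℓ - x := by
  have h0 : (0 : ℤ) < (ℓ - 2 * x : ℕ) := by omega
  have h1 := Int.emod_nonneg (cond o (a + t : ℤ) (a - t)) h0.ne'
  have h2 := Int.emod_lt_of_pos (cond o (a + t : ℤ) (a - t)) h0
  unfold cpos
  omega

lemma cpos_inj {x : ℕ} {o : Bool} {a s t : ℕ} (hs : s < ℓ - 2 * x) (ht : t < ℓ - 2 * x)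
    (h : cpos ℓ x o a s = cpos ℓ x o a t) : s = t := by
  have h0 : (0 : ℤ) < (ℓ - 2 * x : ℕ) := by omega
  have h1 := Int.emod_nonneg (cond o (a + s : ℤ) (a - s)) h0.ne'
  have h2 := Int.emod_nonneg (cond o (a + t : ℤ) (a - t)) h0.ne'
  have h3 : cond o (a + s : ℤ) (a - s) ≡ cond o (a + t : ℤ) (a - t) [ZMOD (ℓ - 2 * x : ℕ)] := by
    unfold cpos at h
    unfold Int.ModEq
    omega
  have h4 : (s : ℤ) ≡ t [ZMOD (ℓ - 2 * x : ℕ)] := by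
    cases o
    · simpa using (Int.ModEq.refl (a : ℤ)).sub h3
    · exact Int.ModEq.add_left_cancel' _ h3
  rw [Int.natCast_modEq_iff] at h4
  exact h4.eq_of_lt_of_lt hs ht

lemma relProb_two_le (hn : 1 ≤ n) {κ η x y a b : ℕ} {o : Bool} (hκ : κ + 2 * x < ℓ) (hx : x + η ≤ κ)
    {i j : Fin N} (hij : i ≠ j) :
    relProb n ℓ N (fun r => Tail ℓ (r i).toWord x ∧
      Win ℓ (r i).toWord (r j).toWord x y a b o (κ - x - η)) ≤
      (2 * (n : ℝ) - 1) ^ (1 - ((κ : ℝ) - η)) := by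
  classical
  refine relProb_le_of_determined hn (by omega) i fun r =>
    ⟨(Finset.range x).image (fun t => ℓ - 1 - t) ∪
      (Finset.range (κ - x - η)).image (cpos ℓ x true a), ?_, fun p hp => ?_⟩
  · rw [card_union_of_disjoint, card_image_tail (by omega), card_image_of_injOn,
      card_range, ← Nat.cast_sub (by omega), Nat.cast_le]
    · omega
    · intro s hs t ht h
      simp only [coe_range, Set.mem_Iio] at hs ht
      exact cpos_inj (by omega) (by omega) h
    · rw [Finset.disjoint_left]
      intro p hp hp'
      obtain ⟨t, ht, rfl⟩ := mem_image.1 hp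
      obtain ⟨s, hs, e⟩ := mem_image.1 hp'
      have := cpos_mem ℓ (x := x) (by omega) true a s
      rw [Finset.mem_range] at ht
      omega
  · rcases mem_union.1 hp with hp | hp
    · refine ⟨?_, fun u v _ _ hu hv huv => ?_⟩
      · obtain ⟨t, ht, rfl⟩ := mem_image.1 hp
        omega
      · simp only [Function.update_self] at hu hv
        exact hu.1.determined (by omega) hv.1 hp huv
    · obtain ⟨s, hs, rfl⟩ := mem_image.1 hp
      rw [Finset.mem_range] at hs
      refine ⟨by have := cpos_mem ℓ (x := x) (by omega) true a s; omega, fun u v _ _ hu hv huv => ?_⟩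
      simp only [Function.update_self, Function.update_of_ne hij.symm] at hu hv
      rw [hu.2 s hs, hv.2 s hs]

lemma relProb_one_le (hn : 1 ≤ n) {κ η x a b : ℕ} {o : Bool} (hκ : κ + 2 * x < ℓ) (hx : x + η ≤ κ)
    (ha : a < ℓ - 2 * x) (hb : b < ℓ - 2 * x) (hab : o = true → a ≠ b) (i : Fin N) :
    relProb n ℓ N (fun r => Tail ℓ (r i).toWord x ∧
      Win ℓ (r i).toWord (r i).toWord x x a b o (κ - x - η)) ≤
      (2 * (n : ℝ) - 1) ^ (1 - ((κ : ℝ) - η) / 2) := by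
  classical
  refine relProb_le_of_determined hn (by omega) i fun r =>
    ⟨(Finset.range x).image (fun t => ℓ - 1 - t) ∪
      (Finset.range (κ - x - η)).image (fun t => max (cpos ℓ x true a t) (cpos ℓ x o b t)), ?_,
      fun p hp => ?_⟩
  · rw [card_union_of_disjoint, card_image_tail (by omega), div_le_iff₀ (by norm_num),
      ← Nat.cast_sub (by omega)]
    · norm_cast
      have := card_le_mul_card_image
        (f := fun t => max (cpos ℓ x true a t) (cpos ℓ x o b t)) (Finset.range (κ - x - η)) 2 (by
        intro z _
        refine (card_le_card (t := (Finset.range (κ - x - η)).filter (cpos ℓ x true a · = z) ∪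
          (Finset.range (κ - x - η)).filter (cpos ℓ x o b · = z)) fun t ht => ?_).trans
            ((card_union_le _ _).trans (Nat.add_le_add (b := 1) (d := 1) ?_ ?_))
        · simp only [Finset.mem_filter, mem_union] at ht ⊢
          rcases max_choice (cpos ℓ x true a t) (cpos ℓ x o b t) with h | h
          · exact Or.inl ⟨ht.1, h ▸ ht.2⟩
          · exact Or.inr ⟨ht.1, h ▸ ht.2⟩
        all_goals
          rw [card_le_one]
          intro s hs t ht
          simp only [Finset.mem_filter, Finset.mem_range] at hs ht
          exact cpos_inj (by omega) (by omega) (hs.2.trans ht.2.symm))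
      rw [card_range] at this
      omega
    · rw [Finset.disjoint_left]
      intro p hp hp'
      obtain ⟨t, ht, rfl⟩ := mem_image.1 hp
      obtain ⟨s, hs, e⟩ := mem_image.1 hp'
      have h1 := cpos_mem ℓ (x := x) (by omega) true a s
      have h2 := cpos_mem ℓ (x := x) (by omega) o b s
      rw [Finset.mem_range] at ht
      omega
  · rcases mem_union.1 hp with hp | hp
    · refine ⟨?_, fun u v _ _ hu hv huv => ?_⟩
      · obtain ⟨t, ht, rfl⟩ := mem_image.1 hp
        omega
      · simp only [Function.update_self] at hu hv
        exact hu.1.determined (by omega) hv.1 hp huv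
    · obtain ⟨s, hs, rfl⟩ := mem_image.1 hp
      rw [Finset.mem_range] at hs
      have h1 := cpos_mem ℓ (x := x) (by omega) true a s
      have h2 := cpos_mem ℓ (x := x) (by omega) o b s
      refine ⟨by omega, fun u v hul _ hu hv huv => ?_⟩
      simp only [Function.update_self] at hu hv
      have e1 := hu.2 s hs
      have e2 := hv.2 s hs
      rcases lt_trichotomy (cpos ℓ x true a s) (cpos ℓ x o b s) with h | h | h
      · rw [max_eq_right h.le] at huv ⊢
        have e3 := huv _ h
        rw [e1, e2] at e3
        refine Option.map_injective ?_ e3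
        cases o
        · exact (Function.LeftInverse.injective (g := linv) fun l => linv_linv l)
        · exact Function.injective_id
      · exfalso
        rw [← h, getElem?_eq_getElem (by omega), Option.map_some, Option.some_inj] at e1
        cases o
        · exact linv_ne _ e1.symm
        · rw [cpos_true, cpos_true, add_right_inj] at h
          have h3 := Nat.ModEq.add_right_cancel' s (show a + s ≡ b + s [MOD ℓ - 2 * x] from h)
          exact hab rfl (h3.eq_of_lt_of_lt ha hb)
      · rw [max_eq_left h.le] at huv ⊢
        rw [e1, e2, huv _ h]

end Probability

section Probability

variable {n ℓ N : ℕ}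

lemma relProb_stuck_le (hn : 2 ≤ n) (hℓ : 1 ≤ ℓ) {A q m : ℕ} (ι : Fin m → Fin N)
    (pos : Fin m → Fin A) (B : Fin q → Base) :
    relProb n ℓ N (fun r => Stuck A q ℓ r m ι pos B) ≤ ((2 * (n : ℝ) - 1) ^ (-(ℓ : ℝ) / 4)) ^ m := by
  classical
  have hn' : (2 : ℝ) ≤ n := by exact_mod_cast hn
  obtain ⟨β, hβ⟩ : ∃ β : ℝ, β = 2 * n - 1 := ⟨_, rfl⟩
  rw [← hβ]
  have hβ0 : 0 < β := by linarith
  by_cases hs : ∃ r : Fin N → FreeGroup (Fin n), Stuck A q ℓ r m ι pos B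
  swap
  · push Not at hs
    refine (relProb_mono (Q := fun _ => False) fun r _ h => hs r h).trans ?_
    simp only [relProb, and_false]
    simp only [Set.ofPred_false, Set.ncard_empty, Nat.cast_zero, zero_div]
    positivity
  obtain ⟨r₀, h₀⟩ := hs
  obtain ⟨e, he⟩ : ∃ e : Fin m × Fin ℓ → ℤ, e = fun x : Fin m × Fin ℓ =>
      ((pos x.1 * ℓ + x.2 : ℕ) : ℤ) := ⟨_, rfl⟩
  have hbar : ∀ {x y}, Cl B x (-1 - y) → Cl B (-1 - x) y := fun h => by simpa using h.bar
  let S : Setoid (Fin m × Fin ℓ) := ⟨fun x y => Cl B (e x) (e y) ∨ Cl B (e x) (-1 - e y),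
    fun x => Or.inl (Cl.refl _), fun h => h.imp Cl.symm fun h => (hbar h).symm, by
      rintro x y z (h | h) (h' | h')
      · exact Or.inl (h.trans h')
      · exact Or.inr (h.trans h')
      · exact Or.inr (h.trans h'.bar)
      · exact Or.inl (h.trans (hbar h'))⟩
  have hcard : 2 * Fintype.card (Quotient S) ≤ m * ℓ := by
    have := mul_card_image_le_card_of_maps_to (f := (Quotient.mk S)) (s := univ)
      (t := univ) (fun _ _ => mem_coe.2 (mem_univ _)) 2 (by
      rintro c -
      obtain ⟨⟨i, s⟩, rfl⟩ := Quotient.exists_rep c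
      obtain ⟨j, t, hne, h⟩ := h₀.free i s
      rw [← card_pair hne]
      refine card_le_card fun x hx => ?_
      rw [mem_filter_univ]
      rcases mem_insert.1 hx with rfl | hx
      · refine (Quotient.sound (s := S) ?_).symm
        change _ ∨ _
        simpa only [he] using h
      · rw [Finset.mem_singleton.1 hx])
    simpa using this
  have hget : ∀ {f : Fin m → FreeGroup (Fin n)}, (∀ i, (f i).toWord.length = ℓ) → ∀ x : Fin m × Fin ℓ,
      (f x.1).toWord[(x.2 : ℕ)]? = some ((f x.1).toWord.getD x.2 (⟨0, by omega⟩, true)) := by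
    intro f hf x
    have h : (x.2 : ℕ) < (f x.1).toWord.length := by rw [hf]; exact x.2.2
    rw [getElem?_eq_getElem h, getD_eq_getElem _ _ h]
  obtain ⟨Z, hZ⟩ : ∃ Z : Finset (Fin m → FreeGroup (Fin n)),
      Z = (Fintype.piFinset fun _ => sphere n ℓ).filter fun f => ∀ x y : Fin m × Fin ℓ,
        (Cl B (e x) (e y) → (f x.1).toWord[(x.2 : ℕ)]? = (f y.1).toWord[(y.2 : ℕ)]?) ∧
        (Cl B (e x) (-1 - e y) →
          (f x.1).toWord[(x.2 : ℕ)]? = (f y.1).toWord[(y.2 : ℕ)]?.map linv) := ⟨_, rfl⟩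
  have hZc : Z.card ≤ (2 * n) ^ Fintype.card (Quotient S) := by
    calc _ ≤ (univ : Finset (Quotient S → Fin n × Bool)).card := by
          refine card_le_card_of_injOn (fun f c =>
            (f c.out.1).toWord.getD c.out.2 (⟨0, by omega⟩, true))
              (fun _ _ => mem_coe.2 (mem_univ _)) ?_
          intro f hf g hg hfg
          simp only [hZ, coe_filter, Set.mem_ofPred_eq, Fintype.mem_piFinset, mem_sphere] at hf hg
          refine funext fun i => toWord_injective (ext_getElem? fun t => ?_)
          rcases lt_or_ge t ℓ with ht | ht
          · have h1 : S ((i, ⟨t, ht⟩) : Fin m × Fin ℓ) (Quotient.mk S (i, ⟨t, ht⟩)).out :=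
              S.symm (Quotient.mk_out (s := S) _)
            have h2 := congrFun hfg (Quotient.mk S (i, ⟨t, ht⟩))
            have h3 := (hget hf.1 _).trans ((congrArg some h2).trans (hget hg.1 _).symm)
            rcases h1 with h1 | h1
            · exact ((hf.2 _ _).1 h1).trans (h3.trans ((hg.2 _ _).1 h1).symm)
            · exact ((hf.2 _ _).2 h1).trans ((congrArg _ h3).trans ((hg.2 _ _).2 h1).symm)
          · rw [getElem?_eq_none (by rw [hf.1]; omega), getElem?_eq_none (by rw [hg.1]; omega)]
      _ = _ := by simp [mul_comm]
  refine (relProb_le_of_comp h₀.inj (card_sphere_pos (by omega) hℓ) (Z := Z) fun r hr h => ?_).trans ?_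
  · rw [hZ, Finset.mem_filter, Fintype.mem_piFinset]
    refine ⟨fun i => mem_sphere.2 (hr _), fun x y => ⟨fun hc => ?_, fun hc => ?_⟩⟩
    · exact h.eq _ _ _ _ (by simpa only [he] using hc)
    · exact h.inv _ _ _ _ (by simpa only [he] using hc)
  have hW : β ^ ℓ ≤ (sphere n ℓ).card := by
    have h1 := rpow_le_card_sphere (n := n) (ℓ := ℓ) (by omega) hℓ
    rw [← hβ] at h1
    refine le_of_mul_le_mul_left (le_trans ?_ h1) hβ0
    gcongr
    linarith
  have h2n : (2 * n : ℝ) ≤ β ^ (3 / 2 : ℝ) := by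
    rw [← Real.sqrt_sq (show (0 : ℝ) ≤ 2 * n by linarith), Real.sqrt_eq_rpow,
      show (3 / 2 : ℝ) = 3 * (1 / 2) by norm_num, Real.rpow_mul hβ0.le]
    refine Real.rpow_le_rpow (by positivity) ?_ (by norm_num)
    rw [hβ]
    norm_num
    nlinarith [mul_nonneg (sub_nonneg.2 hn') (sub_nonneg.2 hn'), pow_pos (show (0 : ℝ) < n by linarith) 3]
  have hcard' : (2 : ℝ) * Fintype.card (Quotient S) ≤ m * ℓ := by exact_mod_cast hcard
  calc (Z.card : ℝ) / (sphere n ℓ).card ^ m ≤ (2 * n) ^ Fintype.card (Quotient S) / (β ^ ℓ) ^ m := by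
        gcongr
        exact_mod_cast hZc
    _ ≤ β ^ (3 / 4 * (m * ℓ) : ℝ) / β ^ (m * ℓ : ℝ) := by
        rw [← pow_mul, ← Real.rpow_natCast β, Nat.cast_mul, mul_comm (ℓ : ℝ)]
        gcongr
        calc _ ≤ (β ^ (3 / 2 : ℝ)) ^ Fintype.card (Quotient S) := by gcongr
          _ = β ^ (3 / 2 * Fintype.card (Quotient S) : ℝ) := by
            rw [← Real.rpow_natCast, ← Real.rpow_mul hβ0.le]
          _ ≤ _ := Real.rpow_le_rpow_of_exponent_le (by linarith) (by linarith)
    _ = _ := by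
        rw [← Real.rpow_sub hβ0, ← Real.rpow_natCast, ← Real.rpow_mul hβ0.le]
        congr 1; ring

lemma relProb_exists_stuck_le (hn : 2 ≤ n) (hℓ : 1 ≤ ℓ) {A q K : ℕ} {p : ℝ}
    (hp : N * (2 * (n : ℝ) - 1) ^ (-(ℓ : ℝ) / 4) ≤ p) (hp1 : p ≤ 1) :
    relProb n ℓ N (fun r => ∃ m ∈ Icc 1 A, ∃ ι pos B, (∀ i, Base.Small K (B i)) ∧
      Stuck A q ℓ r m ι pos B) ≤ A * (A ^ A * ((2 * K + 1) ^ 3) ^ q * p) := by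
  classical
  have hn' : (2 : ℝ) ≤ n := by exact_mod_cast hn
  obtain ⟨I, hI⟩ : ∃ I : Finset ℤ, I = Icc (-K : ℤ) K := ⟨_, rfl⟩
  have hIc : I.card = 2 * K + 1 := by rw [hI, Int.card_Icc]; omega
  obtain ⟨T, hT⟩ : ∃ T : Finset Base, T = (I ×ˢ I ×ˢ I).image fun z => ⟨z.1, z.2.1, z.2.2⟩ := ⟨_, rfl⟩
  have hTc : T.card ≤ (2 * K + 1) ^ 3 := by
    rw [hT]
    refine card_image_le.trans ?_
    rw [card_product, card_product, hIc]
    exact le_of_eq (by ring)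
  have hq0 : 0 ≤ (2 * (n : ℝ) - 1) ^ (-(ℓ : ℝ) / 4) := Real.rpow_nonneg (by linarith) _
  have h0 : 0 ≤ p := (by positivity : (0 : ℝ) ≤ N * (2 * (n : ℝ) - 1) ^ (-(ℓ : ℝ) / 4)).trans hp
  refine (relProb_exists_le (Icc 1 A) fun m hm => ?_).trans_eq (by
    rw [Nat.card_Icc, Nat.add_sub_cancel])
  rw [mem_Icc] at hm
  have h1 := relProb_exists_le (n := n) (ℓ := ℓ) (N := N)
    ((univ : Finset (Fin m → Fin N)) ×ˢ (univ : Finset (Fin m → Fin A)) ×ˢ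
      Fintype.piFinset fun _ : Fin q => T) (Q := fun x r => Stuck A q ℓ r m x.1 x.2.1 x.2.2)
    fun x _ => relProb_stuck_le hn hℓ x.1 x.2.1 x.2.2
  refine (relProb_mono ?_).trans (h1.trans ?_)
  · rintro r - ⟨ι, pos, B, hB, h⟩
    refine ⟨(ι, pos, B), ?_, h⟩
    simp only [Finset.mem_product, mem_univ, true_and, Fintype.mem_piFinset]
    intro i
    rw [hT]
    refine mem_image.2 ⟨((B i).a, (B i).b, (B i).t), ?_, rfl⟩
    simpa [hI, Base.Small] using hB i
  · simp only [card_product, card_univ, Fintype.card_fun, Fintype.card_fin,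
      Fintype.card_piFinset_const]
    push_cast
    have h2 : (A : ℝ) ^ m ≤ A ^ A := pow_le_pow_right₀ (by exact_mod_cast hm.1.trans hm.2) hm.2
    have h3 : (T.card : ℝ) ^ q ≤ ((2 * K + 1) ^ 3) ^ q := by
      gcongr; exact_mod_cast hTc
    have h4 : (N * (2 * (n : ℝ) - 1) ^ (-(ℓ : ℝ) / 4)) ^ m ≤ p :=
      (pow_le_pow_left₀ (by positivity) hp m).trans (pow_le_of_le_one h0 hp1 (by omega))
    calc _ = A ^ m * (T.card : ℝ) ^ q * (N * (2 * (n : ℝ) - 1) ^ (-(ℓ : ℝ) / 4)) ^ m := by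
          rw [mul_pow]; ring
      _ ≤ _ := by gcongr

end Probability

lemma relProb_not_nice_le {n ℓ N : ℕ} (hn : 1 ≤ n) {κ η X : ℕ} (hκ : κ + 2 * X < ℓ) (hX : X + η ≤ κ) :
    relProb n ℓ N (fun r => ¬ Nice ℓ κ η X fun i => (r i).toWord) ≤
      N * (2 * (n : ℝ) - 1) ^ (1 - (X : ℝ)) +
      (2 * ℓ ^ 4 * (N ^ 2 * (2 * (n : ℝ) - 1) ^ (1 - ((κ : ℝ) - η))) +
      2 * ℓ ^ 3 * (N * (2 * (n : ℝ) - 1) ^ (1 - ((κ : ℝ) - η) / 2))) := by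
  classical
  have hn' : (1 : ℝ) ≤ n := by exact_mod_cast hn
  have hXl : (X : ℝ) ≤ ℓ := by exact_mod_cast (by omega : X ≤ ℓ)
  have hb : ∀ z : ℝ, 0 ≤ (2 * (n : ℝ) - 1) ^ z := fun z => Real.rpow_nonneg (by linarith) _
  have h1 := relProb_exists_le (n := n) (ℓ := ℓ) (N := N) univ
    fun i _ => relProb_tail_le hn (x := X) (by omega) i
  have h2 := relProb_exists_le (n := n) (ℓ := ℓ) (N := N)
    ((univ ×ˢ univ ×ˢ Finset.range X ×ˢ Finset.range X ×ˢ Finset.range ℓ ×ˢ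
      Finset.range ℓ ×ˢ univ).filter fun z => z.1 ≠ z.2.1)
    (Q := fun z r => Tail ℓ (r z.1).toWord z.2.2.1 ∧ Win ℓ (r z.1).toWord (r z.2.1).toWord z.2.2.1
      z.2.2.2.1 z.2.2.2.2.1 z.2.2.2.2.2.1 z.2.2.2.2.2.2 (κ - z.2.2.1 - η)) (fun z hz => by
      simp only [Finset.mem_filter, Finset.mem_product, Finset.mem_range] at hz
      exact relProb_two_le hn (by omega) (by omega) hz.2)
  have h3 := relProb_exists_le (n := n) (ℓ := ℓ) (N := N)
    ((univ ×ˢ Finset.range X ×ˢ Finset.range ℓ ×ˢ Finset.range ℓ ×ˢ univ).filter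
      fun z => z.2.2.1 < ℓ - 2 * z.2.1 ∧ z.2.2.2.1 < ℓ - 2 * z.2.1 ∧
        (z.2.2.2.2 = true → z.2.2.1 ≠ z.2.2.2.1))
    (Q := fun z r => Tail ℓ (r z.1).toWord z.2.1 ∧ Win ℓ (r z.1).toWord (r z.1).toWord z.2.1
      z.2.1 z.2.2.1 z.2.2.2.1 z.2.2.2.2 (κ - z.2.1 - η)) (fun z hz => by
      simp only [Finset.mem_filter, Finset.mem_product, Finset.mem_range] at hz
      exact relProb_one_le hn (by omega) (by omega) hz.2.1 hz.2.2.1 hz.2.2.2 _)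
  refine (relProb_mono fun r _ h => ?_).trans <| (relProb_or_le _ _).trans <|
    add_le_add (h1.trans ?_) <| (relProb_or_le _ _).trans <| add_le_add (h2.trans ?_) (h3.trans ?_)
  · by_contra! h'
    refine h ⟨fun i => h'.1 i (mem_univ _), fun i j hij x hx y hy a ha b hb o ht hw => ?_,
      fun i x hx a ha b hb o hab ht hw => ?_⟩
    · exact h'.2.1 (i, j, x, y, a, b, o) (by simp [*]) ht hw
    · have ha' : a < ℓ := by omega
      have hb' : b < ℓ := by omega
      exact h'.2.2 (i, x, a, b, o) (by simp_all) ht hw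
  · simp
  · rw [← mul_assoc]
    refine mul_le_mul_of_nonneg_right ?_ (hb _)
    refine (Nat.cast_le.2 (card_filter_le _ _)).trans ?_
    simp only [card_product, card_univ, Fintype.card_fin, card_range,
      Fintype.card_bool]
    push_cast
    calc (N * (N * (X * (X * (ℓ * (ℓ * 2))))) : ℝ) ≤ N * (N * (ℓ * (ℓ * (ℓ * (ℓ * 2))))) := by gcongr
      _ = _ := by ring
  · rw [← mul_assoc]
    refine mul_le_mul_of_nonneg_right ?_ (hb _)
    refine (Nat.cast_le.2 (card_filter_le _ _)).trans ?_
    simp only [card_product, card_univ, Fintype.card_fin, card_range,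
      Fintype.card_bool]
    push_cast
    calc (N * (X * (ℓ * (ℓ * 2))) : ℝ) ≤ N * (ℓ * (ℓ * (ℓ * 2))) := by gcongr
      _ = _ := by ring

lemma eventually_scales {d : ℝ} (hd0 : 0 ≤ d) {δ : ℝ} (hδ : δ = 1 / 16 - d) (h0 : 0 < δ) :
    ∀ᶠ ℓ : ℕ in atTop, ∃ κ η X : ℕ, 8 * κ ≤ ℓ ∧ 2 ≤ κ ∧ X + η ≤ κ ∧ κ + 2 * X < ℓ ∧
      24 * ℓ + 8 ≤ ⌈128 / δ⌉₊ * η ∧ (d + δ / 4) * ℓ ≤ X ∧ (2 * d + δ) * ℓ ≤ (κ : ℝ) - η := by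
  filter_upwards [(tendsto_natCast_atTop_atTop (R := ℝ)).eventually_ge_atTop (64 / δ)] with ℓ hℓ
  rw [div_le_iff₀ h0] at hℓ
  have hd' : d * ℓ = 1 / 16 * ℓ - ℓ * δ := by rw [hδ]; ring
  have hdl : 0 ≤ d * ℓ := by positivity
  have h1 := Nat.floor_le (show 0 ≤ δ / 2 * ℓ by positivity)
  have h2 := Nat.lt_floor_add_one (δ / 2 * ℓ)
  have h3 := Nat.le_ceil ((d + δ / 4) * ℓ)
  have h4 := Nat.ceil_lt_add_one (show 0 ≤ (d + δ / 4) * ℓ by positivity)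
  have h5 : (ℓ : ℝ) ≤ 8 * (ℓ / 8 : ℕ) + 7 := by exact_mod_cast (by omega : ℓ ≤ 8 * (ℓ / 8) + 7)
  have h6 : 8 * ((ℓ / 8 : ℕ) : ℝ) ≤ ℓ := by exact_mod_cast (by omega : 8 * (ℓ / 8) ≤ ℓ)
  refine ⟨ℓ / 8, ⌊δ / 2 * ℓ⌋₊, ⌈(d + δ / 4) * ℓ⌉₊, by omega, ?_, ?_, ?_, ?_, h3, by linarith⟩
  · rw [← Nat.cast_le (α := ℝ)]; push_cast; linarith
  · rw [← Nat.cast_le (α := ℝ)]; push_cast; linarith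
  · rw [← Nat.cast_lt (α := ℝ)]; push_cast; linarith
  · rw [← Nat.cast_le (α := ℝ)]; push_cast
    calc (24 * ℓ + 8 : ℝ) ≤ 32 * ℓ := by linarith
      _ = 128 / δ * (δ / 4 * ℓ) := by field_simp; ring
      _ ≤ _ := by
        gcongr
        · exact Nat.le_ceil _
        · linarith

lemma tendsto_error {y : ℝ} (h0 : 0 ≤ y) (h1 : y < 1) (b C D : ℝ) (q : ℕ) :
    Tendsto (fun ℓ : ℕ => b * y ^ ℓ + (2 * ℓ ^ 4 * (b * y ^ ℓ) + 2 * ℓ ^ 3 * (b * y ^ ℓ)) +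
      C * (D * (ℓ : ℝ) ^ q * y ^ ℓ)) atTop (nhds 0) := by
  have h : ∀ k : ℕ, Tendsto (fun ℓ : ℕ => (ℓ : ℝ) ^ k * y ^ ℓ) atTop (nhds 0) := fun k =>
    tendsto_pow_const_mul_const_pow_of_abs_lt_one k (by rwa [abs_of_nonneg h0])
  have := (((h 0).const_mul b).add (((h 4).const_mul (2 * b)).add ((h 3).const_mul (2 * b)))).add
    ((h q).const_mul (C * D))
  simp only [mul_zero, add_zero] at this
  refine this.congr fun ℓ => ?_
  ring

end RandomGroup

open RandomGroup

/-- With overwhelming probability, every solution in the random group `Γ_ℓ` of density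
`d < 1/16` of a fixed finite system of equations `V(x̄) = 1` (a finite set `V` of words
in the free group on the variables `x̄ = (x₁,…,x_k)`) is the image, under the canonical
quotient map `π_ℓ : F_n → Γ_ℓ`, of a solution of the same system in `F_n`. -/
theorem randomGroup_solutions_lift
    (n : ℕ) (hn : 2 ≤ n) (d : ℝ) (hd0 : 0 ≤ d) (hd : d < 1/16)
    (k : ℕ) (V : Finset (FreeGroup (Fin k))) :
    wop n d (fun _ r =>
      ∀ b : Fin k → RandGroup r,
        (∀ w ∈ V, FreeGroup.lift b w = 1) →
          ∃ c : Fin k → FreeGroup (Fin n),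
            (∀ w ∈ V, FreeGroup.lift c w = 1) ∧ ∀ i, randProj r (c i) = b i) := by
  have hn' : (2 : ℝ) ≤ n := by exact_mod_cast hn
  have : Inhabited (Fin n) := ⟨⟨0, by omega⟩⟩
  obtain ⟨δ, hδ⟩ : ∃ δ : ℝ, δ = 1 / 16 - d := ⟨_, rfl⟩
  have h0 : 0 < δ := by linarith
  obtain ⟨E, hE⟩ : ∃ E : ℕ, E = ⌈128 / δ⌉₊ := ⟨_, rfl⟩
  obtain ⟨A, hA⟩ : ∃ A : ℕ, A = (∑ w ∈ V, w.toWord.length) *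
    areaBound E (3 * (∑ w ∈ V, w.toWord.length) * (2 * E + 1) + 20) := ⟨_, rfl⟩
  obtain ⟨M, hM⟩ : ∃ M : ℕ, M = V.card * A := ⟨_, rfl⟩
  obtain ⟨q, hq⟩ : ∃ q : ℕ, q = ∑ w ∈ V, 2 * (3 * A + w.toWord.length) := ⟨_, rfl⟩
  obtain ⟨β, hβ⟩ : ∃ β : ℝ, β = 2 * n - 1 := ⟨_, rfl⟩
  have hβ1 : 1 < β := by linarith
  have hβ0 : 0 < β := by linarith
  obtain ⟨y, hy⟩ : ∃ y : ℝ, y = β ^ (-(δ / 4)) := ⟨_, rfl⟩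
  have hy0 : 0 ≤ y := hy ▸ Real.rpow_nonneg hβ0.le _
  have hy1 : y < 1 := hy ▸ Real.rpow_lt_one_of_one_lt_of_neg hβ1 (by linarith)
  have hyl : ∀ ℓ : ℕ, y ^ ℓ = β ^ (-(δ / 4 * ℓ)) := fun ℓ => by
    rw [hy, ← Real.rpow_natCast, ← Real.rpow_mul hβ0.le, neg_mul]
  have herr := tendsto_error hy0 hy1 β M (M ^ M * ((4 * M + 1) ^ 3) ^ q) (3 * q)
  have hlow := herr.const_sub 1
  rw [sub_zero] at hlow
  refine tendsto_of_tendsto_of_tendsto_of_le_of_le' hlow tendsto_const_nhds ?_ ?_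
  swap
  · filter_upwards [eventually_ge_atTop 1] with ℓ hℓ
    exact (relProb_mono fun _ _ _ => trivial).trans_eq (relProb_true (card_sphere_pos (by omega) hℓ))
  filter_upwards [eventually_scales hd0 hδ h0, eventually_ge_atTop 1] with ℓ ⟨κ, η, X, h1, h2, h3, h4,
    h5, h6, h7⟩ hℓ
  have hl1 : (1 : ℝ) ≤ ℓ := by exact_mod_cast hℓ
  have hdl : 0 ≤ d * ℓ := by positivity
  have hδl : 0 ≤ δ * ℓ := by positivity
  have hd' : d * ℓ = 1 / 16 * ℓ - δ * ℓ := by rw [hδ]; ring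
  have hN : (numRel n d ℓ : ℝ) ≤ β ^ (d * ℓ) := by
    rw [hβ]; exact Nat.floor_le (Real.rpow_nonneg (by linarith) _)
  have hNz : ∀ z, numRel n d ℓ * β ^ z ≤ β ^ (d * ℓ + z) := fun z => by
    rw [Real.rpow_add hβ0]; gcongr
  have hby : ∀ z : ℝ, z ≤ 1 - δ / 4 * ℓ → β ^ z ≤ β * y ^ ℓ := fun z hz => by
    rw [hyl]
    nth_rw 2 [← Real.rpow_one β]
    rw [← Real.rpow_add hβ0]
    exact Real.rpow_le_rpow_of_exponent_le hβ1.le (by linarith)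
  have hs := relProb_exists_stuck_le (N := numRel n d ℓ) hn hℓ (A := M) (q := q) (K := 2 * (M * ℓ))
    (p := y ^ ℓ) (by
      rw [← hβ, hyl]
      exact (hNz _).trans (Real.rpow_le_rpow_of_exponent_le hβ1.le (by linarith)))
    (pow_le_one₀ hy0 hy1.le)
  have hnice := relProb_not_nice_le (N := numRel n d ℓ) (by omega : 1 ≤ n) h4 h3
  rw [← hβ] at hnice
  rw [sub_le_iff_le_add']
  refine (relProb_true (N := numRel n d ℓ) (card_sphere_pos (by omega : 1 ≤ n) hℓ)).ge.trans <|
    (relProb_mono fun r hr _ => ?_).trans <| (relProb_or_le _ _).trans <|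
    add_le_add ((relProb_or_le _ _).trans <| add_le_add (hnice.trans ?_) (hs.trans ?_)) le_rfl
  · by_contra! h
    obtain ⟨⟨h8, h9⟩, b, hb, h10⟩ := h
    obtain ⟨c, hc, hcb⟩ := exists_lift_of_nice hr h8 h1 h2 h3 (hE ▸ h5) V hA
      (fun m hm hm' ι pos B hB hst => h9 m (Finset.mem_Icc.2 ⟨hm, hM ▸ hm'⟩) ι (hM ▸ pos) (hq ▸ B)
        (by subst hM hq; exact hB) (by subst hM hq; exact hst)) b hb
    obtain ⟨i, hi⟩ := h10 c hc
    exact hi (hcb i)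
  · gcongr ?_ + (_ * ?_ + _ * ?_)
    · exact (hNz _).trans (hby _ (by linarith))
    · rw [sq, mul_assoc]
      refine (mul_le_mul_of_nonneg_left (hNz _) (Nat.cast_nonneg _)).trans ((hNz _).trans (hby _ ?_))
      linarith
    · exact (hNz _).trans (hby _ (by linarith))
  · gcongr (M : ℝ) * ?_
    rw [pow_mul, mul_assoc (_ ^ _) (_ ^ q) (_ ^ q), ← mul_pow, ← mul_pow]
    gcongr
    push_cast
    nlinarith [Nat.cast_nonneg (α := ℝ) M]
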